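/- Let D be a set of positive integers that is not a subset of {1,2}; if D contains only even numbers set d = gcd{i : 2i ∈ D}, otherwise d = 1. For n ≡ 0 (mod d) with M_{D,n} > 0, let a map be chosen uniformly at random among the rooted planar maps with n edges all of whose vertex degrees lie in D, and for each fixed degree k ∈ D let X_n^{(k)} be the random number of vertices of degree k. Then there exists a constant σ_k ≥ 0 such that the normalized random variable (X_n^{(k)} − E[X_n^{(k)}])/√n converges in distribution, as n → ∞ along n ≡ 0 (mod d), to a centered Gaussian distribution with variance σ_k² (interpreted as the Dirac mass at 0 if σ_k = 0). -/

import Mathlib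

/-- The number of cycles of the permutation `σ` that meet the predicate `P`
(cycles = orbits, so fixed points count as cycles of length one). -/
noncomputable def cycleCountOn {m : ℕ} (σ : Equiv.Perm (Fin m)) (P : Fin m → Prop) : ℕ :=
  Nat.card (Quot (fun x y : {z : Fin m // P z} => σ.SameCycle x.1 y.1))

/-- The total number of cycles (orbits) of a permutation. -/
noncomputable def cycleCount {m : ℕ} (σ : Equiv.Perm (Fin m)) : ℕ :=
  cycleCountOn σ fun _ => True

/-- The subgroup generated by `σ` and `α` acts transitively on the darts. -/
def IsTransitivePair {m : ℕ} (σ α : Equiv.Perm (Fin m)) : Prop :=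
  ∀ x y : Fin m, ∃ g ∈ Subgroup.closure ({σ, α} : Set (Equiv.Perm (Fin m))), g x = y

/-- The permutation model of a rooted planar map with `n` edges: `α` is a fixed-point-free
involution of the `2n` darts, `⟨σ, α⟩` is transitive, and Euler's relation
`c(σ) − n + c(σα) = 2` holds (vertices = cycles of `σ`, faces = cycles of `σα`). -/
def IsPlanarMap {n : ℕ} (σ α : Equiv.Perm (Fin (2 * n))) : Prop :=
  (∀ x, α (α x) = x) ∧ (∀ x, α x ≠ x) ∧ IsTransitivePair σ α ∧
    cycleCount σ + cycleCount (σ * α) = n + 2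

open scoped Classical in
/-- The finite set of labeled pairs `(σ, α)` encoding planar maps with `n` edges and all
vertex degrees in `D`. -/
noncomputable def pairFinset (D : Set ℕ) (n : ℕ) :
    Finset (Equiv.Perm (Fin (2 * n)) × Equiv.Perm (Fin (2 * n))) :=
  Finset.univ.filter fun p =>
    IsPlanarMap p.1 p.2 ∧ ∀ x, Function.minimalPeriod p.1 x ∈ D

/-- The number of vertices of degree `k` of the map encoded by `σ`, i.e. the number of
cycles of `σ` of length `k`. -/
noncomputable def degCount {m : ℕ} (σ : Equiv.Perm (Fin m)) (k : ℕ) : ℕ :=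
  cycleCountOn σ fun x => Function.minimalPeriod σ x = k

/-- `E[X_n^{(k)}]`: the expected number of vertices of degree `k` of a uniformly random
rooted planar map with `n` edges and vertex degrees in `D`.  Since the statistic is
invariant under relabeling and every rooted map corresponds to exactly `(2n−1)!` labeled
pairs, this is the average over all labeled pairs. -/
noncomputable def EX (D : Set ℕ) (k n : ℕ) : ℝ :=
  (∑ p ∈ pairFinset D n, (degCount p.1 k : ℝ)) / ((pairFinset D n).card : ℝ)
open MeasureTheory in
/-- The law of the normalized random variable `(X_n^{(k)} − E[X_n^{(k)}])/√n`, where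
`X_n^{(k)}` is the number of vertices of degree `k` of a uniformly random rooted planar
map with `n` edges and vertex degrees in `D` (realized as the uniform distribution on
labeled pairs, the statistic being relabeling-invariant). -/
noncomputable def lawX (D : Set ℕ) (k n : ℕ) : Measure ℝ :=
  (((pairFinset D n).card : ENNReal))⁻¹ •
    ∑ p ∈ pairFinset D n,
      Measure.dirac (((degCount p.1 k : ℝ) - EX D k n) / Real.sqrt n)

namespace DC
noncomputable section
open Finset
set_option linter.unusedVariables false
set_option linter.unusedSectionVars false
local notation "◆" => (by positivity)
local notation "◇" => (by omega)
local notation "▲" => (by linarith)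
local notation "△" => (by simp)
local notation "▼" => (by fun_prop)
local notation "▽" => (by norm_num)
local notation "rexp" => Real.exp
local notation "cexp" => Complex.exp
local notation "rcos" => Real.cos
local notation "rsin" => Real.sin
local notation "rpi" => Real.pi
local notation "pX" => Polynomial.X
local notation "pC" => Polynomial.C
local notation "sX" => PowerSeries.X
local notation "psC" => PowerSeries.C
local notation "sco" => PowerSeries.coeff
local notation "pder" => Polynomial.derivative
local notation:max "↟" x:max => (x : ℝ)
local notation:max "⇈" x:max => (x : ℂ)
local notation:max "⤓" x:max => x - 1
local notation:max "⤒" x:max => x + 1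
local notation:max "⧉" x:max => 2 * x

section
open Equiv
open scoped Classical
variable {Ω : Type} [Fintype Ω]

def cl (s : Setoid Ω) (x : Ω) : Finset Ω := univ.filter (fun y => s x y)
def nc (s : Setoid Ω) (Y : Finset Ω) : ℕ := (Y.image (cl s)).card
def sc (σ : Perm Ω) : Setoid Ω := Perm.SameCycle.setoid σ

theorem mem_cl {s : Setoid Ω} {x y : Ω} : y ∈ cl s x ↔ s x y := by simp [cl]
theorem cl_eq {s : Setoid Ω} {x y : Ω} : cl s x = cl s y ↔ s x y := by
  constructor
  · intro h
    have : y ∈ cl s x := by rw [h, mem_cl]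
    exact mem_cl.1 this
  · intro h; ext z; rw [mem_cl, mem_cl]
    exact ⟨fun h' => s.trans (s.symm h) h', fun h' => s.trans h h'⟩

theorem nc_ker {β : Type*} [DecidableEq β] (f : Ω → β) (Y : Finset Ω) :
    nc (Setoid.ker f) Y = (Y.image f).card := by
  unfold nc
  have : Y.image (cl (Setoid.ker f)) = (Y.image f).image (fun v => univ.filter (fun z => v = f z)) := by
    rw [Finset.image_image]; congr 1; ext x z; simp [mem_cl, Setoid.ker_def]
  rw [this, Finset.card_image_of_injOn]
  intro a ha b _ hab
  simp only [coe_image, Set.mem_image, mem_coe] at ha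
  obtain ⟨x, _, rfl⟩ := ha
  have : x ∈ univ.filter (fun z => f x = f z) := by simp
  simp_all

theorem sc_apply {σ : Perm Ω} {x y : Ω} : sc σ x y ↔ σ.SameCycle x y := Iff.rfl

theorem sc_le {σ : Perm Ω} {r : Setoid Ω} : sc σ ≤ r ↔ ∀ x, r x (σ x) := by
  constructor
  · intro h x; exact h (sc_apply.2 ⟨1, by simp⟩)
  · intro h x y hxy
    obtain ⟨i, rfl⟩ := Perm.SameCycle.exists_nat_pow_eq hxy
    induction i with
    | zero => exact r.refl _
    | succ i ih =>
      rw [pow_succ', Perm.mul_apply]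
      exact r.trans (ih (sc_apply.2 ⟨i, by simp⟩)) (h _)

theorem sc_step (σ : Perm Ω) (x : Ω) : sc σ x (σ x) := sc_le.1 le_rfl x

theorem sc_closed {σ : Perm Ω} {S : Ω → Prop} (h : ∀ z, S z → S (σ z)) {a b : Ω}
    (hab : sc σ a b) (ha : S a) : S b := by
  obtain ⟨i, rfl⟩ := Perm.SameCycle.exists_nat_pow_eq hab
  clear hab
  induction i with
  | zero => exact ha
  | succ i ih => rw [pow_succ', Perm.mul_apply]; exact h _ ih

theorem swap_le {x y : Ω} {r : Setoid Ω} : sc (swap x y) ≤ r ↔ r x y := by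
  rw [sc_le]
  constructor
  · intro h; simpa using h x
  · intro h z
    rcases eq_or_ne z x with rfl | hx
    · simpa using h
    rcases eq_or_ne z y with rfl | hy
    · simpa using r.symm h
    rw [swap_apply_of_ne_of_ne hx hy]

theorem sup_pair {s : Setoid Ω} {x y a b : Ω} :
    (s ⊔ sc (swap x y)) a b ↔ s a b ∨ (s a x ∧ s y b) ∨ (s a y ∧ s x b) := by
  constructor
  · let r : Setoid Ω := ⟨fun a b => s a b ∨ (s a x ∧ s y b) ∨ (s a y ∧ s x b), by
      constructor
      · simp
      · rintro a b (h | ⟨h, h'⟩ | ⟨h, h'⟩)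
        · exact Or.inl (s.symm h)
        · exact Or.inr (Or.inr ⟨s.symm h', s.symm h⟩)
        · exact Or.inr (Or.inl ⟨s.symm h', s.symm h⟩)
      · rintro a b c (h | ⟨h, h'⟩ | ⟨h, h'⟩) (k | ⟨k, k'⟩ | ⟨k, k'⟩)
        · exact Or.inl (s.trans h k)
        · exact Or.inr (Or.inl ⟨s.trans h k, k'⟩)
        · exact Or.inr (Or.inr ⟨s.trans h k, k'⟩)
        · exact Or.inr (Or.inl ⟨h, s.trans h' k⟩)
        · simp_all
        · exact Or.inl (s.trans h k')
        · exact Or.inr (Or.inr ⟨h, s.trans h' k⟩)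
        · exact Or.inl (s.trans h k')
        simp_all⟩
    have h1 : s ⊔ sc (swap x y) ≤ r := sup_le (fun a b h => Or.inl h)
      (swap_le.2 (Or.inr (Or.inl ⟨s.refl x, s.refl y⟩)))
    exact fun h => h1 h
  · have hs : s ≤ s ⊔ sc (swap x y) := le_sup_left
    have hp : (s ⊔ sc (swap x y)) x y := swap_le.1 le_sup_right
    rintro (h | ⟨h, h'⟩ | ⟨h, h'⟩)
    · exact hs h
    · exact Setoid.trans' _ (hs h) (Setoid.trans' _ hp (hs h'))
    · exact Setoid.trans' _ (hs h) (Setoid.trans' _ (Setoid.symm' _ hp) (hs h'))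

theorem sup_pair_same {s : Setoid Ω} {x y : Ω} (h : s x y) : s ⊔ sc (swap x y) = s :=
  sup_eq_left.2 (swap_le.2 h)

theorem nc_sup {s : Setoid Ω} {x y : Ω} (h : ¬ s x y) :
    nc (s ⊔ sc (swap x y)) univ + 1 = nc s univ := by
  have e : s ⊔ sc (swap x y) = Setoid.ker (fun z => if s x z then cl s y else cl s z) := by
    ext a b
    rw [sup_pair, Setoid.ker_def]
    by_cases ha : s x a <;> by_cases hb : s x b
    · simp only [ha, hb, if_true, iff_true]; exact Or.inl (s.trans (s.symm ha) hb)
    · simp only [ha, hb, if_true, if_false, cl_eq, and_false, or_false]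
      constructor
      · rintro (k | k)
        · exact absurd (s.trans ha k) hb
        · exact k.2
      · intro k; exact Or.inr ⟨s.symm ha, k⟩
    · simp only [ha, hb, if_true, if_false, cl_eq, and_true]
      constructor
      · rintro (k | k | k)
        · exact absurd (s.trans hb (s.symm k)) ha
        · exact absurd (s.symm k.1) ha
        · exact k
      simp_all
    · simp only [ha, hb, if_false, cl_eq, and_false, or_false]
      constructor
      · rintro (k | k)
        · exact k
        · exact absurd (s.symm k.1) ha
      · exact Or.inl
  rw [e, nc_ker]
  have : univ.image (fun z => if s x z then cl s y else cl s z) = (univ.image (cl s)).erase (cl s x) := by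
    ext c
    simp only [mem_image, mem_univ, true_and, mem_erase]
    constructor
    · rintro ⟨z, rfl⟩
      by_cases hz : s x z
      · simp only [hz, if_true]; exact ⟨fun k => h (s.symm (cl_eq.1 k)), y, rfl⟩
      · simp only [hz, if_false]; exact ⟨fun k => hz (s.symm (cl_eq.1 k)), z, rfl⟩
    · rintro ⟨hc, z, rfl⟩
      have hz : ¬ s x z := fun k => hc (cl_eq.2 (s.symm k))
      grind
  rw [this, Finset.card_erase_of_mem (mem_image_of_mem _ (mem_univ _)), nc]
  grind

theorem nc_add {s : Setoid Ω} {Y Z : Finset Ω} (h : ∀ a ∈ Y, ∀ b ∈ Z, ¬ s a b) :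
    nc s (Y ∪ Z) = nc s Y + nc s Z := by
  unfold nc
  rw [Finset.image_union, Finset.card_union_of_disjoint]
  rw [Finset.disjoint_left]
  intro c hc hc'
  obtain ⟨a, ha, rfl⟩ := mem_image.1 hc
  obtain ⟨b, hb, e⟩ := mem_image.1 hc'
  exact h a ha b hb (s.symm (cl_eq.1 e))

theorem nc_congr {s s' : Setoid Ω} {Y : Finset Ω} (h : ∀ a ∈ Y, ∀ b, s a b ↔ s' a b) :
    nc s Y = nc s' Y := by
  unfold nc
  congr 1
  apply Finset.image_congr
  intro a ha
  ext b; rw [mem_cl, mem_cl]; exact h a ha b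

/-! swaps -/
theorem sup_swap (σ : Perm Ω) (x y : Ω) :
    sc (σ * swap x y) ⊔ sc (swap x y) = sc σ ⊔ sc (swap x y) := by
  apply le_antisymm
  · refine sup_le (sc_le.2 fun z => ?_) le_sup_right
    have h1 : (sc σ ⊔ sc (swap x y)) z (swap x y z) := sc_le.1 le_sup_right z
    have h2 : (sc σ ⊔ sc (swap x y)) (swap x y z) (σ (swap x y z)) := sc_le.1 le_sup_left _
    exact Setoid.trans' _ h1 h2
  · refine sup_le (sc_le.2 fun z => ?_) le_sup_right
    have h1 : (sc (σ * swap x y) ⊔ sc (swap x y)) z (swap x y z) := sc_le.1 le_sup_right z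
    have h2 : (sc (σ * swap x y) ⊔ sc (swap x y)) (swap x y z) ((σ * swap x y) (swap x y z)) :=
      sc_le.1 le_sup_left _
    simp only [Perm.mul_apply, swap_apply_self] at h2
    exact Setoid.trans' _ h1 h2

theorem swap_join {σ : Perm Ω} {x y : Ω} (h : ¬ sc σ x y) : sc (σ * swap x y) x y := by
  have hex : ∃ n, 0 < n ∧ (σ ^ n) x = x := ⟨orderOf σ, orderOf_pos σ, by simp⟩
  let p := Nat.find hex
  have hp := Nat.find_spec hex
  have key : ∀ j, j + 1 ≤ p → ((σ * swap x y) ^ ⤒j) y = (σ ^ ⤒j) x := by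
    intro j
    induction j with
    | zero => intro _; simp
    | succ j ih =>
      intro hj
      rw [pow_succ', Perm.mul_apply, ih ◇, Perm.mul_apply, swap_apply_of_ne_of_ne,
        pow_succ' _ ⤒j, Perm.mul_apply]
      · intro hx
        exact Nat.find_min hex (show j + 1 < p by omega) ⟨by omega, hx⟩
      · intro hy
        exact h ⟨((j + 1 : ℕ) : ℤ), by rw [zpow_natCast]; exact hy⟩
  have hp1 : 0 < p := hp.1
  obtain ⟨m, hm⟩ : ∃ m, p = m + 1 := ⟨p - 1, by omega⟩
  have := key m ◇
  rw [← hm, hp.2] at this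
  exact Setoid.symm' _ (show sc (σ * swap x y) y x from ⟨(p : ℕ), by simpa using this⟩)

/-- splitting: `y = σ^⤒j x` with `j` minimal. -/
theorem swap_split {σ : Perm Ω} {x y : Ω} (hne : x ≠ y) (h : sc σ x y) :
    ∃ j, (σ ^ ⤒j) x = y ∧ (∀ i < j, (σ ^ ⤒i) x ≠ y ∧ (σ ^ ⤒i) x ≠ x) ∧
      ∀ z, sc (σ * swap x y) y z ↔ ∃ i ≤ j, z = (σ ^ ⤒i) x := by
  have hex : ∃ j, (σ ^ ⤒j) x = y := by
    obtain ⟨i, hi⟩ := Perm.SameCycle.exists_nat_pow_eq h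
    cases i with
    | zero => simp_all
    | succ i => exact ⟨i, hi⟩
  let j := Nat.find hex
  have hj : (σ ^ ⤒j) x = y := Nat.find_spec hex
  have hmin : ∀ i < j, (σ ^ ⤒i) x ≠ y := fun i hi => Nat.find_min hex hi
  have hmin2 : ∀ i < j, (σ ^ ⤒i) x ≠ x := by
    intro i hi hx
    have : (σ ^ (j - i - 1 + 1)) x = y := by
      have h1 : (σ ^ ((j - i - 1 + 1) + ⤒i)) x = y := by
        grind
      rwa [pow_add, Perm.mul_apply, hx] at h1
    grind
  refine ⟨j, hj, fun i hi => ⟨hmin i hi, hmin2 i hi⟩, fun z => ⟨fun hz => ?_, ?_⟩⟩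
  · refine sc_closed (S := fun z => ∃ i ≤ j, z = (σ ^ ⤒i) x) ?_ hz ⟨j, le_rfl, hj.symm⟩
    rintro _ ⟨i, hi, rfl⟩
    rcases hi.lt_or_eq with hi | rfl
    · refine ⟨i + 1, hi, ?_⟩
      rw [Perm.mul_apply, swap_apply_of_ne_of_ne (hmin2 i hi) (hmin i hi), pow_succ' _ ⤒i,
        Perm.mul_apply]
    · exact ⟨0, Nat.zero_le _, by rw [hj]; simp⟩
  · rintro ⟨i, hi, rfl⟩
    have key : ((σ * swap x y) ^ ⤒i) y = (σ ^ ⤒i) x := by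
      induction i with
      | zero => simp
      | succ i ih =>
        rw [pow_succ', Perm.mul_apply, ih ◇, Perm.mul_apply,
          swap_apply_of_ne_of_ne (hmin2 i ◇) (hmin i ◇), pow_succ' _ ⤒i,
          Perm.mul_apply]
    exact ⟨((i + 1 : ℕ) : ℤ), by rw [zpow_natCast]; exact key⟩

theorem swap_split_not {σ : Perm Ω} {x y : Ω} (hne : x ≠ y) (h : sc σ x y) :
    ¬ sc (σ * swap x y) x y := by
  obtain ⟨j, hj, hm, hz⟩ := swap_split hne h
  intro k
  obtain ⟨i, hi, e⟩ := (hz x).1 (Setoid.symm' _ k)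
  grind

def isInv (α : Perm Ω) : Prop := ∀ z, α (α z) = z
abbrev EE (σ α : Perm Ω) : Setoid Ω := sc σ ⊔ sc α
def df (σ α : Perm Ω) (Y : Finset Ω) : ℤ :=
  Y.card + 2 * nc (EE σ α) Y - nc (sc σ) Y - nc (sc α) Y - nc (sc (σ * α)) Y

section move
variable {σ α : Perm Ω} {x y : Ω}

theorem mv_x (h : α x = y) : (swap x y * α) x = x := by simp [h]
theorem mv_y (hi : isInv α) (h : α x = y) : (swap x y * α) y = y := by
  have : α y = x := by rw [← h, hi]
  simp [this]
theorem mv_z (hi : isInv α) (h : α x = y) {z : Ω} (hx : z ≠ x) (hy : z ≠ y) :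
    (swap x y * α) z = α z := by
  rw [Perm.mul_apply, swap_apply_of_ne_of_ne]
  · intro k; apply hy; rw [← h, ← k, hi]
  · intro k; apply hx; apply α.injective; rw [k, h]
theorem mv_inv (hi : isInv α) (h : α x = y) : isInv (swap x y * α) := by
  intro z
  by_cases hx : z = x
  · simp_all
  by_cases hy : z = y
  · subst hy; rw [mv_y hi h, mv_y hi h]
  rw [mv_z hi h hx hy, mv_z hi h, hi]
  · intro k; apply hy; rw [← h, ← k, hi]
  · intro k; apply hx; apply α.injective; rw [k, h]

theorem mv_sc (hi : isInv α) (h : α x = y) :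
    sc α = sc (swap x y * α) ⊔ sc (swap x y) := by
  apply le_antisymm
  · rw [sc_le]; intro z
    by_cases hx : z = x
    · subst hx; rw [h]; exact swap_le.1 le_sup_right
    by_cases hy : z = y
    · subst hy; rw [show α z = x by rw [← h, hi]]; exact Setoid.symm' _ (swap_le.1 le_sup_right)
    have : (sc (swap x y * α)) z (α z) := by
      have := sc_step (swap x y * α) z
      rwa [mv_z hi h hx hy] at this
    exact (le_sup_left : _ ≤ sc (swap x y * α) ⊔ sc (swap x y)) this
  · refine sup_le (sc_le.2 fun z => ?_) (swap_le.2 (h ▸ sc_step α x))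
    by_cases hx : z = x
    · subst hx; rw [mv_x h]
    by_cases hy : z = y
    · subst hy; rw [mv_y hi h]
    rw [mv_z hi h hx hy]; exact sc_step α z

theorem mv_not (hne : x ≠ y) (h : α x = y) : ¬ sc (swap x y * α) x y := fun k =>
  hne (Perm.SameCycle.eq_of_left k (mv_x h))

theorem mv_EE (hi : isInv α) (h : α x = y) :
    EE σ α = EE (σ * swap x y) (swap x y * α) ⊔ sc (swap x y) := by
  unfold EE
  rw [mv_sc hi h, sup_comm (sc (swap x y * α)), ← sup_assoc, ← sup_swap, sup_assoc, sup_assoc,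
    sup_comm (sc (swap x y))]

theorem mv_mul : (σ * swap x y) * (swap x y * α) = σ * α := by
  rw [mul_assoc, ← mul_assoc (swap x y), swap_mul_self, one_mul]

theorem mv_merge (hi : isInv α) (h : α x = y) (hne : x ≠ y) (hxy : ¬ sc σ x y) :
    EE (σ * swap x y) (swap x y * α) = EE σ α ∧
    df (σ * swap x y) (swap x y * α) univ = df σ α univ := by
  have hj := swap_join hxy
  have e : EE σ α = EE (σ * swap x y) (swap x y * α) := by
    rw [mv_EE hi h, sup_pair_same]
    exact (le_sup_left : sc (σ * swap x y) ≤ _) hj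
  refine ⟨e.symm, ?_⟩
  unfold df
  rw [← e, mv_mul]
  have h1 := nc_sup hxy
  rw [← sup_swap, sup_pair_same hj] at h1
  have h2 := nc_sup (mv_not hne h)
  rw [← mv_sc hi h] at h2
  omega

theorem mv_split (hi : isInv α) (h : α x = y) (hne : x ≠ y) (hxy : sc σ x y) :
    df σ α univ = df (σ * swap x y) (swap x y * α) univ +
      (if EE (σ * swap x y) (swap x y * α) x y then 2 else 0) := by
  have hj := swap_split_not hne hxy
  have e : EE σ α = EE (σ * swap x y) (swap x y * α) ⊔ sc (swap x y) := mv_EE hi h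
  unfold df
  rw [mv_mul]
  have h1 := nc_sup hj
  rw [sup_swap, sup_pair_same hxy] at h1
  have h2 := nc_sup (mv_not hne h)
  rw [← mv_sc hi h] at h2
  split_ifs with k
  · rw [e, sup_pair_same k]; omega
  · have h3 := nc_sup k
    grind
end move

theorem nc_one (Y : Finset Ω) : nc (sc (1 : Perm Ω)) Y = Y.card := by
  have : sc (1 : Perm Ω) = Setoid.ker id := by
    ext a b; rw [sc_apply, Perm.sameCycle_one]; rfl
  rw [this, nc_ker, image_id]

theorem EE_one (σ : Perm Ω) : EE σ 1 = sc σ := by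
  refine sup_eq_left.2 (sc_le.2 fun z => ?_)
  exact Setoid.refl' _ z

theorem df_one (σ : Perm Ω) (Y : Finset Ω) : df σ 1 Y = 0 := by
  unfold df; rw [EE_one, nc_one, mul_one]; ring

theorem mv_support {α : Perm Ω} {x y : Ω} (hi : isInv α) (h : α x = y) (hne : x ≠ y) :
    (swap x y * α).support.card < α.support.card := by
  apply card_lt_card
  refine ⟨fun z hz => ?_, fun k => ?_⟩
  · rw [Perm.mem_support] at hz ⊢
    by_cases hx : z = x
    · simp_all
    by_cases hy : z = y
    · subst hy; exact absurd (mv_y hi h) hz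
    rwa [mv_z hi h hx hy] at hz
  · have : x ∈ α.support := by rw [Perm.mem_support, h]; exact hne.symm
    exact (Perm.mem_support.1 (k this)) (mv_x h)

theorem df_nonneg : ∀ (n : ℕ) (σ α : Perm Ω), isInv α → α.support.card ≤ n → 0 ≤ df σ α univ := by
  intro n
  induction n with
  | zero =>
    intro σ α _ h
    have : α = 1 := by simp_all
    rw [this, df_one]
  | succ n ih =>
    intro σ α hi h
    by_cases h1 : α = 1
    · rw [h1, df_one]
    obtain ⟨x, hx⟩ : ∃ x, α x ≠ x := by
      by_contra! k; exact h1 (Perm.ext k)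
    have hs := mv_support hi rfl hx.symm
    have := ih (σ * swap x (α x)) (swap x (α x) * α) (mv_inv hi rfl) ◇
    by_cases hxy : sc σ x (α x)
    · rw [mv_split hi rfl hx.symm hxy]; split_ifs <;> omega
    · rw [← (mv_merge hi rfl hx.symm hxy).2]; exact this
end

section
open Equiv
open scoped Classical
variable {Ω : Type} [Fintype Ω]

abbrev cyc (σ : Perm Ω) (x : Ω) : Finset Ω := cl (sc σ) x
def inv (σ : Perm Ω) (Y : Finset Ω) : Prop := ∀ z, σ z ∈ Y ↔ z ∈ Y

def NS (σ : Perm Ω) (Y L : Finset Ω) : Finset (Perm Ω) :=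
  univ.filter fun α => isInv α ∧ (∀ z, α z = z ↔ (z ∉ Y ∨ z ∈ L)) ∧
    (∀ a ∈ Y, ∀ b ∈ Y, EE σ α a b) ∧ df σ α univ = 0

def Nt : ℕ → ℕ → Finset Ω → Perm Ω → ℕ
  | 0, l, Z, _ => if l = 0 ∧ Z = ∅ then 1 else 0
  | _ + 1, 0, Z, _ => if Z = ∅ then 1 else 0
  | m + 1, l + 1, Z, σ =>
    ∑ y ∈ Z, Nt m (l + (cyc σ y).card - 1) (Z \ cyc σ y) σ +
    ∑ b ∈ range l, ∑ Z1 ∈ Z.powerset.filter (inv σ),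
      Nt m (l - 1 - b) (Z \ Z1) σ * Nt m b Z1 σ

theorem self_mem_cyc (σ : Perm Ω) (x : Ω) : x ∈ cyc σ x := mem_cl.2 ((sc σ).refl x)

theorem inv_of {σ : Perm Ω} {Y : Finset Ω} (h : ∀ z ∈ Y, σ z ∈ Y) : inv σ Y := by
  intro z
  refine ⟨fun hz => ?_, h z⟩
  have : (sc σ) (σ z) z := Setoid.symm' _ (sc_step σ z)
  exact sc_closed (S := (· ∈ Y)) h this hz

theorem inv.sc {σ : Perm Ω} {Y : Finset Ω} (h : inv σ Y) {a b : Ω} (hab : sc σ a b) :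
    a ∈ Y ↔ b ∈ Y :=
  ⟨fun k => sc_closed (S := (· ∈ Y)) (fun z hz => (h z).2 hz) hab k,
   fun k => sc_closed (S := (· ∈ Y)) (fun z hz => (h z).2 hz) (Setoid.symm' _ hab) k⟩

theorem inv_cyc (σ : Perm Ω) (x : Ω) : inv σ (cyc σ x) := by
  apply inv_of
  intro z hz
  rw [mem_cl] at hz ⊢
  exact (sc σ).trans hz (sc_step σ z)

theorem inv.compl {σ : Perm Ω} {Y : Finset Ω} (h : inv σ Y) : inv σ Yᶜ := fun z => by
  rw [mem_compl, mem_compl, h z]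
theorem inv.union {σ : Perm Ω} {Y Z : Finset Ω} (h : inv σ Y) (h' : inv σ Z) : inv σ (Y ∪ Z) :=
  fun z => by rw [mem_union, mem_union, h z, h' z]
theorem inv.sdiff {σ : Perm Ω} {Y Z : Finset Ω} (h : inv σ Y) (h' : inv σ Z) : inv σ (Y \ Z) :=
  fun z => by rw [mem_sdiff, mem_sdiff, h z, h' z]
theorem inv.cyc_sub {σ : Perm Ω} {Y : Finset Ω} (h : inv σ Y) {x : Ω} (hx : x ∈ Y) :
    cyc σ x ⊆ Y := fun z hz => (h.sc (mem_cl.1 hz)).1 hx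

theorem inv.mul {σ τ : Perm Ω} {Y : Finset Ω} (h : inv σ Y) (h' : inv τ Y) : inv (σ * τ) Y :=
  fun z => by rw [Perm.mul_apply, h, h']

theorem inv_one {Y : Finset Ω} : inv (1 : Perm Ω) Y := fun _ => Iff.rfl

theorem EE_mono_on {σ α τ β : Perm Ω} {S : Finset Ω} (hσ : inv σ S) (hα : inv α S)
    (h1 : ∀ z ∈ S, σ z = τ z) (h2 : ∀ z ∈ S, α z = β z) {a b : Ω} (ha : a ∈ S)
    (hab : EE σ α a b) : EE τ β a b ∧ b ∈ S := by
  let r : Setoid Ω := ⟨fun a b => (a ∈ S ∧ b ∈ S ∧ EE τ β a b) ∨ (a ∉ S ∧ b ∉ S), by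
    constructor
    · intro a
      by_cases h : a ∈ S
      · simp_all
      simp_all
    · rintro a b (⟨h, h', k⟩ | h)
      · exact Or.inl ⟨h', h, Setoid.symm' _ k⟩
      simp_all
    · rintro a b c (⟨h, h', k⟩ | h) (⟨l, l', m⟩ | l)
      · exact Or.inl ⟨h, l', Setoid.trans' _ k m⟩
      · exact absurd h' l.1
      · exact absurd l h.2
      simp_all⟩
  have hr : EE σ α ≤ r := by
    refine sup_le (sc_le.2 fun z => ?_) (sc_le.2 fun z => ?_)
    · by_cases hz : z ∈ S
      · refine Or.inl ⟨hz, (hσ z).2 hz, ?_⟩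
        rw [h1 z hz]; exact (le_sup_left : sc τ ≤ EE τ β) (sc_step τ z)
      · exact Or.inr ⟨hz, fun k => hz ((hσ z).1 k)⟩
    · by_cases hz : z ∈ S
      · refine Or.inl ⟨hz, (hα z).2 hz, ?_⟩
        rw [h2 z hz]; exact (le_sup_right : sc β ≤ EE τ β) (sc_step β z)
      · exact Or.inr ⟨hz, fun k => hz ((hα z).1 k)⟩
  rcases hr hab with h | h
  · simp_all
  · exact absurd ha h.1

theorem EE_on {σ α τ β : Perm Ω} {S : Finset Ω} (hσ : inv σ S) (hα : inv α S)
    (h1 : ∀ z ∈ S, σ z = τ z) (h2 : ∀ z ∈ S, α z = β z) {a b : Ω} (ha : a ∈ S) :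
    EE σ α a b ↔ EE τ β a b := by
  refine ⟨fun h => (EE_mono_on hσ hα h1 h2 ha h).1, fun h => ?_⟩
  refine (EE_mono_on (S := S) ?_ ?_ (fun z hz => (h1 z hz).symm) (fun z hz => (h2 z hz).symm) ha h).1
  · exact inv_of fun z hz => by rw [← h1 z hz]; exact (hσ z).2 hz
  · exact inv_of fun z hz => by rw [← h2 z hz]; exact (hα z).2 hz

theorem sc_on {σ τ : Perm Ω} {S : Finset Ω} (hσ : inv σ S)
    (h1 : ∀ z ∈ S, σ z = τ z) {a b : Ω} (ha : a ∈ S) : sc σ a b ↔ sc τ a b := by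
  rw [← EE_one, ← EE_one τ]
  exact EE_on hσ inv_one h1 (fun _ _ => rfl) ha

theorem cyc_on {σ τ : Perm Ω} {S : Finset Ω} (hσ : inv σ S)
    (h1 : ∀ z ∈ S, σ z = τ z) {a : Ω} (ha : a ∈ S) : cyc σ a = cyc τ a := by
  ext b; rw [mem_cl, mem_cl]; exact sc_on hσ h1 ha

theorem df_on {σ α τ β : Perm Ω} {S : Finset Ω} (hσ : inv σ S) (hα : inv α S)
    (h1 : ∀ z ∈ S, σ z = τ z) (h2 : ∀ z ∈ S, α z = β z) : df σ α S = df τ β S := by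
  unfold df
  rw [nc_congr (fun a ha b => EE_on hσ hα h1 h2 ha), nc_congr (fun a ha b => sc_on hσ h1 ha),
    nc_congr (fun a ha b => sc_on hα h2 ha),
    nc_congr (fun a ha b => sc_on (hσ.mul hα) (τ := τ * β) (fun z hz => ?_) ha)]
  rw [Perm.mul_apply, Perm.mul_apply, ← h2 z hz, h1 _ ((hα z).2 hz)]

theorem nc_split {s : Setoid Ω} {S : Finset Ω} (h : ∀ a ∈ S, ∀ b, s a b → b ∈ S) :
    nc s univ = nc s S + nc s Sᶜ := by
  rw [← nc_add, union_compl]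
  intro a ha b hb k
  exact (mem_compl.1 hb) (h a ha b k)

theorem df_split {σ α : Perm Ω} {S : Finset Ω} (hσ : inv σ S) (hα : inv α S) :
    df σ α univ = df σ α S + df σ α Sᶜ := by
  unfold df
  rw [nc_split (s := EE σ α) (S := S), nc_split (s := sc σ) (S := S), nc_split (s := sc α) (S := S),
    nc_split (s := sc (σ * α)) (S := S), Finset.card_univ, ← Finset.card_compl_add_card S]
  · push_cast; ring
  · intro a ha b h; exact ((hσ.mul hα).sc h).1 ha
  · intro a ha b h; exact (hα.sc h).1 ha
  · intro a ha b h; exact (hσ.sc h).1 ha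
  · intro a ha b h; exact (EE_mono_on hσ hα (fun _ _ => rfl) (fun _ _ => rfl) ha h).2

theorem Nt_on {σ τ : Perm Ω} : ∀ (m l : ℕ) (Z : Finset Ω), inv σ Z → (∀ z ∈ Z, σ z = τ z) →
    Nt m l Z σ = Nt m l Z τ
  | 0, l, Z, _, _ => rfl
  | m + 1, 0, Z, _, _ => rfl
  | m + 1, l + 1, Z, h, h1 => by
    have hτ : inv τ Z := inv_of fun z hz => by rw [← h1 z hz]; exact (h z).2 hz
    unfold Nt
    congr 1
    · refine sum_congr rfl fun y hy => ?_
      rw [← cyc_on h h1 hy]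
      exact Nt_on m _ _ (h.sdiff (inv_cyc σ y)) (fun z hz => h1 z (mem_sdiff.1 hz).1)
    · refine sum_congr rfl fun b _ => ?_
      have : Z.powerset.filter (inv σ) = Z.powerset.filter (inv τ) := by
        ext Y
        simp only [mem_filter, mem_powerset]
        refine and_congr_right fun hY => ?_
        exact forall_congr' fun z => by
          by_cases hz : z ∈ Z
          · rw [h1 z hz]
          · have a1 : z ∉ Y := fun k => hz (hY k)
            have a2 : σ z ∉ Y := fun k => hz ((h z).1 (hY k))
            have a3 : τ z ∉ Y := fun k => hz ((hτ z).1 (hY k))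
            simp [a1, a2, a3]
      rw [this]
      refine sum_congr rfl fun Y hY => ?_
      rw [← this] at hY
      obtain ⟨hY, hi⟩ := mem_filter.1 hY
      rw [mem_powerset] at hY
      rw [Nt_on m _ (Z \ Y) (h.sdiff hi) (fun z hz => h1 z (mem_sdiff.1 hz).1),
        Nt_on m _ Y hi (fun z hz => h1 z (hY hz))]
end

section
open Equiv
open scoped Classical
variable {Ω : Type} [Fintype Ω]

theorem inv_compl {σ : Perm Ω} {Y : Finset Ω} : inv σ Yᶜ ↔ inv σ Y :=
  ⟨fun h => by simpa using h.compl, inv.compl⟩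

def res (S : Finset Ω) (α : Perm Ω) : Perm Ω :=
  if h : Function.Involutive (fun z => if z ∈ S then α z else z) then h.toPerm else 1

theorem res_apply {S : Finset Ω} {α : Perm Ω} (hi : isInv α) (hS : inv α S) (z : Ω) :
    res S α z = if z ∈ S then α z else z := by
  have h : Function.Involutive (fun z => if z ∈ S then α z else z) := by
    intro z
    by_cases hz : z ∈ S
    · have := (hS z).2 hz
      simp [hz, this, hi z]
    · simp [hz]
  rw [res, dif_pos h]; rfl

theorem res_inv {S : Finset Ω} {α : Perm Ω} (hi : isInv α) (hS : inv α S) : isInv (res S α) := by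
  intro z
  rw [res_apply hi hS, res_apply hi hS]
  by_cases hz : z ∈ S
  · have := (hS z).2 hz
    simp [hz, this, hi z]
  · simp [hz]

def SS (σ : Perm Ω) (Y L : Finset Ω) (x y : Ω) : Finset (Perm Ω) :=
  univ.filter fun α => isInv α ∧ (∀ z, α z = z ↔ (z ∉ Y ∨ z ∈ L)) ∧
    ¬ EE σ α x y ∧ (∀ z ∈ Y, EE σ α x z ∨ EE σ α y z) ∧ df σ α univ = 0

theorem df_res {σ α β : Perm Ω} {S : Finset Ω} (hσ : inv σ S) (hα : inv α S)
    (h1 : ∀ z ∈ S, β z = α z) (h2 : ∀ z ∉ S, β z = z) : df σ β univ = df σ α S := by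
  have hβ : inv β S := inv_of fun z hz => by rw [h1 z hz]; exact (hα z).2 hz
  rw [df_split hσ hβ, df_on hσ hβ (fun _ _ => rfl) h1,
    df_on (τ := σ) (β := 1) hσ.compl hβ.compl (fun _ _ => rfl) (fun z hz => h2 z (mem_compl.1 hz)),
    df_one, add_zero]

theorem glue {σ α α1 α2 : Perm Ω} {Y L Y2 : Finset Ω} {x y : Ω} (hσ : inv σ Y)
    (hL : L ⊆ Y) (hY2 : Y2 ⊆ Y) (h2 : inv σ Y2) (hy : y ∈ Y2) (hx : x ∈ Y \ Y2)
    (hi : isInv α) (hα : inv α Y2) (i1 : isInv α1) (i2 : isInv α2)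
    (a1 : ∀ z, α1 z = if z ∈ Y2 then z else α z) (a2 : ∀ z, α2 z = if z ∈ Y2 then α z else z) :
    (α ∈ SS σ Y L x y ∧ cl (EE σ α) y = Y2) ↔
      (α1 ∈ NS σ (Y \ Y2) (L \ Y2) ∧ α2 ∈ NS σ Y2 (L ∩ Y2)) := by
  have b2 : ∀ z ∈ Y2, α z = α2 z := fun z hz => by rw [a2, if_pos hz]
  have b1 : ∀ z ∈ Y2ᶜ, α z = α1 z := fun z hz => by simp_all
  have d2 : df σ α2 univ = df σ α Y2 := df_res h2 hα (fun z hz => (b2 z hz).symm)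
    (fun z hz => by rw [a2, if_neg hz])
  have d1 : df σ α1 univ = df σ α Y2ᶜ := df_res h2.compl hα.compl (fun z hz => (b1 z hz).symm)
    (fun z hz => by simp_all)
  have d0 := df_split h2 hα
  have n1 := df_nonneg _ σ α1 i1 le_rfl
  have n2 := df_nonneg _ σ α2 i2 le_rfl
  have e2 : ∀ a ∈ Y2, ∀ b, EE σ α a b ↔ EE σ α2 a b := fun a ha b =>
    EE_on h2 hα (fun _ _ => rfl) b2 ha
  have e1 : ∀ a ∈ Y2ᶜ, ∀ b, EE σ α a b ↔ EE σ α1 a b := fun a ha b =>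
    EE_on h2.compl hα.compl (fun _ _ => rfl) b1 ha
  have c2 : ∀ a ∈ Y2, ∀ b, EE σ α a b → b ∈ Y2 := fun a ha b h =>
    (EE_mono_on h2 hα (fun _ _ => rfl) b2 ha h).2
  rw [mem_sdiff] at hx
  simp only [SS, NS, mem_filter, mem_univ, true_and]
  constructor
  · rintro ⟨⟨-, hf, hn, hc, hd⟩, hcl⟩
    refine ⟨⟨i1, fun z => ?_, fun a ha b hb => ?_, by omega⟩, ⟨i2, fun z => ?_, fun a ha b hb => ?_, by omega⟩⟩
    · grind
    · rw [mem_sdiff] at ha hb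
      rw [← e1 a (mem_compl.2 ha.2)]
      have ha' : ¬ EE σ α y a := fun k => ha.2 (hcl ▸ mem_cl.2 k)
      have hb' : ¬ EE σ α y b := fun k => hb.2 (hcl ▸ mem_cl.2 k)
      exact Setoid.trans' _ (Setoid.symm' _ ((hc a ha.1).resolve_right ha'))
        ((hc b hb.1).resolve_right hb')
    · grind
    · rw [← e2 a ha]
      rw [← hcl, mem_cl] at ha hb
      exact Setoid.trans' _ (Setoid.symm' _ ha) hb
  · rintro ⟨⟨-, hf1, hc1, hd1⟩, ⟨-, hf2, hc2, hd2⟩⟩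
    refine ⟨⟨hi, fun z => ?_, fun h => ?_, fun z hz => ?_, by omega⟩, ?_⟩
    · by_cases hz : z ∈ Y2
      · grind
      simp_all
    · exact hx.2 (c2 y hy _ (Setoid.symm' _ h))
    · by_cases hz2 : z ∈ Y2
      · simp_all
      simp_all
    · ext z; rw [mem_cl]
      grind

theorem SS_card {σ : Perm Ω} {Y L : Finset Ω} {x y : Ω} (hσ : inv σ Y) (hL : L ⊆ Y)
    (hx : x ∈ Y) (hy : y ∈ Y) :
    (SS σ Y L x y).card = ∑ Y2 ∈ Y.powerset.filter (fun Y2 => inv σ Y2 ∧ y ∈ Y2 ∧ x ∉ Y2),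
      (NS σ (Y \ Y2) (L \ Y2)).card * (NS σ Y2 (L ∩ Y2)).card := by
  rw [Finset.card_eq_sum_card_fiberwise (f := fun α => cl (EE σ α) y)
    (t := Y.powerset.filter (fun Y2 => inv σ Y2 ∧ y ∈ Y2 ∧ x ∉ Y2))]
  · refine sum_congr rfl fun Y2 hY2 => ?_
    obtain ⟨hs, h2, hy2, hx2⟩ := mem_filter.1 hY2
    rw [mem_powerset] at hs
    rw [← card_product]
    have hx' : x ∈ Y \ Y2 := mem_sdiff.2 ⟨hx, hx2⟩
    have hα : ∀ α, cl (EE σ α) y = Y2 → inv α Y2 := by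
      intro α h
      apply inv_of
      intro z hz
      rw [← h, mem_cl] at hz ⊢
      exact Setoid.trans' _ hz ((le_sup_right : sc α ≤ EE σ α) (sc_step α z))
    have P : ∀ p ∈ NS σ (Y \ Y2) (L \ Y2) ×ˢ NS σ Y2 (L ∩ Y2), isInv p.1 ∧ isInv p.2 ∧
        (∀ z ∈ Y2, p.1 z = z) ∧ (∀ z ∈ Y2, p.2 z ∈ Y2) ∧ (∀ z ∉ Y2, p.2 z = z) ∧
        (∀ z ∉ Y2, p.1 z ∉ Y2) := by
      rintro ⟨p1, p2⟩ hp
      simp only [mem_product, NS, mem_filter, mem_univ, true_and] at hp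
      obtain ⟨⟨i1, f1, -⟩, ⟨i2, f2, -⟩⟩ := hp
      have g1 : ∀ z ∈ Y2, p1 z = z := fun z hz => (f1 z).2 (Or.inl (by simp [hz]))
      have g2 : ∀ z ∉ Y2, p2 z = z := fun z hz => (f2 z).2 (Or.inl hz)
      refine ⟨i1, i2, g1, fun z hz => ?_, g2, fun z hz k => ?_⟩
      · by_contra k
        have := g2 _ k
        rw [i2] at this
        exact k (this ▸ hz)
      · have := g1 _ k
        rw [i1] at this
        exact hz (this ▸ k)
    refine Finset.card_nbij' (fun α => (res Y2ᶜ α, res Y2 α)) (fun p => p.1 * p.2) ?_ ?_ ?_ ?_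
    · intro α h
      obtain ⟨h1, h3⟩ := mem_filter.1 h
      have hi := (mem_filter.1 h1).2.1
      have hv := hα α h3
      rw [mem_coe, mem_product]
      refine (glue hσ hL hs h2 hy2 hx' hi hv (res_inv hi hv.compl) (res_inv hi hv) ?_ ?_).1 ⟨h1, h3⟩
      · intro z; rw [res_apply hi hv.compl]
        simp
      · intro z; rw [res_apply hi hv]
    · intro p hp
      obtain ⟨i1, i2, g1, g2, g3, g4⟩ := P p hp
      have A : ∀ z ∈ Y2, (p.1 * p.2) z = p.2 z := fun z hz => by
        simp_all
      have B : ∀ z ∉ Y2, (p.1 * p.2) z = p.1 z := fun z hz => by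
        simp_all
      have hi : isInv (p.1 * p.2) := by
        intro z
        by_cases hz : z ∈ Y2
        · rw [A z hz, A _ (g2 z hz), i2]
        · rw [B z hz, B _ (g4 z hz), i1]
      have hv : inv (p.1 * p.2) Y2 := inv_of fun z hz => by simp_all
      rw [mem_coe, mem_filter]
      refine (glue hσ hL hs h2 hy2 hx' hi hv i1 i2 ?_ ?_).2 (mem_product.1 hp)
      · simp_all
      simp_all
    · intro α h
      obtain ⟨h1, h3⟩ := mem_filter.1 h
      have hi := (mem_filter.1 h1).2.1
      have hv := hα α h3
      ext z
      simp only [Perm.mul_apply]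
      rw [res_apply hi hv, res_apply hi hv.compl]
      by_cases hz : z ∈ Y2
      · simp [hz, (hv z).2 hz]
      · simp [hz]
    · intro p hp
      obtain ⟨i1, i2, g1, g2, g3, g4⟩ := P p hp
      have A : ∀ z ∈ Y2, (p.1 * p.2) z = p.2 z := fun z hz => by
        simp_all
      have B : ∀ z ∉ Y2, (p.1 * p.2) z = p.1 z := fun z hz => by
        simp_all
      have hi : isInv (p.1 * p.2) := by
        intro z
        by_cases hz : z ∈ Y2
        · rw [A z hz, A _ (g2 z hz), i2]
        · rw [B z hz, B _ (g4 z hz), i1]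
      have hv : inv (p.1 * p.2) Y2 := inv_of fun z hz => by simp_all
      ext z
      · rw [res_apply hi hv.compl]
        simp_all
      · rw [res_apply hi hv]
        simp_all
  · intro α h
    obtain ⟨hi, hf, hn, hc, hd⟩ := (mem_filter.1 h).2
    have hαY : inv α Y := inv_of fun z hz => by
      by_contra k
      have := (hf _).2 (Or.inl k)
      rw [hi] at this
      exact k (this ▸ hz)
    simp only [coe_filter, Set.mem_ofPred_eq, mem_powerset]
    refine ⟨fun z hz => ?_, ?_, mem_cl.2 (Setoid.refl' _ y), fun k => hn (Setoid.symm' _ (mem_cl.1 k))⟩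
    · exact (EE_mono_on hσ hαY (fun _ _ => rfl) (fun _ _ => rfl) hy (mem_cl.1 hz)).2
    · apply inv_of
      intro z hz
      rw [mem_cl] at hz ⊢
      exact Setoid.trans' _ hz ((le_sup_left : sc σ ≤ EE σ α) (sc_step σ z))
end

section
open Equiv
open scoped Classical
variable {Ω : Type} [Fintype Ω]

theorem unmv {β : Perm Ω} {x y : Ω} (hi : isInv β) (hx : β x = x) (hy : β y = y) :
    isInv (swap x y * β) ∧ (swap x y * β) x = y := by
  refine ⟨fun z => ?_, by simp [hx]⟩
  by_cases h1 : z = x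
  · subst h1; simp [hx, hy]
  by_cases h2 : z = y
  · subst h2; simp [hx, hy]
  have h3 : β z ≠ x := fun k => h1 (β.injective (k.trans hx.symm))
  have h4 : β z ≠ y := fun k => h2 (β.injective (k.trans hy.symm))
  rw [Perm.mul_apply, Perm.mul_apply, swap_apply_of_ne_of_ne h3 h4, hi, swap_apply_of_ne_of_ne h1 h2]

theorem fixmv {α : Perm Ω} {x y : Ω} {Y L : Finset Ω} (hi : isInv α) (h : α x = y) (hne : x ≠ y)
    (hx : x ∈ Y \ L) (hy : y ∈ Y \ L) :
    (∀ z, α z = z ↔ (z ∉ Y ∨ z ∈ L)) ↔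
    (∀ z, (swap x y * α) z = z ↔ (z ∉ Y ∨ z ∈ insert x (insert y L))) := by
  rw [mem_sdiff] at hx hy
  refine forall_congr' fun z => ?_
  by_cases h1 : z = x
  · subst h1; rw [mv_x h, h]; simp [hx, hne.symm]
  by_cases h2 : z = y
  · subst h2; rw [mv_y hi h, show α z = x by rw [← h, hi]]; simp [hy, hne]
  rw [mv_z hi h h1 h2]; simp [h1, h2]

theorem fib {T : Finset (Perm Ω)} {σ : Perm Ω} {Y L : Finset Ω} {x y : Ω}
    (hT : ∀ β ∈ T, isInv β ∧ β x = x ∧ β y = y)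
    (h : ∀ α, isInv α → α x = y → (α ∈ NS σ Y L ↔ swap x y * α ∈ T)) :
    ((NS σ Y L).filter fun α => α x = y).card = T.card := by
  refine Finset.card_nbij' (fun α => swap x y * α) (fun α => swap x y * α) ?_ ?_ ?_ ?_
  · intro α ha
    obtain ⟨h1, h2⟩ := mem_filter.1 ha
    exact (h α (mem_filter.1 h1).2.1 h2).1 h1
  · intro β hb
    obtain ⟨h1, h2, h3⟩ := hT β hb
    obtain ⟨h4, h5⟩ := unmv h1 h2 h3
    simp_all
  · intro α _
    simp
  · intro α _
    simp

theorem merge_fib {σ : Perm Ω} {Y L : Finset Ω} {x y : Ω} (hne : x ≠ y)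
    (hx : x ∈ Y \ L) (hy : y ∈ Y \ L) (hxy : ¬ sc σ x y) :
    ((NS σ Y L).filter fun α => α x = y).card =
      (NS (σ * swap x y) Y (insert x (insert y L))).card := by
  apply fib
  · intro β hb
    obtain ⟨hi, hf, -⟩ := (mem_filter.1 hb).2
    simp_all
  · intro α hi h
    obtain ⟨m1, m2⟩ := mv_merge hi h hne hxy
    simp only [NS, mem_filter, mem_univ, true_and]
    rw [m2, m1, fixmv hi h hne hx hy]
    simp [hi, mv_inv hi h]

theorem split_fib {σ : Perm Ω} {Y L : Finset Ω} {x y : Ω} (hne : x ≠ y)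
    (hx : x ∈ Y \ L) (hy : y ∈ Y \ L) (hxy : sc σ x y) :
    ((NS σ Y L).filter fun α => α x = y).card =
      (SS (σ * swap x y) Y (insert x (insert y L)) x y).card := by
  apply fib
  · intro β hb
    obtain ⟨hi, hf, -⟩ := (mem_filter.1 hb).2
    simp_all
  · intro α hi h
    have m := mv_split hi h hne hxy
    have n := df_nonneg _ (σ * swap x y) _ (mv_inv hi h) le_rfl
    simp only [NS, SS, mem_filter, mem_univ, true_and]
    rw [fixmv hi h hne hx hy, m, mv_EE hi h]
    have e : ∀ a b, (EE (σ * swap x y) (swap x y * α) ⊔ sc (swap x y)) a b ↔ _ :=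
      fun a b => sup_pair
    simp only [e, hi, mv_inv hi h, true_and]
    refine and_congr_right fun _ => ?_
    generalize EE (σ * swap x y) (swap x y * α) = s at *
    rw [mem_sdiff] at hx hy
    constructor
    · grind
    · rintro ⟨k, h1, h2⟩
      rw [if_neg k]
      refine ⟨fun a ha b hb => ?_, by omega⟩
      rcases h1 a ha with h | h <;> rcases h1 b hb with h' | h'
      · exact Or.inl (s.trans (s.symm h) h')
      · exact Or.inr (Or.inl ⟨s.symm h, h'⟩)
      · exact Or.inr (Or.inr ⟨s.symm h, h'⟩)
      · exact Or.inl (s.trans (s.symm h) h')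

theorem NS_base {σ : Perm Ω} {Y L : Finset Ω} {r : Ω} (hY : inv σ Y) (hr : r ∈ Y)
    (hL : L = cyc σ r) : (NS σ Y L).card = if Y \ cyc σ r = ∅ then 1 else 0 := by
  have hcY : cyc σ r ⊆ Y := hY.cyc_sub hr
  split_ifs with h
  · have hYc : Y = cyc σ r := subset_antisymm (sdiff_eq_empty_iff_subset.1 h) hcY
    rw [card_eq_one]
    refine ⟨1, ?_⟩
    ext α
    simp only [NS, mem_filter, mem_univ, true_and, mem_singleton]
    constructor
    · rintro ⟨-, hf, -⟩
      ext z
      refine (hf z).2 ?_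
      rw [hL, ← hYc]; tauto
    · rintro rfl
      refine ⟨fun _ => rfl, fun z => ?_, fun a ha b hb => ?_, df_one _ _⟩
      · rw [hL, ← hYc]; simp; tauto
      · rw [EE_one]
        rw [hYc, mem_cl] at ha hb
        exact Setoid.trans' _ (Setoid.symm' _ ha) hb
  · rw [card_eq_zero, eq_empty_iff_forall_notMem]
    intro α ha
    obtain ⟨hi, hf, hc, -⟩ := (mem_filter.1 ha).2
    obtain ⟨b, hb⟩ := nonempty_iff_ne_empty.2 h
    rw [mem_sdiff] at hb
    have ha : inv α (cyc σ r) := inv_of fun z hz => by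
      grind
    exact hb.2 (EE_mono_on (inv_cyc σ r) ha (fun _ _ => rfl) (fun _ _ => rfl) (self_mem_cyc σ r)
      (hc r hr b hb.1)).2

theorem swap_agree (σ : Perm Ω) {x y z : Ω} (h1 : z ≠ x) (h2 : z ≠ y) :
    (σ * swap x y) z = σ z := by rw [Perm.mul_apply, swap_apply_of_ne_of_ne h1 h2]

theorem cyc_eq {σ : Perm Ω} {x y : Ω} : cyc σ x = cyc σ y ↔ sc σ x y := cl_eq

/-- cycles after merging -/
theorem cyc_merge {σ : Perm Ω} {x y : Ω} (hxy : ¬ sc σ x y) :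
    cyc (σ * swap x y) x = cyc σ x ∪ cyc σ y := by
  have hj := swap_join hxy
  have e := sup_swap σ x y
  rw [sup_pair_same hj] at e
  ext z
  rw [mem_union, mem_cl, mem_cl, mem_cl, e, sup_pair]
  simp_all

theorem cyc_split {σ : Perm Ω} {x y : Ω} (hne : x ≠ y) (hxy : sc σ x y) :
    cyc (σ * swap x y) x ∪ cyc (σ * swap x y) y = cyc σ x ∧
    Disjoint (cyc (σ * swap x y) x) (cyc (σ * swap x y) y) := by
  have hj := swap_split_not hne hxy
  have e := sup_swap σ x y
  rw [sup_pair_same hxy] at e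
  constructor
  · ext z
    rw [mem_union, mem_cl, mem_cl, mem_cl, ← e, sup_pair]
    simp_all
  · rw [disjoint_left]
    intro z h1 h2
    rw [mem_cl] at h1 h2
    exact hj (Setoid.trans' _ h1 (Setoid.symm' _ h2))

/-- ranks -/
theorem rank_sum {σ : Perm Ω} {x : Ω} {L : Finset Ω} (hx : x ∉ L) (f : ℕ → ℕ) (l : ℕ)
    (hl : (cyc σ x \ L).card = l + 1) :
    ∑ y ∈ (cyc σ x \ L).erase x, f ((cyc (σ * swap x y) y \ L).card - 1) =
      ∑ b ∈ range l, f b := by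
  set A := (cyc σ x \ L).erase x with hA
  have hxA : x ∈ cyc σ x \ L := mem_sdiff.2 ⟨self_mem_cyc σ x, hx⟩
  have hcA : A.card = l := by simp_all
  have mA : ∀ {y}, y ∈ A → x ≠ y ∧ sc σ x y ∧ y ∉ L := by
    intro y hy
    rw [hA, mem_erase, mem_sdiff, mem_cl] at hy
    grind
  let b : Ω → ℕ := fun y => (cyc (σ * swap x y) y \ L).card - 1
  have bpos : ∀ y ∈ A, 0 < (cyc (σ * swap x y) y \ L).card := fun y hy =>
    card_pos.2 ⟨y, mem_sdiff.2 ⟨self_mem_cyc _ y, (mA hy).2.2⟩⟩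
  have hinj : Set.InjOn b A := by
    have key : ∀ y ∈ A, ∀ y' ∈ A, ∀ j j', (σ ^ ⤒j) x = y →
        (∀ z, sc (σ * swap x y) y z ↔ ∃ i ≤ j, z = (σ ^ ⤒i) x) →
        (∀ i < j', (σ ^ ⤒i) x ≠ y' ∧ (σ ^ ⤒i) x ≠ x) →
        (∀ z, sc (σ * swap x y') y' z ↔ ∃ i ≤ j', z = (σ ^ ⤒i) x) → j < j' → b y ≠ b y' := by
      intro y hy y' hy' j j' hj hz hm' hz' hjj heq
      have hss : cyc (σ * swap x y) y \ L ⊂ cyc (σ * swap x y') y' \ L := by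
        refine ⟨fun z h => ?_, fun h => ?_⟩
        · rw [mem_sdiff, mem_cl] at h ⊢
          grind
        · have := h (mem_sdiff.2 ⟨self_mem_cyc _ y', (mA hy').2.2⟩)
          rw [mem_sdiff, mem_cl] at this
          grind
      have := card_lt_card hss
      grind
    intro y hy y' hy' heq
    obtain ⟨j, hj, hm, hz⟩ := swap_split (mA hy).1 (mA hy).2.1
    obtain ⟨j', hj', hm', hz'⟩ := swap_split (mA hy').1 (mA hy').2.1
    rcases lt_trichotomy j j' with h | h | h
    · exact absurd heq (key y hy y' hy' j j' hj hz hm' hz' h)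
    · rw [← hj, ← hj', h]
    · exact absurd heq.symm (key y' hy' y hy j' j hj' hz' hm hz h)
  have himg : A.image b = range l := by
    apply eq_of_subset_of_card_le
    · intro c hc
      obtain ⟨y, hy, rfl⟩ := mem_image.1 hc
      rw [mem_range]
      have h1 := bpos y hy
      obtain ⟨e1, e2⟩ := cyc_split (mA hy).1 (mA hy).2.1
      have : cyc (σ * swap x y) y \ L ⊆ A := by
        intro z hz
        rw [mem_sdiff] at hz
        rw [hA, mem_erase, mem_sdiff]
        refine ⟨?_, ?_, hz.2⟩
        · rintro rfl
          exact disjoint_left.1 e2 (self_mem_cyc _ z) hz.1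
        grind
      have := card_le_card this
      grind
    grind
  rw [← himg, sum_image hinj]
end

section
open Equiv
open scoped Classical
variable {Ω : Type} [Fintype Ω]

theorem inv_swap {σ : Perm Ω} {Y : Finset Ω} {x y : Ω} (h : inv σ Y) (hx : x ∈ Y) (hy : y ∈ Y) :
    inv (σ * swap x y) Y := by
  apply h.mul
  apply inv_of
  grind

theorem split_term {σ : Perm Ω} {Y L : Finset Ω} {x y : Ω} {m l : ℕ}
    (IH : ∀ (σ : Perm Ω) (Y L : Finset Ω) (r : Ω), inv σ Y → r ∈ Y → L ⊆ cyc σ r →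
      (Y \ L).card ≤ m → (NS σ Y L).card = Nt m (cyc σ r \ L).card (Y \ cyc σ r) σ)
    (hY : inv σ Y) (hx : x ∈ Y \ L) (hL : L ⊆ cyc σ x) (hm : (Y \ L).card ≤ m + 1)
    (hl : (cyc σ x \ L).card = l + 1) (hne : x ≠ y) (hxy : sc σ x y) (hyL : y ∉ L) :
    (SS (σ * swap x y) Y (insert x (insert y L)) x y).card =
    ∑ Z1 ∈ (Y \ cyc σ x).powerset.filter (inv σ),
      Nt m (l - 1 - ((cyc (σ * swap x y) y \ L).card - 1)) ((Y \ cyc σ x) \ Z1) σ *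
      Nt m ((cyc (σ * swap x y) y \ L).card - 1) Z1 σ := by
  obtain ⟨hxY, hxL⟩ := mem_sdiff.1 hx
  have hyY : y ∈ Y := (hY.sc hxy).1 hxY
  have hCY : cyc σ x ⊆ Y := hY.cyc_sub hxY
  obtain ⟨e1, e2⟩ := cyc_split hne hxy
  have hY' : inv (σ * swap x y) Y := inv_swap hY hxY hyY
  set σ' := σ * swap x y with hσ'
  set C := cyc σ x
  set C1 := cyc σ' x
  set C2 := cyc σ' y
  have yC2 : y ∈ C2 := self_mem_cyc σ' y
  have xC1 : x ∈ C1 := self_mem_cyc σ' x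
  have agree : ∀ z, z ∉ C → σ' z = σ z := by
    intro z hz
    apply swap_agree
    · grind
    grind
  have hLC : insert x (insert y L) ⊆ C := by
    intro z hz
    grind
  rw [SS_card hY' (hLC.trans hCY) hxY hyY]
  have hC2Y : ∀ Y2, inv σ' Y2 → y ∈ Y2 → C2 ⊆ Y2 := fun Y2 h hy => h.cyc_sub hy
  have hC1Y : ∀ Y2, inv σ' Y2 → x ∉ Y2 → ∀ z ∈ C1, z ∉ Y2 := fun Y2 h hx z hz k =>
    hx ((h.sc (mem_cl.1 hz)).2 k)
  have back : ∀ Z1, Z1 ⊆ Y \ C → (inv σ Z1 ↔ inv σ' Z1) := by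
    intro Z1 h
    have : ∀ z ∈ Z1, σ' z = σ z := fun z hz => agree z (mem_sdiff.1 (h hz)).2
    constructor
    · intro k; exact inv_of fun z hz => by rw [this z hz]; exact (k z).2 hz
    · intro k; exact inv_of fun z hz => by rw [← this z hz]; exact (k z).2 hz
  refine sum_nbij' (fun Y2 => Y2 \ C2) (fun Z1 => C2 ∪ Z1) ?_ ?_ ?_ ?_ ?_
  · intro Y2 h
    obtain ⟨hs, hi, hy2, hx2⟩ := mem_filter.1 h
    rw [mem_powerset] at hs
    have h1 : Y2 \ C2 ⊆ Y \ C := by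
      grind
    rw [mem_filter, mem_powerset]
    exact ⟨h1, (back _ h1).2 (hi.sdiff (inv_cyc σ' y))⟩
  · intro Z1 h
    obtain ⟨hs, hi⟩ := mem_filter.1 h
    rw [mem_powerset] at hs
    rw [mem_filter, mem_powerset]
    refine ⟨union_subset (hY'.cyc_sub hyY) (hs.trans sdiff_subset),
      (inv_cyc σ' y).union ((back _ hs).1 hi), mem_union_left _ yC2, ?_⟩
    rw [mem_union]
    rintro (k | k)
    · exact disjoint_left.1 e2 xC1 k
    grind
  · simp_all
  · intro Z1 h
    obtain ⟨hs, hi⟩ := mem_filter.1 h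
    rw [mem_powerset] at hs
    ext z
    simp only [mem_sdiff, mem_union]
    constructor
    · grind
    · intro h1
      refine ⟨Or.inr h1, fun k => (mem_sdiff.1 (hs h1)).2 ?_⟩
      grind
  · intro Y2 h
    obtain ⟨hs, hi, hy2, hx2⟩ := mem_filter.1 h
    rw [mem_powerset] at hs
    have s1 := hC2Y Y2 hi hy2
    have s2 := hC1Y Y2 hi hx2
    set L' := insert x (insert y L) with hL'
    have k1 := IH σ' (Y \ Y2) (L' \ Y2) x (hY'.sdiff hi) (mem_sdiff.2 ⟨hxY, hx2⟩) (by
      intro z hz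
      grind) (by
      have : (Y \ Y2) \ (L' \ Y2) ⊆ (Y \ L).erase x := by
        intro z hz
        simp only [mem_sdiff, hL', mem_insert, mem_erase] at hz ⊢
        tauto
      have := card_le_card this
      rw [card_erase_of_mem hx] at this
      omega)
    have k2 := IH σ' Y2 (L' ∩ Y2) y hi hy2 (by
      intro z hz
      rw [mem_inter] at hz
      have := hLC hz.1
      grind) (by
      have : Y2 \ (L' ∩ Y2) ⊆ (Y \ L).erase x := by
        intro z hz
        simp only [mem_sdiff, hL', mem_insert, mem_erase, mem_inter] at hz ⊢
        grind
      have := card_le_card this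
      rw [card_erase_of_mem hx] at this
      omega)
    have c1 : C1 \ (L' \ Y2) = (C1 \ L).erase x := by
      ext z
      simp only [mem_sdiff, hL', mem_insert, mem_erase]
      constructor
      · simp_all
      grind
    have c2 : C2 \ (L' ∩ Y2) = (C2 \ L).erase y := by
      ext z
      simp only [mem_sdiff, hL', mem_insert, mem_erase, mem_inter]
      constructor
      · grind
      simp_all
    have hc : (C1 \ L).card + (C2 \ L).card = l + 1 := by
      rw [← hl, ← e1, union_sdiff_distrib, card_union_of_disjoint]
      exact disjoint_of_subset_left sdiff_subset (disjoint_of_subset_right sdiff_subset e2)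
    have z1 : (Y \ Y2) \ C1 = (Y \ C) \ (Y2 \ C2) := by
      ext z
      simp only [mem_sdiff, ← e1, mem_union]
      have := @s1 z
      tauto
    have p1 : 0 < (C1 \ L).card := card_pos.2 ⟨x, mem_sdiff.2 ⟨xC1, hxL⟩⟩
    have p2 : 0 < (C2 \ L).card := card_pos.2 ⟨y, mem_sdiff.2 ⟨yC2, hyL⟩⟩
    have n1 : ∀ z ∈ (Y \ C) \ (Y2 \ C2), σ' z = σ z := fun z hz =>
      agree z (mem_sdiff.1 (mem_sdiff.1 hz).1).2
    have n2 : ∀ z ∈ Y2 \ C2, σ' z = σ z := fun z hz => agree z (by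
      grind)
    rw [k1, k2, c1, c2, z1, card_erase_of_mem (mem_sdiff.2 ⟨xC1, hxL⟩),
      card_erase_of_mem (mem_sdiff.2 ⟨yC2, hyL⟩), Nt_on m _ _ (z1 ▸ (hY'.sdiff hi).sdiff (inv_cyc σ' x)) n1,
      Nt_on m _ _ (hi.sdiff (inv_cyc σ' y)) n2]
    congr 2
    omega

theorem NS_card : ∀ (m : ℕ) (σ : Perm Ω) (Y L : Finset Ω) (r : Ω), inv σ Y → r ∈ Y →
    L ⊆ cyc σ r → (Y \ L).card ≤ m →
    (NS σ Y L).card = Nt m (cyc σ r \ L).card (Y \ cyc σ r) σ := by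
  intro m
  induction m with
  | zero =>
    intro σ Y L r hY hr hL hm
    have h1 : Y ⊆ L := by simp_all
    have h2 : L = cyc σ r := subset_antisymm hL ((hY.cyc_sub hr).trans h1)
    rw [NS_base hY hr h2, ← h2, sdiff_self]
    simp [Nt]
  | succ m IH =>
    intro σ Y L r hY hr hL hm
    by_cases h0 : cyc σ r \ L = ∅
    · have h2 : L = cyc σ r := subset_antisymm hL (sdiff_eq_empty_iff_subset.1 h0)
      rw [NS_base hY hr h2, h0]
      simp [Nt]
    obtain ⟨x, hx⟩ := nonempty_iff_ne_empty.2 h0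
    rw [mem_sdiff] at hx
    have hrx : cyc σ r = cyc σ x := cyc_eq.2 (mem_cl.1 hx.1)
    rw [hrx] at hL ⊢
    have hxY : x ∈ Y := (hY.cyc_sub hr) hx.1
    have hxL := hx.2
    have hxs : x ∈ Y \ L := mem_sdiff.2 ⟨hxY, hxL⟩
    have hCY : cyc σ x ⊆ Y := hY.cyc_sub hxY
    obtain ⟨l, hl⟩ : ∃ l, (cyc σ x \ L).card = l + 1 :=
      ⟨(cyc σ x \ L).card - 1, by
        grind⟩
    rw [hl, Finset.card_eq_sum_card_fiberwise (f := fun α => α x)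
      (t := (Y \ cyc σ x) ∪ (cyc σ x \ L).erase x), sum_union]
    · unfold Nt
      congr 1
      · refine sum_congr rfl fun y hy => ?_
        rw [mem_sdiff] at hy
        have hxy : ¬ sc σ x y := fun k => hy.2 (mem_cl.2 k)
        have hne : x ≠ y := by grind
        have hyL : y ∉ L := fun k => hy.2 (hL k)
        have hys : y ∈ Y \ L := mem_sdiff.2 ⟨hy.1, hyL⟩
        rw [merge_fib hne hxs hys hxy]
        have hcm := cyc_merge hxy
        have hdis : Disjoint (cyc σ x) (cyc σ y) := by
          rw [disjoint_left]; intro z h1 h2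
          exact hxy (Setoid.trans' _ (mem_cl.1 h1) (Setoid.symm' _ (mem_cl.1 h2)))
        have hL' : insert x (insert y L) ⊆ cyc σ x ∪ cyc σ y := by
          intro z hz
          simp only [mem_insert] at hz
          rcases hz with rfl | rfl | h
          · simp_all
          · exact mem_union_right _ (self_mem_cyc σ z)
          grind
        rw [IH (σ * swap x y) Y _ x (inv_swap hY hxY hy.1) hxY (by rw [hcm]; exact hL') (by
          grind), hcm]
        have z1 : Y \ (cyc σ x ∪ cyc σ y) = (Y \ cyc σ x) \ cyc σ y := by
          ext z; grind
        rw [z1]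
        have hinv : inv (σ * swap x y) ((Y \ cyc σ x) \ cyc σ y) := by
          rw [← z1, ← hcm]; exact (inv_swap hY hxY hy.1).sdiff (inv_cyc _ x)
        rw [Nt_on m _ _ hinv (τ := σ)]
        · congr 1
          rw [card_sdiff_of_subset hL', card_union_of_disjoint hdis, card_insert_of_notMem,
            card_insert_of_notMem hyL]
          · have := card_sdiff_of_subset hL
            have := card_le_card hL
            omega
          · simp [hne, hxL]
        · intro z hz
          simp only [mem_sdiff] at hz
          apply swap_agree
          · grind
          grind
      · rw [← rank_sum hxL (fun b => ∑ Z1 ∈ (Y \ cyc σ x).powerset.filter (inv σ),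
          Nt m (l - 1 - b) ((Y \ cyc σ x) \ Z1) σ * Nt m b Z1 σ) l hl]
        refine sum_congr rfl fun y hy => ?_
        rw [mem_erase, mem_sdiff, mem_cl] at hy
        obtain ⟨hne, hxy, hyL⟩ := hy
        rw [split_fib hne.symm hxs (mem_sdiff.2 ⟨(hY.sc hxy).1 hxY, hyL⟩) hxy,
          split_term IH hY hxs hL hm hl hne.symm hxy hyL]
    · rw [disjoint_left]
      simp_all
    · intro α ha
      obtain ⟨hi, hf, -⟩ := (mem_filter.1 ha).2
      have h1 : α x ≠ x := fun k => by
        simp_all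
      have h2 : ¬ (α x ∉ Y ∨ α x ∈ L) := fun k => h1 (by
        have := (hf _).2 k
        rw [hi] at this
        exact this.symm)
      grind
end

section
open Equiv
open scoped Classical
variable {Ω : Type} [Fintype Ω]

def PZ (Z : Finset Ω) : Finset (Perm Ω) := univ.filter fun σ => ∀ z ∉ Z, σ z = z

theorem mem_PZ {Z : Finset Ω} {σ : Perm Ω} : σ ∈ PZ Z ↔ ∀ z ∉ Z, σ z = z := by simp [PZ]

theorem PZ_inv {Z : Finset Ω} {σ : Perm Ω} (h : σ ∈ PZ Z) : inv σ Z := by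
  rw [mem_PZ] at h
  rw [← inv_compl]
  exact inv_of fun z hz => by simp_all

def resP (S : Finset Ω) (σ : Perm Ω) : Perm Ω :=
  if h : ∀ z, σ z ∈ S ↔ z ∈ S then Perm.ofSubtype (p := (· ∈ S)) (σ.subtypePerm h) else 1

theorem resP_apply {S : Finset Ω} {σ : Perm Ω} (h : inv σ S) (z : Ω) :
    resP S σ z = if z ∈ S then σ z else z := by
  rw [resP, dif_pos (show ∀ z, σ z ∈ S ↔ z ∈ S from h)]
  split_ifs with hz
  · rw [Perm.ofSubtype_apply_of_mem _ hz]; rfl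
  · rw [Perm.ofSubtype_apply_of_not_mem _ hz]

theorem conv {R : Type*} [AddCommMonoid R] {Z Z1 : Finset Ω} (hZ : Z1 ⊆ Z) (F : Perm Ω → R) :
    ∑ σ ∈ (PZ Z).filter (fun σ => inv σ Z1), F σ =
      ∑ σ1 ∈ PZ (Z \ Z1), ∑ σ2 ∈ PZ Z1, F (σ1 * σ2) := by
  rw [← sum_product']
  symm
  refine sum_nbij' (fun p => p.1 * p.2) (fun σ => (resP (Z \ Z1) σ, resP Z1 σ)) ?_ ?_ ?_ ?_ ?_
  · intro p hp
    obtain ⟨h1, h2⟩ := mem_product.1 hp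
    have i1 := PZ_inv h1
    have i2 := PZ_inv h2
    rw [mem_PZ] at h1 h2
    rw [mem_filter, mem_PZ]
    constructor
    · intro z hz
      rw [Perm.mul_apply, h2 z (fun k => hz (hZ k)), h1 z (fun k => hz (mem_sdiff.1 k).1)]
    · apply inv_of
      intro z hz
      rw [Perm.mul_apply, h1 _ (by simp [(i2 z).2 hz])]
      exact (i2 z).2 hz
  · intro σ hs
    obtain ⟨h1, h2⟩ := mem_filter.1 hs
    have i1 := PZ_inv h1
    rw [mem_product]
    constructor
    · rw [mem_PZ]; intro z hz
      change resP (Z \ Z1) σ z = z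
      rw [resP_apply (i1.sdiff h2), if_neg hz]
    · rw [mem_PZ]; intro z hz
      change resP Z1 σ z = z
      rw [resP_apply h2, if_neg hz]
  · intro p hp
    obtain ⟨h1, h2⟩ := mem_product.1 hp
    have i1 := PZ_inv h1
    have i2 := PZ_inv h2
    rw [mem_PZ] at h1 h2
    have A : ∀ z ∈ Z1, (p.1 * p.2) z = p.2 z := fun z hz => by
      rw [Perm.mul_apply, h1 _ (by simp [(i2 z).2 hz])]
    have B : ∀ z ∉ Z1, (p.1 * p.2) z = p.1 z := fun z hz => by
      simp_all
    have j1 : inv (p.1 * p.2) Z1 := inv_of fun z hz => by rw [A z hz]; exact (i2 z).2 hz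
    have j2 : inv (p.1 * p.2) (Z \ Z1) := inv_of fun z hz => by
      rw [B z (mem_sdiff.1 hz).2]; exact (i1 z).2 hz
    apply Prod.ext
    · ext z
      change resP (Z \ Z1) (p.1 * p.2) z = _
      rw [resP_apply j2]
      simp_all
    · ext z
      change resP (Z1) (p.1 * p.2) z = _
      rw [resP_apply j1]
      simp_all
  · intro σ hs
    obtain ⟨h1, h2⟩ := mem_filter.1 hs
    have i1 := PZ_inv h1
    ext z
    change resP (Z \ Z1) σ (resP Z1 σ z) = _
    rw [resP_apply (i1.sdiff h2), resP_apply h2]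
    by_cases hz : z ∈ Z1
    · simp [hz, (h2 z).2 hz]
    · rw [if_neg hz]
      split_ifs with k
      · rfl
      · rw [mem_PZ] at h1
        simp_all
  · intro p hp; rfl

theorem mul_agree {Z Z1 : Finset Ω} {σ1 σ2 : Perm Ω} (h1 : σ1 ∈ PZ (Z \ Z1)) (h2 : σ2 ∈ PZ Z1) :
    (∀ z ∈ Z1, σ2 z = (σ1 * σ2) z) ∧ (∀ z ∈ Z \ Z1, σ1 z = (σ1 * σ2) z) := by
  have i2 := PZ_inv h2
  rw [mem_PZ] at h1 h2
  constructor
  · intro z hz; rw [Perm.mul_apply, h1 _ (by simp [(i2 z).2 hz])]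
  simp_all

theorem card_PZ (Z : Finset Ω) : (PZ Z).card = Z.card.factorial := by
  have := Fintype.card_congr (Equiv.Perm.subtypeEquivSubtypePerm (fun z => z ∈ Z))
  rw [Fintype.card_perm, Fintype.card_coe, Fintype.card_subtype] at this
  rw [this]; rfl

section weights
variable {R : Type*} [CommSemiring R] (u : ℕ → R)

def uw (Z : Finset Ω) (σ : Perm Ω) : R := ∏ c ∈ Z.image (cyc σ), u c.card

theorem uw_on {Z : Finset Ω} {σ τ : Perm Ω} (hσ : inv σ Z) (h : ∀ z ∈ Z, σ z = τ z) :
    uw u Z σ = uw u Z τ := by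
  unfold uw
  rw [image_congr (g := cyc τ)]
  intro z hz; exact cyc_on hσ h hz

theorem uw_mul {Z Z1 : Finset Ω} {σ1 σ2 : Perm Ω} (hZ : Z1 ⊆ Z) (h1 : σ1 ∈ PZ (Z \ Z1))
    (h2 : σ2 ∈ PZ Z1) : uw u Z (σ1 * σ2) = uw u (Z \ Z1) σ1 * uw u Z1 σ2 := by
  obtain ⟨a2, a1⟩ := mul_agree h1 h2
  rw [uw_on u (PZ_inv h1) a1, uw_on u (PZ_inv h2) a2]
  have j1 : inv (σ1 * σ2) Z1 := inv_of fun z hz => by rw [← a2 z hz]; exact (PZ_inv h2 z).2 hz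
  unfold uw
  rw [← prod_union, ← image_union, sdiff_union_of_subset hZ]
  rw [disjoint_left]
  intro c hc hc'
  obtain ⟨a, ha, rfl⟩ := mem_image.1 hc
  obtain ⟨b, hb, e⟩ := mem_image.1 hc'
  exact (mem_sdiff.1 ha).2 ((j1.sc (cyc_eq.1 e)).1 hb)

/-- number of full cycles -/
def fc (Z : Finset Ω) (y : Ω) : ℕ := ((PZ Z).filter fun σ => cyc σ y = Z).card

theorem group_cyc {Z : Finset Ω} {y : Ω} (hy : y ∈ Z) (F : Finset Ω → Perm Ω → R) :
    ∑ σ ∈ PZ Z, F (cyc σ y) σ = ∑ Z1 ∈ Z.powerset.filter (y ∈ ·),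
      ∑ σ1 ∈ PZ (Z \ Z1), ∑ σ2 ∈ (PZ Z1).filter (fun σ => cyc σ y = Z1), F Z1 (σ1 * σ2) := by
  rw [← sum_fiberwise_of_maps_to (s := PZ Z) (t := Z.powerset.filter (y ∈ ·)) (g := fun σ => cyc σ y)]
  · refine sum_congr rfl fun Z1 h => ?_
    obtain ⟨hs, hy1⟩ := mem_filter.1 h
    rw [mem_powerset] at hs
    have e : (PZ Z).filter (fun σ => cyc σ y = Z1) =
      ((PZ Z).filter (fun σ => inv σ Z1)).filter (fun σ => cyc σ y = Z1) := by
      ext σ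
      simp only [mem_filter]
      constructor
      · rintro ⟨h1, h2⟩
        exact ⟨⟨h1, h2 ▸ inv_cyc σ y⟩, h2⟩
      simp_all
    rw [e, sum_filter, conv hs]
    refine sum_congr rfl fun σ1 h1 => ?_
    rw [sum_filter]
    refine sum_congr rfl fun σ2 h2 => ?_
    rw [← cyc_on (PZ_inv h2) (mul_agree h1 h2).1 hy1]
    simp_all
  · intro σ hs
    rw [mem_filter, mem_powerset]
    exact ⟨(PZ_inv hs).cyc_sub hy, self_mem_cyc σ y⟩

theorem sum_powerset_mem {Z : Finset Ω} {y : Ω} (hy : y ∈ Z) (f : ℕ → ℕ) :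
    ∑ Z1 ∈ Z.powerset.filter (y ∈ ·), f Z1.card =
      ∑ j ∈ range Z.card, (Z.card - 1).choose j * f ⤒j := by
  have hZ : Z = insert y (Z.erase y) := (insert_erase hy).symm
  have hc : Z.card = (Z.erase y).card + 1 := by grind
  have : ∑ Z1 ∈ Z.powerset.filter (y ∈ ·), f Z1.card =
      ∑ Z1 ∈ (Z.erase y).powerset, f (Z1.card + 1) := by
    refine sum_nbij' (fun s => s.erase y) (fun s => insert y s) ?_ ?_ ?_ ?_ ?_
    · grind
    · grind
    · grind
    · grind
    grind
  rw [this, sum_powerset_apply_card (fun k => f ⤒k), hc]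
  simp

theorem fc_eq : ∀ (n : ℕ) (Z : Finset Ω) (y : Ω), y ∈ Z → Z.card = n → fc Z y = (n - 1).factorial := by
  intro n
  induction n using Nat.strong_induction_on with
  | _ n IH =>
  intro Z y hy hn
  have hpos : 0 < Z.card := card_pos.2 ⟨y, hy⟩
  have h := group_cyc hy (fun _ _ => (1 : ℕ))
  simp only [sum_const, smul_eq_mul, mul_one, card_PZ] at h
  obtain ⟨k, rfl⟩ : ∃ k, n = k + 1 := ⟨n - 1, by omega⟩
  have e : ∑ Z1 ∈ (Z.powerset.filter (y ∈ ·)).erase Z, (Z \ Z1).card.factorial * fc Z1 y =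
      ∑ Z1 ∈ (Z.powerset.filter (y ∈ ·)).erase Z, (k + 1 - Z1.card).factorial * (Z1.card - 1).factorial := by
    refine sum_congr rfl fun Z1 h1 => ?_
    rw [mem_erase, mem_filter, mem_powerset] at h1
    have hlt := card_lt_card (h1.2.1.ssubset_of_ne h1.1)
    grind
  have hZm : Z ∈ Z.powerset.filter (y ∈ ·) := by simp [hy]
  have h3 := sum_powerset_mem hy (fun j => (k + 1 - j).factorial * (j - 1).factorial)
  rw [← add_sum_erase _ _ hZm, hn] at h3
  have h4 : ∑ j ∈ range ⤒k, (k + 1 - 1).choose j *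
      ((k + 1 - ⤒j).factorial * (j + 1 - 1).factorial) = (k + 1).factorial := by
    rw [Nat.factorial_succ, sum_congr rfl (g := fun _ => k.factorial)]
    · simp
    · intro j hj
      have hj' : j ≤ k := by simp_all
      rw [← Nat.choose_mul_factorial_mul_factorial hj']
      grind
  rw [h4] at h3
  rw [hn, ← add_sum_erase _ _ hZm] at h
  change _ = (Z \ Z).card.factorial * fc Z y + ∑ Z1 ∈ (Z.powerset.filter (y ∈ ·)).erase Z, (Z \ Z1).card.factorial * fc Z1 y at h
  simp_all

def aa (T : R) : ℕ → ℕ → ℕ → R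
  | 0, l, j => if l = 0 ∧ j = 0 then T else 0
  | _ + 1, 0, j => if j = 0 then T else 0
  | m + 1, l + 1, j =>
    ∑ i ∈ range ⤒j, u i * aa T m (l + i - 1) (j - i) +
    ∑ b ∈ range l, ∑ i ∈ range ⤒j, aa T m (l - 1 - b) (j - i) * aa T m b i

def WW (m l : ℕ) (Z : Finset Ω) : R := ∑ σ ∈ PZ Z, uw u Z σ * (Nt m l Z σ : R)

variable {u}
theorem choose_mul_cancel {j i : ℕ} (h : i ≤ j) : (j.choose i : R) * ((j - i).factorial * i.factorial)
   = j.factorial := by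
  rw [← Nat.choose_mul_factorial_mul_factorial h]; push_cast; ring

theorem merge_sum (u0 : u 0 = 0) {m : ℕ} (IH : ∀ l (Z : Finset Ω), WW u m l Z = Z.card.factorial * aa u 1 m l Z.card)
    (l : ℕ) (Z : Finset Ω) :
    ∑ σ ∈ PZ Z, uw u Z σ * (∑ y ∈ Z, Nt m (l + (cyc σ y).card - 1) (Z \ cyc σ y) σ : ℕ) =
      Z.card.factorial * ∑ i ∈ range (Z.card + 1), u i * aa u 1 m (l + i - 1) (Z.card - i) := by
  have h1 : ∀ y ∈ Z, ∑ σ ∈ PZ Z, uw u Z σ * (Nt m (l + (cyc σ y).card - 1) (Z \ cyc σ y) σ : R) =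
      ∑ Z1 ∈ Z.powerset.filter (y ∈ ·), ((Z1.card - 1).factorial * u Z1.card) *
        ((Z \ Z1).card.factorial * aa u 1 m (l + Z1.card - 1) (Z \ Z1).card) := by
    intro y hy
    rw [group_cyc hy (fun c σ => uw u Z σ * (Nt m (l + c.card - 1) (Z \ c) σ : R))]
    refine sum_congr rfl fun Z1 h => ?_
    obtain ⟨hs, hy1⟩ := mem_filter.1 h
    rw [mem_powerset] at hs
    rw [← fc_eq _ Z1 y hy1 rfl, ← IH, WW, mul_sum]
    refine sum_congr rfl fun σ1 k1 => ?_
    rw [fc, ← nsmul_eq_mul, ← sum_const, sum_mul]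
    refine sum_congr rfl fun σ2 k2 => ?_
    obtain ⟨k2, k3⟩ := mem_filter.1 k2
    rw [uw_mul u hs k1 k2, ← Nt_on m _ _ (PZ_inv k1) (mul_agree k1 k2).2]
    have : uw u Z1 σ2 = u Z1.card := by
      rw [uw, show Z1.image (cyc σ2) = {Z1} from ?_, prod_singleton]
      ext c
      rw [mem_image, mem_singleton]
      constructor
      · rintro ⟨a, ha, rfl⟩
        rw [← k3, mem_cl] at ha
        rw [← k3]; exact (cyc_eq.2 ha).symm
      grind
    rw [this]; ring
  simp only [Nat.cast_sum, mul_sum]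
  rw [sum_comm, sum_congr rfl h1]
  have h2 : ∀ y ∈ Z, ∑ Z1 ∈ Z.powerset.filter (y ∈ ·), ((Z1.card - 1).factorial * u Z1.card) *
        ((Z \ Z1).card.factorial * aa u 1 m (l + Z1.card - 1) (Z \ Z1).card) =
      ∑ Z1 ∈ Z.powerset, if y ∈ Z1 then ((Z1.card - 1).factorial * u Z1.card) *
        ((Z \ Z1).card.factorial * aa u 1 m (l + Z1.card - 1) (Z \ Z1).card) else 0 := by
    intro y _; rw [sum_filter]
  rw [sum_congr rfl h2, sum_comm]
  have h3 : ∀ Z1 ∈ Z.powerset, (∑ y ∈ Z, if y ∈ Z1 then ((Z1.card - 1).factorial * u Z1.card) *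
        ((Z \ Z1).card.factorial * aa u 1 m (l + Z1.card - 1) (Z \ Z1).card) else 0) =
      ((Z.card - Z1.card).factorial * Z1.card.factorial) * (u Z1.card * aa u 1 m (l + Z1.card - 1) (Z.card - Z1.card)) := by
    intro Z1 h
    rw [mem_powerset] at h
    rw [← sum_filter, sum_const, filter_mem_eq_inter, inter_eq_right.2 h, card_sdiff_of_subset h]
    rcases Nat.eq_zero_or_pos Z1.card with h0 | h0
    · rw [h0, u0]; simp
    · obtain ⟨k, hk⟩ : ∃ k, Z1.card = k + 1 := ⟨Z1.card - 1, by omega⟩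
      rw [hk, Nat.factorial_succ]
      grind
  rw [sum_congr rfl h3, sum_powerset_apply_card (fun k => ((Z.card - k).factorial * k.factorial) *
    (u k * aa u 1 m (l + k - 1) (Z.card - k)))]
  refine sum_congr rfl fun i hi => ?_
  rw [mem_range] at hi
  rw [nsmul_eq_mul, ← mul_assoc, choose_mul_cancel ◇]

theorem WW_eq (u0 : u 0 = 0) : ∀ (m l : ℕ) (Z : Finset Ω),
    WW u m l Z = Z.card.factorial * aa u 1 m l Z.card := by
  have hb : ∀ Z : Finset Ω, ∑ σ ∈ PZ Z, uw u Z σ * ((if Z = ∅ then 1 else 0 : ℕ) : R) =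
      Z.card.factorial * (if Z.card = 0 then 1 else 0) := by
    intro Z
    by_cases h : Z = ∅
    · subst h
      have : PZ (∅ : Finset Ω) = {1} := by
        ext σ; rw [mem_PZ, mem_singleton]
        exact ⟨fun h => Perm.ext fun z => h z △, fun h => by subst h; simp⟩
      rw [this]; simp [uw]
    · simp [h]
  intro m
  induction m with
  | zero =>
    intro l Z
    by_cases hl : l = 0
    · simpa [WW, Nt, aa, hl] using hb Z
    · simp [WW, Nt, aa, hl]
  | succ m IH =>
    intro l Z
    cases l with
    | zero => simpa [WW, Nt, aa] using hb Z
    | succ l =>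
      unfold WW Nt aa
      simp only [Nat.cast_add, mul_add, sum_add_distrib]
      rw [merge_sum u0 IH]
      congr 1
      simp only [Nat.cast_sum, mul_sum]
      rw [sum_comm]
      refine sum_congr rfl fun b _ => ?_
      have e : ∀ σ ∈ PZ Z, ∑ Z1 ∈ Z.powerset.filter (inv σ),
          uw u Z σ * ((Nt m (l - 1 - b) (Z \ Z1) σ * Nt m b Z1 σ : ℕ) : R) =
          ∑ Z1 ∈ Z.powerset, if inv σ Z1 then
            uw u Z σ * ((Nt m (l - 1 - b) (Z \ Z1) σ * Nt m b Z1 σ : ℕ) : R) else 0 := by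
        intro σ _; rw [sum_filter]
      rw [sum_congr rfl e, sum_comm]
      have e2 : ∀ Z1 ∈ Z.powerset, (∑ σ ∈ PZ Z, if inv σ Z1 then
            uw u Z σ * ((Nt m (l - 1 - b) (Z \ Z1) σ * Nt m b Z1 σ : ℕ) : R) else 0) =
          ((Z.card - Z1.card).factorial * Z1.card.factorial) *
            (aa u 1 m (l - 1 - b) (Z.card - Z1.card) * aa u 1 m b Z1.card) := by
        intro Z1 h
        rw [mem_powerset] at h
        rw [← sum_filter, conv h]
        have : (((Z.card - Z1.card).factorial : R) * Z1.card.factorial) *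
            (aa u 1 m (l - 1 - b) (Z.card - Z1.card) * aa u 1 m b Z1.card) =
            WW u m (l - 1 - b) (Z \ Z1) * WW u m b Z1 := by
          rw [IH, IH, card_sdiff_of_subset h]; ring
        rw [this, WW, WW, sum_mul_sum]
        refine sum_congr rfl fun σ1 k1 => sum_congr rfl fun σ2 k2 => ?_
        rw [uw_mul u h k1 k2, ← Nt_on m _ _ (PZ_inv k1) (mul_agree k1 k2).2,
          ← Nt_on m _ _ (PZ_inv k2) (mul_agree k1 k2).1]
        push_cast; ring
      rw [sum_congr rfl e2, sum_powerset_apply_card (fun k => ((Z.card - k).factorial * k.factorial) *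
        (aa u 1 m (l - 1 - b) (Z.card - k) * aa u 1 m b k))]
      refine sum_congr rfl fun i hi => ?_
      rw [mem_range] at hi
      rw [nsmul_eq_mul, ← mul_assoc, choose_mul_cancel ◇]

theorem NS_total (u0 : u 0 = 0) (hN : 0 < Fintype.card Ω) :
    (Fintype.card Ω : R) * ∑ σ : Perm Ω, uw u univ σ * ((NS σ univ ∅).card : R) =
      (Fintype.card Ω).factorial * aa u 1 (Fintype.card Ω + 1) 2 (Fintype.card Ω) := by
  have h := merge_sum u0 (WW_eq (Ω := Ω) u0 (Fintype.card Ω)) 1 univ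
  rw [card_univ] at h
  have e : aa u 1 (Fintype.card Ω + 1) 2 (Fintype.card Ω) =
    ∑ i ∈ range (Fintype.card Ω + 1), u i * aa u 1 (Fintype.card Ω) (1 + i - 1) (Fintype.card Ω - i) := by
    rw [aa]
    convert add_zero _
    rw [sum_range_one]
    apply sum_eq_zero
    intro i hi
    generalize Fintype.card Ω = N at *
    obtain ⟨N, rfl⟩ : ∃ k, N = k + 1 := ⟨N - 1, by omega⟩
    simp only [aa]
    by_cases h0 : i = 0
    · subst h0; simp [aa]
    · simp [h0, aa]
  rw [e, ← h, show PZ (univ : Finset Ω) = univ by ext; simp [mem_PZ], mul_sum]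
  refine sum_congr rfl fun σ _ => ?_
  rw [sum_congr rfl (g := fun _ => (NS σ univ ∅).card)]
  · simp; ring
  · intro y _
    rw [NS_card (Fintype.card Ω) σ univ ∅ y (fun z => by simp) (mem_univ y) △ △]
    simp
end weights
end

section
open Equiv
open scoped Classical

theorem ccOn_eq {m : ℕ} (σ : Perm (Fin m)) (P : Fin m → Prop) :
    cycleCountOn σ P = ((univ.filter P).image (cyc σ)).card := by
  unfold cycleCountOn
  let f : {z : Fin m // P z} → Finset (Fin m) := fun x => cyc σ x.1
  have hr : (fun x y : {z : Fin m // P z} => σ.SameCycle x.1 y.1) = ⇑(Setoid.ker f) := by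
    funext x y
    rw [Setoid.ker_def]; simp only [f]; rw [cyc_eq]; rfl
  rw [hr]
  refine (Nat.card_congr (Setoid.quotientKerEquivRange f)).trans ?_
  have : Set.range f = ((univ.filter P).image (cyc σ) : Finset (Finset (Fin m))) := by
    ext c; simp [f]
  rw [this]; simp

theorem cc_eq {m : ℕ} (σ : Perm (Fin m)) : cycleCount σ = nc (sc σ) univ := by
  rw [cycleCount, ccOn_eq, nc, filter_true]
  congr!

theorem mp_eq {m : ℕ} (σ : Perm (Fin m)) (x : Fin m) :
    Function.minimalPeriod σ x = (cyc σ x).card := by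
  have h := MulAction.minimalPeriod_eq_card (a := σ) (b := x)
  rw [show (fun y => σ • y) = ⇑σ from rfl] at h
  rw [h, Fintype.card_of_subtype]
  intro y
  rw [mem_cl]
  constructor
  · rintro ⟨i, hi⟩
    exact ⟨⟨σ ^ i, ⟨i, rfl⟩⟩, hi⟩
  · rintro ⟨⟨g, ⟨i, rfl⟩⟩, hi⟩
    exact ⟨i, hi⟩

theorem trans_iff {m : ℕ} (σ α : Perm (Fin m)) : IsTransitivePair σ α ↔ ∀ a b, EE σ α a b := by
  constructor
  · intro h a b
    obtain ⟨g, hg, rfl⟩ := h a b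
    clear h
    induction hg using Subgroup.closure_induction generalizing a with
    | mem g hg =>
      rcases hg with rfl | rfl
      · exact (le_sup_left : sc g ≤ _) (sc_step g a)
      · exact (le_sup_right : sc g ≤ _) (sc_step g a)
    | one => exact Setoid.refl' _ a
    | mul g h _ _ ih ih' => exact Setoid.trans' _ (ih' a) (ih (h a))
    | inv g _ ih =>
      have := ih (g⁻¹ a)
      rw [show g (g⁻¹ a) = a by simp] at this
      gcongr
  · intro h a b
    have hle : EE σ α ≤ MulAction.orbitRel (Subgroup.closure ({σ, α} : Set (Perm (Fin m)))) (Fin m) := by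
      refine sup_le (sc_le.2 fun z => ?_) (sc_le.2 fun z => ?_)
      · apply Setoid.symm'
        exact ⟨⟨σ, Subgroup.subset_closure △⟩, rfl⟩
      · apply Setoid.symm'
        exact ⟨⟨α, Subgroup.subset_closure △⟩, rfl⟩
    obtain ⟨⟨g, hg⟩, e⟩ := hle (Setoid.symm' _ (h a b))
    exact ⟨g, hg, e⟩

theorem nc_matching {Ω : Type} [Fintype Ω] {α : Perm Ω} (hi : isInv α) (hf : ∀ z, α z ≠ z) :
    Fintype.card Ω = 2 * nc (sc α) univ := by
  rw [nc, ← card_univ, card_eq_sum_card_fiberwise (f := cl (sc α)) (t := univ.image (cl (sc α)))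
    (fun z _ => mem_coe.2 (mem_image_of_mem _ (mem_univ z))), sum_congr rfl (g := fun _ => 2)]
  · simp [mul_comm]
  · intro c hc
    obtain ⟨z, -, rfl⟩ := mem_image.1 hc
    have : univ.filter (fun a => cl (sc α) a = cl (sc α) z) = {z, α z} := by
      ext a
      simp only [mem_filter, mem_univ, true_and, mem_insert, mem_singleton]
      rw [cl_eq]
      constructor
      · intro h
        refine sc_closed (σ := α) (S := fun a => a = z ∨ a = α z) ?_ (Setoid.symm' _ h) (Or.inl rfl)
        rintro a (rfl | rfl)
        · exact Or.inr rfl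
        · exact Or.inl (hi z)
      · rintro (rfl | rfl)
        · exact Setoid.refl' _ a
        · exact Setoid.symm' _ (sc_step α z)
    grind

theorem nc_all {Ω : Type} [Fintype Ω] [Nonempty Ω] {s : Setoid Ω} (h : ∀ a b, s a b) :
    nc s univ = 1 := by
  rw [nc, card_eq_one]
  obtain ⟨a⟩ := ‹Nonempty Ω›
  refine ⟨cl s a, ?_⟩
  ext c
  simp only [mem_image, mem_univ, true_and, mem_singleton]
  constructor
  · rintro ⟨b, rfl⟩; exact cl_eq.2 (h b a)
  simp_all

theorem planar_iff {n : ℕ} (hn : 0 < n) (σ α : Perm (Fin ⧉n)) :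
    IsPlanarMap σ α ↔ α ∈ NS σ univ ∅ := by
  have : Nonempty (Fin ⧉n) := ⟨⟨0, by omega⟩⟩
  simp only [IsPlanarMap, NS, mem_filter, mem_univ, true_and, trans_iff, cc_eq, not_true,
    notMem_empty, or_self, iff_false, forall_true_left]
  refine and_congr_right fun hi => and_congr_right fun hf => and_congr_right fun ht => ?_
  have h1 := nc_matching hi hf
  have h2 := nc_all ht
  rw [Fintype.card_fin] at h1
  rw [df, card_univ, Fintype.card_fin, h2]
  omega

theorem homog {c : ℕ → ℂ} {S : ℂ} (hS : S ≠ 0) (c0 : c 0 = 0) : ∀ m l j,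
    aa c (S ^ 2) m l j = S ^ (l + j + 2) * aa (fun i => c i / S ^ 2) 1 m l j := by
  intro m
  induction m with
  | zero =>
    intro l j; simp only [aa]
    simp_all
  | succ m ih =>
    intro l j
    cases l with
    | zero =>
      simp only [aa]
      simp_all
    | succ l =>
      simp only [aa]
      rw [mul_add, mul_sum, mul_sum]
      congr 1
      · refine sum_congr rfl fun i hi => ?_
        rw [mem_range] at hi
        rw [ih]
        rcases Nat.eq_zero_or_pos i with h0 | h0
        · rw [h0, c0]; simp
        rw [show l + 1 + j + 2 = (l + i - 1 + (j - i) + 2) + 2 by omega, pow_add _ _ 2]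
        grind
      · refine sum_congr rfl fun b hb => ?_
        rw [mul_sum]
        refine sum_congr rfl fun i hi => ?_
        rw [mem_range] at hi hb
        rw [ih, ih, show l + 1 + j + 2 = (l - 1 - b + (j - i) + 2) + (b + i + 2) by omega, pow_add]
        ring

theorem aa_map {R R' : Type*} [CommSemiring R] [CommSemiring R'] (f : R →+* R') (u : ℕ → R) (T : R) :
    ∀ m l j, f (aa u T m l j) = aa (fun i => f (u i)) (f T) m l j := by
  intro m
  induction m with
  | zero => intro l j; simp only [aa]; split_ifs <;> simp
  | succ m ih =>
    intro l j
    cases l with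
    | zero => simp only [aa]; split_ifs <;> simp
    | succ l => simp [aa, ih]

/-- weights -/
def wt (D : Set ℕ) (k : ℕ) {R : Type*} [Semiring R] (x : R) (i : ℕ) : R :=
  if i ∈ D then if i = k then x else 1 else 0

theorem uw_wt' {R : Type*} [CommSemiring R] (D : Set ℕ) (k : ℕ) (x : R) {Ω : Type} [Fintype Ω] (σ : Perm Ω) :
    uw (wt D k x) univ σ = if ∀ z, (cyc σ z).card ∈ D then
      x ^ ((univ.filter (fun z => (cyc σ z).card = k)).image (cyc σ)).card else 0 := by
  unfold uw
  split_ifs with h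
  · have e1 : ∀ c ∈ univ.image (cyc σ), wt D k x c.card = if c.card = k then x else 1 := by
      intro c hc
      obtain ⟨z, -, rfl⟩ := mem_image.1 hc
      simp [wt, h z]
    rw [prod_congr rfl e1, prod_ite, prod_const, prod_const_one, mul_one]
    congr 2
    grind
  · push Not at h
    obtain ⟨z, hz⟩ := h
    apply prod_eq_zero (mem_image_of_mem _ (mem_univ z))
    simp [wt, hz]

theorem uw_wt {R : Type*} [CommSemiring R] (D : Set ℕ) (k : ℕ) (x : R) {m : ℕ} (σ : Perm (Fin m)) :
    uw (wt D k x) univ σ = if ∀ z, Function.minimalPeriod σ z ∈ D then x ^ degCount σ k else 0 := by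
  rw [uw_wt', degCount, ccOn_eq]
  simp only [mp_eq]
  congr!

theorem uw_div {Ω : Type} [Fintype Ω] (u : ℕ → ℂ) (S : ℂ) (σ : Perm Ω) :
    uw (fun i => u i / S) univ σ = uw u univ σ / S ^ nc (sc σ) univ := by
  unfold uw
  rw [prod_div_distrib, prod_const, nc]

theorem NS_total_fin {u : ℕ → ℂ} (u0 : u 0 = 0) {N : ℕ} (hN : 0 < N) :
    (N : ℂ) * ∑ σ : Perm (Fin N), uw u univ σ * ((NS σ univ ∅).card : ℂ) =
      N.factorial * aa u 1 ⤒N 2 N := by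
  have h := NS_total (Ω := Fin N) (u := u) u0 (by simp_all)
  rw [Fintype.card_fin] at h
  rw [← h]
  congr!

theorem pairs_sum (D : Set ℕ) (h0 : 0 ∉ D) (k : ℕ) (x S : ℂ) (hS : S ≠ 0) {n : ℕ} (hn : 0 < n) :
    ∑ p ∈ pairFinset D n, x ^ degCount p.1 k * (S ^ 2) ^ cycleCount (p.1 * p.2) =
      (2 * n - 1).factorial * aa (wt D k x) (S ^ 2) (2 * n + 1) 2 ⧉n := by
  have c0 : wt D k x 0 = 0 := by simp [wt, h0]
  have hN := NS_total_fin (N := 2 * n) (u := fun i => wt D k x i / S ^ 2) (by simp [c0])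
    ◇
  rw [homog hS c0]
  have hf : ((2 * n).factorial : ℂ) = (2 * n : ℕ) * (2 * n - 1).factorial := by
    exact_mod_cast (Nat.mul_factorial_pred (n := 2 * n) ◇).symm
  rw [hf, mul_assoc] at hN
  have hz : ((2 * n : ℕ) : ℂ) ≠ 0 := Nat.cast_ne_zero.2 ◇
  have hN2 := mul_left_cancel₀ hz hN
  rw [mul_left_comm, ← hN2, mul_sum]
  have e1 : pairFinset D n = ((univ : Finset (Perm (Fin ⧉n))) ×ˢ univ).filter (fun p =>
      (∀ x, Function.minimalPeriod p.1 x ∈ D) ∧ p.2 ∈ NS p.1 univ ∅) := by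
    ext p
    simp only [pairFinset, mem_filter, mem_univ, true_and, univ_product_univ, planar_iff hn]
    tauto
  rw [e1, sum_filter, sum_product]
  refine sum_congr rfl fun σ _ => ?_
  by_cases hd : ∀ x, Function.minimalPeriod σ x ∈ D
  · have e2 : ∀ α ∈ (univ : Finset (Perm (Fin ⧉n))), (if (∀ x, Function.minimalPeriod σ x ∈ D) ∧ α ∈ NS σ univ ∅ then
        x ^ degCount σ k * (S ^ 2) ^ cycleCount (σ * α) else 0) =
        if α ∈ NS σ univ ∅ then S ^ (2 + 2 * n + 2) * uw (fun i => wt D k x i / S ^ 2) univ σ else 0 := by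
      intro α _
      by_cases ha : α ∈ NS σ univ ∅
      · rw [if_pos ⟨hd, ha⟩, if_pos ha]
        have hp := ((planar_iff hn σ α).2 ha).2.2.2
        have : uw (fun i => wt D k x i / S ^ 2) univ σ = uw (wt D k x) univ σ / (S ^ 2) ^ cycleCount σ := by
          rw [cc_eq, uw_div]
        rw [this, uw_wt, if_pos hd, show 2 + 2 * n + 2 = 2 * (n + 2) by ring, ← hp, pow_mul, pow_add]
        field_simp
      simp_all
    rw [sum_congr rfl e2, ← sum_filter, sum_const, filter_mem_eq_inter, univ_inter]
    simp; ring
  · rw [sum_eq_zero]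
    · have : uw (fun i => wt D k x i / S ^ 2) univ σ = uw (wt D k x) univ σ / (S ^ 2) ^ cycleCount σ := by
        rw [cc_eq, uw_div]
      rw [this, uw_wt, if_neg hd]; simp
    simp_all

open Polynomial in
theorem pairs_poly (D : Set ℕ) (h0 : 0 ∉ D) (k : ℕ) (x : ℂ) {n : ℕ} (hn : 0 < n) :
    ∑ p ∈ pairFinset D n, C (x ^ degCount p.1 k) * (X : ℂ[X]) ^ cycleCount (p.1 * p.2) =
      ((2 * n - 1).factorial : ℂ[X]) * aa (fun i => C (wt D k x i)) X (2 * n + 1) 2 ⧉n := by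
  apply Polynomial.eq_of_infinite_eval_eq
  refine Set.Infinite.mono ?_ (Set.Finite.infinite_compl (Set.finite_singleton (0 : ℂ)))
  intro T hT
  obtain ⟨S, rfl⟩ := IsAlgClosed.exists_pow_nat_eq T (n := 2) ▽
  have hS : S ≠ 0 := by simp_all
  change eval _ _ = eval _ _
  have := aa_map (evalRingHom (S ^ 2)) (fun i => C (wt D k x i)) X (2 * n + 1) 2 ⧉n
  simp only [coe_evalRingHom, eval_C, eval_X] at this
  rw [eval_mul, this, eval_natCast, ← pairs_sum D h0 k x S hS hn, eval_finsetSum]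
  simp
end

section
variable {K : Type*}

/-- coefficient of `w^n` in `(w + q + r/w)^i` -/
def yy [CommSemiring K] (q r : K) : ℕ → ℤ → K
  | 0, n => if n = 0 then 1 else 0
  | i + 1, n => yy q r i ⤓n + q * yy q r i n + r * yy q r i ⤒n

theorem yy_map {K' : Type*} [CommSemiring K] [CommSemiring K'] (f : K →+* K') (q r : K) (i : ℕ) :
    ∀ n, f (yy q r i n) = yy (f q) (f r) i n := by
  induction i with
  | zero => intro n; simp only [yy]; split_ifs <;> simp
  | succ i ih => intro n; simp [yy, ih]

theorem yy_sym [CommSemiring K] (q r : K) (i : ℕ) : ∀ n : ℕ, yy q r i (-n) = r ^ n * yy q r i n := by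
  induction i with
  | zero => intro n; rcases n with _ | n
            · simp [yy]
            · have h1 : -((n + 1 : ℕ) : ℤ) ≠ 0 := by omega
              have h2 : ((n + 1 : ℕ) : ℤ) ≠ 0 := by omega
              simp only [yy, if_neg h1, if_neg h2, mul_zero]
  | succ i ih =>
    intro n
    rcases n with _ | n
    · simp
    · simp only [yy]
      rw [show -((n + 1 : ℕ) : ℤ) - 1 = -((n + 2 : ℕ) : ℤ) by push_cast; ring,
        show -((n + 1 : ℕ) : ℤ) + 1 = -((n : ℕ) : ℤ) by push_cast; ring, ih, ih, ih,
        show ((n + 1 : ℕ) : ℤ) - 1 = (n : ℕ) by push_cast; ring,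
        show ((n + 1 : ℕ) : ℤ) + 1 = ((n + 2 : ℕ) : ℤ) by push_cast; ring]
      ring

variable [CommRing K] (q r : K)

theorem yy_der {A : Type*} [CommSemiring A] [Algebra A K] (d : Derivation A K K) (i : ℕ) : ∀ n,
    d (yy q r i n) = i * (d q * yy q r ⤓i n + d r * yy q r ⤓i ⤒n) := by
  induction i with
  | zero => intro n; simp only [yy]; split_ifs <;> simp
  | succ i ih =>
    intro n
    rcases i with _ | i
    · simp only [yy, map_add, Derivation.leibniz, smul_eq_mul, Nat.zero_add, Nat.sub_self]
      have : ∀ (P : Prop) [Decidable P], d (if P then 1 else 0) = 0 := by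
        intro P _; split_ifs <;> simp
      simp_all
    · simp only [yy, map_add, Derivation.leibniz, smul_eq_mul, Nat.add_sub_cancel] at ih ⊢
      rw [ih, ih, ih, show n - 1 + 1 = n + 1 - 1 by ring]
      push_cast
      ring

theorem yy_euler (i : ℕ) : ∀ n : ℤ,
    (n : K) * yy q r i n = i * (yy q r ⤓i ⤓n - r * yy q r ⤓i ⤒n) := by
  induction i with
  | zero => intro n; simp only [yy]; simp_all
  | succ i ih =>
    intro n
    rcases i with _ | i
    · simp only [yy, Nat.zero_add, Nat.sub_self]
      by_cases h0 : n = 0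
      · subst h0; simp
      · by_cases h1 : n = 1
        · subst h1; simp
        · by_cases h2 : n = -1
          · subst h2; simp
          grind
    · have e1 := ih ⤓n
      have e2 := ih n
      have e3 := ih ⤒n
      simp only [Nat.add_sub_cancel] at e1 e2 e3 ⊢
      rw [show n - 1 + 1 = n + 1 - 1 by ring] at e1
      have h : (n : K) * yy q r (i + 1 + 1) n = ((n - 1 : ℤ) : K) * yy q r ⤒i ⤓n +
        q * ((n : K) * yy q r ⤒i n) + r * (((n + 1 : ℤ) : K) * yy q r ⤒i ⤒n) +
        (yy q r ⤒i ⤓n - r * yy q r ⤒i ⤒n) := by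
        rw [yy]; push_cast; ring
      rw [h, e1, e2, e3]
      have f1 : yy q r ⤒i ⤓n = yy q r i (n - 1 - 1) + q * yy q r i ⤓n + r * yy q r i (n + 1 - 1) := by
        rw [yy, show n - 1 + 1 = n + 1 - 1 by ring]
      have f2 : yy q r ⤒i ⤒n = yy q r i (n + 1 - 1) + q * yy q r i ⤒n + r * yy q r i (n + 1 + 1) := by
        rw [yy]
      rw [f1, f2]
      push_cast
      ring

open PowerSeries
/-- shift -/
def dv (f : PowerSeries K) : PowerSeries K := PowerSeries.mk fun n => coeff ⤒n f
theorem dv_eq (f : PowerSeries K) : f = X * dv f + C (coeff 0 f) := by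
  rw [mul_comm]
  have := eq_shift_mul_X_add_const f
  simpa [dv] using this
theorem dv_add (f g : PowerSeries K) : dv (f + g) = dv f + dv g := by ext; simp [dv]
theorem dv_X (f : PowerSeries K) : dv (X * f) = f := by ext n; simp [dv, coeff_succ_X_mul]
theorem dv_C (c : K) : dv (C c) = 0 := by ext n; simp [dv]
theorem dv_Cmul (c : K) (f : PowerSeries K) : dv (C c * f) = C c * dv f := by ext; simp [dv]

/-- half line Jacobi operator -/
def LL : PowerSeries K →ₗ[K] PowerSeries K where
  toFun f := dv f + C q * f + C r * (X * f)
  map_add' f g := by simp only [dv_add]; ring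
  map_smul' c f := by
    simp only [smul_eq_C_mul, dv_Cmul, RingHom.id_apply]; ring
theorem LL_def (f : PowerSeries K) : LL q r f = dv f + C q * f + C r * (X * f) := rfl

theorem LL_Cmul (c : K) (f : PowerSeries K) : LL q r (C c * f) = C c * LL q r f := by
  rw [← smul_eq_C_mul, map_smul, smul_eq_C_mul]
theorem LL_pow_Cmul (c : K) (f : PowerSeries K) (m : ℕ) : (LL q r ^ m) (C c * f) = C c * (LL q r ^ m) f := by
  rw [← smul_eq_C_mul, map_smul, smul_eq_C_mul]

theorem LL_mul (f g : PowerSeries K) : LL q r (X * f * g) = X * LL q r f * g + C (coeff 0 f) * g := by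
  rw [LL_def, LL_def, mul_assoc X f g, dv_X]
  nth_rewrite 1 [dv_eq f]
  ring

theorem LL_pow_mul (f g : PowerSeries K) (m : ℕ) : coeff 0 ((LL q r ^ m) (X * f * g)) =
    ∑ b ∈ range m, coeff 0 ((LL q r ^ (m - 1 - b)) f) * coeff 0 ((LL q r ^ b) g) := by
  induction m generalizing f g with
  | zero => simp
  | succ m ih =>
    rw [pow_succ, Module.End.mul_apply, LL_mul, map_add, map_add, ih, sum_range_succ]
    congr 1
    · refine sum_congr rfl fun b hb => ?_
      rw [mem_range] at hb
      rw [show m + 1 - 1 - b = (m - 1 - b) + 1 by omega, pow_succ, Module.End.mul_apply]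
    · rw [← smul_eq_C_mul, map_smul]; simp

def al (i : ℕ) : PowerSeries K := PowerSeries.mk fun j => yy q r i (-(j : ℤ))

theorem al_zero : al q r 0 = 1 := by
  ext n; rcases n with _ | n
  · simp [al, yy]
  · simp [al, yy, coeff_one]

theorem al_succ (i : ℕ) : al q r ⤒i =
    dv (al q r i) + C q * al q r i + C r * (X * al q r i) + C (coeff 1 (al q r i)) := by
  ext n
  rcases n with _ | n
  · have := yy_sym q r i 1
    simp [al, yy, dv] at this ⊢
    rw [this]
  · simp only [al, dv, map_add, coeff_mk, coeff_C_mul, coeff_succ_X_mul, coeff_C, yy]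
    grind

theorem dv_al_succ (i : ℕ) : dv (al q r ⤒i) = LL q r (dv (al q r i)) + C (coeff 0 (al q r i)) * C r := by
  rw [al_succ, dv_add, dv_add, dv_add, dv_C, dv_Cmul, dv_Cmul, dv_X, LL_def]
  nth_rewrite 3 [dv_eq (al q r i)]
  ring

theorem LL_one (k : ℕ) : C r * (LL q r ^ k) 1 = C r * al q r k - dv (dv (al q r k)) := by
  induction k with
  | zero =>
    have h0 : dv (0 : PowerSeries K) = 0 := by have := dv_C (0 : K); simpa using this
    have h1 : dv (1 : PowerSeries K) = 0 := by have := dv_C (1 : K); simpa using this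
    simp [al_zero, h0, h1]
  | succ k ih =>
    rw [pow_succ', Module.End.mul_apply, ← smul_eq_C_mul, ← map_smul, smul_eq_C_mul, ih, dv_al_succ, al_succ]
    set a := al q r k
    have e1 : dv (LL q r (dv a)) = dv (dv (dv a)) + C q * dv (dv a) + C r * dv a := by
      rw [LL_def, dv_add, dv_add, dv_Cmul, dv_Cmul, dv_X]
    rw [dv_add, e1, ← map_mul, dv_C, map_sub, LL_def, LL_def, dv_Cmul]
    have := dv_eq (dv a)
    rw [show coeff 0 (dv a) = coeff 1 a by simp [dv]] at this
    grind

theorem bil (i k : ℕ) : (LL q r ^ i) (dv (al q r k)) + (LL q r ^ k) (dv (al q r i)) =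
    2 * (X * dv (al q r i) * dv (al q r k)) + C (coeff 0 (al q r i)) * dv (al q r k)
      + C (coeff 0 (al q r k)) * dv (al q r i) := by
  induction i with
  | zero =>
    rw [al_zero, show dv (1 : PowerSeries K) = 0 by rw [show (1 : PowerSeries K) = C 1 by simp, dv_C]]
    simp
  | succ i ih =>
    have f1 : (LL q r ^ k) (dv (al q r ⤒i)) = LL q r ((LL q r ^ k) (dv (al q r i))) +
        C (coeff 0 (al q r i)) * (C r * al q r k - dv (dv (al q r k))) := by
      rw [dv_al_succ, map_add, ← LL_one, ← Module.End.mul_apply, ← pow_succ, pow_succ', Module.End.mul_apply]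
      congr 1
      rw [← mul_one (C (coeff 0 (al q r i)) * C r), mul_assoc, ← smul_eq_C_mul, ← smul_eq_C_mul, map_smul, map_smul]
      simp only [smul_eq_C_mul]
    have f2 : LL q r ((LL q r ^ i) (dv (al q r k))) + LL q r ((LL q r ^ k) (dv (al q r i))) =
      2 * (X * LL q r (dv (al q r i)) * dv (al q r k) + C (coeff 0 (dv (al q r i))) * dv (al q r k))
        + C (coeff 0 (al q r i)) * LL q r (dv (al q r k)) + C (coeff 0 (al q r k)) * LL q r (dv (al q r i)) := by
      rw [← map_add, ih, map_add, map_add, LL_Cmul, LL_Cmul, two_mul, map_add, LL_mul]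
      ring
    rw [f1, pow_succ', Module.End.mul_apply, ← add_assoc, f2, dv_al_succ]
    have e1 : coeff 0 (al q r ⤒i) = 2 * coeff 0 (dv (al q r i)) + q * coeff 0 (al q r i) := by
      rw [al_succ]; simp [dv]; ring
    rw [e1]
    have := dv_eq (al q r k)
    simp only [map_add, map_mul, map_ofNat]
    rw [LL_def q r (dv (al q r k))]
    grind

variable (g : ℕ → K) (N : ℕ)
/-- the symmetric element `𝒜` (nonpositive part) -/
def ca : PowerSeries K := al q r 1 - ∑ i ∈ range N, C (g i) * al q r ⤓i
/-- `ω_l` -/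
def om (l : ℕ) : K := coeff 0 ((LL q r ^ l) (dv (ca q r g N)))

theorem dv_linear (f : ℕ → PowerSeries K) (s : Finset ℕ) : dv (∑ i ∈ s, C (g i) * f i) = ∑ i ∈ s, C (g i) * dv (f i) := by
  ext n; simp [dv]
theorem dv_sub (f g : PowerSeries K) : dv (f - g) = dv f - dv g := by ext; simp [dv]

theorem bil_ca (k : ℕ) : LL q r (dv (al q r k)) - ∑ i ∈ range N, C (g i) * (LL q r ^ ⤓i) (dv (al q r k))
     + (LL q r ^ k) (dv (ca q r g N)) =
    2 * (X * dv (ca q r g N) * dv (al q r k)) + C (coeff 0 (ca q r g N)) * dv (al q r k)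
      + C (coeff 0 (al q r k)) * dv (ca q r g N) := by
  have h1 := bil q r 1 k
  have h2 := sum_congr (rfl : range N = range N) fun i _ => congrArg (fun z => C (g i) * z) (bil q r ⤓i k)
  simp only [mul_add, sum_add_distrib] at h2
  have e : (LL q r ^ k) (dv (ca q r g N)) = (LL q r ^ k) (dv (al q r 1)) - ∑ i ∈ range N, C (g i) * (LL q r ^ k) (dv (al q r ⤓i)) := by
    rw [ca, dv_sub, dv_linear, map_sub, map_sum]
    simp only [LL_pow_Cmul]
  rw [e, ca, dv_sub, dv_linear, map_sub, map_sub, mul_sub, sub_mul, mul_sub, sub_mul, map_sum, map_sum, mul_sub, mul_sum,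
    mul_sum, sum_mul, sum_mul]
  rw [pow_one] at h1
  simp only [coeff_C_mul, map_mul]
  have h3 : ∑ x ∈ range N, C (g x) * (2 * (X * dv (al q r ⤓x) * dv (al q r k))) =
    2 * ∑ x ∈ range N, X * (C (g x) * dv (al q r ⤓x)) * dv (al q r k) := by
    rw [mul_sum]; exact sum_congr rfl fun _ _ => by ring
  have h4 : ∑ x ∈ range N, C (g x) * (C (coeff 0 (al q r ⤓x)) * dv (al q r k)) =
    ∑ x ∈ range N, C (g x) * C (coeff 0 (al q r ⤓x)) * dv (al q r k) := sum_congr rfl fun _ _ => by ring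
  have h5 : ∑ x ∈ range N, C (g x) * (C (coeff 0 (al q r k)) * dv (al q r ⤓x)) =
    ∑ x ∈ range N, C (coeff 0 (al q r k)) * (C (g x) * dv (al q r ⤓x)) := sum_congr rfl fun _ _ => by ring
  grind

theorem ca_sq (h2 : IsUnit (2 : K)) (hA : coeff 0 (ca q r g N) = 0) :
    LL q r (dv (ca q r g N)) - ∑ i ∈ range N, C (g i) * (LL q r ^ ⤓i) (dv (ca q r g N)) =
      X * dv (ca q r g N) * dv (ca q r g N) := by
  have h1 := bil_ca q r g N 1
  have h3 := sum_congr (rfl : range N = range N) fun i _ => congrArg (fun z => C (g i) * z) (bil_ca q r g N ⤓i)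
  simp only [hA, map_zero, zero_mul, add_zero, mul_add, sum_add_distrib, mul_sub, sum_sub_distrib] at h1 h3
  have u2 : IsUnit (2 : PowerSeries K) := by
    have := h2.map (C (R := K)); rwa [map_ofNat] at this
  apply u2.mul_left_cancel
  set B := dv (ca q r g N) with hB
  have e : B = dv (al q r 1) - ∑ i ∈ range N, C (g i) * dv (al q r ⤓i) := by
    rw [hB, ca, dv_sub, dv_linear]
  have e1 : LL q r B = LL q r (dv (al q r 1)) - ∑ i ∈ range N, C (g i) * LL q r (dv (al q r ⤓i)) := by
    rw [e, map_sub, map_sum]; simp only [LL_Cmul]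
  have e2 : ∀ j, (LL q r ^ j) B = (LL q r ^ j) (dv (al q r 1)) - ∑ i ∈ range N, C (g i) * (LL q r ^ j) (dv (al q r ⤓i)) := by
    intro j; rw [e, map_sub, map_sum]; simp only [LL_pow_Cmul]
  have e3 : ∑ j ∈ range N, C (g j) * (LL q r ^ ⤓j) B = ∑ j ∈ range N, C (g j) * (LL q r ^ ⤓j) (dv (al q r 1)) -
     ∑ x ∈ range N, C (g x) * ∑ i ∈ range N, C (g i) * (LL q r ^ ⤓i) (dv (al q r ⤓x)) := by
    rw [sum_congr rfl fun j _ => by rw [e2 ⤓j]]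
    simp only [mul_sub, sum_sub_distrib, mul_sum]
    congr 1
    rw [sum_comm]
    exact sum_congr rfl fun _ _ => sum_congr rfl fun _ _ => by ring
  have e0 := hA
  rw [ca, map_sub, map_sum] at e0
  simp only [coeff_C_mul] at e0
  have e4 := congrArg (C (R := K)) e0
  rw [map_sub, map_sum, map_zero] at e4
  simp only [map_mul] at e4
  have h5 : ∑ x ∈ range N, C (g x) * (C (coeff 0 (al q r ⤓x)) * B) =
    (∑ x ∈ range N, C (g x) * C (coeff 0 (al q r ⤓x))) * B := by rw [sum_mul]; exact sum_congr rfl fun _ _ => by ring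
  have h6 : ∑ x ∈ range N, C (g x) * (2 * (X * B * dv (al q r ⤓x))) =
    2 * (X * B * ∑ x ∈ range N, C (g x) * dv (al q r ⤓x)) := by simp only [mul_sum]; exact sum_congr rfl fun _ _ => by ring
  grind

theorem om_loop (h2 : IsUnit (2 : K)) (hA : coeff 0 (ca q r g N) = 0) (g0 : g 0 = 0) (l : ℕ) :
    om q r g N ⤒l = ∑ i ∈ range N, g i * om q r g N (l + i - 1) +
      ∑ b ∈ range l, om q r g N (l - 1 - b) * om q r g N b := by
  have h := congrArg (fun z => coeff 0 ((LL q r ^ l) z)) (ca_sq q r g N h2 hA)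
  simp only [LL_pow_mul, map_sub, map_sum, LL_pow_Cmul, coeff_C_mul] at h
  rw [← Module.End.mul_apply, ← pow_succ] at h
  rw [om, sub_eq_iff_eq_add.1 h, add_comm]
  congr 1
  refine sum_congr rfl fun i _ => ?_
  rcases i with _ | i
  · simp [g0]
  · rw [← Module.End.mul_apply, ← pow_add]; rfl

theorem om_zero : om q r g N 0 = coeff 1 (ca q r g N) := by simp [om, dv]
theorem om_two : om q r g N 2 = coeff 3 (ca q r g N) + 2 * q * coeff 2 (ca q r g N) + (r + q ^ 2) * coeff 1 (ca q r g N) := by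
  have h1 : ∀ f, coeff 0 (LL q r f) = coeff 1 f + q * coeff 0 f := by intro f; simp [LL_def, dv]
  have h2 : ∀ f, coeff 1 (LL q r f) = coeff 2 f + q * coeff 1 f + r * coeff 0 f := by
    intro f
    have := coeff_succ_X_mul 0 f
    simp only [zero_add] at this
    simp [LL_def, dv, this]
  rw [om, pow_two, Module.End.mul_apply, h1, h2, h1]
  simp [dv]; ring
end

section
variable {K : Type*} [CommRing K] (q r : K) (g : ℕ → K) (N : ℕ)

def Az (n : ℤ) : K := yy q r 1 n - ∑ i ∈ range N, g i * yy q r ⤓i n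
def Ez (n : ℤ) : K := yy q r 0 n - ∑ i ∈ range N, ((i - 1 : ℕ) : K) * g i * yy q r (i - 1 - 1) n

theorem ca_coeff (j : ℕ) : sco j (ca q r g N) = Az q r g N (-j) := by
  simp [ca, Az, al]

theorem Ez_sym : Ez q r g N (-1) = r * Ez q r g N 1 := by
  have h : ∀ i, yy q r i (-1) = r * yy q r i 1 := fun i => by simpa using yy_sym q r i 1
  simp only [Ez, h, mul_sub, mul_sum]
  grind

theorem Az_euler (n : ℤ) : (n : K) * Az q r g N n = Ez q r g N ⤓n - r * Ez q r g N ⤒n := by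
  have h1 := yy_euler q r 1 n
  simp only [Az, Ez, mul_sub, mul_sum, h1]
  have : ∑ i ∈ range N, (n : K) * (g i * yy q r ⤓i n) = ∑ i ∈ range N, ((i - 1 : ℕ) : K) * g i * yy q r (i - 1 - 1) ⤓n
     - ∑ i ∈ range N, r * (((i - 1 : ℕ) : K) * g i * yy q r (i - 1 - 1) ⤒n) := by
    rw [← sum_sub_distrib]
    refine sum_congr rfl fun i _ => ?_
    linear_combination g i * yy_euler q r ⤓i n
  grind

theorem Az_der {A : Type*} [CommSemiring A] [Algebra A K] (d : Derivation A K K) (n : ℤ) :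
    d (Az q r g N n) = d q * Ez q r g N n + d r * Ez q r g N ⤒n - ∑ i ∈ range N, d (g i) * yy q r ⤓i n := by
  have h1 := yy_der q r d 1 n
  simp only [Az, Ez, map_sub, map_sum, mul_sub, mul_sum, h1, Derivation.leibniz, smul_eq_mul, sum_add_distrib]
  have : ∑ i ∈ range N, g i * d (yy q r ⤓i n) = ∑ i ∈ range N, d q * (((i - 1 : ℕ) : K) * g i * yy q r (i - 1 - 1) n)
     + ∑ i ∈ range N, d r * (((i - 1 : ℕ) : K) * g i * yy q r (i - 1 - 1) ⤒n) := by
    rw [← sum_add_distrib]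
    refine sum_congr rfl fun i _ => ?_
    rw [yy_der]; ring
  grind

theorem sum_ig (g0 : g 0 = 0) (n : ℤ) : ∑ i ∈ range N, (i * g i) * yy q r ⤓i n =
    2 * yy q r 1 n - (Ez q r g N ⤓n + q * Ez q r g N n + r * Ez q r g N ⤒n) - Az q r g N n := by
  have h1 : ∀ i ∈ range N, (i * g i) * yy q r ⤓i n = g i * yy q r ⤓i n +
    (((i - 1 : ℕ) : K) * g i * yy q r (i - 1 - 1) ⤓n + q * (((i - 1 : ℕ) : K) * g i * yy q r (i - 1 - 1) n) +
      r * (((i - 1 : ℕ) : K) * g i * yy q r (i - 1 - 1) ⤒n)) := by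
    intro i _
    rcases i with _ | _ | i
    · simp [g0]
    · simp
    · simp only [Nat.add_sub_cancel, yy]; push_cast; ring
  rw [sum_congr rfl h1, Az, Ez, Ez, Ez]
  simp only [sum_add_distrib, ← mul_sum]
  rw [show yy q r 1 n = yy q r 0 ⤓n + q * yy q r 0 n + r * yy q r 0 ⤒n from rfl]
  ring

theorem key {A : Type*} [CommSemiring A] [Algebra A K] (δ D : Derivation A K K) (g0 : g 0 = 0)
    (hA : Az q r g N 0 = 0) (hδ : ∀ i, δ (g i) = 0) (hT : δ (Az q r g N (-1)) = 1)
    (hD : ∀ i, D (g i) = i * g i) (hT' : D (Az q r g N (-1)) = 0) :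
    r * δ (δ (om q r g N 2)) = D r + 2 * r := by
  have d0 := Az_der q r g N δ 0
  have d1 := Az_der q r g N δ (-1)
  have d2 := Az_der q r g N δ (-2)
  have d3 := Az_der q r g N δ (-3)
  have D0 := Az_der q r g N D 0
  have D1 := Az_der q r g N D (-1)
  have s0 := sum_ig q r g N g0 0
  have s1 := sum_ig q r g N g0 (-1)
  have u1 := Az_euler q r g N (-1)
  have u2 := Az_euler q r g N (-2)
  have es := Ez_sym q r g N
  have y0 : yy q r 1 0 = q := by simp [yy]
  have y1 : yy q r 1 (-1) = r := by simp [yy]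
  simp only [hδ, hD, hA, hT, hT', map_zero, zero_mul, sum_const_zero, sub_zero, s0, s1, y0, y1] at d0 d1 d2 d3 D0 D1
  norm_num at d0 d1 d2 d3 D0 D1 u1 u2
  have o2 := om_two q r g N
  rw [ca_coeff, ca_coeff, ca_coeff] at o2
  norm_num at o2
  have c2 : ∀ z : K, δ ⧉z = 2 * δ z := by intro z; rw [two_mul, map_add, two_mul]
  have c3 : ∀ z : K, δ (z ^ 2) = 2 * z * δ z := by
    intro z; simp; ring
  have e1 : δ (om q r g N 2) = 2 * r + q ^ 2 := by
    have h1 : δ (2 * q * Az q r g N (-2)) = 2 * (q * δ (Az q r g N (-2)) + Az q r g N (-2) * δ q) := by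
      rw [mul_assoc, c2, Derivation.leibniz, smul_eq_mul, smul_eq_mul]
    have h2 : δ ((r + q ^ 2) * Az q r g N (-1)) = (r + q ^ 2) * 1 + Az q r g N (-1) * (δ r + 2 * q * δ q) := by
      simp_all
    rw [o2, map_add, map_add, h1, h2, d3, d2]
    linear_combination (-(δ r + 2 * q * δ q)) * u1 - δ q * u2 - r * d1 - 2 * q * r * d0 + 2 * q * δ r * es
  rw [e1, map_add, c2, c3]
  linear_combination (-(D r + 2 * r)) * d1 - r * (D q + q) * d0 + δ r * D1 + r * δ q * D0
    - δ r * u1 + (δ r * (D q + q) + r * δ q - (D r + 2 * r) * δ q) * es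
end

section
local notation "B" => Polynomial ℂ
local notation "K" => PowerSeries (Polynomial ℂ)

theorem coeff_nat_mul (m : ℕ) (f : K) (n : ℕ) : sco n ((m : K) * f) = m * sco n f := by
  rw [← map_natCast (psC : B →+* K), PowerSeries.coeff_C_mul]

def drho : Derivation ℕ K K where
  toFun f := PowerSeries.mk fun n => pder (sco n f)
  map_add' f g := by ext1 n; simp
  map_smul' m f := by ext1 n; simp [coeff_nat_mul]
  map_one_eq_zero' := by
    ext1 n; simp [PowerSeries.coeff_one, apply_ite]
  leibniz' f g := by
    ext1 n
    simp only [LinearMap.coe_mk, AddHom.coe_mk, PowerSeries.coeff_mk, PowerSeries.coeff_mul, map_sum,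
      Polynomial.derivative_mul, smul_eq_mul, map_add, sum_add_distrib]
    rw [add_comm]; congr 1
    rw [← Finset.Nat.sum_antidiagonal_swap]
    grind

theorem drho_coeff (f : K) (n : ℕ) : sco n (drho f) = pder (sco n f) := by
  simp [drho, PowerSeries.coeff_mk]

def thX : Derivation ℕ K K where
  toFun f := PowerSeries.mk fun n => (n : B) * (sco n f)
  map_add' f g := by ext1 n; simp [mul_add]
  map_smul' m f := by
    ext1 n; simp [coeff_nat_mul, mul_left_comm]
  map_one_eq_zero' := by
    ext1 n; simp
  leibniz' f g := by
    ext1 n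
    simp only [LinearMap.coe_mk, AddHom.coe_mk, PowerSeries.coeff_mk, PowerSeries.coeff_mul,
      smul_eq_mul, map_add]
    rw [← Finset.Nat.sum_antidiagonal_swap (n := n) (f := fun p => sco p.1 g * _),
      ← sum_add_distrib, mul_sum]
    refine sum_congr rfl fun p hp => ?_
    rw [← mem_antidiagonal.1 hp]; grind

theorem thX_coeff (f : K) (n : ℕ) : sco n (thX f) = n * sco n f := by
  simp [thX, PowerSeries.coeff_mk]

def rel (M : ℕ) (U : PowerSeries K) (z : K) : Prop :=
  (sX : K) ^ M ∣ (PowerSeries.trunc M U).eval sX - z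

theorem rel_zero (U : PowerSeries K) (z : K) : rel 0 U z := by simp [rel]

theorem rel_add {M : ℕ} {U V : PowerSeries K} {z w : K} (h : rel M U z) (h' : rel M V w) : rel M (U + V) (z + w) := by
  unfold rel at *
  rw [map_add, Polynomial.eval_add, add_sub_add_comm]; exact dvd_add h h'

theorem rel_sum {ι : Type*} {M : ℕ} (s : Finset ι) (U : ι → PowerSeries K) (z : ι → K)
    (h : ∀ i ∈ s, rel M (U i) (z i)) : rel M (∑ i ∈ s, U i) (∑ i ∈ s, z i) := by
  unfold rel at *
  rw [map_sum, Polynomial.eval_finsetSum, ← sum_sub_distrib]; exact dvd_sum h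

theorem rel_mul {M : ℕ} {U V : PowerSeries K} {z w : K} (h : rel M U z) (h' : rel M V w) : rel M (U * V) (z * w) := by
  unfold rel at *
  have h1 : (pX : Polynomial K) ^ M ∣ PowerSeries.trunc M (U * V) - PowerSeries.trunc M U * PowerSeries.trunc M V := by
    rw [Polynomial.X_pow_dvd_iff]
    intro d hd
    rw [Polynomial.coeff_sub, PowerSeries.coeff_trunc, if_pos hd, PowerSeries.coeff_mul_eq_coeff_trunc_mul_trunc U V hd, ← Polynomial.coeff_coe,
      Polynomial.coe_mul, sub_self]
  obtain ⟨t, ht⟩ := h1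
  have h2 := congrArg (Polynomial.eval (sX : K)) ht
  simp only [Polynomial.eval_sub, Polynomial.eval_mul, Polynomial.eval_pow, Polynomial.eval_X] at h2
  have e : Polynomial.eval sX (PowerSeries.trunc M (U * V)) - z * w = 
    sX ^ M * Polynomial.eval sX t + (Polynomial.eval sX (PowerSeries.trunc M U) - z) * Polynomial.eval sX (PowerSeries.trunc M V)
     + z * (Polynomial.eval sX (PowerSeries.trunc M V) - w) := by linear_combination h2
  rw [e]
  exact dvd_add (dvd_add (dvd_mul_right _ _) (h.mul_right _)) (h'.mul_left _)

theorem rel_C {M : ℕ} (z : K) : rel M (psC z) z := by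
  unfold rel
  cases M with
  | zero => simp
  | succ M => simp

theorem rel_X {M : ℕ} {U : PowerSeries K} {z : K} (h : rel M U z) : rel ⤒M (sX * U) (sX * z) := by
  unfold rel at *
  have : PowerSeries.trunc ⤒M (sX * U) = pX * PowerSeries.trunc M U := by
    ext1 n
    cases n with
    | zero => simp [PowerSeries.coeff_trunc]
    | succ n => simp [PowerSeries.coeff_trunc, PowerSeries.coeff_succ_X_mul]
  rw [this, Polynomial.eval_mul, Polynomial.eval_X, ← mul_sub, pow_succ']
  gcongr

theorem rel_mono {M M' : ℕ} (hM : M ≤ M') {U : PowerSeries K} {z : K} (h : rel M' U z) : rel M U z := by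
  unfold rel at *
  have : (pX : Polynomial K) ^ M ∣ PowerSeries.trunc M' U - PowerSeries.trunc M U := by
    rw [Polynomial.X_pow_dvd_iff]
    intro d hd
    rw [Polynomial.coeff_sub, PowerSeries.coeff_trunc, PowerSeries.coeff_trunc, if_pos hd, if_pos ◇, sub_self]
  obtain ⟨t, ht⟩ := this
  have h2 := congrArg (Polynomial.eval (sX : K)) ht
  simp only [Polynomial.eval_sub, Polynomial.eval_mul, Polynomial.eval_pow, Polynomial.eval_X] at h2
  have h3 := dvd_sub ((pow_dvd_pow _ hM).trans h) (Dvd.intro _ h2.symm)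
  grind

theorem rel_unique (c : ℕ → ℂ) (N : ℕ) (c0 : c 0 = 0) (U : ℕ → PowerSeries K) (z : ℕ → K)
    (h0 : ∀ M, rel M (U 0) (z 0))
    (hU : ∀ l, U ⤒l = ∑ i ∈ range N, psC (psC (pC (c i))) * (sX ^ i * U (l + i - 1))
       + ∑ b ∈ range l, U (l - 1 - b) * U b)
    (hz : ∀ l, z ⤒l = ∑ i ∈ range N, (psC (pC (c i))) * sX ^ i * z (l + i - 1)
       + ∑ b ∈ range l, z (l - 1 - b) * z b) (M : ℕ) : ∀ l, rel M (U l) (z l) := by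
  induction M with
  | zero => exact fun l => rel_zero _ _
  | succ M ih =>
    intro l
    induction l using Nat.strong_induction_on with
    | _ l il =>
    cases l with
    | zero => exact h0 _
    | succ l =>
      rw [hU, hz]
      refine rel_add (rel_sum _ _ _ fun i _ => ?_) (rel_sum _ _ _ fun b hb => ?_)
      · rcases i with _ | i
        · simp only [c0, map_zero, zero_mul]; simpa using rel_C (M := M + 1) 0
        · rw [mul_assoc]
          refine rel_mul (rel_C _) ?_
          have : ∀ k, rel M (sX ^ k * U (l + ⤒i - 1)) (sX ^ k * z (l + ⤒i - 1)) := by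
            intro k
            induction k with
            | zero => simpa using ih _
            | succ k ik => rw [pow_succ', pow_succ', mul_assoc, mul_assoc]; exact rel_mono (Nat.le_succ _) (rel_X ik)
          rw [pow_succ', pow_succ', mul_assoc, mul_assoc]
          exact rel_X (this i)
      · have := mem_range.1 hb
        exact rel_mul (il _ ◇) (il _ ◇)
end

section
local notation "B" => Polynomial ℂ
local notation "K" => PowerSeries (Polynomial ℂ)

theorem fix_exists {R : Type*} [CommRing R] (F : PowerSeries R → PowerSeries R)
    (hF : ∀ m a b, sX ^ m ∣ a - b → sX ^ ⤒m ∣ F a - F b) :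
    ∃ Q, F Q = Q ∧ ∀ m, sX ^ m ∣ Q - F^[m] 0 := by
  have h1 : ∀ m, sX ^ m ∣ F^[m + 1] 0 - F^[m] 0 := by
    intro m
    induction m with
    | zero => simp
    | succ m ih => have := hF _ _ _ ih; rwa [← Function.iterate_succ_apply' F, ← Function.iterate_succ_apply' F] at this
  have h2 : ∀ m k, sX ^ m ∣ F^[m + k] 0 - F^[m] 0 := by
    intro m k
    induction k with
    | zero => simp
    | succ k ih =>
      have := dvd_add ((pow_dvd_pow _ (Nat.le_add_right m k)).trans (h1 (m + k))) ih
      grind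
  let Q : PowerSeries R := PowerSeries.mk fun n => sco n (F^[n + 1] 0)
  have h3 : ∀ m, sX ^ m ∣ Q - F^[m] 0 := by
    intro m
    rw [PowerSeries.X_pow_dvd_iff]
    intro d hd
    obtain ⟨k, rfl⟩ := Nat.exists_eq_add_of_le (show d + 1 ≤ m from hd)
    have := (PowerSeries.X_pow_dvd_iff.1 (h2 ⤒d k)) d (Nat.lt_succ_self d)
    simp only [Q, map_sub, PowerSeries.coeff_mk] at this ⊢
    grind
  refine ⟨Q, ?_, h3⟩
  ext n
  have a := hF _ _ _ (h3 n)
  have b := h3 ⤒n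
  rw [Function.iterate_succ_apply'] at b
  have := PowerSeries.X_pow_dvd_iff.1 (dvd_sub a b) n (Nat.lt_succ_self n)
  grind

theorem aa_stable {R : Type*} [CommSemiring R] (u : ℕ → R) (T : R) (u0 : u 0 = 0) :
    ∀ m l j, l + j ≤ 2 * m → aa u T ⤒m l j = aa u T m l j := by
  intro m
  induction m with
  | zero => intro l j h; obtain rfl : l = 0 := by omega
            obtain rfl : j = 0 := by omega
            simp [aa]
  | succ m ih =>
    intro l j h
    cases l with
    | zero => simp [aa]
    | succ l =>
      rw [aa, aa]
      congr 1
      · refine sum_congr rfl fun i hi => ?_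
        grind
      · refine sum_congr rfl fun b hb => sum_congr rfl fun i hi => ?_
        grind

theorem aa_eq {R : Type*} [CommSemiring R] (u : ℕ → R) (T : R) (u0 : u 0 = 0) (m l j : ℕ) (h : l + j ≤ 2 * m) :
    aa u T m l j = aa u T (l + j) l j := by
  have : ∀ m k, l + j ≤ 2 * m → aa u T (m + k) l j = aa u T m l j := by
    intro m k h
    induction k with
    | zero => rfl
    | succ k ih => rw [← add_assoc, aa_stable u T u0 _ _ _ ◇, ih]
  rcases le_total m (l + j) with h' | h'
  · obtain ⟨k, hk⟩ := Nat.exists_eq_add_of_le h'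
    simp_all
  · obtain ⟨k, rfl⟩ := Nat.exists_eq_add_of_le h'
    grind

def Aj (c : ℕ → ℂ) (l j : ℕ) : B := aa (fun i => pC (c i)) pX (l + j) l j

theorem Aj_zero (c : ℕ → ℂ) (j : ℕ) : Aj c 0 j = if j = 0 then pX else 0 := by
  rw [Aj]; cases j <;> simp [aa]

theorem Aj_succ (c : ℕ → ℂ) (c0 : c 0 = 0) (l j : ℕ) : Aj c ⤒l j =
    ∑ i ∈ range ⤒j, pC (c i) * Aj c (l + i - 1) (j - i) +
      ∑ b ∈ range l, ∑ i ∈ range ⤒j, Aj c (l - 1 - b) (j - i) * Aj c b i := by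
  rw [Aj, show l + 1 + j = (l + j) + 1 by ring, aa]
  have u0 : (fun i => pC (c i)) 0 = 0 := by simp [c0]
  refine congrArg₂ (· + ·) (sum_congr rfl fun i hi => ?_) (sum_congr rfl fun b hb => sum_congr rfl fun i hi => ?_)
  · have := mem_range.1 hi
    rcases Nat.eq_zero_or_pos i with h' | h'
    · simp_all
    · rw [aa_eq _ _ u0 _ _ _ ◇, Aj]
  · have := mem_range.1 hi; have := mem_range.1 hb
    rw [aa_eq _ _ u0 _ _ _ ◇, aa_eq _ _ u0 _ b _ ◇, Aj, Aj]

def evT (T : K) : B →+* K := Polynomial.eval₂RingHom (PowerSeries.C.comp pC) T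

theorem evT_C (T : K) (z : ℂ) : evT T (pC z) = psC (pC z) := by
  simp [evT]
theorem evT_X (T : K) : evT T pX = T := by simp [evT]

def UU (c : ℕ → ℂ) (T : K) (l : ℕ) : PowerSeries K := PowerSeries.mk fun j => evT T (Aj c l j)

theorem UU_succ (c : ℕ → ℂ) (N : ℕ) (c0 : c 0 = 0) (hc : ∀ i, N ≤ i → c i = 0) (T : K) (l : ℕ) :
    UU c T ⤒l = ∑ i ∈ range N, psC (psC (pC (c i))) * (sX ^ i * UU c T (l + i - 1))
       + ∑ b ∈ range l, UU c T (l - 1 - b) * UU c T b := by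
  ext1 j
  rw [UU, PowerSeries.coeff_mk, Aj_succ c c0, map_add, map_sum, map_sum, map_add, map_sum, map_sum]
  congr 1
  · have e : ∀ i, sco j (psC (psC (pC (c i))) * (sX ^ i * UU c T (l + i - 1)))
      = if i ≤ j then evT T (pC (c i) * Aj c (l + i - 1) (j - i)) else 0 := by
      intro i
      rw [PowerSeries.coeff_C_mul, PowerSeries.coeff_X_pow_mul']
      split_ifs
      · rw [map_mul, evT_C]; simp [UU]
      · simp
    rw [sum_congr rfl fun i _ => e i, ← sum_filter]
    refine sum_subset_zero_on_sdiff ?_ ?_ (fun _ _ => rfl) |>.symm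
    · intro i; simp
    grind
  · refine sum_congr rfl fun b _ => ?_
    rw [PowerSeries.coeff_mul, Finset.Nat.sum_antidiagonal_eq_sum_range_succ_mk, map_sum, ← sum_range_reflect]
    refine sum_congr rfl fun i hi => ?_
    have := mem_range.1 hi
    simp only [UU, PowerSeries.coeff_mk, map_mul]
    grind
end

section
local notation "B" => Polynomial ℂ
local notation "K" => PowerSeries (Polynomial ℂ)
local notation "ρ" => (psC (pX : Polynomial ℂ) : PowerSeries (Polynomial ℂ))

theorem drho_rho : drho ρ = 1 := by
  ext1 n; rw [drho_coeff, PowerSeries.coeff_C, PowerSeries.coeff_one]; split_ifs <;> simp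

theorem drho_X : drho sX = 0 := by
  ext1 n; rw [drho_coeff, PowerSeries.coeff_X]; split_ifs <;> simp

theorem drho_CC (z : ℂ) : drho (psC (pC z)) = 0 := by
  ext1 n; rw [drho_coeff, PowerSeries.coeff_C]; split_ifs <;> simp

theorem thX_C (z : B) : thX (psC z) = 0 := by
  ext1 n; rw [thX_coeff, PowerSeries.coeff_C]; simp_all

theorem thX_X : thX sX = sX := by
  ext1 n; rw [thX_coeff, PowerSeries.coeff_X]; simp_all

theorem drho_inv {ε e : K} (h : ε * e = 1) : drho e = -(e ^ 2 * drho ε) := by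
  have := congrArg drho h
  rw [Derivation.leibniz, Derivation.map_one_eq_zero, smul_eq_mul, smul_eq_mul] at this
  grind

theorem drho_T {ε T : K} (hT : T = ρ * ε) : drho T = ε + ρ * drho ε := by
  rw [hT, Derivation.leibniz, drho_rho, smul_eq_mul, smul_eq_mul]; ring

theorem res_pow {ε e T : K} (hT : T = ρ * ε) (h : ε * e = 1) (f k j : ℕ) :
    (sco j (T ^ k * (e ^ ⤒f * drho T))).coeff f = if j = 0 ∧ k = f then 1 else 0 := by
  have hd := drho_T hT
  have key : ∀ m, ε ^ m * e ^ m = 1 := fun m => by rw [← mul_pow, h, one_pow]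
  have cC : ∀ (m : ℕ) (z : K), sco j (ρ ^ m * z) = pX ^ m * sco j z := by
    intro m z; rw [← map_pow, PowerSeries.coeff_C_mul]
  rcases lt_trichotomy f k with hk | rfl | hk
  · rw [if_neg ◇, hT, mul_pow, mul_assoc, cC, Polynomial.coeff_X_pow_mul', if_neg ◇]
  · have e1 : T ^ f * (e ^ ⤒f * drho T) = ρ ^ f * (1 + ρ ^ 1 * (e * drho ε)) := by
      rw [hd, hT]
      linear_combination (ρ ^ f * e * (ε + ρ * drho ε)) * key f + ρ ^ f * h
    rw [e1, cC, Polynomial.coeff_X_pow_mul', if_pos le_rfl, map_add, cC, PowerSeries.coeff_one]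
    simp [apply_ite]
    split_ifs <;> simp
  · obtain ⟨m, rfl⟩ := Nat.exists_eq_add_of_lt hk
    have e1 : T ^ k * (e ^ (k + m + 1 + 1) * drho T) = ρ ^ k * (e ^ ⤒m + ρ * e ^ (m + 2) * drho ε) := by
      rw [hd, hT]
      linear_combination (ρ ^ k * e ^ (m + 2) * (ε + ρ * drho ε)) * key k + ρ ^ k * e ^ ⤒m * h
    have e2 : ((m + 1 : ℕ) : K) * (e ^ ⤒m + ρ * e ^ (m + 2) * drho ε) = ((m + 1 : ℕ) : K) * e ^ ⤒m - ρ ^ 1 * drho (e ^ ⤒m) := by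
      rw [Derivation.leibniz_pow, drho_inv h, smul_eq_mul, nsmul_eq_mul, Nat.add_sub_cancel]; ring
    have e3 := congrArg (fun z => (sco j z).coeff ⤒m) e2
    simp only [coeff_nat_mul, map_sub, cC, drho_coeff, Polynomial.coeff_natCast_mul, Polynomial.coeff_sub] at e3
    rw [pow_one pX, Polynomial.coeff_X_mul, Polynomial.coeff_derivative] at e3
    rw [e1, cC, if_neg ◇, Polynomial.coeff_X_pow_mul', if_pos ◇, show k + m + 1 - k = m + 1 by omega]
    have h4 : ((m + 1 : ℕ) : ℂ) ≠ 0 := by exact_mod_cast Nat.succ_ne_zero m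
    grind

theorem res_ev {ε e T : K} (hT : T = ρ * ε) (h : ε * e = 1) (f j : ℕ) (P : B) :
    (sco j (evT T P * (e ^ ⤒f * drho T))).coeff f = if j = 0 then P.coeff f else 0 := by
  induction P using Polynomial.induction_on' with
  | add p q hp hq => rw [map_add, add_mul, map_add, Polynomial.coeff_add, hp, hq]; split_ifs <;> simp
  | monomial k a =>
    rw [← Polynomial.C_mul_X_pow_eq_monomial, map_mul (evT T), map_pow, evT_C, evT_X, mul_assoc, PowerSeries.coeff_C_mul,
      Polynomial.coeff_C_mul, res_pow hT h, Polynomial.coeff_C_mul, Polynomial.coeff_X_pow]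
    grind <;> simp [h1, h2, eq_comm] <;> grind

theorem evT_der (δ : Derivation ℕ K K) {T : K} (hT : δ T = 1) (hC : ∀ z, δ (psC (pC z)) = 0) (P : B) :
    δ (evT T P) = evT T (pder P) := by
  induction P using Polynomial.induction_on' with
  | add p q hp hq => simp [hp, hq]
  | monomial k a =>
    rw [← Polynomial.C_mul_X_pow_eq_monomial, map_mul, map_pow, evT_C, evT_X, Derivation.leibniz, hC, Derivation.leibniz_pow, hT]
    simp [evT_C, evT_X, Polynomial.derivative_X_pow]

theorem geo_choose {R : Type*} [CommRing R] {γ e : R} (h : (1 - γ) * e = 1) (L f : ℕ) :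
    γ ^ L ∣ e ^ ⤒f - ∑ s ∈ range L, ((f + s).choose f : R) * γ ^ s := by
  induction f with
  | zero =>
    have := mul_neg_geom_sum γ L
    simp only [Nat.choose_zero_right, Nat.cast_one, one_mul, zero_add, pow_one]
    refine ⟨e, ?_⟩
    grind
  | succ f ih =>
    have e1 : (∑ s ∈ range L, ((f + 1 + s).choose ⤒f : R) * γ ^ s) * (1 - γ) =
       ∑ s ∈ range L, ((f + s).choose f : R) * γ ^ s - ((f + L).choose ⤒f : R) * γ ^ L := by
      clear ih
      induction L with
      | zero => simp
      | succ L ih =>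
        rw [sum_range_succ, add_mul, ih, sum_range_succ]
        have : ((f + 1 + L).choose ⤒f : R) = (f + L).choose f + (f + L).choose ⤒f := by
          rw [show f + 1 + L = (f + L) + 1 by ring, Nat.choose_succ_succ]; push_cast; ring
        grind
    have e2 : e ^ (f + 1 + 1) - ∑ s ∈ range L, ((f + 1 + s).choose ⤒f : R) * γ ^ s =
       e * (e ^ ⤒f - ∑ s ∈ range L, ((f + s).choose f : R) * γ ^ s) + γ ^ L * (e * ((f + L).choose ⤒f : R)) := by
      grind
    rw [e2]
    exact dvd_add (ih.mul_left _) (dvd_mul_right _ _)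
end

section
local notation "B" => Polynomial ℂ
local notation "K" => PowerSeries (Polynomial ℂ)
local notation "ρ" => (psC (pX : Polynomial ℂ) : PowerSeries (Polynomial ℂ))

def gw (c : ℕ → ℂ) (i : ℕ) : K := psC (pC (c i)) * sX ^ i

theorem gw_dvd (c : ℕ → ℂ) (c0 : c 0 = 0) (i : ℕ) : sX ∣ gw c i := by
  cases i with
  | zero => simp [gw, c0]
  | succ i => exact (dvd_pow_self _ (Nat.succ_ne_zero i)).mul_left _

theorem isUnit_cc {z : K} (h : sX ∣ z - 1) : ∃ w, z * w = 1 := by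
  have : IsUnit z := by
    rw [PowerSeries.isUnit_iff_constantCoeff]
    rw [PowerSeries.X_dvd_iff, map_sub, map_one, sub_eq_zero] at h
    simp_all
  exact this.exists_right_inv

theorem dX_dvd (δ : Derivation ℕ K K) (hX : δ sX = 0) {M : ℕ} {z : K} (h : sX ^ M ∣ z) :
    sX ^ M ∣ δ z := by
  obtain ⟨w, rfl⟩ := h
  simp_all

set_option maxHeartbeats 1600000 in
theorem main_id (c : ℕ → ℂ) (N : ℕ) (c0 : c 0 = 0) (hc : ∀ i, N ≤ i → c i = 0) (Q : K)
    (hQ : Q = ∑ i ∈ range N, gw c i * yy Q ρ ⤓i 0) {n : ℕ} (hn : 0 < n) (f : ℕ) :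
    (pder (pder (Aj c 2 ⧉n))).coeff f =
      ∑ s ∈ range (2 * n + 1), ((f + s).choose f : ℂ) * ((2 * n : ℕ) / (s + 1 : ℕ)) *
        (sco ⧉n ((∑ i ∈ range N, gw c i * yy Q ρ ⤓i 1) ^ ⤒s)).coeff f := by
  set Γ : K := ∑ i ∈ range N, gw c i * yy Q ρ ⤓i 1 with hΓ
  set T : K := Az Q ρ (gw c) N (-1) with hTdef
  have hy : ∀ i, yy Q ρ i (-1) = ρ * yy Q ρ i 1 := fun i => by simpa using yy_sym Q ρ i 1
  have hT : T = ρ * (1 - Γ) := by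
    rw [hTdef, Az, hy, show yy Q ρ 1 1 = 1 by simp [yy], mul_sub, hΓ, mul_sum]
    grind
  have hA : Az Q ρ (gw c) N 0 = 0 := by
    rw [Az, show yy Q ρ 1 0 = Q by simp [yy], ← hQ, sub_self]
  have hΓX : sX ∣ Γ := dvd_sum fun i _ => (gw_dvd c c0 i).mul_right _
  obtain ⟨e, he⟩ := isUnit_cc (z := 1 - Γ) (by rw [sub_sub_cancel_left]; exact (dvd_neg).2 hΓX)
  have hT' := drho_T hT
  have hdε : sX ∣ drho (1 - Γ) := by
    rw [map_sub, Derivation.map_one_eq_zero, zero_sub, dvd_neg]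
    simpa using dX_dvd drho drho_X (M := 1) (by simpa using hΓX)
  obtain ⟨u, hu⟩ := isUnit_cc (z := drho T) (by
    rw [hT', show 1 - Γ + ρ * drho (1 - Γ) - 1 = ρ * drho (1 - Γ) - Γ by ring]
    exact dvd_sub (hdε.mul_left _) hΓX)
  let δ : Derivation ℕ K K := u • drho
  have hδ : ∀ z, δ z = u * drho z := fun z => rfl
  let D : Derivation ℕ K K := thX + (-(thX T)) • δ
  have hD : ∀ z, D z = thX z - thX T * δ z := fun z => by
    rw [sub_eq_add_neg, ← neg_mul]; rfl
  have hδT : δ T = 1 := by rw [hδ, mul_comm, hu]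
  have hδX : δ sX = 0 := by rw [hδ, drho_X, mul_zero]
  have hδC : ∀ z, δ (psC (pC z)) = 0 := fun z => by rw [hδ, drho_CC, mul_zero]
  have hδg : ∀ i, δ (gw c i) = 0 := fun i => by
    rw [gw, Derivation.leibniz, Derivation.leibniz_pow, hδC, hδX]; simp
  have hk := key Q ρ (gw c) N δ D (by simp [gw, c0]) hA hδg hδT (fun i => (hD _).trans (by
      rw [hδg, mul_zero, sub_zero, gw, Derivation.leibniz, Derivation.leibniz_pow, thX_C, thX_X]
      rcases i with _ | i
      · simp
      simp; ring)) ((hD _).trans (by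
      grind))
  have hk : ρ * δ (δ (om Q ρ (gw c) N 2)) = D ρ + 2 * ρ := hk
  have hthT : thX T = -(ρ * thX Γ) := by
    rw [hT, Derivation.leibniz, thX_C, map_sub, Derivation.map_one_eq_zero, smul_eq_mul, smul_eq_mul]; ring
  have hk2 : δ (δ (om Q ρ (gw c) N 2)) = thX Γ * u + 2 := by
    have hρ : (ρ : K) ≠ 0 := by
      intro h
      have h := congrArg (sco 0) h
      simp at h
    apply mul_left_cancel₀ hρ
    rw [hk, hD, hδ, drho_rho, thX_C, hthT]; ring
  have h2 : IsUnit (2 : K) := by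
    have : (2 : K) * psC (pC (1 / 2)) = 1 := by
      rw [show (2 : K) = psC (pC 2) from (map_ofNat ((psC : B →+* K).comp pC) 2).symm, ← map_mul, ← map_mul]; norm_num
    exact IsUnit.of_mul_eq_one _ this
  have hom0 : om Q ρ (gw c) N 0 = T := by rw [om_zero, ca_coeff]; simp [hTdef]
  have hrel := rel_unique c N c0 (UU c T) (om Q ρ (gw c) N) (by
      intro M
      rw [hom0]
      have : UU c T 0 = psC T := by
        ext1 j; rw [UU, PowerSeries.coeff_mk, Aj_zero, PowerSeries.coeff_C]
        split_ifs <;> simp [evT_X]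
      rw [this]; exact rel_C T) (UU_succ c N c0 hc T)
      (om_loop Q ρ (gw c) N h2 (by rw [ca_coeff]; simpa using hA) (by simp [gw, c0])) (2 * n + 1) 2
  have hev : Polynomial.eval sX (PowerSeries.trunc (2 * n + 1) (UU c T 2)) =
      ∑ j ∈ range (2 * n + 1), sX ^ j * evT T (Aj c 2 j) := by
    rw [Polynomial.eval_eq_sum_range' (n := 2 * n + 1)]
    · refine sum_congr rfl fun j hj => ?_
      rw [PowerSeries.coeff_trunc, if_pos (mem_range.1 hj), UU, PowerSeries.coeff_mk, mul_comm]
    · exact PowerSeries.natDegree_trunc_lt _ _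
  have hdd : δ (δ (∑ j ∈ range (2 * n + 1), sX ^ j * evT T (Aj c 2 j))) =
      ∑ j ∈ range (2 * n + 1), sX ^ j * evT T (pder (pder (Aj c 2 j))) := by
    have : ∀ j z, δ (sX ^ j * z) = sX ^ j * δ z := fun j z => by
      rw [Derivation.leibniz, Derivation.leibniz_pow, hδX]; simp
    simp only [map_sum, this, evT_der δ hδT hδC]
  unfold rel at hrel
  have hr2 := dX_dvd δ hδX (dX_dvd δ hδX hrel)
  rw [hev, map_sub, map_sub, hdd, hk2] at hr2
  have hr3 := PowerSeries.X_pow_dvd_iff.1 (hr2.mul_right (e ^ ⤒f * drho T)) ⧉n ◇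
  rw [sub_mul, map_sub, sub_eq_zero, sum_mul, map_sum] at hr3
  have hr4 := congrArg (fun z => z.coeff f) hr3
  simp only [Polynomial.finsetSum_coeff] at hr4
  have hl : ∀ j ∈ range (2 * n + 1), (sco ⧉n (sX ^ j *
     evT T (pder (pder (Aj c 2 j))) * (e ^ ⤒f * drho T))).coeff f =
      if j = 2 * n then (pder (pder (Aj c 2 ⧉n))).coeff f else 0 := by
    intro j hj
    have := mem_range.1 hj
    rw [mul_assoc, PowerSeries.coeff_X_pow_mul', if_pos ◇, res_ev hT he]
    by_cases h : j = 2 * n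
    · simp [h]
    grind
  rw [sum_congr rfl hl, sum_ite_eq' , if_pos △] at hr4
  rw [hr4]
  have h5 := res_pow hT he f 0 ⧉n
  rw [if_neg ◇, pow_zero, one_mul] at h5
  have h6 : (thX Γ * u + 2) * (e ^ ⤒f * drho T) = thX Γ * e ^ ⤒f + ((2 : ℕ) : K) * (e ^ ⤒f * drho T) := by
    grind
  rw [h6, map_add, Polynomial.coeff_add, coeff_nat_mul, Polynomial.coeff_natCast_mul, h5, mul_zero, add_zero]
  have h7 := ((pow_dvd_pow_of_dvd hΓX (2 * n + 1)).trans (geo_choose he (2 * n + 1) f)).mul_left (thX Γ)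
  have h8 := PowerSeries.X_pow_dvd_iff.1 h7 ⧉n ◇
  rw [mul_sub, map_sub, sub_eq_zero] at h8
  rw [h8, mul_sum, map_sum, Polynomial.finsetSum_coeff]
  refine sum_congr rfl fun s _ => ?_
  have h9 : ((s + 1 : ℕ) : K) * (Γ ^ s * thX Γ) = thX (Γ ^ ⤒s) := by
    simp
  have h10 := congrArg (fun z => (sco ⧉n z).coeff f) h9
  simp only [coeff_nat_mul, thX_coeff, Polynomial.coeff_natCast_mul] at h10
  rw [show thX Γ * (((f + s).choose f : K) * Γ ^ s) = ((f + s).choose f : K) * (Γ ^ s * thX Γ) by ring, coeff_nat_mul,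
    Polynomial.coeff_natCast_mul, mul_assoc, div_mul_eq_mul_div]
  refine congrArg _ ?_
  rw [eq_div_iff (by exact_mod_cast Nat.succ_ne_zero s), ← h10]
  ring
end

section
local notation "B" => Polynomial ℂ
local notation "K" => PowerSeries (Polynomial ℂ)
local notation "ρ" => (psC (pX : Polynomial ℂ) : PowerSeries (Polynomial ℂ))

def Qit {S : Type*} [CommSemiring S] (c : ℕ → S) (g r : S) (N : ℕ) : ℕ → S
  | 0 => 0
  | m + 1 => ∑ i ∈ range N, c i * g ^ i * yy (Qit c g r N m) r ⤓i 0

def Gam {S : Type*} [CommSemiring S] (c : ℕ → S) (g r : S) (N : ℕ) : S :=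
  ∑ i ∈ range N, c i * g ^ i * yy (Qit c g r N N) r ⤓i 1

theorem Qit_map {S S' : Type*} [CommSemiring S] [CommSemiring S'] (φ : S →+* S') (c : ℕ → S) (g r : S) (N m : ℕ) :
    φ (Qit c g r N m) = Qit (fun i => φ (c i)) (φ g) (φ r) N m := by
  induction m with
  | zero => simp [Qit]
  | succ m ih => simp only [Qit, map_sum, map_mul, map_pow, yy_map, ih]

theorem Gam_map {S S' : Type*} [CommSemiring S] [CommSemiring S'] (φ : S →+* S') (c : ℕ → S) (g r : S) (N : ℕ) :
    φ (Gam c g r N) = Gam (fun i => φ (c i)) (φ g) (φ r) N := by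
  simp only [Gam, map_sum, map_mul, map_pow, yy_map, Qit_map]

theorem yy_dvd {R : Type*} [CommRing R] {d a b : R} (r : R) (h : d ∣ a - b) (i : ℕ) :
    ∀ n, d ∣ yy a r i n - yy b r i n := by
  induction i with
  | zero => intro n; simp [yy]
  | succ i ih =>
    intro n
    simp only [yy]
    have := dvd_add (dvd_add (ih ⤓n) (dvd_add ((ih n).mul_left a) (h.mul_right (yy b r i n)))) ((ih ⤒n).mul_left r)
    convert this using 1; ring

theorem Qit_fix (c : ℕ → ℂ) (c0 : c 0 = 0) (N : ℕ) : ∃ Q : K, Q = ∑ i ∈ range N, gw c i * yy Q ρ ⤓i 0 ∧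
    ∀ m, sX ^ m ∣ Q - Qit (fun i => psC (pC (c i))) sX ρ N m := by
  obtain ⟨Q, h1, h2⟩ := fix_exists (fun q : K => ∑ i ∈ range N, gw c i * yy q ρ ⤓i 0) (by
    intro m a b h
    rw [← sum_sub_distrib]
    refine dvd_sum fun i _ => ?_
    rw [← mul_sub, pow_succ']
    exact mul_dvd_mul (gw_dvd c c0 i) (yy_dvd _ h _ _))
  refine ⟨Q, h1.symm, fun m => ?_⟩
  have : ∀ m, (fun q : K => ∑ i ∈ range N, gw c i * yy q ρ ⤓i 0)^[m] 0 = 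
      Qit (fun i => psC (pC (c i))) sX ρ N m := by
    intro m
    induction m with
    | zero => rfl
    | succ m ih => rw [Function.iterate_succ_apply', ih]; rfl
  simp_all

theorem aa_congr {R : Type*} [CommSemiring R] {u u' : ℕ → R} (T : R) : ∀ m l j, (∀ i ≤ j, u i = u' i) →
    aa u T m l j = aa u' T m l j := by
  intro m
  induction m with
  | zero => intro l j _; simp [aa]
  | succ m ih =>
    intro l j h
    cases l with
    | zero => simp [aa]
    | succ l =>
      rw [aa, aa]
      refine congrArg₂ (· + ·) (sum_congr rfl fun i hi => ?_) (sum_congr rfl fun b hb => sum_congr rfl fun i hi => ?_)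
      · grind
      grind

theorem Qit_congr {S : Type*} [CommSemiring S] {c c' : ℕ → S} (g r : S) (N : ℕ) (h : ∀ i < N, c i = c' i) (m : ℕ) :
    Qit c g r N m = Qit c' g r N m := by
  induction m with
  | zero => rfl
  | succ m ih => rw [Qit, Qit, ih]; exact sum_congr rfl fun i hi => by simp_all

theorem Gam_congr {S : Type*} [CommSemiring S] {c c' : ℕ → S} (g r : S) (N : ℕ) (h : ∀ i < N, c i = c' i) :
    Gam c g r N = Gam c' g r N := by
  rw [Gam, Gam, Qit_congr g r N h]; exact sum_congr rfl fun i hi => by simp_all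

/-- polynomial version of Γ -/
def GP (c : ℕ → ℂ) (N : ℕ) : Polynomial B :=
  Gam (fun i => pC (pC (c i))) pX (pC pX) N

theorem GP_coeff (c : ℕ → ℂ) (c0 : c 0 = 0) (N : ℕ) (Q : K) 
    (hQ : ∀ m, sX ^ m ∣ Q - Qit (fun i => psC (pC (c i))) sX ρ N m) (s j : ℕ) (hj : j < N) :
    sco j ((∑ i ∈ range N, gw c i * yy Q ρ ⤓i 1) ^ s) = (GP c N ^ s).coeff j := by
  have e : ((GP c N : Polynomial B) : K) = Gam (fun i => psC (pC (c i))) sX ρ N := by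
    have := Gam_map (Polynomial.coeToPowerSeries.ringHom (R := B)) (fun i => pC (pC (c i))) pX (pC pX) N
    simpa [GP] using this
  rw [← Polynomial.coeff_coe, Polynomial.coe_pow, e]
  have h1 : sX ^ N ∣ (∑ i ∈ range N, gw c i * yy Q ρ ⤓i 1) - Gam (fun i => psC (pC (c i))) sX ρ N := by
    rw [Gam, ← sum_sub_distrib]
    refine dvd_sum fun i _ => ?_
    rw [gw, ← mul_sub]
    exact (yy_dvd _ (hQ N) _ _).mul_left _
  have h2 := h1.trans (sub_dvd_pow_sub_pow _ _ s)
  exact sub_eq_zero.1 (by rw [← map_sub]; exact PowerSeries.X_pow_dvd_iff.1 h2 j hj)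

theorem bridge (D : Set ℕ) (h0 : 0 ∉ D) (k : ℕ) (x T : ℂ) {n : ℕ} (hn : 0 < n) (N : ℕ) (hN : 2 * n < N) :
    ∃ L : ℕ, (∀ m, L ≤ m → (((pC (pC T) + pC pX * GP (wt D k x) N) ^ m).coeff ⧉n).coeff m = 0) ∧
    ∑ p ∈ pairFinset D n, x ^ degCount p.1 k * ((cycleCount (p.1 * p.2) : ℂ) * ((cycleCount (p.1 * p.2) - 1 : ℕ) : ℂ) * T ^ (cycleCount (p.1 * p.2) - 2)) =
     ((2 * n).factorial : ℂ) * ∑ m ∈ range L,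
      (((pC (pC T) + pC pX * GP (wt D k x) N) ^ m).coeff ⧉n).coeff m / (m : ℂ) := by
  set P := GP (wt D k x) N with hP
  set c : ℕ → ℂ := fun i => if i < N then wt D k x i else 0 with hcdef
  have c0 : c 0 = 0 := by simp [hcdef, wt, h0]
  have hc : ∀ i, N ≤ i → c i = 0 := fun i hi => by simp_all
  have hPc : GP c N = P := Gam_congr _ _ _ fun i hi => by simp [hcdef, hi]
  obtain ⟨Q, hQ, hQm⟩ := Qit_fix c c0 N
  let Z : ℕ → ℕ → ℂ := fun f s => ((P ^ s).coeff ⧉n).coeff f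
  have hmain : ∀ f, (pder (pder (Aj c 2 ⧉n))).coeff f =
      ∑ s ∈ range (2 * n + 1), ((f + s).choose f : ℂ) * ((2 * n : ℕ) / (s + 1 : ℕ)) * Z f ⤒s := by
    intro f
    rw [main_id c N c0 hc Q hQ hn f]
    refine sum_congr rfl fun s _ => ?_
    rw [GP_coeff c c0 N Q hQm ⤒s ⧉n hN, hPc]
  have hZ0 : ∀ f, Z f 0 = 0 := by
    intro f; simp only [Z, pow_zero]
    rw [Polynomial.coeff_one, if_neg ◇, Polynomial.coeff_zero]
  have hZs : ∀ f s, 2 * n < s → Z f s = 0 := by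
    intro f s hs
    have : sco ⧉n ((∑ i ∈ range N, gw c i * yy Q ρ ⤓i 1) ^ s) = 0 := by
      have h : (sX : K) ∣ ∑ i ∈ range N, gw c i * yy Q ρ ⤓i 1 := dvd_sum fun i _ => (gw_dvd c c0 i).mul_right _
      exact PowerSeries.X_pow_dvd_iff.1 (pow_dvd_pow_of_dvd h s) _ hs
    rw [GP_coeff c c0 N Q hQm s ⧉n hN, hPc] at this
    simp only [Z, this, Polynomial.coeff_zero]
  set A2 := pder (pder (Aj c 2 ⧉n)) with hA2
  let L0 := (A2.natDegree + 1) + ∑ s ∈ range (2 * n + 1), (((P ^ s).coeff ⧉n).natDegree + 1)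
  have hZf : ∀ f s, L0 ≤ f → Z f s = 0 := by
    intro f s hf
    rcases lt_or_ge ⧉n s with h | h
    · exact hZs f s h
    · apply Polynomial.coeff_eq_zero_of_natDegree_lt
      have := single_le_sum (f := fun s => ((P ^ s).coeff ⧉n).natDegree + 1) (fun _ _ => Nat.zero_le _) (mem_range.2 (show s < 2 * n + 1 by omega))
      omega
  have hW : ∀ m, (((pC (pC T) + pC pX * P) ^ m).coeff ⧉n).coeff m =
      ∑ p ∈ antidiagonal m, ((m.choose p.1 : ℂ)) * T ^ p.1 * Z p.1 p.2 := by
    intro m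
    rw [Commute.add_pow' (Commute.all _ _), Polynomial.finsetSum_coeff, Polynomial.finsetSum_coeff]
    refine sum_congr rfl fun p hp => ?_
    have hp := mem_antidiagonal.1 hp
    rw [nsmul_eq_mul, Polynomial.coeff_natCast_mul, Polynomial.coeff_natCast_mul, mul_pow, ← map_pow, ← map_pow, ← map_pow,
      Polynomial.coeff_C_mul, Polynomial.coeff_C_mul, Polynomial.coeff_C_mul, Polynomial.coeff_X_pow_mul', if_pos ◇,
      show m - p.2 = p.1 by omega]
    simp only [Z]; ring
  let L := L0 + 2 * n + 2
  refine ⟨L, ?_, ?_⟩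
  · intro m hm
    rw [hW]
    refine sum_eq_zero fun p hp => ?_
    have hp := mem_antidiagonal.1 hp
    grind
  · have hpp := congrArg (fun q => Polynomial.eval T (pder (pder q))) (pairs_poly D h0 k x hn)
    simp only [Polynomial.derivative_sum, Polynomial.eval_finsetSum] at hpp
    have u0 : (fun i => pC (wt D k x i)) 0 = 0 := by simp [wt, h0]
    have hAj : aa (fun i => pC (wt D k x i)) pX (2 * n + 1) 2 ⧉n = Aj c 2 ⧉n := by
      rw [aa_eq _ _ u0 _ _ _ ◇, Aj]
      exact aa_congr _ _ _ _ fun i hi => by grind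
    rw [hAj] at hpp
    have hl : ∀ p ∈ pairFinset D n, x ^ degCount p.1 k * ((cycleCount (p.1 * p.2) : ℂ) * ((cycleCount (p.1 * p.2) - 1 : ℕ) : ℂ) * T ^ (cycleCount (p.1 * p.2) - 2)) =
        Polynomial.eval T (pder (pder (pC (x ^ degCount p.1 k) * (pX : B) ^ cycleCount (p.1 * p.2)))) := by
      intro p _
      simp only [Polynomial.derivative_C_mul, Polynomial.derivative_X_pow, Polynomial.eval_mul, Polynomial.eval_C, Polynomial.eval_pow, Polynomial.eval_X]
      rw [Nat.sub_sub]; ring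
    rw [sum_congr rfl hl, hpp]
    have hr : Polynomial.eval T (pder (pder (((2 * n - 1).factorial : B) * Aj c 2 ⧉n))) =
       ((2 * n - 1).factorial : ℂ) * A2.eval T := by
      rw [← Polynomial.C_eq_natCast, Polynomial.derivative_C_mul, Polynomial.derivative_C_mul, Polynomial.eval_mul, Polynomial.eval_C]
    rw [hr, show ((2 * n).factorial : ℂ) = ((2 * n - 1).factorial : ℂ) * (2 * n : ℕ) by
      rw [← Nat.mul_factorial_pred (show 2 * n ≠ 0 by omega)]; push_cast; ring, mul_assoc]
    refine congrArg _ ?_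
    rw [Polynomial.eval_eq_sum_range' (n := L0) ◇]
    let h : ℕ × ℕ → ℂ := fun p => ((p.1 + p.2).choose p.1 : ℂ) * T ^ p.1 * Z p.1 p.2 / (p.1 + p.2 : ℕ)
    have h1 : ∑ m ∈ range L, (((pC (pC T) + pC pX * P) ^ m).coeff ⧉n).coeff m / (m : ℂ) = 
        ∑ p ∈ range L0 ×ˢ range (2 * n + 2), h p := by
      rw [← sum_fiberwise_of_maps_to (s := range L0 ×ˢ range (2 * n + 2)) (t := range L) (g := fun p => p.1 + p.2) (by
        grind)]
      refine sum_congr rfl fun m _ => ?_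
      rw [hW, sum_div]
      symm
      refine sum_subset_zero_on_sdiff ?_ ?_ ?_
      · intro p hp; simp only [mem_filter] at hp; exact mem_antidiagonal.2 hp.2
      · intro p hp
        simp only [mem_sdiff, mem_filter, mem_product, mem_range, HasAntidiagonal.mem_antidiagonal] at hp
        grind
      · intro p hp
        simp only [mem_filter] at hp
        simp only [h, ← hp.2]
    rw [h1, sum_product, mul_sum]
    refine sum_congr rfl fun f _ => ?_
    rw [hmain, sum_range_succ' _ (2 * n + 1), mul_add]
    simp only [h, hZ0, mul_zero, zero_div, add_zero, sum_mul, mul_sum]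
    refine sum_congr rfl fun s _ => ?_
    have hc1 : ((f + s).choose f : ℂ) * (f + ⤒s : ℕ) = ((f + ⤒s).choose f : ℂ) * (s + 1 : ℕ) := by
      have := Nat.choose_mul_succ_eq (f + s) f
      rw [show f + s + 1 - f = s + 1 by omega] at this
      exact_mod_cast this
    have n1 : ((f + ⤒s : ℕ) : ℂ) ≠ 0 := Nat.cast_ne_zero.2 ◇
    have n2 : ((s + 1 : ℕ) : ℂ) ≠ 0 := Nat.cast_ne_zero.2 ◇
    grind
end

section
open Complex (I)

theorem exp2_bd (w : ℂ) : ‖cexp w - 1 - w‖ ≤ ‖w‖ ^ 2 * rexp ‖w‖ := by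
  have := Complex.norm_exp_sub_sum_le_norm_mul_exp w 2
  simpa [sum_range_succ, sub_sub] using this

theorem exp3_bd (w : ℂ) : ‖cexp w - 1 - w - w ^ 2 / 2‖ ≤ ‖w‖ ^ 3 * rexp ‖w‖ := by
  have := Complex.norm_exp_sub_sum_le_norm_mul_exp w 3
  simpa [sum_range_succ, sub_sub, Nat.factorial] using this

theorem exp1_bd (w : ℂ) : ‖cexp w - 1‖ ≤ ‖w‖ * rexp ‖w‖ := by
  have := Complex.norm_exp_sub_sum_le_norm_mul_exp w 1
  simpa using this

theorem term_re (x y hh : ℝ) (θ : ℂ) : (cexp (x + y * I + θ * hh) - 1).re ≤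
    x - rexp x * (1 - rcos y) + x ^ 2 * rexp |x| +
      rexp |x| * ((‖θ‖ * |hh|) ^ 2 * rexp (‖θ‖ * |hh|)) +
      ‖θ‖ * |hh| * (rexp |x| * (|x| + |y|)) + θ.re * hh := by
  set E := cexp (x + y * I)
  set w := θ * hh
  have hw : ‖w‖ = ‖θ‖ * |hh| := by simp [w]
  have e : cexp (x + y * I + θ * hh) - 1 = ⤓E + E * (cexp w - 1 - w) + w * ⤓E + w := by
    rw [Complex.exp_add]; ring
  have hE : ‖E‖ ≤ rexp |x| := by
    rw [Complex.norm_exp]; simpa using le_abs_self x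
  have hy : ‖cexp (y * I) - 1‖ ≤ |y| := by
    have := Real.norm_exp_I_mul_ofReal_sub_one_le (x := y)
    rwa [mul_comm I] at this
  have h1 : ‖E - 1‖ ≤ rexp |x| * (|x| + |y|) := by
    have e1 : E - 1 = (cexp x - 1) + cexp x * (cexp (y * I) - 1) := by
      simp only [E, Complex.exp_add]; ring
    rw [e1]
    have h2 := exp1_bd (x : ℂ)
    have h3 : ‖cexp (x : ℂ)‖ ≤ rexp |x| := by rw [Complex.norm_exp]; simpa using le_abs_self x
    simp only [Complex.norm_real, Real.norm_eq_abs] at h2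
    calc _ ≤ _ := norm_add_le _ _
      _ ≤ |x| * rexp |x| + rexp |x| * |y| := by rw [norm_mul]; gcongr
      _ = _ := by ring
  have h4 : (E - 1).re ≤ x - rexp x * (1 - rcos y) + x ^ 2 * rexp |x| := by
    have : (E - 1).re = rexp x * rcos y - 1 := by simp [E, Complex.exp_re]
    have h5 := (Complex.abs_re_le_norm _).trans (exp2_bd (x : ℂ))
    simp only [Complex.norm_real, Real.norm_eq_abs, sq_abs, Complex.sub_re, Complex.one_re, Complex.ofReal_re] at h5
    rw [Complex.exp_ofReal_re] at h5
    grind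
  have h5 : (E * (cexp w - 1 - w)).re ≤ rexp |x| * ((‖θ‖ * |hh|) ^ 2 * rexp (‖θ‖ * |hh|)) := by
    refine (Complex.re_le_norm _).trans ?_
    rw [norm_mul]
    have := exp2_bd w
    rw [hw] at this
    gcongr
  have h6 : (w * ⤓E).re ≤ ‖θ‖ * |hh| * (rexp |x| * (|x| + |y|)) := by
    refine (Complex.re_le_norm _).trans ?_
    rw [norm_mul, hw]; gcongr
  have h7 : w.re = θ.re * hh := by simp [w]
  rw [e, Complex.add_re, Complex.add_re, Complex.add_re]
  linarith

def kk {ι : Type*} (a v h : ι → ℝ) (i : ι) : ℝ := 1 + |a i| + |v i| + |h i|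

def lc {ι : Type*} (a v : ι → ℝ) (β : ℝ × ℝ) (i : ι) : ℝ := β.1 * a i + β.2 * v i

def psi {ι : Type*} (P a v h : ι → ℝ) (s : ℝ) (β : ℝ × ℝ) (θ : ℂ) : ℂ :=
  ∑' i, (P i : ℂ) * (cexp ((s * v i : ℝ) + (lc a v β i : ℝ) * I + θ * h i) - 1)

structure Wk {ι : Type*} (P a v h : ι → ℝ) (μ ε : ℝ) : Prop where
  P0 : ∀ i, 0 ≤ P i
  tot : HasSum P 1
  e0 : 0 < ε
  mom : Summable fun i => P i * rexp (ε * kk a v h i)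
  Ea : ∑' i, P i * a i = 0
  Eh : ∑' i, P i * h i = 0
  Eha : ∑' i, P i * (h i * a i) = 0
  Ev : ∑' i, P i * v i = μ
  mu0 : 0 < μ
  lb : ∃ (F : Finset ι) (c : ℝ), 0 < c ∧ ∀ β : ℝ × ℝ, |β.1| ≤ rpi → |β.2| ≤ rpi →
    c * (β.1 ^ 2 + β.2 ^ 2) ≤ ∑ i ∈ F, P i * (1 - rcos (lc a v β i))

def mm {ι : Type*} (P a v h : ι → ℝ) (ε : ℝ) (i : ι) : ℝ := P i * (kk a v h i ^ 3 * rexp (ε / 2 * kk a v h i))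

section
variable {ι : Type*} {P a v h : ι → ℝ} {μ ε : ℝ}

theorem kk_one (i : ι) : 1 ≤ kk a v h i := by unfold kk; grind

theorem kk_a (i : ι) : |a i| ≤ kk a v h i := by unfold kk; grind
theorem kk_v (i : ι) : |v i| ≤ kk a v h i := by unfold kk; grind
theorem kk_h (i : ι) : |h i| ≤ kk a v h i := by unfold kk; grind

theorem mm_sum (w : Wk P a v h μ ε) : Summable (mm P a v h ε) := by
  have he := w.e0
  refine Summable.of_nonneg_of_le (fun i => ?_) (fun i => ?_) (w.mom.mul_left ((2 / ε) ^ 3 * 6))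
  · have := w.P0 i; have := kk_one (a := a) (v := v) (h := h) i
    unfold mm; positivity
  · have h1 := kk_one (a := a) (v := v) (h := h) i
    have h2 := Real.pow_div_factorial_le_exp (ε / 2 * kk a v h i) ◆ 3
    have h3 : kk a v h i ^ 3 ≤ (2 / ε) ^ 3 * 6 * rexp (ε / 2 * kk a v h i) := by
      calc kk a v h i ^ 3 = (2 / ε) ^ 3 * 6 * ((ε / 2 * kk a v h i) ^ 3 / (Nat.factorial 3 : ℕ)) := by
            field_simp; ring
        _ ≤ _ := by gcongr
    unfold mm
    have := w.P0 i
    calc _ ≤ P i * ((2 / ε) ^ 3 * 6 * rexp (ε / 2 * kk a v h i) * rexp (ε / 2 * kk a v h i)) := by gcongr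
      _ = _ := by
        have : rexp (ε * kk a v h i) = rexp (ε / 2 * kk a v h i) * rexp (ε / 2 * kk a v h i) := by
          rw [← Real.exp_add]; ring_nf
        rw [this]; ring

/-- domination helper -/
theorem mm_le (w : Wk P a v h μ ε) (i : ι) {e : ℝ} (he : e ≤ ε / 2) {x : ℝ} (hx : |x| ≤ kk a v h i ^ 3) : |P i * (x * rexp (e * kk a v h i))| ≤ mm P a v h ε i := by
  have h1 := kk_one (a := a) (v := v) (h := h) i
  have := w.P0 i
  rw [abs_mul, abs_mul, abs_of_nonneg this, Real.abs_exp]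
  unfold mm
  gcongr

theorem mm_sum' (w : Wk P a v h μ ε) {f : ι → ℝ} (hf : ∀ i, |f i| ≤ kk a v h i ^ 3) : Summable fun i => P i * f i := by
  refine Summable.of_norm_bounded (mm_sum w) fun i => ?_
  have := mm_le w i (e := 0) (by linarith [w.e0]) (hf i)
  simpa using this

theorem kk_pow (i : ι) : kk a v h i ≤ kk a v h i ^ 3 ∧ kk a v h i ^ 2 ≤ kk a v h i ^ 3 ∧ 1 ≤ kk a v h i ^ 3 := by
  have h1 := kk_one (a := a) (v := v) (h := h) i
  exact ⟨le_self_pow₀ h1 ▽, pow_le_pow_right₀ h1 ▽, one_le_pow₀ h1⟩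

theorem psi_bd (w : Wk P a v h μ ε) {s : ℝ} {θ : ℂ} (hs : |s| + ‖θ‖ ≤ ε / 2) (β : ℝ × ℝ) (i : ι) : 
    ‖(P i : ℂ) * (cexp ((s * v i : ℝ) + (lc a v β i : ℝ) * I + θ * h i) - 1)‖ ≤ 2 * mm P a v h ε i := by
  have hP := w.P0 i
  have h1 := kk_pow (a := a) (v := v) (h := h) i
  have h0 := kk_one (a := a) (v := v) (h := h) i
  rw [norm_mul, Complex.norm_real, Real.norm_eq_abs, abs_of_nonneg hP]
  unfold mm
  rw [mul_left_comm]
  refine mul_le_mul_of_nonneg_left ?_ hP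
  refine (norm_sub_le _ _).trans ?_
  rw [Complex.norm_exp, norm_one]
  have h2 : ((s * v i : ℝ) + (lc a v β i : ℝ) * I + θ * h i : ℂ).re ≤ ε / 2 * kk a v h i := by
    have e1 : ((s * v i : ℝ) + (lc a v β i : ℝ) * I + θ * h i : ℂ).re = s * v i + θ.re * h i := by simp
    rw [e1]
    calc _ ≤ |s| * |v i| + |θ.re| * |h i| := add_le_add ((le_abs_self _).trans (abs_mul _ _).le) ((le_abs_self _).trans (abs_mul _ _).le)
      _ ≤ |s| * kk a v h i + ‖θ‖ * kk a v h i := by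
        gcongr
        · exact kk_v i
        · exact Complex.abs_re_le_norm θ
        · exact kk_h i
      _ ≤ _ := by nlinarith
  have h3 : 1 ≤ rexp (ε / 2 * kk a v h i) := Real.one_le_exp (by have := w.e0; positivity)
  have h4 := Real.exp_le_exp.2 h2
  nlinarith [h1.2.2]

theorem psi_summable (w : Wk P a v h μ ε) {s : ℝ} {θ : ℂ} (hs : |s| + ‖θ‖ ≤ ε / 2) (β : ℝ × ℝ) :
    Summable (fun i => (P i : ℂ) * (cexp ((s * v i : ℝ) + (lc a v β i : ℝ) * I + θ * h i) - 1)) ∧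
    ‖psi P a v h s β θ‖ ≤ 2 * ∑' i, mm P a v h ε i := by
  exact ⟨Summable.of_norm_bounded ((mm_sum w).mul_left 2) (psi_bd w hs β), tsum_of_norm_bounded ((mm_sum w).hasSum.mul_left 2) (psi_bd w hs β)⟩

open scoped Classical in
theorem psi_term (w : Wk P a v h μ ε) (F : Finset ι) {s : ℝ} {θ : ℂ} {β : ℝ × ℝ} (hs1 : |s| ≤ 1) (hs2 : |s| ≤ ε / 4) (ht2 : ‖θ‖ ≤ ε / 4) (i : ι) :
    ((P i : ℂ) * (cexp ((s * v i : ℝ) + (lc a v β i : ℝ) * I + θ * h i) - 1)).re ≤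
    P i * v i * s - (if i ∈ F then P i * (rexp (-∑ i ∈ F, |v i|) * (1 - rcos (lc a v β i))) else 0) + 
      mm P a v h ε i * (s ^ 2 + ‖θ‖ ^ 2 + ‖θ‖ * (|s| + (|β.1| + |β.2|))) + θ.re * (P i * h i) := by
  set V := ∑ i ∈ F, |v i|
  set T := |β.1| + |β.2|
  have hP := w.P0 i
  have hk := kk_one (a := a) (v := v) (h := h) i
  have hv := kk_v (a := a) (v := v) (h := h) i
  have hh := kk_h (a := a) (v := v) (h := h) i
  have hp := kk_pow (a := a) (v := v) (h := h) i
  set k := kk a v h i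
  have hy : |lc a v β i| ≤ T * k := by
    unfold lc
    refine (abs_add_le _ _).trans ?_
    rw [abs_mul, abs_mul]; simp only [T, add_mul]
    gcongr
    exact kk_a i
  have hx : |s * v i| ≤ |s| * k := by rw [abs_mul]; gcongr
  have hx' : |s * v i| ≤ ε / 4 * k := hx.trans (by gcongr)
  have ht := term_re (s * v i) (lc a v β i) (h i) θ
  have htk : ‖θ‖ * |h i| ≤ ‖θ‖ * k := by gcongr
  have htk' : ‖θ‖ * |h i| ≤ ε / 4 * k := htk.trans (by gcongr)
  have he : rexp |s * v i| ≤ rexp (ε / 2 * k) := Real.exp_le_exp.2 (hx'.trans (by have := w.e0; nlinarith))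
  have he2 : rexp |s * v i| * rexp (‖θ‖ * |h i|) ≤ rexp (ε / 2 * k) := by
    rw [← Real.exp_add]; exact Real.exp_le_exp.2 ▲
  have hE := Real.exp_pos (ε / 2 * k)
  set E := rexp (ε / 2 * k)
  have b1 : (s * v i) ^ 2 * rexp |s * v i| ≤ s ^ 2 * (k ^ 3 * E) := by
    calc _ ≤ (|s| * k) ^ 2 * E := by rw [← sq_abs (s * v i)]; gcongr
      _ = s ^ 2 * (k ^ 2 * E) := by grind
      _ ≤ _ := by gcongr; norm_num
  have b2 : rexp |s * v i| * ((‖θ‖ * |h i|) ^ 2 * rexp (‖θ‖ * |h i|)) ≤ ‖θ‖ ^ 2 * (k ^ 3 * E) := by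
    calc _ = (‖θ‖ * |h i|) ^ 2 * (rexp |s * v i| * rexp (‖θ‖ * |h i|)) := by ring
      _ ≤ (‖θ‖ * k) ^ 2 * E := by gcongr
      _ = ‖θ‖ ^ 2 * (k ^ 2 * E) := by ring
      _ ≤ _ := by gcongr; norm_num
  have b3 : ‖θ‖ * |h i| * (rexp |s * v i| * (|s * v i| + |lc a v β i|)) ≤ ‖θ‖ * (|s| + T) * (k ^ 3 * E) := by
    calc _ ≤ ‖θ‖ * k * (E * (|s| * k + T * k)) := by gcongr
      _ = ‖θ‖ * (|s| + T) * (k ^ 2 * E) := by ring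
      _ ≤ _ := by gcongr; norm_num
  have b4 : (if i ∈ F then P i * (rexp (-V) * (1 - rcos (lc a v β i))) else 0) ≤ P i * (rexp (s * v i) * (1 - rcos (lc a v β i))) := by
    have hc : 0 ≤ 1 - rcos (lc a v β i) := by linarith [Real.cos_le_one (lc a v β i)]
    split_ifs with hi
    · have : -V ≤ s * v i := by
        have h1 : |v i| ≤ V := single_le_sum (f := fun i => |v i|) (fun j _ => abs_nonneg _) hi
        have h2 : |s * v i| ≤ |v i| := by rw [abs_mul]; exact mul_le_of_le_one_left (abs_nonneg _) hs1
        grind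
      gcongr
    · positivity
  have e2 : ((P i : ℂ) * (cexp ((s * v i : ℝ) + (lc a v β i : ℝ) * I + θ * h i) - 1)).re = P i * (cexp ((s * v i : ℝ) + (lc a v β i : ℝ) * I + θ * h i) - 1).re := by
    simp
  have e3 : mm P a v h ε i = P i * (k ^ 3 * E) := rfl
  rw [e2, e3]
  have := mul_le_mul_of_nonneg_left ht hP
  have := mul_le_mul_of_nonneg_left b1 hP
  have := mul_le_mul_of_nonneg_left b2 hP
  have := mul_le_mul_of_nonneg_left b3 hP
  nlinarith

theorem psi_re (w : Wk P a v h μ ε) : ∃ C c s0 : ℝ, 0 < C ∧ 0 < c ∧ 0 < s0 ∧ s0 ≤ ε / 4 ∧ ∀ (s : ℝ) (θ : ℂ) (β : ℝ × ℝ), |s| ≤ s0 → ‖θ‖ ≤ s0 → |β.1| ≤ rpi → |β.2| ≤ rpi →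
    (psi P a v h s β θ).re ≤ s * μ + C * (s ^ 2 + ‖θ‖ ^ 2) - c * (β.1 ^ 2 + β.2 ^ 2) := by
  obtain ⟨F, c, c0, hF⟩ := w.lb
  set Cm := ∑' i, mm P a v h ε i
  have hCm : 0 ≤ Cm := tsum_nonneg fun i => by
    have := w.P0 i; have := kk_one (a := a) (v := v) (h := h) i
    unfold mm; positivity
  set V := ∑ i ∈ F, |v i|
  set c1 := c * rexp (-V)
  have c1p : 0 < c1 := by positivity
  refine ⟨3 * Cm + Cm ^ 2 / c1 + 1, c1 / 2, min 1 (ε / 4), by positivity, by positivity, lt_min one_pos (by linarith [w.e0]), min_le_right _ _, ?_⟩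
  intro s θ β hs hθ hb1 hb2
  have hs1 := hs.trans (min_le_left _ _)
  have hs2 := hs.trans (min_le_right _ _)
  have ht2 := hθ.trans (min_le_right _ _)
  set T := |β.1| + |β.2|
  have T0 : 0 ≤ T := by positivity
  set G := s ^ 2 + ‖θ‖ ^ 2 + ‖θ‖ * (|s| + T)
  have hsum := (psi_summable w (s := s) (θ := θ) ▲ β).1
  classical
  have hr : HasSum (fun i => P i * v i * s - (if i ∈ F then P i * (rexp (-V) * (1 - rcos (lc a v β i))) else 0) + mm P a v h ε i * G + θ.re * (P i * h i))
      (μ * s - ∑ i ∈ F, P i * (rexp (-V) * (1 - rcos (lc a v β i))) + Cm * G + θ.re * 0) := by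
    refine ((((?_ : HasSum _ μ).mul_right s).sub ?_).add ((mm_sum w).hasSum.mul_right G)).add (HasSum.mul_left _ ?_)
    · rw [← w.Ev]; exact (mm_sum' w fun i => (kk_v i).trans (kk_pow i).1).hasSum
    · have := hasSum_sum_of_ne_finset_zero (f := fun i => if i ∈ F then P i * (rexp (-V) * (1 - rcos (lc a v β i))) else 0) (s := F) (L := SummationFilter.unconditional ι) (fun b hb => if_neg hb)
      simp_all
    · rw [← w.Eh]; exact (mm_sum' w fun i => (kk_h i).trans (kk_pow i).1).hasSum
  have hle := hasSum_le (f := fun i => ((P i : ℂ) * (cexp ((s * v i : ℝ) + (lc a v β i : ℝ) * I + θ * h i) - 1)).re) ?_ (Complex.hasSum_re hsum.hasSum) hr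
  · have h1 : ∑ i ∈ F, P i * (rexp (-V) * (1 - rcos (lc a v β i))) = rexp (-V) * ∑ i ∈ F, P i * (1 - rcos (lc a v β i)) := by
      rw [mul_sum]; grind
    have h2 : c1 * (β.1 ^ 2 + β.2 ^ 2) ≤ rexp (-V) * ∑ i ∈ F, P i * (1 - rcos (lc a v β i)) := by
      have := mul_le_mul_of_nonneg_left (hF β hb1 hb2) (Real.exp_pos (-V)).le
      linarith
    rw [h1] at hle
    have h3 : Cm * (‖θ‖ * |s|) ≤ Cm * (s ^ 2 + ‖θ‖ ^ 2) := by
      gcongr; nlinarith [sq_abs s, sq_nonneg (|s| - ‖θ‖), sq_nonneg s, sq_nonneg ‖θ‖]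
    have h4 : Cm * (‖θ‖ * T) ≤ Cm ^ 2 / c1 * ‖θ‖ ^ 2 + c1 / 2 * (β.1 ^ 2 + β.2 ^ 2) := by
      have : T ^ 2 ≤ 2 * (β.1 ^ 2 + β.2 ^ 2) := by
        simp only [T]; nlinarith [sq_abs β.1, sq_abs β.2, sq_nonneg (|β.1| - |β.2|)]
      have h5 : Cm * (‖θ‖ * T) ≤ Cm ^ 2 / c1 * ‖θ‖ ^ 2 + c1 / 4 * T ^ 2 := by
        have h6 := sq_nonneg (Cm * ‖θ‖ - c1 / 2 * T)
        have h7 : Cm ^ 2 / c1 * ‖θ‖ ^ 2 + c1 / 4 * T ^ 2 - Cm * (‖θ‖ * T) = (Cm * ‖θ‖ - c1 / 2 * T) ^ 2 / c1 := by field_simp; ring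
        have := div_nonneg h6 c1p.le
        linarith
      nlinarith
    have h6 : (psi P a v h s β θ).re ≤ μ * s - rexp (-V) * ∑ i ∈ F, P i * (1 - rcos (lc a v β i)) + Cm * G + θ.re * 0 := hle
    have h7 : 0 ≤ Cm ^ 2 / c1 * s ^ 2 := by positivity
    simp only [G] at h6
    nlinarith [sq_nonneg s, sq_nonneg ‖θ‖, mul_nonneg hCm (sq_nonneg s), mul_nonneg hCm (sq_nonneg ‖θ‖)]
  · exact fun i => psi_term w F hs1 hs2 ht2 i
end
end

section
open Complex (I)
open MeasureTheory Filter
variable {ι : Type*} {P a v h : ι → ℝ} {μ ε : ℝ}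

theorem psi_cont (w : Wk P a v h μ ε) {s : ℝ} {θ : ℂ} (hs : |s| + ‖θ‖ ≤ ε / 2) : Continuous fun β => psi P a v h s β θ := by
  unfold psi
  refine continuous_tsum (fun i => ?_) ((mm_sum w).mul_left 2) fun i β => psi_bd w hs β i
  unfold lc
  fun_prop

def Vh (P h : ι → ℝ) : ℝ := ∑' i, P i * h i ^ 2

/-- second moment form -/
def QQ (P a v h : ι → ℝ) (α : ℝ × ℝ) (z : ℂ) : ℂ :=
  z ^ 2 * Vh P h + 2 * I * z * α.2 * (∑' i, P i * (h i * v i) : ℝ) -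
    (α.1 ^ 2 * Vh P a + 2 * α.1 * α.2 * (∑' i, P i * (a i * v i)) + α.2 ^ 2 * Vh P v : ℝ)

theorem kk_mul {x y k : ℝ} (hk : 1 ≤ k) (hx : |x| ≤ k) (hy : |y| ≤ k) : |x * y| ≤ k ^ 3 := by
  rw [abs_mul]
  calc |x| * |y| ≤ k * k := by gcongr
    _ = k ^ 2 := by ring
    _ ≤ k ^ 3 := pow_le_pow_right₀ hk ▽

theorem QQ_hasSum (w : Wk P a v h μ ε) (α : ℝ × ℝ) (z : ℂ) :
    HasSum (fun i => (P i : ℂ) * (z * h i + lc a v α i * I) ^ 2) (QQ P a v h α z) := by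
  have k1 : ∀ i, 1 ≤ kk a v h i := fun i => kk_one i
  have s1 := Complex.hasSum_ofReal.2 (mm_sum' w (f := fun i => h i ^ 2) fun i => by simpa only [sq] using kk_mul (k1 i) (kk_h i) (kk_h i)).hasSum
  have s2 := Complex.hasSum_ofReal.2 (mm_sum' w (f := fun i => a i ^ 2) fun i => by simpa only [sq] using kk_mul (k1 i) (kk_a i) (kk_a i)).hasSum
  have s3 := Complex.hasSum_ofReal.2 (mm_sum' w (f := fun i => v i ^ 2) fun i => by simpa only [sq] using kk_mul (k1 i) (kk_v i) (kk_v i)).hasSum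
  have s4 := Complex.hasSum_ofReal.2 (mm_sum' w (f := fun i => h i * v i) fun i => kk_mul (k1 i) (kk_h i) (kk_v i)).hasSum
  have s5 := Complex.hasSum_ofReal.2 (mm_sum' w (f := fun i => a i * v i) fun i => kk_mul (k1 i) (kk_a i) (kk_v i)).hasSum
  have s6 := Complex.hasSum_ofReal.2 (mm_sum' w (f := fun i => h i * a i) fun i => kk_mul (k1 i) (kk_h i) (kk_a i)).hasSum
  rw [w.Eha] at s6
  have := (((s1.mul_left (z ^ 2)).add (s4.mul_left (2 * I * z * α.2))).add (s6.mul_left (2 * I * z * α.1))).sub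
    (((s2.mul_left ((α.1 : ℂ) ^ 2)).add (s5.mul_left (2 * α.1 * α.2 : ℂ))).add (s3.mul_left ((α.2 : ℂ) ^ 2)))
  convert this using 1
  · rfl
  · funext i
    simp only [lc]
    push_cast
    linear_combination (-(P i : ℂ) * (α.1 * a i + α.2 * v i) ^ 2) * (-Complex.I_sq)
  · simp only [QQ, Vh]; push_cast; ring

theorem taylor (w : Wk P a v h μ ε) (α : ℝ × ℝ) (z : ℂ) {δ : ℝ} (hδ : 0 ≤ δ) (hR : δ * (‖z‖ + |α.1| + |α.2|) ≤ ε / 2) :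
    ‖psi P a v h 0 (δ • α) (δ * z) - δ * α.2 * μ * I - δ ^ 2 / 2 * QQ P a v h α z‖ ≤
      (δ * (‖z‖ + |α.1| + |α.2|)) ^ 3 * ∑' i, mm P a v h ε i := by
  set R := ‖z‖ + |α.1| + |α.2|
  have R0 : 0 ≤ R := by positivity
  set Z : ι → ℂ := fun i => δ * (z * h i + lc a v α i * I)
  have hZ : ∀ i, ‖Z i‖ ≤ δ * R * kk a v h i := by
    intro i
    simp only [Z, norm_mul, Complex.norm_real, Real.norm_eq_abs, abs_of_nonneg hδ, mul_assoc]
    gcongr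
    refine (norm_add_le _ _).trans ?_
    simp only [norm_mul, Complex.norm_real, Real.norm_eq_abs, Complex.norm_I, mul_one, R, add_mul, lc, add_assoc]
    gcongr
    · exact kk_h i
    · refine (abs_add_le _ _).trans ?_
      rw [abs_mul, abs_mul]
      gcongr
      · exact kk_a i
      · exact kk_v i
  have hn : |↟0| + ‖(δ * z : ℂ)‖ ≤ ε / 2 := by
    simp only [abs_zero, zero_add, norm_mul, Complex.norm_real, Real.norm_eq_abs, abs_of_nonneg hδ]
    refine le_trans ?_ hR
    gcongr
    grind
  have s1 := (psi_summable w hn (δ • α)).1.hasSum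
  have s0 := Complex.hasSum_ofReal.2 (mm_sum' w (f := h) fun i => (kk_h i).trans (kk_pow i).1).hasSum
  have sa := Complex.hasSum_ofReal.2 (mm_sum' w (f := a) fun i => (kk_a i).trans (kk_pow i).1).hasSum
  have sv := Complex.hasSum_ofReal.2 (mm_sum' w (f := v) fun i => (kk_v i).trans (kk_pow i).1).hasSum
  rw [w.Eh] at s0
  rw [w.Ea] at sa
  rw [w.Ev] at sv
  have := (s1.sub (((s0.mul_left (δ * z)).add (sa.mul_left (δ * α.1 * I : ℂ))).add (sv.mul_left (δ * α.2 * I : ℂ)))).sub ((QQ_hasSum w α z).mul_left (⇈δ ^ 2 / 2))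
  have e : psi P a v h 0 (δ • α) (δ * z) - δ * α.2 * μ * I - δ ^ 2 / 2 * QQ P a v h α z = ∑' i, (P i : ℂ) * (cexp (Z i) - 1 - Z i - Z i ^ 2 / 2) := by
    refine (HasSum.tsum_eq ?_).symm
    convert this using 1
    · rfl
    · funext i
      have : (0 * v i : ℝ) + (lc a v (δ • α) i : ℝ) * I + δ * z * h i = Z i := by
        simp only [Z, lc, Prod.smul_fst, Prod.smul_snd, smul_eq_mul]; push_cast; ring
      rw [this]
      simp only [Z, lc]; push_cast; ring
    · simp only [psi]; push_cast; ring
  rw [e]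
  refine tsum_of_norm_bounded ((mm_sum w).hasSum.mul_left _) fun i => ?_
  have hP := w.P0 i
  have hk := kk_one (a := a) (v := v) (h := h) i
  rw [norm_mul, Complex.norm_real, Real.norm_eq_abs, abs_of_nonneg hP]
  unfold mm
  calc _ ≤ P i * ((δ * R * kk a v h i) ^ 3 * rexp (ε / 2 * kk a v h i)) := by
        gcongr
        refine (exp3_bd _).trans ?_
        gcongr
        · exact hZ i
        · exact (hZ i).trans (by gcongr)
    _ = _ := by ring

def Box : Set (ℝ × ℝ) := Set.Icc (-rpi) rpi ×ˢ Set.Icc (-rpi) rpi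

theorem Box_meas : MeasurableSet Box := measurableSet_Icc.prod measurableSet_Icc
theorem Box_mem {β : ℝ × ℝ} (hβ : β ∈ Box) : |β.1| ≤ rpi ∧ |β.2| ≤ rpi :=
  ⟨abs_le.2 (Set.mem_Icc.1 hβ.1), abs_le.2 (Set.mem_Icc.1 hβ.2)⟩
theorem Box_compact : IsCompact Box := isCompact_Icc.prod isCompact_Icc
theorem Box_vol : (volume Box).toReal = ⧉rpi ^ 2 := by
  rw [Box, Measure.volume_eq_prod, Measure.prod_prod, ENNReal.toReal_mul, Real.volume_Icc, ENNReal.toReal_ofReal (by linarith [Real.pi_pos])]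
  ring

theorem gauss2_int {b : ℝ} (hb : 0 < b) : Integrable (fun α : ℝ × ℝ => rexp (-b * (α.1 ^ 2 + α.2 ^ 2))) ∧
    ∫ α : ℝ × ℝ, rexp (-b * (α.1 ^ 2 + α.2 ^ 2)) = rpi / b := by
  have e : (fun α : ℝ × ℝ => rexp (-b * (α.1 ^ 2 + α.2 ^ 2))) = fun α => rexp (-b * α.1 ^ 2) * rexp (-b * α.2 ^ 2) := by
    funext α; rw [← Real.exp_add]; ring_nf
  rw [e]
  refine ⟨(integrable_exp_neg_mul_sq hb).mul_prod (integrable_exp_neg_mul_sq hb), ?_⟩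
  rw [Measure.volume_eq_prod, integral_prod_mul (fun x : ℝ => rexp (-b * x ^ 2)) (fun x : ℝ => rexp (-b * x ^ 2)), integral_gaussian, Real.mul_self_sqrt ◆]

set_option maxHeartbeats 1000000 in
theorem J_bound (w : Wk P a v h μ ε) {ω : ℝ} (hω : 0 < ω) (z : ℂ) : ∃ C δ : ℝ, 0 < C ∧ 0 < δ ∧ ∃ n0 : ℕ, ∀ n : ℕ, n0 ≤ n → ∀ (M : ℝ) (J : ℝ → ℂ), M = ω * n →
    (∀ t, 0 < t → ∀ s : ℝ, |s| + ‖z / (√n : ℝ)‖ ≤ ε / 2 → (2 * rpi : ℂ) ^ 2 * J t * rexp (s * M) =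
      ∫ β in Box, cexp (t * psi P a v h s β (z / (√n : ℝ)) - M * β.2 * I)) →
    (∫ β in Box, cexp (- M * β.2 * I) = 0) → ∀ t, 0 < t → ‖J t‖ / t ≤ C / (1 + t) ^ 2 * rexp (-δ * (t * μ - M) ^ 2 / (t + n) + C * t / n) := by
  obtain ⟨C, c, s0, hC, hc, hs0, hs0e, hre⟩ := psi_re w
  set Cm := ∑' i, mm P a v h ε i
  have hCm : 0 ≤ Cm := tsum_nonneg fun i => by
    have := w.P0 i; have := kk_one (a := a) (v := v) (h := h) i
    unfold mm; positivity
  have hμ := w.mu0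
  set δ := min (s0 / (μ + ω)) (1 / ⧉C)
  have hδ : 0 < δ := by positivity
  obtain ⟨n0, hn0⟩ := exists_nat_gt ((‖z‖ / s0) ^ 2)
  set C' := C * ‖z‖ ^ 2 + 4 * (2 * Cm * rexp ⧉Cm) * rexp (s0 * μ) + 4 / c
  have hp := Real.pi_pos
  have hC' : 0 < C' := by positivity
  refine ⟨C', δ / 2, hC', by positivity, n0 + 1, fun n hn M J hM hJ hJ0 t ht => ?_⟩
  have hn1 : ↟0 < n := by exact_mod_cast (by omega : 0 < n)
  have hθ : ‖z / (√n : ℝ)‖ ≤ s0 := by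
    rw [norm_div, Complex.norm_real, Real.norm_eq_abs, abs_of_nonneg (Real.sqrt_nonneg _), div_le_iff₀ (Real.sqrt_pos.2 hn1), mul_comm, ← div_le_iff₀ hs0]
    refine Real.le_sqrt_of_sq_le (hn0.le.trans ?_)
    exact_mod_cast (by omega : n0 ≤ n)
  have hθ2 : ‖z / (√n : ℝ)‖ ^ 2 = ‖z‖ ^ 2 / n := by
    rw [norm_div, Complex.norm_real, Real.norm_eq_abs, div_pow, sq_abs, Real.sq_sqrt hn1.le]
  set Δ := t * μ - M
  set s := -δ * Δ / (t + n)
  have htn : 0 < t + n := by linarith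
  have hs : |s| ≤ s0 := by
    have h1 : |Δ| ≤ (μ + ω) * (t + n) := by
      simp only [Δ, hM]
      rw [abs_le]; constructor <;> nlinarith
    simp only [s]
    rw [abs_div, abs_mul, abs_neg, abs_of_pos hδ, abs_of_pos htn, div_le_iff₀ htn]
    calc δ * |Δ| ≤ (s0 / (μ + ω)) * ((μ + ω) * (t + n)) := by gcongr; exact min_le_left _ _
      _ = s0 * (t + n) := by field_simp
  have hsum : |s| + ‖z / (√n : ℝ)‖ ≤ ε / 2 := by linarith
  have hj := hJ t ht s hsum
  -- exponent estimate
  have hex : s * Δ + C * t * s ^ 2 ≤ -(δ / 2) * Δ ^ 2 / (t + n) := by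
    have h1 : s * Δ = - δ * Δ ^ 2 / (t + n) := by simp only [s]; ring
    have h2 : C * t * s ^ 2 ≤ δ / 2 * Δ ^ 2 / (t + n) := by
      have h3 : C * δ ≤ 1 / 2 := by
        calc C * δ ≤ C * (1 / ⧉C) := by gcongr; exact min_le_right _ _
          _ = 1 / 2 := by field_simp
      have h4 : C * t * s ^ 2 = (C * δ) * (t / (t + n)) * (δ * Δ ^ 2 / (t + n)) := by ring
      have h5 : t / (t + n) ≤ 1 := by rw [div_le_one htn]; linarith
      rw [h4]
      calc _ ≤ 1 / 2 * 1 * (δ * Δ ^ 2 / (t + n)) := by gcongr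
        _ = _ := by ring
    grind
  have hJn : ‖J t‖ * rexp (s * M) = (⧉rpi ^ 2)⁻¹ * ‖∫ β in Box, cexp (t * psi P a v h s β (z / (√n : ℝ)) - M * β.2 * I)‖ := by
    rw [← hj, norm_mul, norm_mul, norm_pow, Complex.norm_real, Real.norm_eq_abs, Real.abs_exp, norm_mul, Complex.norm_real, Real.norm_eq_abs, abs_of_pos hp]
    simp only [Complex.norm_ofNat]
    field_simp
  set Ex := rexp (-(δ / 2) * Δ ^ 2 / (t + n) + C' * t / n)
  rcases le_or_gt t 1 with ht1 | ht1
  · have hb : ‖∫ β in Box, cexp (t * psi P a v h s β (z / (√n : ℝ)) - M * β.2 * I)‖ ≤ t * (2 * Cm * rexp ⧉Cm) * ⧉rpi ^ 2 := by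
      have hi : ∫ β in Box, cexp (t * psi P a v h s β (z / (√n : ℝ)) - M * β.2 * I) = ∫ β in Box, (cexp (t * psi P a v h s β (z / (√n : ℝ))) - 1) * cexp (- M * β.2 * I) := by
        have : ∀ β : ℝ × ℝ, (cexp (t * psi P a v h s β (z / (√n : ℝ))) - 1) * cexp (- M * β.2 * I) = cexp (t * psi P a v h s β (z / (√n : ℝ)) - M * β.2 * I) - cexp (- M * β.2 * I) := by
          intro β; rw [sub_mul, one_mul, ← Complex.exp_add]; ring_nf
        simp only [this]
        rw [integral_sub, hJ0, sub_zero]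
        · refine ContinuousOn.integrableOn_compact Box_compact (Continuous.continuousOn ?_)
          have := psi_cont w hsum
          fun_prop
        · exact ContinuousOn.integrableOn_compact Box_compact (Continuous.continuousOn ▼)
      rw [hi, ← Box_vol]
      refine norm_setIntegral_le_of_norm_le_const Box_compact.measure_lt_top fun β _ => ?_
      rw [norm_mul, Complex.norm_exp (- M * β.2 * I)]
      have h0 : (- ⇈M * β.2 * I).re = 0 := by simp
      rw [h0, Real.exp_zero, mul_one]
      refine (exp1_bd _).trans ?_
      have h1 := (psi_summable w hsum β).2
      rw [norm_mul, Complex.norm_real, Real.norm_eq_abs, abs_of_pos ht]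
      have h2 : t * ‖psi P a v h s β (z / (√n : ℝ))‖ ≤ 2 * Cm := by
        calc _ ≤ 1 * ‖psi P a v h s β (z / (√n : ℝ))‖ := by gcongr
          _ ≤ _ := by rw [one_mul]; exact h1
      rw [mul_assoc]
      gcongr
    have h1 : ‖J t‖ * rexp (s * M) ≤ t * (2 * Cm * rexp ⧉Cm) := by
      rw [hJn]
      calc _ ≤ (⧉rpi ^ 2)⁻¹ * (t * (2 * Cm * rexp ⧉Cm) * ⧉rpi ^ 2) := by gcongr
        _ = _ := by field_simp
    have h2 : rexp (-(s * M)) ≤ rexp (s0 * μ) * Ex := by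
      rw [← Real.exp_add]
      refine Real.exp_le_exp.2 ?_
      have h3 : -(s * M) = s * Δ - s * (t * μ) := by simp only [Δ]; ring
      have h4 : -(s * (t * μ)) ≤ s0 * μ := by
        have : |s * (t * μ)| ≤ s0 * (1 * μ) := by rw [abs_mul, abs_mul, abs_of_pos ht, abs_of_pos hμ]; gcongr
        linarith [neg_abs_le (s * (t * μ))]
      have h5 : 0 ≤ C' * t / n := by positivity
      have h6 : 0 ≤ C * t * s ^ 2 := by positivity
      linarith
    have h3 : ‖J t‖ ≤ t * (2 * Cm * rexp ⧉Cm) * (rexp (s0 * μ) * Ex) := by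
      calc ‖J t‖ = ‖J t‖ * rexp (s * M) * rexp (-(s * M)) := by rw [mul_assoc, ← Real.exp_add]; simp
        _ ≤ _ := by gcongr
    rw [div_le_iff₀ ht]
    have h4 : 1 / 4 ≤ 1 / (1 + t) ^ 2 := by
      gcongr
      nlinarith
    have h5 : 4 * (2 * Cm * rexp ⧉Cm) * rexp (s0 * μ) ≤ C' := by
      have : 0 ≤ C * ‖z‖ ^ 2 + 4 / c := by positivity
      linarith
    calc ‖J t‖ ≤ t * (2 * Cm * rexp ⧉Cm) * (rexp (s0 * μ) * Ex) := h3
      _ = (4 * (2 * Cm * rexp ⧉Cm) * rexp (s0 * μ)) * (1 / 4) * Ex * t := by ring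
      _ ≤ C' * (1 / (1 + t) ^ 2) * Ex * t := by gcongr
      _ = _ := by ring
  · have hb : ‖∫ β in Box, cexp (t * psi P a v h s β (z / (√n : ℝ)) - M * β.2 * I)‖ ≤ rexp (t * (s * μ + C * (s ^ 2 + ‖z‖ ^ 2 / n))) * (rpi / (c * t)) := by
      have hi := gauss2_int (b := c * t) ◆
      rw [← hi.2, ← integral_const_mul]
      refine (norm_integral_le_integral_norm _).trans ?_
      refine le_trans (setIntegral_mono_on (g := fun β : ℝ × ℝ => rexp (t * (s * μ + C * (s ^ 2 + ‖z‖ ^ 2 / n))) * rexp (-(c * t) * (β.1 ^ 2 + β.2 ^ 2))) ?_ ?_ Box_meas ?_) ?_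
      · refine ContinuousOn.integrableOn_compact Box_compact (Continuous.continuousOn ?_)
        have := psi_cont w hsum
        fun_prop
      · exact (hi.1.const_mul _).integrableOn
      · intro β hβ
        rw [Complex.norm_exp, ← Real.exp_add]
        refine Real.exp_le_exp.2 ?_
        have e1 : (⇈t * psi P a v h s β (z / (√n : ℝ)) - M * β.2 * I).re = t * (psi P a v h s β (z / (√n : ℝ))).re := by simp
        rw [e1]
        have := hre s _ β hs hθ (Box_mem hβ).1 (Box_mem hβ).2
        rw [hθ2] at this
        have := mul_le_mul_of_nonneg_left this ht.le
        linarith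
      · exact setIntegral_le_integral (hi.1.const_mul _) (Eventually.of_forall fun β => by positivity)
    have h1 : ‖J t‖ * rexp (s * M) ≤ rexp (t * (s * μ + C * (s ^ 2 + ‖z‖ ^ 2 / n))) * (1 / (c * t)) := by
      rw [hJn]
      calc _ ≤ (⧉rpi ^ 2)⁻¹ * (rexp (t * (s * μ + C * (s ^ 2 + ‖z‖ ^ 2 / n))) * (rpi / (c * t))) := by gcongr
        _ = rexp (t * (s * μ + C * (s ^ 2 + ‖z‖ ^ 2 / n))) * (1 / (c * t)) * (1 / (4 * rpi)) := by field_simp; norm_num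
        _ ≤ _ := by
          refine mul_le_of_le_one_right ◆ ?_
          rw [div_le_one ◆]; linarith [Real.pi_gt_three]
    have h2 : ‖J t‖ ≤ Ex * (1 / (c * t)) := by
      calc ‖J t‖ = ‖J t‖ * rexp (s * M) * rexp (-(s * M)) := by rw [mul_assoc, ← Real.exp_add]; simp
        _ ≤ rexp (t * (s * μ + C * (s ^ 2 + ‖z‖ ^ 2 / n))) * (1 / (c * t)) * rexp (-(s * M)) := by gcongr
        _ = rexp (t * (s * μ + C * (s ^ 2 + ‖z‖ ^ 2 / n)) + -(s * M)) * (1 / (c * t)) := by rw [Real.exp_add]; ring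
        _ ≤ _ := by
          gcongr
          simp only [Ex]
          refine Real.exp_le_exp.2 ?_
          have h3 : C * ‖z‖ ^ 2 * t / n ≤ C' * t / n := by
            have : 0 ≤ 4 * (2 * Cm * rexp ⧉Cm) * rexp (s0 * μ) + 4 / c := by positivity
            gcongr; linarith
          grind
    have h5 : 4 / c ≤ C' := by
      have : 0 ≤ C * ‖z‖ ^ 2 + 4 * (2 * Cm * rexp ⧉Cm) * rexp (s0 * μ) := by positivity
      linarith
    have h6 : 1 / t ^ 2 ≤ 4 / (1 + t) ^ 2 := by
      rw [div_le_div_iff₀ ◆ ◆]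
      have : (1 + t) ^ 2 ≤ ⧉t ^ 2 := pow_le_pow_left₀ ▲ ▲ 2
      linarith
    calc ‖J t‖ / t ≤ Ex * (1 / (c * t)) / t := by gcongr
      _ = 1 / c * (1 / t ^ 2) * Ex := by field_simp
      _ ≤ 1 / c * (4 / (1 + t) ^ 2) * Ex := by gcongr
      _ = 4 / c / (1 + t) ^ 2 * Ex := by ring
      _ ≤ C' / (1 + t) ^ 2 * Ex := by gcongr
end

section
open Complex (I)
open MeasureTheory Filter Topology
variable {ι : Type*} {P a v h : ι → ℝ} {μ ε : ℝ}

theorem posdef (w : Wk P a v h μ ε) : ∃ c : ℝ, 0 < c ∧ ∀ x y : ℝ,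
    c * (x ^ 2 + y ^ 2) ≤ x ^ 2 * Vh P a + 2 * x * y * (∑' i, P i * (a i * v i)) + y ^ 2 * Vh P v := by
  obtain ⟨F, c, c0, hF⟩ := w.lb
  refine ⟨2 * c, by positivity, fun x y => ?_⟩
  have hs : HasSum (fun i => P i * (lc a v (x, y) i) ^ 2) (x ^ 2 * Vh P a + 2 * x * y * (∑' i, P i * (a i * v i)) + y ^ 2 * Vh P v) := by
    rw [← Complex.hasSum_ofReal]
    have := (QQ_hasSum w (x, y) 0).neg
    convert this using 1
    · rfl
    · funext i; push_cast
      linear_combination (P i * (lc a v (x, y) i : ℂ) ^ 2) * Complex.I_sq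
    · simp [QQ]
  have hp := Real.pi_pos
  set r := rpi / (1 + |x| + |y|)
  have hr : 0 < r := by positivity
  have hrx : ∀ b : ℝ, |b| ≤ 1 + |x| + |y| → |r * b| ≤ rpi := by
    intro b hb
    rw [abs_mul, abs_of_pos hr]
    calc r * |b| ≤ r * (1 + |x| + |y|) := by gcongr
      _ = rpi := by grind
  have h1 := hF (r * x, r * y) (hrx x (by linarith [abs_nonneg y])) (hrx y (by linarith [abs_nonneg x]))
  have h2 : ∑ i ∈ F, P i * (1 - rcos (lc a v (r * x, r * y) i)) ≤ r ^ 2 / 2 * ∑ i ∈ F, P i * (lc a v (x, y) i) ^ 2 := by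
    rw [mul_sum]
    refine sum_le_sum fun i _ => ?_
    have e : lc a v (r * x, r * y) i = r * lc a v (x, y) i := by simp only [lc]; ring
    have h3 := Real.one_sub_sq_div_two_le_cos (x := lc a v (r * x, r * y) i)
    rw [e] at h3 ⊢
    calc P i * (1 - rcos (r * lc a v (x, y) i)) ≤ P i * ((r * lc a v (x, y) i) ^ 2 / 2) := by
          have := w.P0 i
          gcongr; linarith
      _ = _ := by ring
  have h3 := sum_le_hasSum F (fun i _ => by have := w.P0 i; positivity) hs
  have h4 : r ^ 2 / 2 * (2 * c * (x ^ 2 + y ^ 2)) ≤ r ^ 2 / 2 * (x ^ 2 * Vh P a + 2 * x * y * (∑' i, P i * (a i * v i)) + y ^ 2 * Vh P v) := by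
    nlinarith
  simp_all

def gi (P a v h : ι → ℝ) (μ τ : ℝ) (z : ℂ) (u : ℝ) (α : ℝ × ℝ) : ℂ := cexp (I * (μ * u * α.2) + τ / 2 * QQ P a v h α z)

theorem gauss_eval (w : Wk P a v h μ ε) {τ : ℝ} (hτ : 0 < τ) : ∃ C0 : ℂ, C0 ≠ 0 ∧ ∀ z : ℂ, (∀ u, Integrable (gi P a v h μ τ z u)) →
    ∫ u : ℝ, ∫ α, gi P a v h μ τ z u α = C0 * cexp (τ * Vh P h * z ^ 2 / 2) := by
  obtain ⟨c, c0, hc⟩ := posdef w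
  set q11 := Vh P a
  set q12 := ∑' i, P i * (a i * v i)
  set q22 := Vh P v
  set bh := ∑' i, P i * (h i * v i)
  have hμ := w.mu0
  have h11 : 0 < q11 := by have := hc 1 0; simp at this; linarith
  have h22 : 0 < q22 - q12 ^ 2 / q11 := by
    have := hc (-q12 / q11) 1
    have h1 : (-q12 / q11) ^ 2 * q11 + 2 * (-q12 / q11) * 1 * q12 + 1 ^ 2 * q22 = q22 - q12 ^ 2 / q11 := by field_simp; ring
    nlinarith
  set B := τ / 2 * (q22 - q12 ^ 2 / q11) with hB
  have hB0 : 0 < B := by positivity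
  have h11' : (q11 : ℂ) ≠ 0 := by exact_mod_cast h11.ne'
  have hB0' : (B : ℂ) ≠ 0 := by exact_mod_cast hB0.ne'
  have hμ' : (μ : ℂ) ≠ 0 := by exact_mod_cast hμ.ne'
  have hτ' : (τ : ℂ) ≠ 0 := by exact_mod_cast hτ.ne'
  have hp : (rpi : ℂ) ≠ 0 := by simp
  have b1 : (-(τ / 2 * q11 : ℝ) : ℂ).re < 0 := by simp_all
  have b2 : (-(B : ℝ) : ℂ).re < 0 := by rw [Complex.neg_re, Complex.ofReal_re]; linarith
  have b3 : (-(μ ^ 2 / (4 * B) : ℝ) : ℂ).re < 0 := by rw [Complex.neg_re, Complex.ofReal_re]; simp_all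
  set K1 : ℂ := (rpi / -(-(τ / 2 * q11 : ℝ) : ℂ)) ^ (1 / 2 : ℂ)
  set K2 : ℂ := (rpi / -(-(B : ℝ) : ℂ)) ^ (1 / 2 : ℂ)
  set K3 : ℂ := (rpi / -(-(μ ^ 2 / (4 * B) : ℝ) : ℂ)) ^ (1 / 2 : ℂ)
  have kne : ∀ x : ℝ, 0 < x → (rpi / -(-(x : ℝ) : ℂ)) ^ (1 / 2 : ℂ) ≠ 0 := by
    intro x hx
    have : (x : ℂ) ≠ 0 := by exact_mod_cast hx.ne'
    simp_all
  refine ⟨K1 * K2 * K3, mul_ne_zero (mul_ne_zero (kne _ ◆) (kne _ hB0)) (kne _ ◆), fun z hz => ?_⟩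
  have hBc : (B : ℂ) = τ / 2 * (q22 - q12 ^ 2 / q11) := by rw [hB]; push_cast; rfl
  have e1 : ∀ u : ℝ, ∫ α, gi P a v h μ τ z u α = K1 * K2 * cexp (τ / 2 * z ^ 2 * Vh P h - (μ * u + τ * z * bh) ^ 2 / (4 * B)) := by
    intro u
    rw [Measure.volume_eq_prod, integral_prod_symm _ ▼]
    have e2 : ∀ y : ℝ, ∫ x : ℝ, gi P a v h μ τ z u (x, y) = K1 * cexp (-(B : ℝ) * y ^ 2 + I * (μ * u + τ * z * bh) * y + τ / 2 * z ^ 2 * Vh P h) := by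
      intro y
      have := integral_cexp_quadratic b1 (-(τ * y * q12)) (I * (μ * u * y) + τ / 2 * z ^ 2 * Vh P h + τ * I * z * y * bh - τ / 2 * q22 * y ^ 2)
      rw [show (fun x : ℝ => gi P a v h μ τ z u (x, y)) = fun x : ℝ => cexp ((-(τ / 2 * q11 : ℝ) : ℂ) * x ^ 2 + -(τ * y * q12) * x + (I * (μ * u * y) + τ / 2 * z ^ 2 * Vh P h + τ * I * z * y * bh - τ / 2 * q22 * y ^ 2)) from ?_, this]
      · congr 2
        rw [hBc]; push_cast; field_simp; ring
      · funext x
        have hQ : QQ P a v h (x, y) z = z ^ 2 * Vh P h + 2 * I * z * y * bh - (x ^ 2 * q11 + 2 * x * y * q12 + y ^ 2 * q22 : ℝ) := rfl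
        simp only [gi, hQ]; congr 1; push_cast; ring
    simp only [e2]
    rw [integral_const_mul, integral_cexp_quadratic b2, mul_assoc K1 K2]
    congr 3
    field_simp
    simp
  simp only [e1]
  rw [integral_const_mul, mul_assoc (K1 * K2)]
  congr 1
  have := integral_cexp_quadratic b3 (-(2 * μ * τ * z * bh / (4 * B))) (τ / 2 * z ^ 2 * Vh P h - (τ * z * bh) ^ 2 / (4 * B))
  rw [show (fun u : ℝ => cexp (τ / 2 * z ^ 2 * Vh P h - (μ * u + τ * z * bh) ^ 2 / (4 * B))) = fun u : ℝ => cexp ((-(μ ^ 2 / (4 * B) : ℝ) : ℂ) * u ^ 2 + -(2 * μ * τ * z * bh / (4 * B)) * u + (τ / 2 * z ^ 2 * Vh P h - (τ * z * bh) ^ 2 / (4 * B))) from ?_, this]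
  · congr 2
    push_cast; field_simp; ring
  · funext u; congr 1; push_cast; ring

/-- hypotheses linking `J` to the walk -/
structure HJ (P a v h : ι → ℝ) (ε : ℝ) (z : ℂ) (M : ℝ) (n : ℕ) (J : ℝ → ℂ) : Prop where
  ct : Continuous J
  rep : ∀ t, 0 < t → ∀ s : ℝ, |s| + ‖z / (√n : ℝ)‖ ≤ ε / 2 → (2 * rpi : ℂ) ^ 2 * J t * rexp (s * M) =
      ∫ β in Box, cexp (t * psi P a v h s β (z / (√n : ℝ)) - M * β.2 * I)
  zero : ∫ β in Box, cexp (- M * β.2 * I) = 0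

theorem sqrt_tt {l : Filter ℕ} (hl : l ≤ atTop) : Tendsto (fun n : ℕ => √↟n) l atTop :=
  (Real.tendsto_sqrt_atTop.comp tendsto_natCast_atTop_atTop).mono_left hl

theorem isqrt_tt {l : Filter ℕ} (hl : l ≤ atTop) : Tendsto (fun n : ℕ => (√↟n)⁻¹) l (𝓝 0) :=
  tendsto_inv_atTop_zero.comp (sqrt_tt hl)

def tn (τ u : ℝ) (n : ℕ) : ℝ := √↟n * u + τ * n

theorem tn_eq (τ u : ℝ) {n : ℕ} (hn : 0 < n) : tn τ u n / n = u * (√↟n)⁻¹ + τ := by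
  have : ↟0 < n := by exact_mod_cast hn
  have h2 := Real.sqrt_pos.2 this
  unfold tn
  grind

theorem tn_tt {l : Filter ℕ} (hl : l ≤ atTop) (τ u : ℝ) : Tendsto (fun n : ℕ => tn τ u n / n) l (𝓝 τ) := by
  have h1 : Tendsto (fun n : ℕ => u * (√↟n)⁻¹ + τ) l (𝓝 (u * 0 + τ)) := ((isqrt_tt hl).const_mul u).add_const τ
  rw [mul_zero, zero_add] at h1
  refine h1.congr' ?_
  filter_upwards [hl (eventually_gt_atTop 0)] with n hn
  exact (tn_eq τ u hn).symm

theorem inner_lim (w : Wk P a v h μ ε) {τ : ℝ} (hτ : 0 < τ) (z : ℂ) (u : ℝ) {l : Filter ℕ} (hl : l ≤ atTop) [l.IsCountablyGenerated] [l.NeBot] :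
    Integrable (gi P a v h μ τ z u) ∧ Tendsto (fun n : ℕ => ⇈n * ∫ β in Box, cexp ((tn τ u n : ℝ) * psi P a v h 0 β (z / (√n : ℝ)) - (τ * μ * n : ℝ) * β.2 * I)) l
      (𝓝 (∫ α, gi P a v h μ τ z u α)) := by
  obtain ⟨C, c, s0, hC, hc, hs0, hs0e, hre⟩ := psi_re w
  have he := w.e0
  set F : ℕ → ℝ × ℝ → ℂ := fun n => Box.indicator fun β => cexp ((tn τ u n : ℝ) * psi P a v h 0 β (z / (√n : ℝ)) - (τ * μ * n : ℝ) * β.2 * I)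
  set bd : ℝ × ℝ → ℝ := fun α => rexp (2 * τ * (C * ‖z‖ ^ 2)) * rexp (-(τ / 2 * c) * (α.1 ^ 2 + α.2 ^ 2))
  have hbd : Integrable bd := (gauss2_int ◆).1.const_mul _
  have hsm := isqrt_tt hl
  have ev0 : ∀ᶠ n : ℕ in l, 0 < n := hl (eventually_gt_atTop 0)
  have evz : ∀ᶠ n : ℕ in l, ‖z / (√↟n : ℝ)‖ ≤ s0 := by
    have : Tendsto (fun n : ℕ => ‖z‖ * (√↟n)⁻¹) l (𝓝 (‖z‖ * 0)) := hsm.const_mul _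
    rw [mul_zero] at this
    filter_upwards [this.eventually (gt_mem_nhds hs0)] with n hn
    rw [norm_div, Complex.norm_real, Real.norm_eq_abs, abs_of_nonneg (Real.sqrt_nonneg _)]
    exact hn.le
  have ht := tn_tt hl τ u
  have evt : ∀ᶠ n : ℕ in l, τ / 2 < tn τ u n / n ∧ tn τ u n / n < 2 * τ :=
    (ht.eventually (lt_mem_nhds ▲)).and (ht.eventually (gt_mem_nhds ▲))
  have hdom : ∀ᶠ n : ℕ in l, ∀ α, ‖F n ((√↟n)⁻¹ • α)‖ ≤ bd α := by
    filter_upwards [ev0, evz, evt] with n hn hz' ht' α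
    have hn' : ↟0 < n := by exact_mod_cast hn
    simp only [F, bd]
    by_cases hα : (√↟n)⁻¹ • α ∈ Box
    · rw [Set.indicator_of_mem hα, Complex.norm_exp, ← Real.exp_add]
      refine Real.exp_le_exp.2 ?_
      have h1 := hre 0 _ _ (by simpa using hs0.le) hz' (Box_mem hα).1 (Box_mem hα).2
      have h2 : ‖z / (√↟n : ℝ)‖ ^ 2 = ‖z‖ ^ 2 / n := by
        rw [norm_div, Complex.norm_real, Real.norm_eq_abs, div_pow, sq_abs, Real.sq_sqrt hn'.le]
      have h3 : ∀ x : ℝ, ((√↟n)⁻¹ * x) ^ 2 = x ^ 2 / n := by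
        intro x; rw [mul_pow, inv_pow, Real.sq_sqrt hn'.le]; ring
      simp only [Prod.smul_fst, Prod.smul_snd, smul_eq_mul, h2, h3] at h1
      have h4 : 0 < tn τ u n := by
        have := mul_pos (lt_trans ◆ ht'.1) hn'
        simp_all
      have h5 := mul_le_mul_of_nonneg_left h1 h4.le
      have h6 : tn τ u n * (0 * μ + C * (0 ^ 2 + ‖z‖ ^ 2 / n) - c * (α.1 ^ 2 / n + α.2 ^ 2 / n)) = tn τ u n / n * (C * ‖z‖ ^ 2) - tn τ u n / n * (c * (α.1 ^ 2 + α.2 ^ 2)) := by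
        field_simp; ring
      rw [h6] at h5
      have h7 : tn τ u n / n * (C * ‖z‖ ^ 2) ≤ 2 * τ * (C * ‖z‖ ^ 2) := by gcongr; exact ht'.2.le
      have h8 : τ / 2 * (c * (α.1 ^ 2 + α.2 ^ 2)) ≤ tn τ u n / n * (c * (α.1 ^ 2 + α.2 ^ 2)) := mul_le_mul_of_nonneg_right ht'.1.le ◆
      have e1 : ((tn τ u n : ℝ) * psi P a v h 0 ((√↟n)⁻¹ • α) (z / (√n : ℝ)) - (τ * μ * n : ℝ) * ((√↟n)⁻¹ • α).2 * I).re = tn τ u n * (psi P a v h 0 ((√↟n)⁻¹ • α) (z / (√n : ℝ))).re := by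
        simp
      rw [e1]
      linarith
    · rw [Set.indicator_of_notMem hα, norm_zero]; positivity
  have hpt : ∀ α, Tendsto (fun n : ℕ => F n ((√↟n)⁻¹ • α)) l (𝓝 (gi P a v h μ τ z u α)) := by
    intro α
    set Cm := ∑' i, mm P a v h ε i
    set R := ‖z‖ + |α.1| + |α.2|
    have evR : ∀ᶠ n : ℕ in l, (√↟n)⁻¹ * R ≤ min (ε / 2) rpi := by
      have : Tendsto (fun n : ℕ => (√↟n)⁻¹ * R) l (𝓝 (0 * R)) := hsm.mul_const _
      rw [zero_mul] at this
      filter_upwards [this.eventually (gt_mem_nhds (show 0 < min (ε / 2) rpi from lt_min ◆ Real.pi_pos))] with n hn using hn.le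
    have key : Tendsto (fun n : ℕ => (tn τ u n : ℝ) * psi P a v h 0 ((√↟n)⁻¹ • α) (z / (√n : ℝ)) - (τ * μ * n : ℝ) * ((√↟n)⁻¹ • α).2 * I) l (𝓝 (I * (μ * u * α.2) + τ / 2 * QQ P a v h α z)) := by
      have h1 : Tendsto (fun n : ℕ => I * (μ * u * α.2) + ((tn τ u n / n : ℝ) : ℂ) / 2 * QQ P a v h α z) l (𝓝 (I * (μ * u * α.2) + τ / 2 * QQ P a v h α z)) :=
        Tendsto.const_add _ (Tendsto.mul_const _ (Tendsto.div_const ((Complex.continuous_ofReal.tendsto _).comp ht) _))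
      have h2 : Tendsto (fun n : ℕ => (tn τ u n / n) * (R ^ 3 * Cm) * (√↟n)⁻¹) l (𝓝 (τ * (R ^ 3 * Cm) * 0)) := (ht.mul_const _).mul hsm
      rw [mul_zero] at h2
      refine tendsto_of_tendsto_of_dist h1 ?_
      refine squeeze_zero' (Eventually.of_forall fun _ => dist_nonneg) ?_ h2
      filter_upwards [ev0, evR, evt] with n hn hR ht'
      have hn' : ↟0 < n := by exact_mod_cast hn
      have hq := Real.sqrt_pos.2 hn'
      have h4 : 0 < tn τ u n := by
        have := mul_pos (lt_trans ◆ ht'.1) hn'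
        simp_all
      have hT := taylor w α z (δ := (√↟n)⁻¹) ◆ (hR.trans (min_le_left _ _))
      have e0 : (((√↟n)⁻¹ : ℝ) : ℂ) * z = z / (√n : ℝ) := by push_cast; ring
      rw [e0] at hT
      rw [dist_comm, dist_eq_norm]
      have hnq : (n : ℂ) = (√↟n : ℂ) * (√↟n : ℂ) := by
        rw [← Complex.ofReal_mul, Real.mul_self_sqrt hn'.le]; simp
      have hqc : ((√↟n : ℝ) : ℂ) ≠ 0 := by exact_mod_cast hq.ne'
      have e1 : (tn τ u n : ℝ) * psi P a v h 0 ((√↟n)⁻¹ • α) (z / (√n : ℝ)) - (τ * μ * n : ℝ) * ((√↟n)⁻¹ • α).2 * I - (I * (μ * u * α.2) + ((tn τ u n / n : ℝ) : ℂ) / 2 * QQ P a v h α z) =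
        (tn τ u n : ℝ) * (psi P a v h 0 ((√↟n)⁻¹ • α) (z / (√n : ℝ)) - ((√↟n)⁻¹ : ℝ) * α.2 * μ * I - ((√↟n)⁻¹ : ℝ) ^ 2 / 2 * QQ P a v h α z) := by
        simp only [Prod.smul_snd, smul_eq_mul, tn]
        push_cast
        rw [hnq]
        field_simp
        ring
      rw [e1, norm_mul, Complex.norm_real, Real.norm_eq_abs, abs_of_pos h4]
      refine (mul_le_mul_of_nonneg_left hT h4.le).trans (le_of_eq ?_)
      have hnq' : (n : ℝ) = √↟n * √↟n := (Real.mul_self_sqrt hn'.le).symm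
      rw [show tn τ u n / n = tn τ u n / (√↟n * √↟n) by rw [← hnq']]
      field_simp
      rfl
    refine (((Complex.continuous_exp.tendsto _).comp key).congr' ?_)
    filter_upwards [evR] with n hR
    have hm : (√↟n)⁻¹ • α ∈ Box := by
      have : ∀ x : ℝ, |x| ≤ R → |(√↟n)⁻¹ * x| ≤ rpi := by
        intro x hx
        rw [abs_mul, abs_of_nonneg ◆]
        exact (mul_le_mul_of_nonneg_left hx ◆).trans (hR.trans (min_le_right _ _))
      refine ⟨Set.mem_Icc.2 (abs_le.1 (this _ ?_)), Set.mem_Icc.2 (abs_le.1 (this _ ?_))⟩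
      · simp only [R]; linarith [norm_nonneg z, abs_nonneg α.2]
      · simp only [R]; linarith [norm_nonneg z, abs_nonneg α.1]
    simp only [F, Set.indicator_of_mem hm, Function.comp]
  have hcont : Continuous (gi P a v h μ τ z u) := by unfold gi QQ; fun_prop
  constructor
  · refine Integrable.mono' hbd hcont.aestronglyMeasurable (Eventually.of_forall fun α => ?_)
    exact le_of_tendsto (hpt α).norm (hdom.mono fun n hn => hn α)
  · have := tendsto_integral_filter_of_dominated_convergence (μ := volume) bd ?_ (hdom.mono fun n hn => Eventually.of_forall hn) hbd (Eventually.of_forall hpt)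
    · refine this.congr' ?_
      filter_upwards [ev0] with n hn
      have hn' : ↟0 < n := by exact_mod_cast hn
      rw [Measure.integral_comp_smul, integral_indicator Box_meas]
      simp
    · filter_upwards [evz] with n hz'
      have hm : Measurable (F n) := by
        refine Measurable.indicator (Continuous.measurable ?_) Box_meas
        have := psi_cont w (s := 0) (θ := z / (√↟n : ℝ)) ▲
        fun_prop
      exact (hm.comp (measurable_const_smul _)).aestronglyMeasurable
end

section
open Complex (I)
open MeasureTheory Filter Topology
variable {ι : Type*} {P a v h : ι → ℝ} {μ ε : ℝ}

theorem outer_aux {τ κ A : ℝ} (hτ : 0 < τ) (hκ : 0 < κ) {C n u E : ℝ} (hC : 0 < C) (hn : 1 ≤ n) (ht : 0 < √n * u + τ * n)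
    (hE : E ≤ A - κ * |u|) :
    n ^ 2 * (C / (1 + (√n * u + τ * n)) ^ 2 * rexp E) ≤ C * (2 / τ + 4 / τ ^ 2) ^ 2 * rexp A * (720 / κ ^ 6 * rexp κ) * (1 + u ^ 2)⁻¹ := by
  have hq : 0 < √n := Real.sqrt_pos.2 ▲
  have hqq : √n * √n = n := Real.mul_self_sqrt ▲
  set t := √n * u + τ * n
  have h1 : n / (1 + t) ≤ (2 / τ + 4 / τ ^ 2) * (1 + |u|) ^ 2 := by
    have h0 : 1 ≤ (1 + |u|) ^ 2 := by nlinarith [abs_nonneg u]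
    rcases le_or_gt (τ * n / 2) t with h | h
    · calc n / (1 + t) ≤ n / (τ * n / 2) := by gcongr; linarith
        _ = 2 / τ * 1 := by field_simp
        _ ≤ _ := by gcongr; have : 0 < 4 / τ ^ 2 := by positivity
                    linarith
    · have h2 : √n * (τ / 2 * √n) < √n * |u| := by
        have : τ * n / 2 < - (√n * u) := by linarith
        calc √n * (τ / 2 * √n) = τ / 2 * (√n * √n) := by ring
          _ = τ * n / 2 := by rw [hqq]; ring
          _ < - (√n * u) := this
          _ = √n * (-u) := by ring
          _ ≤ _ := by gcongr; exact neg_le_abs u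
      have h3 : √n ≤ 2 / τ * |u| := by
        have := (lt_of_mul_lt_mul_left h2 hq.le).le
        calc √n = 2 / τ * (τ / 2 * √n) := by field_simp
          _ ≤ _ := by gcongr
      calc n / (1 + t) ≤ n := div_le_self ▲ ▲
        _ = √n * √n := hqq.symm
        _ ≤ (2 / τ * |u|) * (2 / τ * |u|) := by gcongr
        _ = 4 / τ ^ 2 * |u| ^ 2 := by ring
        _ ≤ _ := by gcongr <;> [(have : 0 < 2 / τ := by positivity); skip] <;> linarith
  have h2 : rexp E ≤ rexp A * rexp (-(κ * |u|)) := by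
    rw [← Real.exp_add]; exact Real.exp_le_exp.2 ▲
  have h3 : (1 + |u|) ^ 6 * rexp (-(κ * |u|)) ≤ 720 / κ ^ 6 * rexp κ := by
    have := Real.pow_div_factorial_le_exp (κ * (1 + |u|)) ◆ 6
    have e : rexp (κ * (1 + |u|)) = rexp κ * rexp (κ * |u|) := by rw [← Real.exp_add]; ring_nf
    rw [e] at this
    simp only [Nat.factorial] at this
    rw [Real.exp_neg, ← div_eq_mul_inv, div_le_iff₀ (Real.exp_pos _)]
    calc (1 + |u|) ^ 6 = 720 / κ ^ 6 * ((κ * (1 + |u|)) ^ 6 / ((5 + 1) * ((4 + 1) * ((3 + 1) * ((2 + 1) * ((1 + 1) * ((0 + 1) * 1))))) : ℕ)) := by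
          push_cast; field_simp
      _ ≤ 720 / κ ^ 6 * (rexp κ * rexp (κ * |u|)) := by gcongr
      _ = _ := by ring
  have h4 : 1 ≤ (1 + |u|) ^ 2 * (1 + u ^ 2)⁻¹ := by
    rw [← div_eq_mul_inv, one_le_div ◆]
    nlinarith [abs_nonneg u, sq_abs u]
  calc n ^ 2 * (C / (1 + t) ^ 2 * rexp E) = C * (n / (1 + t)) ^ 2 * rexp E * 1 := by rw [div_pow]; ring
    _ ≤ C * ((2 / τ + 4 / τ ^ 2) * (1 + |u|) ^ 2) ^ 2 * (rexp A * rexp (-(κ * |u|))) * ((1 + |u|) ^ 2 * (1 + u ^ 2)⁻¹) := by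
        gcongr
    _ = C * (2 / τ + 4 / τ ^ 2) ^ 2 * rexp A * ((1 + |u|) ^ 6 * rexp (-(κ * |u|))) * (1 + u ^ 2)⁻¹ := by ring
    _ ≤ _ := by gcongr

theorem outer_exp {δ μ C τ : ℝ} (hδ : 0 < δ) (hC : 0 < C) (hτ : 0 < τ) {n u : ℝ} (hn : 1 ≤ n) (hn2 : 2 * C / (δ * μ ^ 2) ≤ √n)
    (hμ : 0 < μ) (ht : 0 < √n * u + τ * n) :
    -δ * ((√n * u + τ * n) * μ - τ * μ * n) ^ 2 / ((√n * u + τ * n) + n) + C * (√n * u + τ * n) / n ≤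
      (δ * μ ^ 2 * (1 + τ) + C * τ) - δ * μ ^ 2 / 2 * |u| := by
  have hq : 0 < √n := Real.sqrt_pos.2 ▲
  have hq1 : 1 ≤ √n := Real.one_le_sqrt.2 hn
  have hqq : √n ^ 2 = n := Real.sq_sqrt ▲
  set t := √n * u + τ * n
  have h1 : |u| - (1 + τ) ≤ n * u ^ 2 / (t + n) := by
    rw [le_div_iff₀ ▲]
    rcases le_or_gt |u| (1 + τ) with h | h
    · nlinarith
    · have h2 : t + n ≤ n * (|u| + (1 + τ)) := by
        have : √n * u ≤ n * |u| := by
          calc √n * u ≤ √n * |u| := by gcongr; exact le_abs_self u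
            _ ≤ n * |u| := by gcongr; nlinarith
        simp only [t]; linarith
      calc (|u| - (1 + τ)) * (t + n) ≤ (|u| - (1 + τ)) * (n * (|u| + (1 + τ))) := by
            gcongr
        _ = n * (|u| ^ 2 - (1 + τ) ^ 2) := by ring
        _ ≤ n * u ^ 2 := by rw [sq_abs]; gcongr; nlinarith
  have h2 : C * t / n ≤ C * τ + δ * μ ^ 2 / 2 * |u| := by
    have h3 : C ≤ δ * μ ^ 2 / 2 * √n := by
      rw [div_le_iff₀ ◆] at hn2; linarith
    rw [div_le_iff₀ ▲]
    calc C * t = C * τ * n + C * √n * u := by simp only [t]; ring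
      _ ≤ C * τ * n + C * √n * |u| := by gcongr; exact le_abs_self u
      _ ≤ C * τ * n + (δ * μ ^ 2 / 2 * √n) * √n * |u| := by gcongr
      _ = C * τ * n + δ * μ ^ 2 / 2 * √n ^ 2 * |u| := by ring
      _ = _ := by rw [hqq]; ring
  have h3 : -δ * (t * μ - τ * μ * n) ^ 2 / (t + n) = - (δ * μ ^ 2 * (n * u ^ 2 / (t + n))) := by
    grind
  rw [h3]
  have := mul_le_mul_of_nonneg_left h1 (show 0 ≤ δ * μ ^ 2 by positivity)
  linarith

theorem walk_lim (w : Wk P a v h μ ε) {τ : ℝ} (hτ : 0 < τ) : ∃ C0 : ℂ, C0 ≠ 0 ∧ ∀ (z : ℂ) (l : Filter ℕ) (_ : l ≤ atTop) (_ : l.IsCountablyGenerated) (_ : l.NeBot)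
    (J : ℕ → ℝ → ℂ), (∀ᶠ n : ℕ in l, HJ P a v h ε z (τ * μ * n) n (J n)) →
    Tendsto (fun n : ℕ => ⇈n * (√↟n : ℝ) * ∫ t in Set.Ioi ↟0, J n t / t) l (𝓝 (C0 * cexp (τ * Vh P h * z ^ 2 / 2))) := by
  obtain ⟨C1, hC1, hev⟩ := gauss_eval w hτ
  have hμ := w.mu0
  have hp := Real.pi_pos
  have hpc : (rpi : ℂ) ≠ 0 := by exact_mod_cast hp.ne'
  have hτc : (τ : ℂ) ≠ 0 := by exact_mod_cast hτ.ne'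
  refine ⟨(⧉rpi ^ 2 * τ : ℂ)⁻¹ * C1, mul_ne_zero (by simp [hpc, hτc]) hC1, fun z l hl _ _ J hJ => ?_⟩
  obtain ⟨C, δ, hC, hδ, n0, hbd⟩ := J_bound w (mul_pos hτ hμ) z
  set G : ℕ → ℝ → ℂ := fun n => (Set.Ioi ↟0).indicator fun t => J n t / t
  set K := C * (2 / τ + 4 / τ ^ 2) ^ 2 * rexp (δ * μ ^ 2 * (1 + τ) + C * τ) * (720 / (δ * μ ^ 2 / 2) ^ 6 * rexp (δ * μ ^ 2 / 2))
  have ev0 : ∀ᶠ n : ℕ in l, 1 ≤ n := hl (eventually_ge_atTop 1)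
  have ht : ∀ u, Tendsto (fun n : ℕ => tn τ u n / n) l (𝓝 τ) := tn_tt hl τ
  have main : Tendsto (fun n : ℕ => ∫ u, ⇈n ^ 2 * G n (tn τ u n)) l (𝓝 (∫ u, (⧉rpi ^ 2 * τ : ℂ)⁻¹ * ∫ α, gi P a v h μ τ z u α)) := by
    refine tendsto_integral_filter_of_dominated_convergence (fun u => K * (1 + u ^ 2)⁻¹) ?_ ?_ (integrable_inv_one_add_sq.const_mul _) (Eventually.of_forall fun u => ?_)
    · filter_upwards [hJ] with n hn
      have h1 : Measurable (G n) := by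
        refine Measurable.indicator ?_ measurableSet_Ioi
        exact hn.ct.measurable.div ▼
      have h2 : Measurable fun u => tn τ u n := by unfold tn; fun_prop
      exact ((h1.comp h2).const_mul _).aestronglyMeasurable
    · filter_upwards [hJ, ev0, hl (eventually_ge_atTop n0), (sqrt_tt hl).eventually_ge_atTop (2 * C / (δ * μ ^ 2))] with n hn hn1 hn0 hnq
      refine Eventually.of_forall fun u => ?_
      have hn1' : ↟1 ≤ n := by exact_mod_cast hn1
      by_cases hu : 0 < tn τ u n
      · simp only [G, Set.indicator_of_mem (Set.mem_Ioi.2 hu)]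
        rw [norm_mul, norm_div, norm_pow, Complex.norm_real, Complex.norm_natCast, Real.norm_eq_abs, abs_of_pos hu]
        have h1 := hbd n hn0 _ (J n) rfl hn.rep hn.zero _ hu
        refine (mul_le_mul_of_nonneg_left h1 ◆).trans ?_
        exact outer_aux hτ ◆ hC hn1' hu (outer_exp hδ hC hτ hn1' hnq hμ hu)
      · simp only [G]
        rw [Set.indicator_of_notMem (by simpa using hu), mul_zero, norm_zero]
        positivity
    · have h1 := (inner_lim w hτ z u hl).2
      have h2 : Tendsto (fun n : ℕ => (((tn τ u n / n : ℝ) : ℂ))⁻¹) l (𝓝 ((τ:ℂ)⁻¹)) :=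
        ((Complex.continuous_ofReal.tendsto _).comp (ht u)).inv₀ hτc
      have h3 := (h2.mul h1).const_mul (((2 * rpi : ℂ) ^ 2)⁻¹)
      rw [mul_inv, mul_assoc]
      refine h3.congr' ?_
      filter_upwards [hJ, ev0, (ht u).eventually (lt_mem_nhds hτ), (isqrt_tt hl).eventually (gt_mem_nhds (show 0 < (ε / 2) / (‖z‖ + 1) by have := w.e0; positivity))] with n hn hn1 htn hz
      have hn' : ↟0 < n := by exact_mod_cast hn1
      have hpos : 0 < tn τ u n := by
        have := mul_pos htn hn'
        rwa [div_mul_cancel₀ _ hn'.ne'] at this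
      have hz' : |↟0| + ‖z / (√↟n : ℝ)‖ ≤ ε / 2 := by
        rw [abs_zero, zero_add, norm_div, Complex.norm_real, Real.norm_eq_abs, abs_of_nonneg (Real.sqrt_nonneg _), div_eq_mul_inv]
        rw [lt_div_iff₀ ◆] at hz
        have : 0 ≤ (√↟n)⁻¹ := by positivity
        linarith
      have h4 := hn.rep _ hpos 0 hz'
      rw [zero_mul, Real.exp_zero, Complex.ofReal_one, mul_one] at h4
      rw [← h4]
      simp only [G, Set.indicator_of_mem (Set.mem_Ioi.2 hpos)]
      have hnc : ⇈n ≠ 0 := by exact_mod_cast hn'.ne'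
      have htc : ((tn τ u n : ℝ):ℂ) ≠ 0 := by exact_mod_cast hpos.ne'
      push_cast
      field_simp
  rw [integral_const_mul, hev z (fun u => (inner_lim w hτ z u hl).1), ← mul_assoc] at main
  refine main.congr' ?_
  filter_upwards [ev0] with n hn1
  have hn' : ↟0 < n := by exact_mod_cast hn1
  have hq := Real.sqrt_pos.2 hn'
  have e1 : ∫ u, G n (tn τ u n) = ((√↟n)⁻¹ : ℝ) * ∫ t in Set.Ioi ↟0, J n t / t := by
    have e2 : ∀ u, tn τ u n = √↟n * (u + τ * √↟n) := by
      intro u; unfold tn; grind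
    simp only [e2]
    rw [integral_add_right_eq_self (fun u => G n (√↟n * u)), Measure.integral_comp_mul_left, integral_indicator measurableSet_Ioi, abs_of_pos ◆, Complex.real_smul]
  rw [integral_const_mul, e1]
  have hqc : ((√↟n : ℝ) : ℂ) ≠ 0 := by exact_mod_cast hq.ne'
  have hnq : (n : ℂ) = (√↟n : ℂ) * (√↟n : ℂ) := by
    rw [← Complex.ofReal_mul, Real.mul_self_sqrt hn'.le]; simp
  have : ⇈n ^ 2 * ((√↟n)⁻¹ : ℝ) = n * (√↟n : ℝ) := by
    rw [hnq]; push_cast; field_simp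
  grind
end

section
open Complex (I)
open MeasureTheory Filter Topology
variable {ι : Type*}

/-- lattice characters -/
def chi (y : ℤ × ℤ) (β : ℝ × ℝ) : ℂ := cexp ((β.1 * y.1 + β.2 * y.2 : ℝ) * I)

theorem chi_norm (y : ℤ × ℤ) (β : ℝ × ℝ) : ‖chi y β‖ = 1 := Complex.norm_exp_ofReal_mul_I _
theorem chi_add (x y : ℤ × ℤ) (β : ℝ × ℝ) : chi (x + y) β = chi x β * chi y β := by
  simp only [chi, ← Complex.exp_add]; congr 1; simp; ring
theorem chi_cont (y : ℤ × ℤ) : Continuous (chi y) := by unfold chi; fun_prop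

theorem chi_1d (n : ℤ) : ∫ x in Set.Icc (-rpi) rpi, cexp ((x * n : ℝ) * I) = if n = 0 then (2 * rpi : ℂ) else 0 := by
  have hp := Real.pi_pos
  rw [integral_Icc_eq_integral_Ioc, ← intervalIntegral.integral_of_le ▲]
  split_ifs with hn
  · subst hn; simp; ring
  · have hc : (n * I : ℂ) ≠ 0 := mul_ne_zero (by exact_mod_cast hn) Complex.I_ne_zero
    have e : ∀ x : ℝ, ((x * n : ℝ) * I : ℂ) = n * I * x := by intro x; push_cast; ring
    simp only [e]
    rw [integral_exp_mul_complex hc]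
    have : cexp (n * I * rpi) = cexp (n * I * (-rpi : ℝ)) := by
      rw [Complex.exp_eq_exp_iff_exists_int]
      exact ⟨n, by push_cast; ring⟩
    simp_all

theorem chi_int (y : ℤ × ℤ) : ∫ β in Box, chi y β = if y = 0 then (2 * rpi : ℂ) ^ 2 else 0 := by
  have e : ∀ β : ℝ × ℝ, chi y β = cexp ((β.1 * y.1 : ℝ) * I) * cexp ((β.2 * y.2 : ℝ) * I) := by
    intro β; rw [← Complex.exp_add, chi]; congr 1; push_cast; ring
  simp only [e]
  rw [Box, Measure.volume_eq_prod, setIntegral_prod_mul (fun x : ℝ => cexp ((x * y.1 : ℝ) * I)) (fun x : ℝ => cexp ((x * y.2 : ℝ) * I)), chi_1d, chi_1d]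
  by_cases h1 : y.1 = 0 <;> by_cases h2 : y.2 = 0 <;> simp [h1, h2, Prod.ext_iff, sq]

def Phi (A : ι → ℂ) (c : ι → ℤ × ℤ) (β : ℝ × ℝ) : ℂ := ∑' i, A i * chi (c i) β

def wF (A : ι → ℂ) (c : ι → ℤ × ℤ) (m : ℕ) (y : ℤ × ℤ) : ℂ := ∫ β in Box, Phi A c β ^ m * chi (-y) β

variable {A : ι → ℂ} {c : ι → ℤ × ℤ}

theorem Phi_sum (hA : Summable A) (β : ℝ × ℝ) : Summable fun i => A i * chi (c i) β :=
  Summable.of_norm_bounded hA.norm fun i => by rw [norm_mul, chi_norm, mul_one]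

theorem Phi_cont (hA : Summable A) : Continuous (Phi A c) := by
  unfold Phi
  exact continuous_tsum (fun i => (chi_cont (c i)).const_mul _) hA.norm fun i β => by rw [norm_mul, chi_norm, mul_one]

theorem Phi_norm (hA : Summable A) (β : ℝ × ℝ) : ‖Phi A c β‖ ≤ ∑' i, ‖A i‖ :=
  tsum_of_norm_bounded hA.norm.hasSum fun i => by rw [norm_mul, chi_norm, mul_one]

theorem wF_zero (y : ℤ × ℤ) : wF A c 0 y = if y = 0 then (2 * rpi : ℂ) ^ 2 else 0 := by
  simp only [wF, pow_zero, one_mul, chi_int, neg_eq_zero]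

theorem Box_intble {f : ℝ × ℝ → ℂ} (hf : Continuous f) : IntegrableOn f Box :=
  ContinuousOn.integrableOn_compact Box_compact hf.continuousOn

theorem wF_succ [Countable ι] (hA : Summable A) (m : ℕ) (y : ℤ × ℤ) : wF A c ⤒m y = ∑' i, A i * wF A c m (y - c i) := by
  have hc := Phi_cont (c := c) hA
  have h0 : ∀ i β, A i * chi (c i) β * (Phi A c β ^ m * chi (-y) β) = A i * (Phi A c β ^ m * chi (-(y - c i)) β) := by
    intro i β
    rw [show -(y - c i) = c i + -y by abel, chi_add]; ring
  have h1 : HasSum (fun i => ∫ β in Box, A i * (Phi A c β ^ m * chi (-(y - c i)) β)) (∫ β in Box, ∑' i, A i * (Phi A c β ^ m * chi (-(y - c i)) β)) := by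
    refine hasSum_integral_of_summable_integral_norm (fun i => Box_intble ((by have := chi_cont (-(y - c i)); fun_prop))) ?_
    simp only [norm_mul, chi_norm, mul_one, integral_const_mul]
    exact hA.norm.mul_right _
  simp only [integral_const_mul] at h1
  simp only [wF]
  rw [h1.tsum_eq]
  congr 1; funext β
  rw [pow_succ', mul_assoc]
  nth_rw 1 [Phi]
  rw [← tsum_mul_right]
  simp_all

theorem wF_exp [Countable ι] (hA : Summable A) (t : ℂ) (y : ℤ × ℤ) :
    HasSum (fun m : ℕ => t ^ m / (m.factorial : ℂ) * wF A c m y) (∫ β in Box, cexp (t * Phi A c β) * chi (-y) β) := by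
  have hc := Phi_cont (c := c) hA
  set S := ∑' i, ‖A i‖
  have h1 : HasSum (fun m : ℕ => ∫ β in Box, t ^ m / (m.factorial : ℂ) * (Phi A c β ^ m * chi (-y) β)) (∫ β in Box, ∑' m : ℕ, t ^ m / (m.factorial : ℂ) * (Phi A c β ^ m * chi (-y) β)) := by
    refine hasSum_integral_of_summable_integral_norm (fun i => Box_intble ((by have := chi_cont (-y); fun_prop))) ?_
    refine Summable.of_nonneg_of_le (fun m => integral_nonneg fun β => norm_nonneg _) (fun m => ?_) ((Real.summable_pow_div_factorial (‖t‖ * S)).mul_right (⧉rpi ^ 2))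
    have : ∫ β in Box, ‖t ^ m / (m.factorial : ℂ) * (Phi A c β ^ m * chi (-y) β)‖ ≤ ∫ β in Box, (‖t‖ * S) ^ m / (m.factorial : ℝ) := by
      refine setIntegral_mono_on (Box_intble ((by have := chi_cont (-y); fun_prop))).norm (integrableOn_const Box_compact.measure_lt_top.ne) Box_meas fun β _ => ?_
      rw [norm_mul, norm_mul, chi_norm, mul_one, norm_div, norm_pow, norm_pow, Complex.norm_natCast, mul_pow, mul_div_right_comm]
      gcongr
      exact Phi_norm hA β
    refine this.trans (le_of_eq ?_)
    rw [setIntegral_const, smul_eq_mul, mul_comm]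
    congr 1
    exact Box_vol
  simp only [integral_const_mul] at h1
  convert h1 using 1
  · rfl
  refine setIntegral_congr_fun Box_meas fun β _ => ?_
  rw [Complex.exp_eq_exp_ℂ, NormedSpace.exp_eq_tsum_div, ← tsum_mul_right]
  refine tsum_congr fun m => ?_
  rw [mul_pow]; ring
end

section
open Complex (I)
open MeasureTheory Filter Topology

abbrev St := Option (ℕ × ℕ × ℕ)

def cst : St → ℤ × ℤ
  | none => (-1, 0)
  | some b => (b.1, b.2.1)

def Aw (p : ℕ → ℕ → ℕ → ℕ) (x T R G : ℂ) : St → ℂ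
  | none => T * R⁻¹
  | some b => p b.1 b.2.1 b.2.2 * x ^ b.2.2 * R ^ b.1 * G ^ b.2.1

variable {p : ℕ → ℕ → ℕ → ℕ} {x T R G : ℂ}

theorem wF_van (hA : Summable (Aw p x T R G)) (m : ℕ) : ∀ y : ℤ × ℤ, (y.2 < 0 ∨ y.1 + m < 0) → wF (Aw p x T R G) cst m y = 0 := by
  induction m with
  | zero =>
    intro y hy
    rw [wF_zero, if_neg]
    rintro rfl
    simp at hy
  | succ m ih =>
    intro y hy
    rw [wF_succ hA]
    refine (tsum_congr fun i => ?_).trans tsum_zero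
    rw [ih, mul_zero]
    push_cast at hy
    rcases i with _ | ⟨a, v, κ⟩ <;> simp only [cst, Prod.fst_sub, Prod.snd_sub] <;> omega

theorem coeff2 (f g : Polynomial (Polynomial ℂ)) (V A : ℕ) : ((f * g).coeff V).coeff A = ∑ v ∈ range ⤒V, ∑ a ∈ range ⤒A, (f.coeff v).coeff a * (g.coeff (V - v)).coeff (A - a) := by
  rw [Polynomial.coeff_mul, Nat.sum_antidiagonal_eq_sum_range_succ_mk, Polynomial.finsetSum_coeff]
  refine sum_congr rfl fun v _ => ?_
  rw [Polynomial.coeff_mul, Nat.sum_antidiagonal_eq_sum_range_succ_mk]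

theorem wF_match (hA : Summable (Aw p x T R G)) (hR : R ≠ 0) (H : Polynomial (Polynomial ℂ)) (Vm Kb : ℕ)
    (hH0 : ∀ v ≤ Vm, (H.coeff v).coeff 0 = if v = 0 then T else 0)
    (hH1 : ∀ v ≤ Vm, ∀ a, (H.coeff v).coeff ⤒a = ∑ κ ∈ range Kb, (p a v κ : ℂ) * x ^ κ)
    (hK : ∀ v ≤ Vm, ∀ a κ, Kb ≤ κ → p a v κ = 0) (m : ℕ) : ∀ V ≤ Vm, ∀ A : ℕ,
    wF (Aw p x T R G) cst m ((A : ℤ) - m, V) = ⧉rpi ^ 2 * (R ^ ((A : ℤ) - m) * G ^ V * ((H ^ m).coeff V).coeff A) := by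
  induction m with
  | zero =>
    intro V hV A
    rw [wF_zero, pow_zero, Polynomial.coeff_one]
    by_cases h1 : V = 0
    · by_cases h2 : A = 0
      · simp [h1, h2]
      · simp [h1, h2, Prod.ext_iff, Polynomial.coeff_one]
    simp_all
  | succ m ih =>
    intro V hV A
    rw [wF_succ hA, tsum_eq_sum (s := insertNone (range A ×ˢ range ⤒V ×ˢ range Kb))]
    · rw [sum_insertNone, pow_succ' H m, coeff2]
      have e0 : (((A : ℤ) - ((m + 1 : ℕ) : ℤ), (V : ℤ)) : ℤ × ℤ) - cst none = ((A : ℤ) - m, (V : ℤ)) := by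
        simp only [cst]; ext <;> simp; ring
      have e1 : ∀ b ∈ range A ×ˢ range ⤒V ×ˢ range Kb, Aw p x T R G (some b) * wF (Aw p x T R G) cst m (((A : ℤ) - ((m + 1 : ℕ) : ℤ), (V : ℤ)) - cst (some b)) =
          ⧉rpi ^ 2 * (R ^ ((A : ℤ) - (m + 1 : ℕ)) * G ^ V) * (p b.1 b.2.1 b.2.2 * x ^ b.2.2 * ((H ^ m).coeff (V - b.2.1)).coeff (A - (b.1 + 1))) := by
        rintro ⟨a, v, κ⟩ hb
        simp only [mem_product, mem_range] at hb
        have e2 : (((A : ℤ) - ((m + 1 : ℕ) : ℤ), (V : ℤ)) : ℤ × ℤ) - cst (some (a, v, κ)) = (((A - ⤒a : ℕ) : ℤ) - m, ((V - v : ℕ) : ℤ)) := by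
          simp only [cst]; ext <;> simp <;> omega
        rw [e2, ih _ ◇]
        have e3 : R ^ ((A : ℤ) - (m + 1 : ℕ)) = R ^ a * R ^ (((A - ⤒a : ℕ) : ℤ) - m) := by
          rw [← zpow_natCast, ← zpow_add₀ hR]; congr 1; omega
        have e4 : G ^ V = G ^ v * G ^ (V - v) := by rw [← pow_add]; congr 1; omega
        rw [e3, e4]
        simp only [Aw]; ring
      rw [e0, ih V hV, sum_congr rfl e1, ← mul_sum]
      have e5 : ∑ v ∈ range ⤒V, ∑ a ∈ range ⤒A, (H.coeff v).coeff a * ((H ^ m).coeff (V - v)).coeff (A - a) =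
          T * ((H ^ m).coeff V).coeff A + ∑ b ∈ range A ×ˢ range ⤒V ×ˢ range Kb, (p b.1 b.2.1 b.2.2 * x ^ b.2.2 * ((H ^ m).coeff (V - b.2.1)).coeff (A - (b.1 + 1))) := by
        have e6 : ∀ v ∈ range ⤒V, ∑ a ∈ range ⤒A, (H.coeff v).coeff a * ((H ^ m).coeff (V - v)).coeff (A - a) =
            (∑ a ∈ range A, ∑ κ ∈ range Kb, (p a v κ : ℂ) * x ^ κ * ((H ^ m).coeff (V - v)).coeff (A - ⤒a)) + if v = 0 then T * ((H ^ m).coeff V).coeff A else 0 := by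
          intro v hv
          have hv' : v ≤ Vm := by grind
          rw [sum_range_succ', hH0 v hv']
          congr 1
          · refine sum_congr rfl fun a _ => ?_
            rw [hH1 v hv', sum_mul]
          grind
        rw [sum_congr rfl e6, sum_add_distrib, add_comm]
        congr 1
        · simp
        · rw [sum_product, sum_comm]
          exact sum_congr rfl fun a _ => by rw [sum_product]
      rw [e5, mul_add, mul_add]
      congr 1
      · have e3 : R ^ ((A : ℤ) - (m + 1 : ℕ)) = R⁻¹ * R ^ ((A : ℤ) - m) := by
          rw [← zpow_neg_one, ← zpow_add₀ hR]; grind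
        rw [e3]; simp only [Aw]; ring
      · ring
    · intro i hi
      rcases i with _ | ⟨a, v, κ⟩
      · simp at hi
      · simp only [some_mem_insertNone, mem_product, mem_range, not_and_or, not_lt] at hi
        by_cases ha : A ≤ a
        · rw [wF_van hA, mul_zero]; right; simp only [cst, Prod.fst_sub]; push_cast; omega
        by_cases hv : V + 1 ≤ v
        · rw [wF_van hA, mul_zero]; left; simp only [cst, Prod.snd_sub]; omega
        have : p a v κ = 0 := hK v ◇ a κ ◇
        simp [Aw, this]
end

section
set_option maxSynthPendingDepth 6
open Polynomial

theorem Qit_stab {R : Type*} [CommRing R] (c : ℕ → R) (c0 : c 0 = 0) (g r : R) (m : ℕ) : ∀ N N' a b : ℕ, m ≤ N → m ≤ N' → m ≤ a → m ≤ b →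
    g ^ m ∣ Qit c g r N a - Qit c g r N' b := by
  have hc : ∀ {d : R} {Q Q' : R} {N N' s: ℕ} {n : ℤ}, s ≤ N → s ≤ N' → d ∣ Q - Q' → g ^ s ∣ g * d →
      g ^ s ∣ ∑ i ∈ range N, c i * g ^ i * yy Q r ⤓i n - ∑ i ∈ range N', c i * g ^ i * yy Q' r ⤓i n := by
    intro d Q Q' N N' s n h1 h2 h3 h4
    have key : ∀ (N : ℕ) Q, s ≤ N → g ^ s ∣ ∑ i ∈ range N, c i * g ^ i * yy Q r ⤓i n - ∑ i ∈ range s, c i * g ^ i * yy Q r ⤓i n := by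
      intro N Q h
      rw [← sum_range_add_sum_Ico _ h, add_sub_cancel_left]
      refine dvd_sum fun i hi => ?_
      exact ((pow_dvd_pow g (mem_Ico.1 hi).1).mul_left _).mul_right _
    have e : g ^ s ∣ ∑ i ∈ range s, c i * g ^ i * yy Q r ⤓i n - ∑ i ∈ range s, c i * g ^ i * yy Q' r ⤓i n := by
      rw [← sum_sub_distrib]
      refine dvd_sum fun i _ => ?_
      rcases i with _ | i
      · simp [c0]
      · refine h4.trans ?_
        rw [← mul_sub, pow_succ', mul_left_comm, mul_assoc]
        exact mul_dvd_mul_left _ ((yy_dvd r h3 _ _).mul_left _)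
    have := ((key N Q h1).add e).sub (key N' Q' h2)
    simp_all
  induction m with
  | zero => simp
  | succ m ih =>
    intro N N' a b h1 h2 h3 h4
    obtain ⟨a, rfl⟩ : ∃ a', a = a' + 1 := ⟨a - 1, by omega⟩
    obtain ⟨b, rfl⟩ : ∃ a', b = a' + 1 := ⟨b - 1, by omega⟩
    exact hc h1 h2 (ih N N' a b ◇ ◇ ◇ ◇) (by rw [pow_succ'])

theorem Gam_stab {R : Type*} [CommRing R] (c : ℕ → R) (c0 : c 0 = 0) (g r : R) (m N N' : ℕ) (h1 : m ≤ N) (h2 : m ≤ N') :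
    g ^ m ∣ Gam c g r N - Gam c g r N' := by
  have key : ∀ (N : ℕ) (Q : R), m ≤ N → g ^ m ∣ ∑ i ∈ range N, c i * g ^ i * yy Q r ⤓i 1 - ∑ i ∈ range m, c i * g ^ i * yy Q r ⤓i 1 := by
    intro N Q h
    rw [← sum_range_add_sum_Ico _ h, add_sub_cancel_left]
    exact dvd_sum fun i hi => ((pow_dvd_pow g (mem_Ico.1 hi).1).mul_left _).mul_right _
  have e : g ^ m ∣ ∑ i ∈ range m, c i * g ^ i * yy (Qit c g r N N) r ⤓i 1 - ∑ i ∈ range m, c i * g ^ i * yy (Qit c g r N' N') r ⤓i 1 := by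
    rw [← sum_sub_distrib]
    refine dvd_sum fun i _ => ?_
    rw [← mul_sub]
    exact (yy_dvd r (Qit_stab c c0 g r m N N' N N' h1 h2 h1 h2) _ _).mul_left _
  have := ((key N (Qit c g r N N) h1).add e).sub (key N' (Qit c g r N' N') h2)
  convert this using 1; rw [Gam, Gam]; ring

/-- additive preorder in a semiring -/
def le' {S : Type*} [CommSemiring S] (a b : S) : Prop := ∃ c, b = a + c

section
variable {S : Type*} [CommSemiring S] {a b a' b' : S}
theorem le'_refl (a : S) : le' a a := ⟨0, by simp⟩
theorem le'_add (h : le' a b) (h' : le' a' b') : le' (a + a') (b + b') := by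
  obtain ⟨x, rfl⟩ := h; obtain ⟨y, rfl⟩ := h'; exact ⟨x + y, by ring⟩
theorem le'_mul (h : le' a b) (h' : le' a' b') : le' (a * a') (b * b') := by
  obtain ⟨x, rfl⟩ := h; obtain ⟨y, rfl⟩ := h'; exact ⟨x * a' + a * y + x * y, by ring⟩
theorem le'_sum {ι : Type*} (s t : Finset ι) (h : s ⊆ t) (f g : ι → S) (hfg : ∀ i ∈ s, le' (f i) (g i)) : le' (∑ i ∈ s, f i) (∑ i ∈ t, g i) := by
  classical
  choose! e he using hfg
  refine ⟨∑ i ∈ s, e i + ∑ i ∈ t \ s, g i, ?_⟩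
  rw [← sum_sdiff h, add_comm, ← add_assoc, ← sum_add_distrib]
  simp_all
theorem yy_le' (r : S) (h : le' a b) (i : ℕ) : ∀ n, le' (yy a r i n) (yy b r i n) := by
  induction i with
  | zero => intro n; exact le'_refl _
  | succ i ih => intro n; exact le'_add (le'_add (ih _) (le'_mul h (ih _))) (le'_mul (le'_refl _) (ih _))
theorem Qit_le' (c : ℕ → S) (g r : S) {N N' : ℕ} (h : N ≤ N') (m : ℕ) : ∀ m', m ≤ m' → le' (Qit c g r N m) (Qit c g r N' m') := by
  induction m with
  | zero => intro m' _; exact ⟨_, (zero_add _).symm⟩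
  | succ m ih =>
    intro m' hm
    obtain ⟨m', rfl⟩ : ∃ a', m' = a' + 1 := ⟨m' - 1, by omega⟩
    exact le'_sum _ _ (range_mono h) _ _ fun i _ => le'_mul (le'_refl _) (yy_le' _ (ih _ ◇) _ _)
theorem Gam_le' (c : ℕ → S) (g r : S) {N N' : ℕ} (h : N ≤ N') : le' (Gam c g r N) (Gam c g r N') :=
  le'_sum _ _ (range_mono h) _ _ fun i _ => le'_mul (le'_refl _) (yy_le' _ (Qit_le' _ _ _ h _ _ h) _ _)
end

abbrev P3 := Polynomial (Polynomial (Polynomial ℕ))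

def GN (D : Set ℕ) (k N : ℕ) : P3 := Gam (fun i => C (C (wt D k X i))) X (C X) N

def pp (D : Set ℕ) (k a j κ : ℕ) : ℕ := (((GN D k ⤒j).coeff j).coeff a).coeff κ

variable {D : Set ℕ} {k : ℕ}

theorem GN_mono {N N' : ℕ} (h : N ≤ N') (a j κ : ℕ) : (((GN D k N).coeff j).coeff a).coeff κ ≤ (((GN D k N').coeff j).coeff a).coeff κ := by
  obtain ⟨c, hc⟩ : le' (GN D k N) (GN D k N') := Gam_le' _ _ _ h
  rw [hc]; simp

theorem wt_map {R R' : Type*} [Semiring R] [Semiring R'] (φ : R →+* R') (x : R) (i : ℕ) : φ (wt D k x i) = wt D k (φ x) i := by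
  simp only [wt]; split_ifs <;> simp

theorem GN_coeff (h0 : 0 ∉ D) {N : ℕ} (a j κ : ℕ) (h : j < N) : (((GN D k N).coeff j).coeff a).coeff κ = pp D k a j κ := by
  let φ := mapRingHom (mapRingHom (mapRingHom (Nat.castRingHom ℤ)))
  have e : ∀ N, φ (GN D k N) = Gam (fun i => C (C (wt D k (X : ℤ[X]) i))) X (C X) N := by
    intro N
    rw [GN, Gam_map]
    simp [φ, wt_map]
  have h1 := Gam_stab (fun i => C (C (wt D k (X : ℤ[X]) i))) (by simp [wt, h0]) X (C X) ⤒j N ⤒j h le_rfl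
  rw [← e, ← e, X_pow_dvd_iff] at h1
  have h2 := h1 j ◇
  rw [coeff_sub, sub_eq_zero] at h2
  have h3 := congrArg (fun f => (f.coeff a).coeff κ) h2
  simp [φ, coeff_map] at h3
  exact_mod_cast h3

theorem GN_le (h0 : 0 ∉ D) (N a j κ : ℕ) : (((GN D k N).coeff j).coeff a).coeff κ ≤ pp D k a j κ := by
  rw [← GN_coeff h0 (N := max N ⤒j) a j κ ◇]
  exact GN_mono (le_max_left _ _) _ _ _

theorem pp_zero (h0 : 0 ∉ D) (a κ : ℕ) : pp D k a 0 κ = 0 := by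
  simp [pp, GN, Gam, wt, h0]

theorem bd3 (f : P3) : ∃ M, f.natDegree < M ∧ (∀ j, (f.coeff j).natDegree < M) ∧ ∀ j a, ((f.coeff j).coeff a).natDegree < M := by
  refine ⟨f.natDegree + ∑ j ∈ f.support, (f.coeff j).natDegree + ∑ j ∈ f.support, ∑ a ∈ (f.coeff j).support, ((f.coeff j).coeff a).natDegree + 1, by omega, fun j => ?_, fun j a => ?_⟩
  · by_cases h : j ∈ f.support
    · have := single_le_sum (f := fun j => (f.coeff j).natDegree) (fun _ _ => Nat.zero_le _) h
      omega
    simp_all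
  · by_cases h : j ∈ f.support
    · have := single_le_sum (f := fun j => ∑ a ∈ (f.coeff j).support, ((f.coeff j).coeff a).natDegree) (fun _ _ => Nat.zero_le _) h
      by_cases h' : a ∈ (f.coeff j).support
      · have := single_le_sum (f := fun a => ((f.coeff j).coeff a).natDegree) (fun _ _ => Nat.zero_le _) h'
        omega
      simp_all
    simp_all

def ev (x r g : ℝ) : P3 →+* ℝ := eval₂RingHom (eval₂RingHom (eval₂RingHom (Nat.castRingHom ℝ) x) r) g

theorem ev_GN (x r g : ℝ) (N : ℕ) : ev x r g (GN D k N) = Gam (wt D k x) g r N := by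
  rw [GN, Gam_map]
  simp [ev]
  congr 1
  funext i
  have := wt_map (D := D) (k := k) (eval₂RingHom (Nat.castRingHom ℝ) x) X i
  simpa using this

theorem ev_hasSum (x r g : ℝ) (f : P3) : HasSum (fun b : ℕ × ℕ × ℕ => ((((f.coeff b.2.1).coeff b.1).coeff b.2.2 : ℕ) : ℝ) * x ^ b.2.2 * r ^ b.1 * g ^ b.2.1) (ev x r g f) := by
  obtain ⟨M, h1, h2, h3⟩ := bd3 f
  have e : ev x r g f = ∑ b ∈ range M ×ˢ range M ×ˢ range M, ((((f.coeff b.2.1).coeff b.1).coeff b.2.2 : ℕ) : ℝ) * x ^ b.2.2 * r ^ b.1 * g ^ b.2.1 := by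
    rw [sum_product, sum_comm' (t' := range M ×ˢ range M) (s' := fun _ => range M) (by simp; try tauto), sum_product]
    simp only [ev, coe_eval₂RingHom]
    rw [eval₂_eq_sum_range' _ h1]
    refine sum_congr rfl fun j _ => ?_
    simp only [coe_eval₂RingHom]
    rw [eval₂_eq_sum_range' _ (h2 j), sum_mul, sum_comm]
    refine sum_congr rfl fun a _ => ?_
    simp only [coe_eval₂RingHom]
    rw [eval₂_eq_sum_range' _ (h3 j a), sum_mul, sum_mul]
    rfl
  rw [e]
  refine hasSum_sum_of_ne_finset_zero fun b hb => ?_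
  have : ((f.coeff b.2.1).coeff b.1).coeff b.2.2 = 0 := by
    simp only [mem_product, mem_range, not_and_or, not_lt] at hb
    rcases hb with hb | hb | hb
    · rw [coeff_eq_zero_of_natDegree_lt (lt_of_lt_of_le (h2 _) hb), coeff_zero]
    · rw [coeff_eq_zero_of_natDegree_lt (lt_of_lt_of_le h1 hb), coeff_zero, coeff_zero]
    · rw [coeff_eq_zero_of_natDegree_lt (lt_of_lt_of_le (h3 _ _) hb)]
  simp [this]

def pt (D : Set ℕ) (k : ℕ) (x r g : ℝ) (b : ℕ × ℕ × ℕ) : ℝ := (pp D k b.1 b.2.1 b.2.2 : ℝ) * x ^ b.2.2 * r ^ b.1 * g ^ b.2.1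

theorem pt_nonneg {x r g : ℝ} (hx : 0 ≤ x) (hr : 0 ≤ r) (hg : 0 ≤ g) (b : ℕ × ℕ × ℕ) : 0 ≤ pt D k x r g b := by
  unfold pt; positivity

theorem pt_summable (h0 : 0 ∉ D) {x r g : ℝ} (hx : 0 ≤ x) (hr : 0 ≤ r) (hg : 0 ≤ g) (B : ℝ) (hB : ∀ N, Gam (wt D k x) g r N ≤ B) :
    Summable (pt D k x r g) ∧ ∑' b, pt D k x r g b ≤ B := by
  have h : ∀ s : Finset (ℕ × ℕ × ℕ), ∑ b ∈ s, pt D k x r g b ≤ B := by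
    intro s
    refine le_trans ?_ (hB (s.sup (fun b => b.2.1) + 1))
    rw [← ev_GN]
    refine le_trans (le_of_eq ?_) (sum_le_hasSum s (fun b _ => by positivity) (ev_hasSum x r g _))
    refine sum_congr rfl fun b hb => ?_
    rw [pt, GN_coeff h0 _ _ _ (Nat.lt_succ_of_le (le_sup (f := fun b => b.2.1) hb))]
  have hs := summable_of_sum_le (pt_nonneg hx hr hg) h
  exact ⟨hs, hs.tsum_le_of_sum_le h⟩

theorem Gam_le_pt (h0 : 0 ∉ D) {x r g : ℝ} (hx : 0 ≤ x) (hr : 0 ≤ r) (hg : 0 ≤ g) (hs : Summable (pt D k x r g)) (N : ℕ) :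
    Gam (wt D k x) g r N ≤ ∑' b, pt D k x r g b := by
  rw [← ev_GN]
  refine hasSum_le (fun b => ?_) (ev_hasSum x r g _) hs.hasSum
  have := GN_le (k := k) h0 N b.1 b.2.1 b.2.2
  have h' : ((((GN D k N).coeff b.2.1).coeff b.1).coeff b.2.2 : ℝ) ≤ pp D k b.1 b.2.1 b.2.2 := by exact_mod_cast this
  unfold pt
  gcongr
end

section
set_option maxSynthPendingDepth 6
open Polynomial

variable {D : Set ℕ} {k : ℕ}

theorem GP_GN (x : ℂ) (N a j : ℕ) : ((GP (wt D k x) N).coeff j).coeff a = eval₂ (Nat.castRingHom ℂ) x (((GN D k N).coeff j).coeff a) := by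
  have e : mapRingHom (mapRingHom (eval₂RingHom (Nat.castRingHom ℂ) x)) (GN D k N) = GP (wt D k x) N := by
    rw [GN, Gam_map, GP]
    simp [wt_map]
  rw [← e]
  simp [coeff_map]

def HH (D : Set ℕ) (k : ℕ) (x T : ℂ) (N : ℕ) : Polynomial (Polynomial ℂ) := C (C T) + C X * GP (wt D k x) N

theorem HH_ex (h0 : 0 ∉ D) (x T : ℂ) {N γ : ℕ} (hγ : 0 < γ) (hp : ∀ a j κ, pp D k a j κ ≠ 0 → γ ∣ j) (Vm : ℕ) (hN : γ * Vm < N) :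
    ∃ (H : Polynomial (Polynomial ℂ)) (Kb : ℕ), (∀ v ≤ Vm, (H.coeff v).coeff 0 = if v = 0 then T else 0) ∧
    (∀ v ≤ Vm, ∀ a, (H.coeff v).coeff ⤒a = ∑ κ ∈ range Kb, ((pp D k a (γ * v) κ : ℕ) : ℂ) * x ^ κ) ∧
    (∀ v ≤ Vm, ∀ a κ, Kb ≤ κ → pp D k a (γ * v) κ = 0) ∧ ∀ m, HH D k x T N ^ m = expand _ γ (H ^ m) := by
  obtain ⟨Kb, -, -, h3⟩ := bd3 (GN D k N)
  have hv : ∀ v ≤ Vm, γ * v < N := fun v h => lt_of_le_of_lt (Nat.mul_le_mul_left _ h) hN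
  refine ⟨contract γ (HH D k x T N), Kb, fun v h => ?_, fun v h a => ?_, fun v h a κ hκ => ?_, fun m => ?_⟩
  · rw [coeff_contract hγ.ne', HH, coeff_add, coeff_C]
    rcases eq_or_ne v 0 with rfl | h
    · simp
    · simp [h, hγ.ne']
  · rw [coeff_contract hγ.ne', HH, coeff_add, coeff_C, coeff_add, coeff_C_mul, coeff_X_mul, GP_GN, eval₂_eq_sum_range' _ (h3 _ _)]
    have : (if v * γ = 0 then C T else 0 : Polynomial ℂ).coeff ⤒a = 0 := by split_ifs <;> simp [coeff_C]
    rw [this, zero_add]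
    refine sum_congr rfl fun κ _ => ?_
    rw [mul_comm v γ, GN_coeff h0 _ _ _ (hv v h)]; simp
  · rw [← GN_coeff h0 _ _ _ (hv v h)]
    exact coeff_eq_zero_of_natDegree_lt (lt_of_lt_of_le (h3 _ _) hκ)
  · rw [map_pow]
    congr 1
    ext1 j
    rw [coeff_expand hγ, coeff_contract hγ.ne']
    split_ifs with hj
    · rw [Nat.div_mul_cancel hj]
    · have hj0 : j ≠ 0 := by rintro rfl; simp at hj
      rw [HH, coeff_add, coeff_C, if_neg hj0, coeff_C_mul, zero_add]
      have : (GP (wt D k x) N).coeff j = 0 := by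
        ext a
        rw [GP_GN]
        have : ((GN D k N).coeff j).coeff a = 0 := by
          ext κ
          have h1 := GN_le (k := k) h0 N a j κ
          have h2 : pp D k a j κ = 0 := by grind
          simp; omega
        simp [this]
      simp [this]
end

section
open Complex (I)
open MeasureTheory Filter Topology

def Pw (p : ℕ → ℕ → ℕ → ℕ) (r G : ℝ) : St → ℝ
  | none => r⁻¹
  | some b => p b.1 b.2.1 b.2.2 * r ^ b.1 * G ^ b.2.1
def aw (i : St) : ℝ := (cst i).1
def vw (i : St) : ℝ := (cst i).2
def hw (e1 e2 : ℝ) : St → ℝ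
  | none => e2
  | some b => e1 * b.2.2
def hc (e1 e2 α β : ℝ) (i : St) : ℝ := hw e1 e2 i - α * vw i - β * aw i

theorem gam_int (m : ℕ) : IntegrableOn (fun t : ℝ => cexp (-t) * (t : ℂ) ^ m) (Set.Ioi 0) ∧
    ∫ t : ℝ in Set.Ioi 0, cexp (-t) * (t : ℂ) ^ m = m.factorial := by
  have h1 := Complex.GammaIntegral_convergent (s := (m + 1 : ℂ)) (by simp; positivity)
  have h2 := Complex.Gamma_nat_eq_factorial m
  rw [Complex.Gamma_eq_integral (by simp; positivity), Complex.GammaIntegral] at h2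
  simp_all

variable {p : ℕ → ℕ → ℕ → ℕ} {r0 G0 e1 e2 α β μ ε : ℝ}

set_option maxHeartbeats 1000000 in
theorem HJ_of (w : Wk (Pw p r0 G0) aw vw (hc e1 e2 α β) μ ε) (hr : 0 < r0) (z : ℂ) {n V : ℕ} (hV : 0 < V)
    (H : Polynomial (Polynomial ℂ)) (Kb L : ℕ)
    (hH0 : ∀ v ≤ V, (H.coeff v).coeff 0 = if v = 0 then cexp (z / (√n : ℝ) * e2) else 0)
    (hH1 : ∀ v ≤ V, ∀ a, (H.coeff v).coeff ⤒a = ∑ κ ∈ range Kb, (p a v κ : ℂ) * cexp (z / (√n : ℝ) * e1) ^ κ)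
    (hK : ∀ v ≤ V, ∀ a κ, Kb ≤ κ → p a v κ = 0) (hL : ∀ m, L ≤ m → ((H ^ m).coeff V).coeff m = 0) :
    ∃ J, HJ (Pw p r0 G0) aw vw (hc e1 e2 α β) ε z V n J ∧
     ∫ t in Set.Ioi 0, J t / t = G0 ^ V * cexp (-(z / (√n : ℝ)) * α * V) * ∑ m ∈ range L, ((H ^ m).coeff V).coeff m / m := by
  set θ : ℂ := z / (√n : ℝ) with hθ
  set W : ℕ → ℂ := fun m => ((H ^ m).coeff V).coeff m with hW
  set K : ℂ := G0 ^ V * cexp (-θ * α * V) with hKdef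
  refine ⟨fun t => K * ∑ m ∈ range L, cexp (-t) * ⇈t ^ m * (W m / m.factorial), ⟨by fun_prop, ?_, ?_⟩, ?_⟩
  · intro t ht s hs
    set R : ℂ := r0 * cexp (-θ * β) with hR
    set G : ℂ := G0 * cexp (s - θ * α) with hG
    have hR0 : R ≠ 0 := mul_ne_zero (by exact_mod_cast hr.ne') (Complex.exp_ne_zero _)
    have eA : ∀ i, Aw p (cexp (θ * e1)) (cexp (θ * e2)) R G i = (Pw p r0 G0 i : ℂ) * cexp ((s * vw i : ℝ) + θ * hc e1 e2 α β i) := by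
      rintro (_ | ⟨a, v, κ⟩)
      · simp only [Aw, Pw, hc, hw, vw, aw, cst, hR, mul_inv, ← Complex.exp_neg]
        push_cast
        rw [mul_left_comm, ← Complex.exp_add]; congr 2; ring
      · simp only [Aw, Pw, hc, hw, vw, aw, cst, hR, hG, mul_pow, ← Complex.exp_nat_mul]
        have : ((s * ((v : ℕ) : ℤ) : ℝ) : ℂ) + θ * ((e1 * κ - α * ((v : ℕ) : ℤ) - β * ((a : ℕ) : ℤ) : ℝ) : ℂ) = κ * (θ * e1) + a * (-θ * β) + v * (s - θ * α) := by
          push_cast; ring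
        rw [this, Complex.exp_add, Complex.exp_add]
        push_cast; ring
    have hA : Summable (Aw p (cexp (θ * e1)) (cexp (θ * e2)) R G) := by
      refine Summable.of_norm_bounded w.mom fun i => ?_
      rw [eA, norm_mul, Complex.norm_real, Real.norm_of_nonneg (w.P0 i), Complex.norm_exp]
      refine mul_le_mul_of_nonneg_left (Real.exp_le_exp.2 ?_) (w.P0 i)
      have h1 : (θ * hc e1 e2 α β i).re ≤ ‖θ‖ * |hc e1 e2 α β i| := by
        refine (Complex.re_le_norm _).trans ?_
        simp
      have h2 : s * vw i ≤ |s| * |vw i| := by rw [← abs_mul]; exact le_abs_self _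
      have h3 := kk_v (a := aw) (v := vw) (h := hc e1 e2 α β) i
      have h4 := kk_h (a := aw) (v := vw) (h := hc e1 e2 α β) i
      have h5 := kk_one (a := aw) (v := vw) (h := hc e1 e2 α β) i
      rw [Complex.add_re, Complex.ofReal_re]
      have he := w.e0
      nlinarith [abs_nonneg s, norm_nonneg θ, mul_le_mul_of_nonneg_left h3 (abs_nonneg s), mul_le_mul_of_nonneg_left h4 (norm_nonneg θ)]
    have ePhi : ∀ b, psi (Pw p r0 G0) aw vw (hc e1 e2 α β) s b θ = Phi (Aw p (cexp (θ * e1)) (cexp (θ * e2)) R G) cst b - 1 := by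
      intro b
      have h1 := (Phi_sum (c := cst) hA b).hasSum.sub (Complex.hasSum_ofReal.2 w.tot)
      rw [Complex.ofReal_one] at h1
      rw [Phi, ← h1.tsum_eq, psi]
      refine tsum_congr fun i => ?_
      rw [eA, chi, mul_assoc, ← Complex.exp_add, mul_sub, mul_one]
      congr 3
      simp only [lc, aw, vw]; push_cast; ring
    have hS := wF_exp (c := cst) hA t (0, (V : ℤ))
    have hwF : ∀ m : ℕ, wF (Aw p (cexp (θ * e1)) (cexp (θ * e2)) R G) cst m (0, (V : ℤ)) = ⧉rpi ^ 2 * (G ^ V * W m) := by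
      intro m
      have := wF_match hA hR0 H V Kb hH0 hH1 hK m V le_rfl m
      simpa using this
    simp only [hwF] at hS
    have h0 := hasSum_sum_of_ne_finset_zero (L := SummationFilter.unconditional ℕ) (f := fun m : ℕ => (t : ℂ) ^ m / m.factorial * (⧉rpi ^ 2 * (G ^ V * W m))) (s := range L)
      (fun m hm => by simp_all)
    have h1 := hS.unique h0
    have h2 : ∀ b : ℝ × ℝ, cexp (t * psi (Pw p r0 G0) aw vw (hc e1 e2 α β) s b θ - (V : ℝ) * b.2 * I) =
        cexp (-t) * (cexp (t * Phi (Aw p (cexp (θ * e1)) (cexp (θ * e2)) R G) cst b) * chi (-(0, (V : ℤ))) b) := by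
      intro b
      rw [ePhi, chi, ← Complex.exp_add, ← Complex.exp_add]; congr 1; simp; ring
    simp only [← hθ, h2]
    rw [integral_const_mul, h1, mul_sum, mul_sum, mul_sum, sum_mul]
    refine sum_congr rfl fun m _ => ?_
    have h3 : G ^ V = K * rexp (s * V) := by
      rw [hG, hKdef, mul_pow, ← Complex.exp_nat_mul, Complex.ofReal_exp, mul_assoc, ← Complex.exp_add]; congr 2; push_cast; ring
    rw [h3]; ring
  · have := chi_int (0, -(V:ℤ))
    rw [if_neg (by simp; omega)] at this
    rw [← this]
    refine integral_congr_ae (ae_of_all _ fun b => ?_)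
    simp only [chi]; congr 1; simp; ring
  · have e : ∀ t ∈ Set.Ioi ↟0, (K * ∑ m ∈ range L, cexp (-t) * ⇈t ^ m * (W m / m.factorial)) / t =
        ∑ m ∈ range L, cexp (-t) * ⇈t ^ ⤓m * (K * W m / m.factorial) := by
      intro t ht
      have ht' : ⇈t ≠ 0 := by exact_mod_cast (ne_of_gt ht)
      rw [mul_sum, sum_div]
      refine sum_congr rfl fun m _ => ?_
      rcases m with _ | m
      · have : W 0 = 0 := by simp [hW, Polynomial.coeff_one, hV.ne']
        simp [this]
      grind
    rw [setIntegral_congr_fun measurableSet_Ioi e, integral_finsetSum _ (fun m _ => (gam_int ⤓m).1.mul_const _), mul_sum]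
    refine sum_congr rfl fun m _ => ?_
    rw [integral_mul_const, (gam_int ⤓m).2]
    rcases m with _ | m
    · have : W 0 = 0 := by simp [hW, Polynomial.coeff_one, hV.ne']
      simp [this]
    · rw [Nat.add_sub_cancel, Nat.factorial_succ]
      have h1 : (m.factorial : ℂ) ≠ 0 := Nat.cast_ne_zero.2 (Nat.factorial_ne_zero m)
      grind
end

section
open MeasureTheory Filter Topology

def Sx (D : Set ℕ) (k n : ℕ) (x T : ℂ) : ℂ := ∑ p ∈ pairFinset D n, x ^ degCount p.1 k * ((cycleCount (p.1 * p.2) : ℂ) * ((cycleCount (p.1 * p.2) - 1 : ℕ) : ℂ) * T ^ (cycleCount (p.1 * p.2) - 2))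

variable {D : Set ℕ} {k : ℕ} {r0 G0 e1 e2 α β μ ε : ℝ}

theorem map_lim (h0 : 0 ∉ D) {γ : ℕ} (hγ : 0 < γ) (hp : ∀ a j κ, pp D k a j κ ≠ 0 → γ ∣ j)
    (w : Wk (Pw (fun a v κ => pp D k a (γ * v) κ) r0 G0) aw vw (hc e1 e2 α β) μ ε) (hr : 0 < r0) :
    ∃ C0 : ℂ, C0 ≠ 0 ∧ ∀ (z : ℂ) (l : Filter ℕ), l ≤ atTop → l.IsCountablyGenerated → l.NeBot → (∀ᶠ n : ℕ in l, γ ∣ 2 * n) →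
      Tendsto (fun n : ℕ => ⇈n * (√↟n : ℝ) * (G0 ^ (2 * n / γ) * cexp (-(z / (√↟n : ℝ)) * α * (2 * n / γ : ℕ)) *
        (Sx D k n (cexp (z / (√↟n : ℝ) * e1)) (cexp (z / (√↟n : ℝ) * e2)) / (2 * n).factorial))) l
        (𝓝 (C0 * cexp ((2 / (γ * μ) : ℝ) * Vh (Pw (fun a v κ => pp D k a (γ * v) κ) r0 G0) (hc e1 e2 α β) * z ^ 2 / 2))) := by
  have hμ := w.mu0
  have hγ' : ↟0 < γ := by exact_mod_cast hγ
  obtain ⟨C0, h1, h2⟩ := walk_lim w (τ := 2 / (γ * μ)) ◆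
  refine ⟨C0, h1, fun z l hl hcg hnb hdiv => ?_⟩
  have key : ∀ n : ℕ, 0 < n → γ ∣ 2 * n → ∃ J, HJ (Pw (fun a v κ => pp D k a (γ * v) κ) r0 G0) aw vw (hc e1 e2 α β) ε z (2 / (γ * μ) * μ * n) n J ∧
      ∫ t in Set.Ioi 0, J t / t = (G0 ^ (2 * n / γ) * cexp (-(z / (√↟n : ℝ)) * α * (2 * n / γ : ℕ)) *
        (Sx D k n (cexp (z / (√↟n : ℝ) * e1)) (cexp (z / (√↟n : ℝ) * e2)) / (2 * n).factorial)) := by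
    intro n hn hd
    obtain ⟨V, hV⟩ := hd
    have eV : 2 * n / γ = V := by simp_all
    have hV0 : 0 < V := by grind
    have hVr : (2 / (γ * μ) * μ * n : ℝ) = V := by
      have : (2 * n : ℝ) = γ * V := by exact_mod_cast hV
      field_simp; linarith
    set x := cexp (z / (√↟n : ℝ) * e1)
    set T := cexp (z / (√↟n : ℝ) * e2)
    obtain ⟨L, hL, hb⟩ := bridge D h0 k x T hn (2 * n + 1) ◇
    obtain ⟨H, Kb, hH0, hH1, hK, hex⟩ := HH_ex h0 x T hγ hp V (N := 2 * n + 1) ◇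
    have eH : ∀ m, (HH D k x T (2 * n + 1) ^ m).coeff ⧉n = (H ^ m).coeff V := by
      intro m
      rw [hex, hV, Polynomial.coeff_expand hγ, if_pos (dvd_mul_right _ _), Nat.mul_div_cancel_left _ hγ]
    obtain ⟨J, hJ, hJi⟩ := HJ_of w hr z hV0 H Kb L hH0 hH1 hK (fun m hm => by rw [← eH]; exact hL m hm)
    refine ⟨J, hVr ▸ hJ, ?_⟩
    rw [hJi, eV]
    congr 1
    have hf : ((2 * n).factorial : ℂ) ≠ 0 := Nat.cast_ne_zero.2 (Nat.factorial_ne_zero _)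
    rw [eq_div_iff hf, mul_comm, Sx, hb]
    congr 1
    exact sum_congr rfl fun m _ => by rw [← eH]; rfl
  choose! J hJ using key
  have hev : ∀ᶠ n : ℕ in l, 0 < n ∧ γ ∣ 2 * n := ((eventually_gt_atTop 0).filter_mono hl).and hdiv
  refine (h2 z l hl hcg hnb J (hev.mono fun n hn => (hJ n hn.1 hn.2).1)).congr' (hev.mono fun n hn => ?_)
  grind
end

section
theorem yy_nonneg {q r : ℝ} (hq : 0 ≤ q) (hr : 0 ≤ r) (i : ℕ) : ∀ n, 0 ≤ yy q r i n := by
  induction i with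
  | zero => intro n; simp only [yy]; split_ifs <;> norm_num
  | succ i ih => intro n; simp only [yy]; have := ih n; have := ih ⤓n; have := ih ⤒n; positivity

theorem yy_mono {q r q' r' : ℝ} (hq : 0 ≤ q) (hr : 0 ≤ r) (h1 : q ≤ q') (h2 : r ≤ r') (i : ℕ) : ∀ n, yy q r i n ≤ yy q' r' i n := by
  induction i with
  | zero => intro n; exact le_rfl
  | succ i ih =>
    intro n; simp only [yy]
    have := yy_nonneg hq hr i
    exact add_le_add (add_le_add (ih _) (mul_le_mul h1 (ih _) (this _) (hq.trans h1))) (mul_le_mul h2 (ih _) (this _) (hr.trans h2))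

theorem yy_scale {c : ℝ} (hc : c ≠ 0) (q r : ℝ) (i : ℕ) : ∀ n : ℤ, yy (c * q) (c ^ 2 * r) i n * c ^ n = c ^ i * yy q r i n := by
  induction i with
  | zero => intro n; simp only [yy]; simp_all
  | succ i ih =>
    intro n; simp only [yy]
    have h1 := ih ⤓n; have h2 := ih n; have h3 := ih ⤒n
    rw [zpow_sub_one₀ hc, ← mul_assoc, mul_inv_eq_iff_eq_mul₀ hc] at h1
    rw [zpow_add_one₀ hc] at h3
    grind

theorem yy_contq (r : ℝ) (i : ℕ) : ∀ n, Continuous fun x : ℝ => yy x r i n := by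
  induction i with
  | zero => intro n; simp only [yy]; fun_prop
  | succ i ih => intro n; simp only [yy]; fun_prop

theorem yy_cont (i : ℕ) : ∀ n, Continuous fun x : ℝ × ℝ => yy x.1 x.2 i n := by
  induction i with
  | zero => intro n; simp only [yy]; fun_prop
  | succ i ih => intro n; simp only [yy]; fun_prop

theorem yy_qpow {q r : ℝ} (hq : 0 ≤ q) (hr : 0 ≤ r) (i : ℕ) : q ^ i ≤ yy q r i 0 := by
  induction i with
  | zero => simp [yy]
  | succ i ih =>
    simp only [yy]
    have := yy_nonneg hq hr i (0 - 1); have h2 := mul_nonneg hr (yy_nonneg hq hr i (0 + 1))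
    rw [pow_succ']; nlinarith

theorem yy_two {q r : ℝ} (hq : 0 ≤ q) (hr : 0 ≤ r) (i : ℕ) : ∀ n, r * yy q r i n ≤ yy q r (i + 2) n := by
  intro n
  simp only [yy, sub_add_cancel, add_sub_cancel_right]
  have h := yy_nonneg hq hr i
  have := h n; have := h ⤓n; have := h ⤒n; have := h (n - 1 - 1); have := h (n + 1 + 1)
  have e : 0 ≤ yy q r i (n - 1 - 1) + q * yy q r i ⤓n + q * (yy q r i ⤓n + q * yy q r i n + r * yy q r i ⤒n) +
      r * (q * yy q r i ⤒n + r * yy q r i (n + 1 + 1)) + r * yy q r i n := by positivity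
  linarith

theorem yy_rpow {q r : ℝ} (hq : 0 ≤ q) (hr : 0 ≤ r) (m : ℕ) (n : ℤ) : ∀ i, r ^ m * yy q r i n ≤ yy q r (i + 2 * m) n := by
  induction m with
  | zero => simp
  | succ m ih =>
    intro i
    refine le_trans ?_ (yy_two hq hr (i + 2 * m) n)
    rw [pow_succ', mul_assoc]; exact mul_le_mul_of_nonneg_left (ih i) hr

/-- symmetrised version -/
def tt (q ρ : ℝ) : ℕ → ℤ → ℝ
  | 0, n => if n = 0 then 1 else 0
  | i + 1, n => ρ * tt q ρ i ⤓n + q * tt q ρ i n + ρ * tt q ρ i ⤒n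

variable {q ρ : ℝ}

theorem tt_yy (hρ : ρ ≠ 0) (i : ℕ) : ∀ n : ℤ, tt q ρ i n = yy q (ρ ^ 2) i n * ρ ^ n := by
  induction i with
  | zero => intro n; simp only [yy, tt]; simp_all
  | succ i ih =>
    intro n; simp only [yy, tt, ih]
    rw [zpow_sub_one₀ hρ, zpow_add_one₀ hρ]; field_simp

theorem tt_nonneg (hq : 0 ≤ q) (hr : 0 ≤ ρ) (i : ℕ) : ∀ n, 0 ≤ tt q ρ i n := by
  induction i with
  | zero => intro n; simp only [tt]; split_ifs <;> norm_num
  | succ i ih => intro n; simp only [tt]; have := ih n; have := ih ⤓n; have := ih ⤒n; positivity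

theorem tt_le (hq : 0 ≤ q) (hr : 0 ≤ ρ) (i : ℕ) : ∀ n, tt q ρ i n ≤ (q + 2 * ρ) ^ i := by
  induction i with
  | zero => intro n; simp only [tt]; split_ifs <;> norm_num
  | succ i ih =>
    intro n; simp only [tt]; rw [pow_succ']
    nlinarith [mul_le_mul_of_nonneg_left (ih n) hq, mul_le_mul_of_nonneg_left (ih ⤓n) hr, mul_le_mul_of_nonneg_left (ih ⤒n) hr]

theorem tt_sym (i : ℕ) : ∀ n, tt q ρ i (-n) = tt q ρ i n := by
  induction i with
  | zero => intro n; simp [tt]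
  | succ i ih =>
    intro n; simp only [tt]
    grind

theorem tt_supp (i : ℕ) : ∀ n : ℤ, (i : ℤ) < |n| → tt q ρ i n = 0 := by
  induction i with
  | zero => intro n hn; simp only [tt]; simp_all
  | succ i ih =>
    intro n hn; push_cast at hn
    simp only [tt]
    grind

theorem tt_hasSum (i : ℕ) : HasSum (tt q ρ i) ((q + 2 * ρ) ^ i) := by
  induction i with
  | zero => simpa [tt] using hasSum_ite_eq (0:ℤ) ↟1
  | succ i ih =>
    have h1 := ((Equiv.subRight (1:ℤ)).hasSum_iff.2 ih).mul_left ρ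
    have h2 := ((Equiv.addRight (1:ℤ)).hasSum_iff.2 ih).mul_left ρ
    have := (h1.add (ih.mul_left q)).add h2
    rw [show (q + 2 * ρ) ^ ⤒i = ρ * (q + 2 * ρ) ^ i + q * (q + 2 * ρ) ^ i + ρ * (q + 2 * ρ) ^ i by ring]
    exact this

theorem tt_conv (i j : ℕ) : ∀ n : ℤ, HasSum (fun k => tt q ρ i k * tt q ρ j (n - k)) (tt q ρ (i + j) n) := by
  induction i with
  | zero =>
    intro n
    have := hasSum_single (f := fun k : ℤ => tt q ρ 0 k * tt q ρ j (n - k)) 0 (fun k hk => by simp [tt, hk])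
    simpa [tt] using this
  | succ i ih =>
    intro n
    have h1 := ((Equiv.subRight (1:ℤ)).hasSum_iff.2 (ih ⤓n)).mul_left ρ
    have h2 := ((Equiv.addRight (1:ℤ)).hasSum_iff.2 (ih ⤒n)).mul_left ρ
    have := (h1.add ((ih n).mul_left q)).add h2
    rw [show i + 1 + j = i + j + 1 by ring]
    refine HasSum.congr_fun this fun k => ?_
    simp only [Function.comp, Equiv.subRight_apply, Equiv.coe_addRight, tt]
    grind

theorem tt_low (m : ℕ) : (q + 2 * ρ) ^ ⧉m ≤ (2 * m + 1) * tt q ρ ⧉m 0 := by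
  have h1 : ∑ k ∈ Icc (-(m:ℤ)) m, tt q ρ m k = (q + 2 * ρ) ^ m := by
    refine (hasSum_sum_of_ne_finset_zero (L := SummationFilter.unconditional ℤ) fun k hk => tt_supp m k ?_).unique (tt_hasSum m)
    grind
  have h2 : ∑ k ∈ Icc (-(m:ℤ)) m, tt q ρ m k * tt q ρ m (0 - k) = tt q ρ (m + m) 0 := by
    refine (hasSum_sum_of_ne_finset_zero (L := SummationFilter.unconditional ℤ) fun k hk => ?_).unique (tt_conv m m 0)
    rw [tt_supp m k, zero_mul]
    grind
  have h3 := sq_sum_le_card_mul_sum_sq (s := Icc (-(m:ℤ)) m) (f := fun k => tt q ρ m k)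
  rw [h1, ← pow_mul, mul_comm m 2] at h3
  refine h3.trans (le_of_eq ?_)
  rw [two_mul m, ← h2]
  congr 1
  · rw [Int.card_Icc]
    have : ((m:ℤ) + 1 - -(m:ℤ)).toNat = 2 * m + 1 := by omega
    simp_all
  · refine sum_congr rfl fun k _ => ?_
    rw [zero_sub, tt_sym, sq]

theorem tt_low' (hq : 0 ≤ q) (hρ : 0 ≤ ρ) (hu : 1 ≤ q + 2 * ρ) (i : ℕ) : 1 / 2 ≤ ⤒i * (tt q ρ i 0 + tt q ρ i 1) := by
  have h := tt_nonneg hq hρ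
  rcases Nat.even_or_odd' i with ⟨m, rfl | rfl⟩
  · have := tt_low (q := q) (ρ := ρ) m
    have h1 := one_le_pow₀ hu (n := 2 * m)
    have h2 := h ⧉m 1
    push_cast
    nlinarith
  · have h0 := tt_low (q := q) (ρ := ρ) m
    have h1 := one_le_pow₀ hu (n := 2 * m)
    have e : (q + ρ) * tt q ρ ⧉m 0 ≤ tt q ρ (2 * m + 1) 0 + tt q ρ (2 * m + 1) 1 := by
      simp only [tt]
      have := h ⧉m (0 - 1); have := h ⧉m (0 + 1); have := h ⧉m (1 + 1); have := h ⧉m 1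
      have e : 0 ≤ ρ * tt q ρ ⧉m (0 - 1) + ρ * tt q ρ ⧉m (0 + 1) + q * tt q ρ ⧉m 1 + ρ * tt q ρ ⧉m (1 + 1) := by positivity
      rw [sub_self]; linarith
    have h3 := h ⧉m 0
    have h4 : 1 / 2 * tt q ρ ⧉m 0 ≤ (q + ρ) * tt q ρ ⧉m 0 := mul_le_mul_of_nonneg_right ▲ h3
    push_cast
    nlinarith
end

section
theorem yy_par (r : ℝ) (i : ℕ) : ∀ n : ℤ, (i + n) % 2 = 1 → yy 0 r i n = 0 := by
  induction i with
  | zero => intro n hn; simp only [yy]; grind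
  | succ i ih =>
    intro n hn; push_cast at hn; simp only [yy]; grind

theorem yy_neg1 (q r : ℝ) (i : ℕ) : yy q r i (-1) = r * yy q r i 1 := by
  simpa using yy_sym (K := ℝ) (q := q) (r := r) i 1

theorem yy_up {q r q' r' : ℝ} (hq : 0 ≤ q) (hr : 0 ≤ r) (h1 : q ≤ q') (h2 : r ≤ r') (i : ℕ) : ∀ n,
    yy q' r' i n - yy q r i n ≤ i * ((q' - q) * yy q' r' ⤓i n + (r' - r) * yy q' r' ⤓i ⤒n) := by
  induction i with
  | zero => intro n; simp [yy]
  | succ i ih =>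
    intro n
    have e1 := ih ⤓n
    have e2 := mul_le_mul_of_nonneg_left (ih n) hq
    have e3 := mul_le_mul_of_nonneg_left (ih ⤒n) hr
    have P := yy_nonneg (hq.trans h1) (hr.trans h2) ⤓i
    have d1 := sub_nonneg.2 h1
    have d2 := sub_nonneg.2 h2
    have e2' : q * (i * ((q' - q) * yy q' r' ⤓i n + (r' - r) * yy q' r' ⤓i ⤒n)) ≤
      q' * (i * ((q' - q) * yy q' r' ⤓i n + (r' - r) * yy q' r' ⤓i ⤒n)) :=
      mul_le_mul_of_nonneg_right h1 (by have := P n; have := P ⤒n; positivity)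
    have e3' : r * (i * ((q' - q) * yy q' r' ⤓i ⤒n + (r' - r) * yy q' r' ⤓i (n + 1 + 1))) ≤
      r' * (i * ((q' - q) * yy q' r' ⤓i ⤒n + (r' - r) * yy q' r' ⤓i (n + 1 + 1))) :=
      mul_le_mul_of_nonneg_right h2 (by have := P (n+1+1); have := P ⤒n; positivity)
    rcases i with _ | i
    · simp [yy]; split_ifs <;> linarith
    · simp only [Nat.add_sub_cancel] at *
      have x1 : yy q' r' ⤒i n = yy q' r' i ⤓n + q' * yy q' r' i n + r' * yy q' r' i ⤒n := rfl
      have x2 : yy q' r' ⤒i ⤒n = yy q' r' i n + q' * yy q' r' i ⤒n + r' * yy q' r' i (n+1+1) := by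
        simp only [yy, add_sub_cancel_right]
      rw [sub_add_cancel] at e1
      have y1 : yy q' r' (i+1+1) n = yy q' r' ⤒i ⤓n + q' * yy q' r' ⤒i n + r' * yy q' r' ⤒i ⤒n := rfl
      have y2 : yy q r (i+1+1) n = yy q r ⤒i ⤓n + q * yy q r ⤒i n + r * yy q r ⤒i ⤒n := rfl
      push_cast at *
      linear_combination e1 + e2 + e3 + e2' + e3' + y1 - y2 + ⤒i * (q' - q) * (-x1) - ⤒i * (r' - r) * x2

theorem yy_dn {q r q' r' : ℝ} (hq : 0 ≤ q) (hr : 0 ≤ r) (h1 : q ≤ q') (h2 : r ≤ r') (i : ℕ) : ∀ n,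
    i * ((q' - q) * yy q r ⤓i n + (r' - r) * yy q r ⤓i ⤒n) ≤ yy q' r' i n - yy q r i n := by
  induction i with
  | zero => intro n; simp [yy]
  | succ i ih =>
    intro n
    have e1 := ih ⤓n
    have e2 := mul_le_mul_of_nonneg_left (ih n) hq
    have e3 := mul_le_mul_of_nonneg_left (ih ⤒n) hr
    have d1 := sub_nonneg.2 h1
    have d2 := sub_nonneg.2 h2
    have m1 := mul_le_mul_of_nonneg_left (yy_mono hq hr h1 h2 i n) d1
    have m2 := mul_le_mul_of_nonneg_left (yy_mono hq hr h1 h2 i ⤒n) d2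
    rcases i with _ | i
    · simp [yy]; split_ifs <;> linarith
    · simp only [Nat.add_sub_cancel] at *
      have x1 : yy q r ⤒i n = yy q r i ⤓n + q * yy q r i n + r * yy q r i ⤒n := rfl
      have x2 : yy q r ⤒i ⤒n = yy q r i n + q * yy q r i ⤒n + r * yy q r i (n+1+1) := by
        simp only [yy, add_sub_cancel_right]
      rw [sub_add_cancel] at e1
      have y1 : yy q' r' (i+1+1) n = yy q' r' ⤒i ⤓n + q' * yy q' r' ⤒i n + r' * yy q' r' ⤒i ⤒n := rfl
      have y2 : yy q r (i+1+1) n = yy q r ⤒i ⤓n + q * yy q r ⤒i n + r * yy q r ⤒i ⤒n := rfl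
      push_cast at *
      linear_combination e1 + e2 + e3 + m1 + m2 - y1 + y2 + ⤒i * (q' - q) * x1 + ⤒i * (r' - r) * x2

/-- partial sums -/
def fs (c : ℕ → ℝ) (n : ℤ) (N : ℕ) (q r : ℝ) : ℝ := ∑ i ∈ range N, c i * yy q r ⤓i n
def gs (c : ℕ → ℝ) (n : ℤ) (N : ℕ) (q r : ℝ) : ℝ := ∑ i ∈ range N, c i * ((i - 1 : ℕ) * yy q r (i - 2) n)

def Sol (c : ℕ → ℝ) (z q r : ℝ) : Prop := 0 ≤ z ∧ 0 ≤ q ∧ 0 ≤ r ∧ ∀ N, z * fs c 0 N q r ≤ q ∧ z * (1 + fs c (-1) N q r) ≤ r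

variable {c : ℕ → ℝ} (hc : ∀ i, 0 ≤ c i)

theorem fs_mono {q r q' r' : ℝ} (hc : ∀ i, 0 ≤ c i) (hq : 0 ≤ q) (hr : 0 ≤ r) (h1 : q ≤ q') (h2 : r ≤ r') (n N) : fs c n N q r ≤ fs c n N q' r' :=
  sum_le_sum fun i _ => mul_le_mul_of_nonneg_left (yy_mono hq hr h1 h2 _ _) (hc i)
theorem fs_N {q r : ℝ} (hc : ∀ i, 0 ≤ c i) (hq : 0 ≤ q) (hr : 0 ≤ r) (n) {N M : ℕ} (h : N ≤ M) : fs c n N q r ≤ fs c n M q r :=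
  sum_le_sum_of_subset_of_nonneg (range_subset_range.2 h) fun i _ _ => mul_nonneg (hc i) (yy_nonneg hq hr _ _)
theorem fs_cont (n N) : Continuous fun x : ℝ × ℝ => fs c n N x.1 x.2 := by
  unfold fs; exact continuous_finsetSum _ fun i _ => continuous_const.mul (yy_cont _ _)
theorem gs_cont (n N) : Continuous fun x : ℝ × ℝ => gs c n N x.1 x.2 := by
  unfold gs; exact continuous_finsetSum _ fun i _ => continuous_const.mul (continuous_const.mul (yy_cont _ _))

theorem fs_up {q r q' r' : ℝ} (hc : ∀ i, 0 ≤ c i) (hq : 0 ≤ q) (hr : 0 ≤ r) (h1 : q ≤ q') (h2 : r ≤ r') (n N) :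
    fs c n N q' r' - fs c n N q r ≤ (q' - q) * gs c n N q' r' + (r' - r) * gs c ⤒n N q' r' := by
  unfold fs gs
  rw [← sum_sub_distrib, mul_sum, mul_sum, ← sum_add_distrib]
  refine sum_le_sum fun i _ => ?_
  have := mul_le_mul_of_nonneg_left (yy_up hq hr h1 h2 ⤓i n) (hc i)
  grind

theorem fs_dn {q r q' r' : ℝ} (hc : ∀ i, 0 ≤ c i) (hq : 0 ≤ q) (hr : 0 ≤ r) (h1 : q ≤ q') (h2 : r ≤ r') (n) {N M : ℕ} (h : N ≤ M) :
    (q' - q) * gs c n N q r + (r' - r) * gs c ⤒n N q r ≤ fs c n M q' r' - fs c n M q r := by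
  have : fs c n N q' r' - fs c n N q r ≤ fs c n M q' r' - fs c n M q r := by
    unfold fs
    rw [← sum_sub_distrib, ← sum_sub_distrib]
    exact sum_le_sum_of_subset_of_nonneg (range_subset_range.2 h) fun i _ _ => by
      rw [← mul_sub]; exact mul_nonneg (hc i) (sub_nonneg.2 (yy_mono hq hr h1 h2 _ _))
  refine le_trans ?_ this
  unfold fs gs
  rw [← sum_sub_distrib, mul_sum, mul_sum, ← sum_add_distrib]
  refine sum_le_sum fun i _ => ?_
  have := mul_le_mul_of_nonneg_left (yy_dn hq hr h1 h2 ⤓i n) (hc i)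
  grind

/-- nonempty -/
theorem sol_init (hc : ∀ i, c i = 0 ∨ c i = 1) (h0 : c 0 = 0) : Sol c (1/128) (1/4) (1/64) := by
  have hb : ∀ N : ℕ, ∑ i ∈ range N, c i * (1/2:ℝ) ^ ⤓i ≤ 2 := by
    intro N
    have : ∑ i ∈ range N, c i * (1/2:ℝ) ^ ⤓i ≤ ∑ i ∈ range N, (1/2:ℝ) ^ i := by
      rcases N with _ | N
      · simp
      rw [sum_range_succ', sum_range_succ, h0]
      have h1 : ∑ i ∈ range N, c ⤒i * (1/2:ℝ) ^ (i + 1 - 1) ≤ ∑ i ∈ range N, (1/2:ℝ) ^ i := by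
        refine sum_le_sum fun i _ => ?_
        rw [Nat.add_sub_cancel]
        rcases hc ⤒i with h | h <;> simp [h]
      have h2 : ↟0 ≤ (1/2:ℝ) ^ N := by positivity
      linarith
    refine this.trans ?_
    have h3 := geom_sum_eq (show (1/2:ℝ) ≠ 1 by norm_num) N
    rw [h3]
    have h2 : ↟0 ≤ (1/2:ℝ) ^ N := by positivity
    grind
  have hy : ∀ i (n : ℤ), yy (1/4:ℝ) (1/64) i n * (1/8) ^ n ≤ (1/2) ^ i := by
    intro i n
    have := tt_le (q := 1/4) (ρ := 1/8) ▽ ▽ i n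
    rw [tt_yy ▽] at this
    linarith
  have hc0 : ∀ i, 0 ≤ c i := fun i => by grind
  refine ⟨by norm_num, by norm_num, by norm_num, fun N => ⟨?_, ?_⟩⟩
  · have : fs c 0 N (1/4) (1/64) ≤ 2 := (sum_le_sum fun i _ => mul_le_mul_of_nonneg_left (by simpa using hy ⤓i 0) (hc0 i)).trans (by simpa using hb N)
    linarith
  · have : fs c (-1) N (1/4) (1/64) ≤ 1/8 * 2 := by
      refine le_trans ?_ (mul_le_mul_of_nonneg_left (hb N) ▽)
      rw [mul_sum]
      refine sum_le_sum fun i _ => ?_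
      have := mul_le_mul_of_nonneg_left (hy ⤓i (-1)) (hc0 i)
      linarith
    linarith

theorem sol_max (hc : ∀ i, c i = 0 ∨ c i = 1) (h0 : c 0 = 0) (i0 : ℕ) (hi : 3 ≤ i0) (hi0 : c i0 = 1) :
    ∃ z q r, 0 < z ∧ Sol c z q r ∧ ∀ z' q' r', Sol c z' q' r' → z' ≤ z := by
  have hc0 : ∀ i, 0 ≤ c i := fun i => by grind
  -- bounds
  have key : ∃ B : ℝ, ∀ z q r, Sol c z q r → 1/128 ≤ z → z ≤ B ∧ q ≤ B ∧ r ≤ B := by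
    have one : ∀ (n : ℤ) {q r : ℝ}, 0 ≤ q → 0 ≤ r → yy q r ⤓i0 n ≤ fs c n ⤒i0 q r := fun n q r hq hr => by
      have := single_le_sum (f := fun i => c i * yy q r ⤓i n) (fun i _ => mul_nonneg (hc0 i) (yy_nonneg hq hr _ _)) (self_mem_range_succ i0)
      simpa [hi0, fs] using this
    refine ⟨128 ^ 2 + 128, fun z q r ⟨hz, hq, hr, h⟩ hz1 => ?_⟩
    have hzr : z ≤ r := by
      have := (h 0).2; simpa [fs] using this
    have a1 : q ^ ⤓i0 ≤ 128 * q := by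
      have := (h ⤒i0).1
      have h2 := (yy_qpow hq hr ⤓i0).trans (one 0 hq hr)
      nlinarith
    have pw : ∀ {x : ℝ} {m : ℕ}, 2 ≤ m → 0 ≤ x → x ^ m ≤ 128 * x → x ≤ 128 := by
      intro x m hm hx h
      by_contra! hh
      have : x ^ 2 ≤ x ^ m := pow_le_pow_right₀ ▲ hm
      nlinarith
    have hq1 : q ≤ 128 := pw ◇ hq a1
    have hr1 : r ≤ 128 ^ 2 := by
      rcases Nat.even_or_odd' i0 with ⟨m, hm | hm⟩
      · have := (h ⤒i0).2
        have h2 := one (-1) hq hr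
        have h3 := yy_rpow hq hr ⤓m (-1) 1
        rw [show 1 + 2 * ⤓m = i0 - 1 by omega] at h3
        have h4 : yy q r 1 (-1) = r := by simp [yy]
        rw [h4, ← pow_succ, show m - 1 + 1 = m by omega] at h3
        have : r ^ m ≤ 128 * r := by nlinarith
        grind
      · have := (h ⤒i0).1
        have h2 := one 0 hq hr
        have h3 := yy_rpow hq hr m 0 0
        rw [show 0 + 2 * m = i0 - 1 by omega] at h3
        have h4 : yy q r 0 0 = 1 := by simp [yy]
        rw [h4, mul_one] at h3
        have h5 : r ^ m ≤ 128 ^ 2 := by nlinarith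
        by_contra! hh
        have : r ^ 1 ≤ r ^ m := pow_le_pow_right₀ ▲ ◇
        linarith
    grind
  obtain ⟨B, hB⟩ := key
  let T : Set (ℝ × ℝ × ℝ) := {p | 1/128 ≤ p.1 ∧ Sol c p.1 p.2.1 p.2.2}
  have hT : IsCompact T := by
    refine IsCompact.of_isClosed_subset (isCompact_Icc (a := (↟0, ↟0, ↟0)) (b := (B, B, B))) ?_ ?_
    · have : T = {p : ℝ × ℝ × ℝ | 1/128 ≤ p.1} ∩ ({p | 0 ≤ p.1} ∩ ({p | 0 ≤ p.2.1} ∩ ({p | 0 ≤ p.2.2} ∩ ⋂ N, ({p | p.1 * fs c 0 N p.2.1 p.2.2 ≤ p.2.1} ∩ {p | p.1 * (1 + fs c (-1) N p.2.1 p.2.2) ≤ p.2.2})))) := by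
        ext p; simp only [T, Sol, Set.mem_ofPred_eq, Set.mem_inter_iff, Set.mem_iInter]
      rw [this]
      have hf : ∀ n N, Continuous fun p : ℝ × ℝ × ℝ => fs c n N p.2.1 p.2.2 := fun n N => (fs_cont n N).comp continuous_snd
      refine (isClosed_le ▼ ▼).inter ((isClosed_le ▼ ▼).inter ((isClosed_le ▼ ▼).inter ((isClosed_le ▼ ▼).inter (isClosed_iInter fun N => ?_))))
      have := hf 0 N; have := hf (-1) N
      exact (isClosed_le ▼ ▼).inter (isClosed_le ▼ ▼)
    · rintro ⟨z, q, r⟩ ⟨h1, h2⟩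
      obtain ⟨b1, b2, b3⟩ := hB z q r h2 h1
      exact ⟨⟨h2.1, h2.2.1, h2.2.2.1⟩, ⟨b1, b2, b3⟩⟩
  obtain ⟨⟨z, q, r⟩, ⟨hz, hs⟩, hm⟩ := hT.exists_isMaxOn ⟨(1/128, 1/4, 1/64), le_rfl, sol_init hc h0⟩ continuous_fst.continuousOn
  simp only at hz hs
  refine ⟨z, q, r, by linarith, hs, fun z' q' r' h' => ?_⟩
  by_cases hz' : 1/128 ≤ z'
  · exact hm (show ((z', q', r') : ℝ × ℝ × ℝ) ∈ T from ⟨hz', h'⟩)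
  · linarith
end

section
open Filter Topology

variable {c : ℕ → ℝ}

theorem gs_neg1 (N q r) : gs c (-1) N q r = r * gs c 1 N q r := by
  unfold gs; rw [mul_sum]; exact sum_congr rfl fun i _ => by rw [yy_neg1]; ring

theorem sol_r {z q r : ℝ} (h : Sol c z q r) : z ≤ r := by
  have := (h.2.2.2 0).2; simpa [fs] using this

theorem crit_norm (hc : ∀ i, c i = 0 ∨ c i = 1) (h0 : c 0 = 0) (i0 : ℕ) (hi : 3 ≤ i0) (hi0 : c i0 = 1) :
    ∃ z q r ε : ℝ, 0 < z ∧ Sol c z q r ∧ (∀ z' q' r', Sol c z' q' r' → z' ≤ z) ∧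
      ((ε = 1 ∧ 0 < q) ∨ (ε = 0 ∧ q = 0 ∧ ∀ i, Odd i → c i = 0)) := by
  have hc0 : ∀ i, 0 ≤ c i := fun i => by grind
  obtain ⟨z, q, r, hz, hs, hm⟩ := sol_max hc h0 i0 hi hi0
  by_cases hb : ∀ i, Odd i → c i = 0
  · refine ⟨z, 0, r, 0, hz, ⟨hs.1, le_rfl, hs.2.2.1, fun N => ⟨?_, ?_⟩⟩, hm, Or.inr ⟨rfl, rfl, hb⟩⟩
    · have : fs c 0 N 0 r = 0 := sum_eq_zero fun i _ => by
        rcases Nat.even_or_odd i with h | h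
        · by_cases hi : i = 0
          · rw [hi, h0, zero_mul]
          rw [yy_par, mul_zero]; grind
        simp_all
      rw [this, mul_zero]
    · exact (mul_le_mul_of_nonneg_left (add_le_add_right (fs_mono hc0 le_rfl hs.2.2.1 hs.2.1 le_rfl _ _) _) hs.1).trans (hs.2.2.2 N).2
  · push Not at hb
    obtain ⟨i, hi, hci⟩ := hb
    refine ⟨z, q, r, 1, hz, hs, hm, Or.inl ⟨rfl, ?_⟩⟩
    obtain ⟨m, rfl⟩ := hi
    have h1 := single_le_sum (f := fun i => c i * yy q r ⤓i 0) (fun i _ => mul_nonneg (hc0 i) (yy_nonneg hs.2.1 hs.2.2.1 _ _)) (self_mem_range_succ (2 * m + 1))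
    simp only [(hc _).resolve_left hci, one_mul] at h1
    have h3 := yy_rpow hs.2.1 hs.2.2.1 m 0 0
    rw [show 0 + 2 * m = 2 * m + 1 - 1 by omega] at h3
    have h4 : yy q r 0 0 = 1 := by simp [yy]
    rw [h4, mul_one] at h3
    have h5 : 0 < r ^ m := pow_pos (hz.trans_le (sol_r hs)) m
    have h6 := (hs.2.2.2 (2 * m + 1 + 1)).1
    exact (mul_pos hz (h5.trans_le (h3.trans h1))).trans_le h6

theorem par0 (hb : ∀ i, Odd i → c i = 0) (h0 : c 0 = 0) (N r) : fs c 0 N 0 r = 0 := sum_eq_zero fun i _ => by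
  rcases Nat.even_or_odd i with h | h
  · by_cases hi : i = 0
    · rw [hi, h0, zero_mul]
    rw [yy_par, mul_zero]; grind
  simp_all

theorem par1 (hb : ∀ i, Odd i → c i = 0) (N r) : gs c 1 N 0 r = 0 := sum_eq_zero fun i _ => by
  rcases Nat.even_or_odd i with h | h
  · rw [yy_par, mul_zero, mul_zero]; grind
  simp_all

theorem critB (hc : ∀ i, 0 ≤ c i) (h0 : c 0 = 0) {z q r ε : ℝ} (hz : 0 < z) (hs : Sol c z q r) (hm : ∀ z' q' r', Sol c z' q' r' → z' ≤ z)
    (hε : (ε = 1 ∧ 0 < q) ∨ (ε = 0 ∧ q = 0 ∧ ∀ i, Odd i → c i = 0)) (N : ℕ) :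
    z * (gs c 0 N q r + √r * gs c 1 N q r) ≤ 1 := by
  by_contra! hlt
  have hr : 0 < r := hz.trans_le (sol_r hs)
  have hρ : 0 < √r := Real.sqrt_pos.2 hr
  have hρ2 : √r * √r = r := Real.mul_self_sqrt hr.le
  have cg : ∀ n, Tendsto (fun s : ℝ => gs c n N (q - s * ε) (r - s * √r)) (𝓝[>] 0) (𝓝 (gs c n N q r)) := fun n => by
    have : Continuous fun s : ℝ => gs c n N (q - s * ε) (r - s * √r) := (gs_cont n N).comp (by fun_prop : Continuous fun s : ℝ => (q - s * ε, r - s * √r))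
    have := this.tendsto 0
    simp only [zero_mul, sub_zero] at this
    exact this.mono_left nhdsWithin_le_nhds
  have e0 : ∀ᶠ s : ℝ in 𝓝[>] 0, ε = 1 → 1 < z * (ε * gs c 0 N (q - s * ε) (r - s * √r) + √r * gs c 1 N (q - s * ε) (r - s * √r)) := by
    by_cases h : ε = 1
    · have := (((cg 0).const_mul ε).add ((cg 1).const_mul √r)).const_mul z
      filter_upwards [this.eventually_const_lt (u := 1) (by simp_all)] with s hs _ using hs
    simp_all
  have hB : ε * gs c 1 N q r = gs c 1 N q r := by
    rcases hε with ⟨h, _⟩ | ⟨_, h, hb⟩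
    · rw [h, one_mul]
    · rw [h, par1 hb, mul_zero]
  have e1 : ∀ᶠ s : ℝ in 𝓝[>] 0, √r < z * (ε * gs c (-1) N (q - s * ε) (r - s * √r) + √r * gs c 0 N (q - s * ε) (r - s * √r)) := by
    have := (((cg (-1)).const_mul ε).add ((cg 0).const_mul √r)).const_mul z
    refine this.eventually_const_lt ?_
    rw [gs_neg1]
    have : z * (ε * (r * gs c 1 N q r) + √r * gs c 0 N q r) = √r * (z * (gs c 0 N q r + √r * gs c 1 N q r)) := by
      grind
    rw [this]; nlinarith
  have e2 : ∀ᶠ s : ℝ in 𝓝[>] 0, s * √r ≤ r ∧ s * ε ≤ q := by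
    have c1 : Tendsto (fun s : ℝ => s * √r) (𝓝[>] 0) (𝓝 0) := by
      have : Continuous fun s : ℝ => s * √r := by fun_prop
      simpa using (this.tendsto 0).mono_left (nhdsWithin_le_nhds (s := Set.Ioi 0))
    have c2 : Tendsto (fun s : ℝ => s * ε) (𝓝[>] 0) (𝓝 0) := by
      have : Continuous fun s : ℝ => s * ε := by fun_prop
      simpa using (this.tendsto 0).mono_left (nhdsWithin_le_nhds (s := Set.Ioi 0))
    refine (c1.eventually_le_const hr).and ?_
    rcases hε with ⟨_, h⟩ | ⟨h, h', _⟩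
    · exact c2.eventually_le_const h
    · simp [h, h']
  obtain ⟨s, h1, h2, ⟨h3, h4⟩, hs0⟩ := (e0.and (e1.and (e2.and self_mem_nhdsWithin))).exists
  have hs0 : 0 < s := hs0
  have hε0 : 0 ≤ ε := by grind <;> simp [h]
  have hq' : 0 ≤ q - s * ε := by linarith
  have hr' : 0 ≤ r - s * √r := by linarith
  have hqq : q - s * ε ≤ q := by simp_all
  have hrr : r - s * √r ≤ r := by simp_all
  obtain ⟨q', hq'e⟩ : ∃ q', q' = q - s * ε := ⟨_, rfl⟩
  obtain ⟨r', hr'e⟩ : ∃ r', r' = r - s * √r := ⟨_, rfl⟩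
  rw [← hq'e] at h1 h2 hq' hqq
  rw [← hr'e] at h1 h2 hr' hrr
  have d0 := fun M (h : N ≤ M) => fs_dn hc hq' hr' hqq hrr 0 h
  have d1 := fun M (h : N ≤ M) => fs_dn hc hq' hr' hqq hrr (-1) h
  simp only [zero_add, show (-1:ℤ) + 1 = 0 by norm_num, show q - q' = s * ε by rw [hq'e]; ring, show r - r' = s * √r by rw [hr'e]; ring] at d0 d1
  set a0 := ε * gs c 0 N q' r' + √r * gs c 1 N q' r' with ha0
  set a1 := ε * gs c (-1) N q' r' + √r * gs c 0 N q' r' with ha1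
  have k0 : ε = 1 → ∀ M, z * fs c 0 M q' r' ≤ q' - s * (z * a0 - 1) := fun h M => by
    refine (mul_le_mul_of_nonneg_left (fs_N hc hq' hr' 0 (le_max_right N M)) hz.le).trans ?_
    have u1 := d0 _ (le_max_left N M)
    have u2 := (hs.2.2.2 (max N M)).1
    have u3 := mul_le_mul_of_nonneg_left u1 hz.le
    have : s * ε * gs c 0 N q' r' + s * √r * gs c 1 N q' r' = s * a0 := by rw [ha0]; ring
    rw [this] at u3
    rw [h] at hq'e
    linarith
  have k1 : ∀ M, z * (1 + fs c (-1) M q' r') ≤ r' - s * (z * a1 - √r) := fun M => by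
    refine (mul_le_mul_of_nonneg_left (add_le_add_right (fs_N hc hq' hr' (-1) (le_max_right N M)) 1) hz.le).trans ?_
    have u1 := d1 _ (le_max_left N M)
    have u2 := (hs.2.2.2 (max N M)).2
    have u3 := mul_le_mul_of_nonneg_left u1 hz.le
    linarith
  have p1 : 0 < s * (z * a1 - √r) := mul_pos hs0 ▲
  obtain ⟨η, hη, hη1, hη2⟩ : ∃ η > 0, η * r' ≤ s * (z * a1 - √r) ∧ (ε = 1 → η * q' ≤ s * (z * a0 - 1)) := by
    by_cases h : ε = 1
    · have p0 : 0 < s * (z * a0 - 1) := mul_pos hs0 (by linarith [h1 h])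
      refine ⟨min (s * (z * a1 - √r) / ⤒r') (s * (z * a0 - 1) / ⤒q'), lt_min ◆ ◆, ?_, fun _ => ?_⟩
      · refine (mul_le_mul_of_nonneg_right (min_le_left _ _) hr').trans ?_
        rw [div_mul_eq_mul_div, div_le_iff₀ ▲]; linarith
      · refine (mul_le_mul_of_nonneg_right (min_le_right _ _) hq').trans ?_
        rw [div_mul_eq_mul_div, div_le_iff₀ ▲]; linarith
    · refine ⟨s * (z * a1 - √r) / ⤒r', by positivity, ?_, fun h' => absurd h' h⟩
      rw [div_mul_eq_mul_div, div_le_iff₀ ▲]; linarith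
  have : Sol c (z * (1 + η)) q' r' := by
    refine ⟨by positivity, hq', hr', fun M => ⟨?_, ?_⟩⟩
    · rcases hε with ⟨h, _⟩ | ⟨h, h', hb⟩
      · have := mul_le_mul_of_nonneg_left (k0 h M) (by linarith : 0 ≤ 1 + η)
        have p0 : 0 < s * (z * a0 - 1) := mul_pos hs0 (by linarith [h1 h])
        nlinarith [hη2 h, mul_pos hη p0]
      · rw [h, h', mul_zero, sub_zero] at hq'e
        rw [hq'e, par0 hb h0, mul_zero]
    · have := mul_le_mul_of_nonneg_left (k1 M) (by linarith : 0 ≤ 1 + η)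
      nlinarith [mul_pos hη p1]
  have := hm _ _ _ this
  nlinarith [mul_pos hz hη]

theorem critC (hc : ∀ i, c i = 0 ∨ c i = 1) {z q r : ℝ} (hz : 0 < z) (hq : 0 ≤ q) (hr : 0 < r)
    (hB : ∀ N, z * (gs c 0 N q r + √r * gs c 1 N q r) ≤ 1) : ∃ u1, q + 2 * √r < u1 ∧ ∀ p : ℕ, Summable fun i => c i * (⤒i * u1 ^ (i - p)) := by
  have hc0 : ∀ i, 0 ≤ c i := fun i => by grind
  have hρ : 0 < √r := Real.sqrt_pos.2 hr
  by_cases hf : ∃ N, ∀ i ≥ N, c i = 0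
  · obtain ⟨N, hN⟩ := hf
    refine ⟨q + 2 * √r + 1, by linarith, fun p => ?_⟩
    refine summable_of_ne_finset_zero (s := range N) fun i hi => ?_
    simp_all
  have hu : q + 2 * √r < 1 := by
    by_contra! hu
    apply hf
    have hterm : ∀ i, 2 ≤ i → c i / 2 ≤ c i * ((i - 1 : ℕ) * yy q r (i - 2) 0) + √r * (c i * ((i - 1 : ℕ) * yy q r (i - 2) 1)) := by
      intro i hi
      have := tt_low' hq hρ.le hu (i - 2)
      rw [tt_yy hρ.ne', tt_yy hρ.ne', Real.sq_sqrt hr.le] at this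
      simp only [zpow_zero, zpow_one, mul_one] at this
      have e : ((i - 1 : ℕ) : ℝ) = ((i - 2 : ℕ) : ℝ) + 1 := by rw [show i - 1 = i - 2 + 1 by omega]; push_cast; rfl
      rw [e]
      have := mul_le_mul_of_nonneg_left this (hc0 i)
      linarith
    have hsum : Summable fun i => c (i + 2) := by
      refine summable_of_sum_range_le (c := 2 / z) (fun i => hc0 _) fun N => ?_
      have h1 := hB (2 + N)
      unfold gs at h1
      rw [mul_sum, ← sum_add_distrib, sum_range_add] at h1
      have h2 : ∑ i ∈ range N, c (i + 2) / 2 ≤ ∑ x ∈ range N, (c (2 + x) * (((2 + x - 1 : ℕ)) * yy q r (2 + x - 2) 0) + √r * (c (2 + x) * (((2 + x - 1 : ℕ)) * yy q r (2 + x - 2) 1))) :=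
        sum_le_sum fun i _ => by grind
      have h3 : 0 ≤ ∑ x ∈ range 2, (c x * (((x - 1 : ℕ)) * yy q r (x - 2) 0) + √r * (c x * (((x - 1 : ℕ)) * yy q r (x - 2) 1))) :=
        sum_nonneg fun i _ => by
          simp_all
      rw [← sum_div] at h2
      rw [le_div_iff₀ hz]
      nlinarith
    have := hsum.tendsto_atTop_zero.eventually_lt_const (show ↟0 < 1 by norm_num)
    obtain ⟨N, hN⟩ := eventually_atTop.1 this
    refine ⟨N + 2, fun i hi => ?_⟩
    have := hN (i - 2) ◇
    grind
  refine ⟨(q + 2 * √r + 1) / 2, by linarith, fun p => ?_⟩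
  set u := (q + 2 * √r + 1) / 2
  have hu0 : 0 ≤ u := by positivity
  have hu1 : u < 1 := by simp only [u]; linarith
  have hu2 : 0 < u := by positivity
  have s1 : Summable fun i : ℕ => (↟i + 1) * u ^ (i - p) := by
    have a := (summable_pow_mul_geometric_of_norm_lt_one 1 (by rwa [Real.norm_of_nonneg hu0])).mul_right (u ^ p)⁻¹
    have b := (summable_geometric_of_lt_one hu0 hu1).mul_right (u ^ p)⁻¹
    have := a.add b
    refine this.of_norm_bounded_eventually_nat (eventually_atTop.2 ⟨p, fun i hi => ?_⟩)
    rw [Real.norm_of_nonneg ◆, pow_sub₀ _ hu2.ne' hi, pow_one]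
    apply le_of_eq; ring
  refine s1.of_nonneg_of_le (fun i => by have := hc0 i; positivity) fun i => ?_
  have : 0 ≤ (↟i + 1) * u ^ (i - p) := by positivity
  rcases hc i with h | h <;> simp [h, this]
end

section
open Filter Topology

variable {c : ℕ → ℝ}

theorem yb {q r u : ℝ} (hq : 0 ≤ q) (hr : 0 < r) (hu : q + 2 * √r ≤ u) (i : ℕ) : yy q r i 0 ≤ u ^ i ∧ yy q r i 1 ≤ u ^ i / √r := by
  have hρ : 0 < √r := Real.sqrt_pos.2 hr
  have h1 := (tt_le hq hρ.le i 0).trans (pow_le_pow_left₀ ◆ hu i)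
  have h2 := (tt_le hq hρ.le i 1).trans (pow_le_pow_left₀ ◆ hu i)
  rw [tt_yy hρ.ne', Real.sq_sqrt hr.le] at h1 h2
  simp only [zpow_zero, zpow_one, mul_one] at h1 h2
  exact ⟨h1, by rwa [le_div_iff₀ hρ]⟩

theorem critD (hc : ∀ i, c i = 0 ∨ c i = 1) (h0 : c 0 = 0) (i0 : ℕ) (hi : 3 ≤ i0) (hi0 : c i0 = 1) {z q r ε : ℝ} (hz : 0 < z) (hs : Sol c z q r)
    (hε : (ε = 1 ∧ 0 < q) ∨ (ε = 0 ∧ q = 0 ∧ ∀ i, Odd i → c i = 0))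
    (hB : ∀ N, z * (gs c 0 N q r + √r * gs c 1 N q r) ≤ 1) :
    ∃ z1 q1 r1, z < z1 ∧ 0 ≤ q1 ∧ 0 < r1 ∧ r / z < r1 / z1 ∧ (∀ N, z1 * fs c 0 N q1 r1 ≤ q1) ∧ ∃ B, ∀ N, fs c 1 N q1 r1 ≤ B := by
  have hc0 : ∀ i, 0 ≤ c i := fun i => by grind
  have hr : 0 < r := hz.trans_le (sol_r hs)
  have hρ : 0 < √r := Real.sqrt_pos.2 hr
  have hq : 0 ≤ q := hs.2.1
  obtain ⟨u1, hu1, hsm⟩ := critC hc hz hq hr hB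
  have hBd : ∀ q1 r1, 0 ≤ q1 → 0 < r1 → q1 + 2 * √r1 ≤ u1 → ∃ B, ∀ N, fs c 1 N q1 r1 ≤ B := fun q1 r1 h1 h2 h3 => by
    have hu0 : 0 ≤ u1 := le_trans ◆ h3
    have hρ1 : 0 < √r1 := Real.sqrt_pos.2 h2
    refine ⟨∑' i, c i * (⤒i * u1 ^ ⤓i) / √r1, fun N => ?_⟩
    refine (sum_le_sum fun i _ => ?_).trans (((hsm 1).div_const _).sum_le_tsum (range N) fun i _ => by have := hc0 i; positivity)
    rw [mul_div_assoc]
    refine mul_le_mul_of_nonneg_left ((yb h1 h2 h3 ⤓i).2.trans ?_) (hc0 i)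
    gcongr
    have : 0 ≤ ↟i * u1 ^ ⤓i := by positivity
    linarith
  have e1 : ∀ᶠ s : ℝ in 𝓝[>] 0, q + s + 2 * √(r + √r / 2 * s) < u1 := by
    have : Continuous fun s : ℝ => q + s + 2 * √(r + √r / 2 * s) := by fun_prop
    have := this.tendsto 0
    simp only [mul_zero, add_zero] at this
    exact (this.mono_left nhdsWithin_le_nhds).eventually_lt_const hu1
  rcases hε with ⟨_, hq0⟩ | ⟨_, hq0, hb⟩
  · obtain ⟨s1, hs1, hs1p⟩ := (e1.and self_mem_nhdsWithin).exists
    have hs1p : 0 < s1 := hs1p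
    let T : ℝ → ℕ → ℝ := fun s i => c i * ((i - 1 : ℕ) * yy (q + s) (r + √r / 2 * s) (i - 2) 0) + √r / 2 * (c i * ((i - 1 : ℕ) * yy (q + s) (r + √r / 2 * s) (i - 2) 1))
    have T0 : ∀ s, 0 ≤ s → ∀ i, 0 ≤ T s i := fun s hs i => by
      have := hc0 i
      have a : 0 ≤ q + s := by positivity
      have b : 0 ≤ r + √r / 2 * s := by positivity
      have := yy_nonneg a b (i - 2) 0; have := yy_nonneg a b (i - 2) 1
      positivity
    have Tm : ∀ s, 0 ≤ s → s ≤ s1 → ∀ i, T s i ≤ T s1 i := fun s h1 h2 i => by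
      have := hc0 i
      have a : 0 ≤ q + s := by positivity
      have b : 0 ≤ r + √r / 2 * s := by positivity
      have a' : q + s ≤ q + s1 := by linarith
      have b' : r + √r / 2 * s ≤ r + √r / 2 * s1 := by gcongr
      have := yy_mono a b a' b' (i - 2) 0; have := yy_mono a b a' b' (i - 2) 1
      simp only [T]; gcongr
    have Ts : Summable (T s1) := by
      have hr1 : 0 < r + √r / 2 * s1 := by positivity
      have hρ1 := Real.sqrt_pos.2 hr1
      have hu0 : 0 ≤ u1 := le_trans ◆ hs1.le
      refine ((hsm 2).mul_left (1 + √r / 2 / √(r + √r / 2 * s1))).of_nonneg_of_le (T0 s1 hs1p.le) fun i => ?_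
      have y := yb (by positivity : 0 ≤ q + s1) hr1 hs1.le (i - 2)
      have hci := hc0 i
      have hn : ((i - 1 : ℕ) : ℝ) ≤ i + 1 := by
        have : i - 1 ≤ i + 1 := by omega
        exact_mod_cast this
      have a : T s1 i ≤ c i * ((i - 1 : ℕ) * u1 ^ (i - 2)) + √r / 2 * (c i * ((i - 1 : ℕ) * (u1 ^ (i - 2) / √(r + √r / 2 * s1)))) := by
        simp only [T]; gcongr; exact y.1; exact y.2
      have b : c i * ((i - 1 : ℕ) * u1 ^ (i - 2)) ≤ c i * (⤒i * u1 ^ (i - 2)) := by gcongr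
      have d := mul_le_mul_of_nonneg_left b (by positivity : 0 ≤ 1 + √r / 2 / √(r + √r / 2 * s1))
      grind
    have Tss : ∀ s, 0 ≤ s → s ≤ s1 → Summable (T s) := fun s h1 h2 => Ts.of_nonneg_of_le (T0 s h1) (Tm s h1 h2)
    have lim : Tendsto (fun s => ∑' i, T s i) (𝓝[>] 0) (𝓝 (∑' i, T 0 i)) := by
      refine tendsto_tsum_of_dominated_convergence Ts (fun i => ?_) ?_
      · have y : ∀ n, Continuous fun s : ℝ => yy (q + s) (r + √r / 2 * s) (i - 2) n := fun n => (yy_cont _ n).comp (by fun_prop : Continuous fun s : ℝ => (q + s, r + √r / 2 * s))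
        have : Continuous fun s => T s i := by
          fun_prop
        exact (this.tendsto 0).mono_left nhdsWithin_le_nhds
      · filter_upwards [Ioo_mem_nhdsGT hs1p] with s hs i
        rw [Real.norm_of_nonneg (T0 s hs.1.le i)]; grind
    have part : ∀ N s, ∑ i ∈ range N, T s i = gs c 0 N (q + s) (r + √r / 2 * s) + √r / 2 * gs c 1 N (q + s) (r + √r / 2 * s) := fun N s => by
      simp only [T, gs, mul_sum, sum_add_distrib]
    have hlt : z * ∑' i, T 0 i < 1 := by
      have hβ : 0 < yy q r (i0 - 2) 1 := by
        rw [show i0 - 2 = i0 - 3 + 1 by omega]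
        have h1 := yy_nonneg hq hr.le (i0 - 3) 1; have h2 := yy_nonneg hq hr.le (i0 - 3) (1 + 1)
        have h3 := yy_qpow hq hr.le (i0 - 3)
        have h4 : 0 < q ^ (i0 - 3) := pow_pos hq0 _
        simp only [yy]; rw [sub_self]; nlinarith
      have h1 := ((Tss 0 le_rfl hs1p.le).hasSum.tendsto_sum_nat).const_mul z
      have h2 : z * ∑' i, T 0 i ≤ 1 - z * (√r / 2 * yy q r (i0 - 2) 1) := by
        refine le_of_tendsto h1 (eventually_atTop.2 ⟨i0 + 1, fun N hN => ?_⟩)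
        rw [part, mul_zero, add_zero, add_zero]
        have g1 : yy q r (i0 - 2) 1 ≤ gs c 1 N q r := by
          have := single_le_sum (f := fun i => c i * ((i - 1 : ℕ) * yy q r (i - 2) 1)) (fun i _ => by
            have := hc0 i; have := yy_nonneg hq hr.le (i - 2) 1; positivity) (mem_range.2 (by omega : i0 < N))
          refine le_trans ?_ this
          simp only [hi0, one_mul]
          have : ↟1 ≤ (i0 - 1 : ℕ) := by exact_mod_cast (by omega : 1 ≤ i0 - 1)
          nlinarith
        have := hB N
        have g2 := mul_le_mul_of_nonneg_left g1 (by positivity : 0 ≤ z * (√r / 2))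
        linarith
      have : 0 < z * (√r / 2 * yy q r (i0 - 2) 1) := by positivity
      linarith
    obtain ⟨s, hs2, hs3⟩ := (((lim.const_mul z).eventually_lt_const hlt).and (Ioo_mem_nhdsGT hs1p)).exists
    have hs0 : 0 < s := hs3.1
    have hq1 : q ≤ q + s := by linarith
    have hr1 : r ≤ r + √r / 2 * s := by simp_all
    have main : ∀ N, z * fs c 0 N (q + s) (r + √r / 2 * s) ≤ q + s - s * (1 - z * ∑' i, T s i) := fun N => by
      have h1 := fs_up hc0 hq hr.le hq1 hr1 0 N
      have h2 := (hs.2.2.2 N).1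
      have h3 := (Tss s hs0.le hs3.2.le).sum_le_tsum (range N) fun i _ => T0 s hs0.le i
      rw [part] at h3
      rw [zero_add] at h1
      have h4 := mul_le_mul_of_nonneg_left h3 (mul_pos hz hs0).le
      have h5 := mul_le_mul_of_nonneg_left h1 hz.le
      linarith
    set δ := s * (1 - z * ∑' i, T s i)
    have hδ : 0 < δ := mul_pos hs0 ▲
    set η := min (δ / (q + s)) (√r / 2 * s / ⧉r)
    have hη : 0 < η := lt_min ◆ ◆
    have k1 : η * (q + s) ≤ δ := by
      have := mul_le_mul_of_nonneg_right (min_le_left (δ / (q + s)) (√r / 2 * s / ⧉r)) (by positivity : 0 ≤ q + s)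
      rwa [div_mul_cancel₀ _ ◆] at this
    have k2 : η * ⧉r ≤ √r / 2 * s := by
      have := mul_le_mul_of_nonneg_right (min_le_right (δ / (q + s)) (√r / 2 * s / ⧉r)) (by positivity : 0 ≤ 2 * r)
      rwa [div_mul_cancel₀ _ ◆] at this
    refine ⟨z * (1 + η), q + s, r + √r / 2 * s, by nlinarith, by positivity, by positivity, ?_, fun N => ?_, hBd _ _ ◆ ◆ ?_⟩
    · rw [div_lt_div_iff₀ hz ◆]
      have : r * (1 + η) < r + √r / 2 * s := by nlinarith
      nlinarith
    · have := mul_le_mul_of_nonneg_left (main N) (by linarith : 0 ≤ 1 + η)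
      nlinarith
    · refine le_trans ?_ hs1.le
      have : √(r + √r / 2 * s) ≤ √(r + √r / 2 * s1) := Real.sqrt_le_sqrt (by have := hs3.2; gcongr)
      linarith [hs3.2]
  · subst hq0
    obtain ⟨s, hs1, hs1p⟩ := (e1.and self_mem_nhdsWithin).exists
    have hs1p : 0 < s := hs1p
    have hp : 0 < √r / 2 * s := by positivity
    refine ⟨z * (1 + √r / 2 * s / ⧉r), 0, r + √r / 2 * s, ?_, le_rfl, by positivity, ?_, fun N => ?_, hBd _ _ le_rfl ◆ ▲⟩
    · simp_all
    · rw [div_lt_div_iff₀ hz ◆]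
      have : r * (1 + √r / 2 * s / ⧉r) < r + √r / 2 * s := by field_simp; nlinarith
      nlinarith
    · rw [par0 hb h0, mul_zero]

theorem crit1 (hc : ∀ i, c i = 0 ∨ c i = 1) (h0 : c 0 = 0) (i0 : ℕ) (hi : 3 ≤ i0) (hi0 : c i0 = 1) :
    ∃ z q r z1 q1 r1, 0 < z ∧ Sol c z q r ∧ (∀ z' q' r', Sol c z' q' r' → z' ≤ z) ∧
      z < z1 ∧ 0 ≤ q1 ∧ 0 < r1 ∧ r / z < r1 / z1 ∧ (∀ N, z1 * fs c 0 N q1 r1 ≤ q1) ∧ ∃ B, ∀ N, fs c 1 N q1 r1 ≤ B := by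
  have hc0 : ∀ i, 0 ≤ c i := fun i => by grind
  obtain ⟨z, q, r, ε, hz, hs, hm, hε⟩ := crit_norm hc h0 i0 hi hi0
  obtain ⟨z1, q1, r1, h⟩ := critD hc h0 i0 hi hi0 hz hs hε (critB hc0 h0 hz hs hm hε)
  exact ⟨z, q, r, z1, q1, r1, hz, hs, hm, h⟩
end

section
open Filter Topology

variable {c : ℕ → ℝ}

theorem fs_sc {g : ℝ} (hg : 0 < g) (h0 : c 0 = 0) (Q r : ℝ) (N : ℕ) :
    ∑ i ∈ range N, c i * g ^ i * yy Q r ⤓i 0 = g * fs c 0 N (g * Q) (g ^ 2 * r) ∧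
    r * ∑ i ∈ range N, c i * g ^ i * yy Q r ⤓i 1 = fs c (-1) N (g * Q) (g ^ 2 * r) := by
  constructor
  · unfold fs; rw [mul_sum]
    refine sum_congr rfl fun i _ => ?_
    rcases i with _ | i
    · simp [h0]
    have := yy_scale hg.ne' Q r i 0
    rw [zpow_zero, mul_one] at this
    grind
  · unfold fs; rw [mul_sum]
    refine sum_congr rfl fun i _ => ?_
    rcases i with _ | i
    · simp [h0]
    have := yy_scale hg.ne' Q r i (-1)
    rw [zpow_neg_one, mul_inv_eq_iff_eq_mul₀ hg.ne'] at this
    rw [Nat.add_sub_cancel, this, yy_neg1]; ring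

theorem Qit_nn (hc : ∀ i, 0 ≤ c i) {g r : ℝ} (hg : 0 ≤ g) (hr : 0 ≤ r) (N m) : 0 ≤ Qit c g r N m := by
  induction m with
  | zero => simp [Qit]
  | succ m ih => simp only [Qit]; exact sum_nonneg fun i _ => mul_nonneg (mul_nonneg (hc i) (pow_nonneg hg i)) (yy_nonneg ih hr _ _)

theorem Qit_mo (hc : ∀ i, 0 ≤ c i) {g r : ℝ} (hg : 0 ≤ g) (hr : 0 ≤ r) {N N' : ℕ} (hN : N ≤ N') (m) : Qit c g r N m ≤ Qit c g r N' m := by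
  induction m with
  | zero => simp [Qit]
  | succ m ih =>
    simp only [Qit]
    refine (sum_le_sum fun i _ => mul_le_mul_of_nonneg_left (yy_mono (Qit_nn hc hg hr N m) hr ih le_rfl _ _) (mul_nonneg (hc i) (pow_nonneg hg i))).trans ?_
    exact sum_le_sum_of_subset_of_nonneg (range_subset_range.2 hN) fun i _ _ => mul_nonneg (mul_nonneg (hc i) (pow_nonneg hg i)) (yy_nonneg (Qit_nn hc hg hr _ _) hr _ _)

theorem Qit_ms (hc : ∀ i, 0 ≤ c i) {g r : ℝ} (hg : 0 ≤ g) (hr : 0 ≤ r) (N m) : Qit c g r N m ≤ Qit c g r N ⤒m := by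
  induction m with
  | zero => rw [Qit]; exact Qit_nn hc hg hr N 1
  | succ m ih =>
    rw [Qit, Qit]
    exact sum_le_sum fun i _ => mul_le_mul_of_nonneg_left (yy_mono (Qit_nn hc hg hr N m) hr ih le_rfl _ _) (mul_nonneg (hc i) (pow_nonneg hg i))

/-- bound of the iterates by a supersolution -/
theorem Qit_sup (hc : ∀ i, 0 ≤ c i) {g r g' r' Q : ℝ} (hg : 0 ≤ g) (hr : 0 ≤ r) (h1 : g ≤ g') (h2 : r ≤ r') (hQ : 0 ≤ Q) (N)
    (h : ∑ i ∈ range N, c i * g' ^ i * yy Q r' ⤓i 0 ≤ Q) (m) : Qit c g r N m ≤ Q := by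
  induction m with
  | zero => simpa [Qit]
  | succ m ih =>
    simp only [Qit]
    refine (sum_le_sum fun i _ => ?_).trans h
    exact mul_le_mul (mul_le_mul_of_nonneg_left (pow_le_pow_left₀ hg h1 i) (hc i)) (yy_mono (Qit_nn hc hg hr N m) hr ih h2 _ _) (yy_nonneg (Qit_nn hc hg hr _ _) hr _ _)
      (mul_nonneg (hc i) (pow_nonneg (hg.trans h1) i))

theorem crit2 (hc : ∀ i, c i = 0 ∨ c i = 1) (h0 : c 0 = 0) (i0 : ℕ) (hi : 3 ≤ i0) (hi0 : c i0 = 1) :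
    ∃ g0 r0 g1 r1 : ℝ, 0 < g0 ∧ 0 < r0 ∧ g0 < g1 ∧ r0 < r1 ∧ (∃ B, ∀ N, Gam c g1 r1 N ≤ B) ∧ (∀ N, 1 + r0 * Gam c g0 r0 N ≤ r0) ∧
      (∀ g r, g0 < g → g ≤ g1 → 0 < r → r ≤ r1 → ∃ N, r < 1 + r * Gam c g r N) ∧
      ∃ q1, 0 ≤ q1 ∧ ∀ N, ∑ i ∈ range N, c i * g1 ^ i * q1 ^ ⤓i ≤ q1 := by
  have hc0 : ∀ i, 0 ≤ c i := fun i => by grind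
  obtain ⟨z, q, r, z1, q1, r1, hz, hs, hm, hzz, hq1, hr1, hrr, hf, B, hB⟩ := crit1 hc h0 i0 hi hi0
  have hr : 0 < r := hz.trans_le (sol_r hs)
  have hz1 : 0 < z1 := hz.trans hzz
  set g0 := √z with hg0e
  set g1 := √z1 with hg1e
  have hg0 : 0 < g0 := Real.sqrt_pos.2 hz
  have hg1 : 0 < g1 := Real.sqrt_pos.2 hz1
  have s0 : g0 ^ 2 = z := Real.sq_sqrt hz.le
  have s1 : g1 ^ 2 = z1 := Real.sq_sqrt hz1.le
  have hQ : ∀ N, ∑ i ∈ range N, c i * g1 ^ i * yy (q1 / g1) (r1 / z1) ⤓i 0 ≤ q1 / g1 := fun N => by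
    rw [(fs_sc hg1 h0 _ _ N).1, mul_div_cancel₀ _ hg1.ne', s1, mul_div_cancel₀ _ hz1.ne', le_div_iff₀ hg1]
    grind
  have hQ0 : 0 ≤ q1 / g1 := by positivity
  have hR0 : 0 < r1 / z1 := by positivity
  refine ⟨g0, r / z, g1, r1 / z1, hg0, by positivity, Real.sqrt_lt_sqrt hz.le hzz, hrr, ?_, fun N => ?_, fun g ρ h1 h2 h3 h4 => ?_, q1 / g1, hQ0, fun N => ?_⟩
  · refine ⟨(r1 / z1)⁻¹ * (r1 * B), fun N => ?_⟩
    have := (fs_sc hg1 h0 (q1 / g1) (r1 / z1) N).2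
    rw [mul_div_cancel₀ _ hg1.ne', s1, mul_div_cancel₀ _ hz1.ne'] at this
    have e : fs c (-1) N q1 r1 = r1 * fs c 1 N q1 r1 := by
      unfold fs; rw [mul_sum]; exact sum_congr rfl fun i _ => by rw [yy_neg1]; ring
    rw [← div_eq_inv_mul, le_div_iff₀' hR0]
    refine (mul_le_mul_of_nonneg_left (b := Gam c g1 (r1 / z1) N) (c := ∑ i ∈ range N, c i * g1 ^ i * yy (q1 / g1) (r1 / z1) ⤓i 1) ?_ hR0.le).trans ?_
    · exact sum_le_sum fun i _ => mul_le_mul_of_nonneg_left (yy_mono (Qit_nn hc0 hg1.le hR0.le _ _) hR0.le (Qit_sup hc0 hg1.le hR0.le le_rfl le_rfl hQ0 N (hQ N) N) le_rfl _ _) (mul_nonneg (hc0 i) (pow_nonneg hg1.le i))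
    simp_all
  · have hq := hs.2.1
    have hQ' : ∑ i ∈ range N, c i * g0 ^ i * yy (q / g0) (r / z) ⤓i 0 ≤ q / g0 := by
      rw [(fs_sc hg0 h0 _ _ N).1, mul_div_cancel₀ _ hg0.ne', s0, mul_div_cancel₀ _ hz.ne', le_div_iff₀ hg0]
      calc _ = g0 ^ 2 * fs c 0 N q r := by ring
        _ ≤ _ := by rw [s0]; exact (hs.2.2.2 N).1
    have hrz : 0 ≤ r / z := by positivity
    have h5 : Gam c g0 (r / z) N ≤ ∑ i ∈ range N, c i * g0 ^ i * yy (q / g0) (r / z) ⤓i 1 :=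
      sum_le_sum fun i _ => mul_le_mul_of_nonneg_left (yy_mono (Qit_nn hc0 hg0.le hrz _ _) hrz (Qit_sup hc0 hg0.le hrz le_rfl le_rfl ◆ N hQ' N) le_rfl _ _) (mul_nonneg (hc0 i) (pow_nonneg hg0.le i))
    have h6 := mul_le_mul_of_nonneg_left h5 hrz
    rw [(fs_sc hg0 h0 (q / g0) (r / z) N).2, mul_div_cancel₀ _ hg0.ne', s0, mul_div_cancel₀ _ hz.ne'] at h6
    have h7 := (hs.2.2.2 N).2
    have : 1 + fs c (-1) N q r ≤ r / z := by rw [le_div_iff₀ hz]; linarith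
    linarith
  · by_contra! hcon
    have hg : 0 < g := hg0.trans h1
    let Qn : ℕ → ℝ := fun N => Qit c g ρ N N
    have Qmo : Monotone Qn := monotone_nat_of_le_succ fun N => (Qit_ms hc0 hg.le h3.le N N).trans (Qit_mo hc0 hg.le h3.le (Nat.le_succ N) _)
    have Qb : BddAbove (Set.range Qn) := ⟨q1 / g1, by rintro _ ⟨N, rfl⟩; exact Qit_sup hc0 hg.le h3.le h2 h4 hQ0 N (hQ N) N⟩
    have Ql := tendsto_atTop_ciSup Qmo Qb
    set Q := ⨆ i, Qn i with hQe
    have Qle : ∀ N, Qn N ≤ Q := fun N => le_ciSup Qb N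
    have Q00 : 0 ≤ Q := (Qit_nn hc0 hg.le h3.le 0 0).trans (Qle 0)
    have cont : ∀ (M : ℕ) n, Tendsto (fun N => ∑ i ∈ range M, c i * g ^ i * yy (Qn N) ρ ⤓i n) atTop (𝓝 (∑ i ∈ range M, c i * g ^ i * yy Q ρ ⤓i n)) := fun M n =>
      tendsto_finsetSum _ fun i _ => (((yy_contq ρ ⤓i n).tendsto Q).comp Ql).const_mul _
    have sub : ∀ (M N : ℕ) n, M ≤ N → ∑ i ∈ range M, c i * g ^ i * yy (Qn N) ρ ⤓i n ≤ ∑ i ∈ range N, c i * g ^ i * yy (Qn N) ρ ⤓i n := fun M N n h =>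
      sum_le_sum_of_subset_of_nonneg (range_subset_range.2 h) fun i _ _ => mul_nonneg (mul_nonneg (hc0 i) (pow_nonneg hg.le i)) (yy_nonneg (Qit_nn hc0 hg.le h3.le _ _) h3.le _ _)
    have S1 : ∀ M, ∑ i ∈ range M, c i * g ^ i * yy Q ρ ⤓i 0 ≤ Q := fun M => by
      refine le_of_tendsto (cont M 0) (eventually_atTop.2 ⟨M, fun N hN => ?_⟩)
      refine (sub M N 0 hN).trans (le_trans ?_ (Qle ⤒N))
      exact (le_of_eq (by rw [Qit])).trans (Qit_mo hc0 hg.le h3.le (Nat.le_succ N) ⤒N)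
    have S2 : ∀ M, 1 + ρ * ∑ i ∈ range M, c i * g ^ i * yy Q ρ ⤓i 1 ≤ ρ := fun M => by
      refine le_of_tendsto (((cont M 1).const_mul ρ).const_add 1) (eventually_atTop.2 ⟨M, fun N hN => ?_⟩)
      refine le_trans ?_ (hcon N)
      exact add_le_add_right (mul_le_mul_of_nonneg_left (sub M N 1 hN) h3.le) 1
    have : Sol c (g ^ 2) (g * Q) (g ^ 2 * ρ) := by
      refine ⟨by positivity, by positivity, by positivity, fun N => ⟨?_, ?_⟩⟩
      · have := S1 N
        rw [(fs_sc hg h0 Q ρ N).1] at this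
        nlinarith
      · have := S2 N
        rw [(fs_sc hg h0 Q ρ N).2] at this
        gcongr
    have := hm _ _ _ this
    nlinarith
  · refine (sum_le_sum fun i _ => ?_).trans (hQ N)
    exact mul_le_mul_of_nonneg_left (yy_qpow hQ0 hR0.le _) (mul_nonneg (hc0 i) (pow_nonneg hg1.le i))
end

section
open Filter Topology

theorem opt_hasSum {α : Type*} {f : Option α → ℝ} {s : ℝ} (h : HasSum (fun b => f (some b)) s) : HasSum f (f none + s) := by
  have h1 : HasSum (fun i : Option α => if i = none then f none else 0) (f none) := by
    classical exact hasSum_ite_eq none (f none)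
  have h2 : HasSum (fun i : Option α => if i = none then 0 else f i) s := by
    refine ((Option.some_injective α).hasSum_iff fun x hx => ?_).1 (by simpa [Function.comp_def] using h)
    rcases x with _ | x
    · simp
    simp_all
  refine (h1.add h2).congr_fun fun i => ?_
  grind

theorem minE {ι : Type*} {P a : ι → ℝ} {ε : ℝ} (hε : 0 < ε) (P0 : ∀ i, 0 ≤ P i) (hm : Summable fun i => P i * rexp (ε * |a i|))
    (h1 : ∑' i, P i ≤ 1) (h2 : ∀ s, |s| ≤ ε → 1 ≤ ∑' i, P i * rexp (s * a i)) : HasSum P 1 ∧ ∑' i, P i * a i = 0 := by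
  have sP : Summable P := hm.of_nonneg_of_le P0 fun i => le_mul_of_one_le_right (P0 i) (Real.one_le_exp ◆)
  have tot : HasSum P 1 := by
    have := h2 0 (by simpa using hε.le)
    simp only [zero_mul, Real.exp_zero, mul_one] at this
    rw [← le_antisymm h1 this]; exact sP.hasSum
  refine ⟨tot, ?_⟩
  have sE : ∀ s, |s| ≤ ε → Summable fun i => P i * rexp (s * a i) := fun s hs => by
    refine hm.of_nonneg_of_le (fun i => mul_nonneg (P0 i) (Real.exp_pos _).le) fun i => mul_le_mul_of_nonneg_left (Real.exp_le_exp.2 ?_) (P0 i)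
    refine (le_abs_self _).trans ?_
    rw [abs_mul]; gcongr
  have e1 : ∀ x : ℝ, 0 ≤ x → x ≤ ε⁻¹ * rexp (ε * x) := fun x _ => by
    have := Real.add_one_le_exp (ε * x)
    rw [← div_eq_inv_mul, le_div_iff₀ hε]; nlinarith
  have sa : Summable fun i => P i * a i := by
    refine (hm.mul_left ε⁻¹).of_norm_bounded fun i => ?_
    rw [norm_mul, Real.norm_of_nonneg (P0 i), Real.norm_eq_abs]
    have := mul_le_mul_of_nonneg_left (e1 _ (abs_nonneg (a i))) (P0 i)
    linarith
  have e2 : ∀ i, a i ^ 2 * rexp (ε / 2 * |a i|) ≤ 16 * ε⁻¹ ^ 2 * rexp (ε * |a i|) := fun i => by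
    have h : |a i| ≤ 4 * ε⁻¹ * rexp (ε / 4 * |a i|) := by
      have := Real.add_one_le_exp (ε / 4 * |a i|)
      rw [show 4 * ε⁻¹ * rexp (ε / 4 * |a i|) = 4 * rexp (ε / 4 * |a i|) / ε by ring, le_div_iff₀ hε]; nlinarith
    have h' := pow_le_pow_left₀ (abs_nonneg _) h 2
    rw [sq_abs, mul_pow, ← Real.exp_nat_mul] at h'
    calc _ ≤ (4 * ε⁻¹) ^ 2 * rexp (((2:ℕ):ℝ) * (ε / 4 * |a i|)) * rexp (ε / 2 * |a i|) := by gcongr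
      _ = _ := by rw [mul_assoc, ← Real.exp_add]; push_cast; ring_nf
  have sC : Summable fun i => P i * (a i ^ 2 * rexp (ε / 2 * |a i|)) := by
    refine (hm.mul_left (16 * ε⁻¹ ^ 2)).of_nonneg_of_le (fun i => by have := P0 i; positivity) fun i => ?_
    have := mul_le_mul_of_nonneg_left (e2 i) (P0 i)
    linarith
  set C := ∑' i, P i * (a i ^ 2 * rexp (ε / 2 * |a i|))
  have key : ∀ s, |s| ≤ ε / 2 → 0 ≤ s * ∑' i, P i * a i + s ^ 2 * C := fun s hs => by
    have u := h2 s ▲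
    have : ∑' i, P i * rexp (s * a i) ≤ ∑' i, (P i + s * (P i * a i) + s ^ 2 * (P i * (a i ^ 2 * rexp (ε / 2 * |a i|)))) := by
      refine (sE s ▲).tsum_le_tsum (fun i => ?_) ((sP.add (sa.mul_left s)).add (sC.mul_left _))
      have b := exp2_bd ((s * a i : ℝ) : ℂ)
      rw [← Complex.ofReal_exp, ← Complex.ofReal_one, ← Complex.ofReal_sub, ← Complex.ofReal_sub, Complex.norm_real, Complex.norm_real] at b
      have b1 := (le_abs_self _).trans b
      rw [Real.norm_eq_abs, sq_abs] at b1
      have b2 : rexp |s * a i| ≤ rexp (ε / 2 * |a i|) := Real.exp_le_exp.2 (by rw [abs_mul]; gcongr)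
      have b3 : (s * a i) ^ 2 * rexp |s * a i| ≤ (s * a i) ^ 2 * rexp (ε / 2 * |a i|) := by gcongr
      have b4 : rexp (s * a i) ≤ 1 + s * a i + (s * a i) ^ 2 * rexp (ε / 2 * |a i|) := by linarith
      have := mul_le_mul_of_nonneg_left b4 (P0 i)
      linarith
    rw [(sP.add (sa.mul_left s)).tsum_add (sC.mul_left _), sP.tsum_add (sa.mul_left s), tsum_mul_left, tsum_mul_left, tot.tsum_eq] at this
    linarith
  set E := ∑' i, P i * a i
  have hC : 0 ≤ C := tsum_nonneg fun i => by have := P0 i; positivity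
  by_contra hE
  have hE' : 0 < |E| := abs_pos.2 hE
  set t := min (ε / 2) (|E| / (2 * ⤒C))
  have ht : 0 < t := lt_min ◆ ◆
  have ht1 : t * (2 * ⤒C) ≤ |E| := by
    have := mul_le_mul_of_nonneg_right (min_le_right (ε / 2) (|E| / (2 * ⤒C))) (by positivity : 0 ≤ 2 * ⤒C)
    rwa [div_mul_cancel₀ _ ◆] at this
  have hts : t ≤ ε / 2 := min_le_left _ _
  have bad : ¬ (0 ≤ -t * |E| + t ^ 2 * C) := by
    nlinarith
  rcases abs_cases E with ⟨h, _⟩ | ⟨h, _⟩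
  · have := key (-t) (by rw [abs_neg, abs_of_pos ht]; exact hts)
    nlinarith
  · have := key t (by rw [abs_of_pos ht]; exact hts)
    simp_all

theorem Gam_mo {c c' : ℕ → ℝ} {g g' r r' : ℝ} (hc : ∀ i, 0 ≤ c i * g ^ i) (h : ∀ i, c i * g ^ i ≤ c' i * g' ^ i) (hr : 0 ≤ r) (hrr : r ≤ r') (N : ℕ) :
    Gam c g r N ≤ Gam c' g' r' N := by
  have q : ∀ m, 0 ≤ Qit c g r N m ∧ Qit c g r N m ≤ Qit c' g' r' N m := fun m => by
    induction m with
    | zero => simp [Qit]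
    | succ m ih =>
      simp only [Qit]
      exact ⟨sum_nonneg fun i _ => mul_nonneg (hc i) (yy_nonneg ih.1 hr _ _), sum_le_sum fun i _ =>
        mul_le_mul (h i) (yy_mono ih.1 hr ih.2 hrr _ _) (yy_nonneg ih.1 hr _ _) ((hc i).trans (h i))⟩
  exact sum_le_sum fun i _ => mul_le_mul (h i) (yy_mono (q N).1 hr (q N).2 hrr _ _) (yy_nonneg (q N).1 hr _ _) ((hc i).trans (h i))

def Lw : St → ℝ
  | none => 1
  | some b => b.1 + b.2.1 + b.2.2

variable {D : Set ℕ} {k : ℕ}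

theorem crit3 (h0 : 0 ∉ D) (i0 : ℕ) (hi : 3 ≤ i0) (hi0 : i0 ∈ D) : ∃ g0 r0 ε g1 q1 : ℝ, 0 < g0 ∧ 0 < r0 ∧ 0 < ε ∧ g0 < g1 ∧ 0 ≤ q1 ∧
    (∀ N, ∑ i ∈ range N, wt D k 1 i * g1 ^ i * q1 ^ ⤓i ≤ q1) ∧
    (Summable fun i => Pw (pp D k) r0 g0 i * rexp (ε * Lw i)) ∧ HasSum (Pw (pp D k) r0 g0) 1 ∧ ∑' i, Pw (pp D k) r0 g0 i * aw i = 0 := by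
  have w0 : wt D k ↟1 0 = 0 := by simp [wt, h0]
  have w1 : wt D k ↟1 i0 = 1 := by simp [wt, hi0]
  have wc : ∀ i, wt D k ↟1 i = 0 ∨ wt D k ↟1 i = 1 := fun i => by unfold wt; split_ifs <;> simp
  have wn : ∀ i, 0 ≤ wt D k ↟1 i := fun i => by grind
  obtain ⟨g0, r0, g1, r1, hg0, hr0, hgg, hrr, ⟨B, hB⟩, hsub, hsup, q1, hq1, htree⟩ := crit2 wc w0 i0 hi w1
  have hg1 : 0 < g1 := hg0.trans hgg
  have hr1 : 0 < r1 := hr0.trans hrr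
  obtain ⟨ε, ⟨hε1, hε2⟩, hε⟩ : ∃ ε : ℝ, (r0 * rexp ε < r1 ∧ g0 * rexp ε * rexp ε < g1) ∧ 0 < ε := by
    have c1 : Continuous fun e : ℝ => r0 * rexp e := by fun_prop
    have c2 : Continuous fun e : ℝ => g0 * rexp e * rexp e := by fun_prop
    have l1 := (c1.tendsto 0).mono_left (nhdsWithin_le_nhds (s := Set.Ioi 0))
    have l2 := (c2.tendsto 0).mono_left (nhdsWithin_le_nhds (s := Set.Ioi 0))
    simp only [Real.exp_zero, mul_one] at l1 l2
    exact (((l1.eventually_lt_const hrr).and (l2.eventually_lt_const hgg)).and self_mem_nhdsWithin).exists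
  have hx : 1 ≤ rexp ε := Real.one_le_exp hε.le
  have sB := (pt_summable h0 zero_le_one hr1.le hg1.le B hB).1
  have sM : Summable (pt D k (rexp ε) (r0 * rexp ε) (g0 * rexp ε)) := by
    refine (pt_summable h0 ◆ ◆ ◆ B fun N => ?_).1
    refine (Gam_mo (c' := wt D k 1) (g' := g1) (fun i => ?_) (fun i => ?_) ◆ hε1.le N).trans (hB N)
    · unfold wt; positivity
    · rcases Nat.eq_zero_or_pos i with rfl | hi
      · simp [wt, h0]
      have a : (g0 * rexp ε) ^ i ≤ g1 ^ i := pow_le_pow_left₀ ◆ (by nlinarith) i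
      have b : rexp ε * (g0 * rexp ε) ^ i ≤ g1 ^ i := by
        have c1 : rexp ε * (g0 * rexp ε) ^ i ≤ rexp ε ^ i * (g0 * rexp ε) ^ i := by
          gcongr; exact le_self_pow₀ hx hi.ne'
        rw [← mul_pow] at c1
        exact c1.trans (pow_le_pow_left₀ ◆ (by nlinarith) i)
      unfold wt; split_ifs
      · simpa using b
      · simpa using a
      · simp
  have mom : Summable fun i => Pw (pp D k) r0 g0 i * rexp (ε * Lw i) := by
    refine (opt_hasSum (HasSum.congr_fun sM.hasSum fun b => ?_)).summable
    simp only [Pw, Lw, pt]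
    rw [mul_add, mul_add, Real.exp_add, Real.exp_add, mul_comm ε, mul_comm ε, mul_comm ε, Real.exp_nat_mul, Real.exp_nat_mul, Real.exp_nat_mul, mul_pow, mul_pow]; ring
  have tsP : ∀ r g, Summable (pt D k 1 r g) → HasSum (Pw (pp D k) r g) (r⁻¹ + ∑' b, pt D k 1 r g b) := fun r g h =>
    opt_hasSum (f := Pw (pp D k) r g) (HasSum.congr_fun h.hasSum fun b => by simp only [Pw, pt, one_pow, mul_one])
  have P0 : ∀ i, 0 ≤ Pw (pp D k) r0 g0 i := fun i => by rcases i with _ | b <;> simp only [Pw] <;> positivity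
  have ptm : ∀ r g, 0 ≤ r → 0 ≤ g → r ≤ r1 → g ≤ g1 → ∀ b, pt D k 1 r g b ≤ pt D k 1 r1 g1 b := fun r g h1 h2 h3 h4 b => by
    unfold pt; gcongr
  have big : ∀ r, 0 < r → r ≤ r1 → 1 ≤ r⁻¹ + ∑' b, pt D k 1 r g0 b := fun r h1 h2 => by
    have lim : Tendsto (fun g => r⁻¹ + ∑' b, pt D k 1 r g b) (𝓝[>] g0) (𝓝 (r⁻¹ + ∑' b, pt D k 1 r g0 b)) := by
      refine Tendsto.const_add _ (tendsto_tsum_of_dominated_convergence sB (fun b => ?_) ?_)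
      · have : Continuous fun g => pt D k 1 r g b := by unfold pt; fun_prop
        exact (this.tendsto g0).mono_left nhdsWithin_le_nhds
      · filter_upwards [Ioo_mem_nhdsGT hgg] with g hg b
        have hg' : 0 ≤ g := hg0.le.trans hg.1.le
        rw [Real.norm_of_nonneg (pt_nonneg zero_le_one h1.le hg' b)]
        grind
    refine ge_of_tendsto lim ?_
    filter_upwards [Ioo_mem_nhdsGT hgg] with g hg
    have hg' : 0 ≤ g := hg0.le.trans hg.1.le
    obtain ⟨N, hN⟩ := hsup g r hg.1 hg.2.le h1 h2
    have := Gam_le_pt h0 zero_le_one h1.le hg' (sB.of_nonneg_of_le (pt_nonneg zero_le_one h1.le hg') (ptm r g h1.le hg' h2 hg.2.le)) N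
    have h3 := mul_le_mul_of_nonneg_left this h1.le
    have h4 : r * 1 ≤ r * (r⁻¹ + ∑' b, pt D k 1 r g b) := by grind
    simp_all
  have sm := pt_summable (k := k) h0 zero_le_one hr0.le hg0.le (⤓r0 / r0) fun N => by
    rw [le_div_iff₀ hr0]; linarith [hsub N]
  have := minE (ε := ε) hε P0 (mom.of_nonneg_of_le (fun i => mul_nonneg (P0 i) (Real.exp_pos _).le) fun i => by
      refine mul_le_mul_of_nonneg_left (Real.exp_le_exp.2 (mul_le_mul_of_nonneg_left (b := |aw i|) ?_ hε.le)) (P0 i)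
      rcases i with _ | b
      · simp [aw, cst, Lw]
      · simp only [aw, cst, Lw, Int.cast_natCast, Nat.abs_cast]
        linarith) (by
      rw [(tsP _ _ sm.1).tsum_eq]
      grind) (fun s hs => by
      have hs' : r0 * rexp s ≤ r1 := le_trans (by gcongr; grind) hε1.le
      have hp : 0 < r0 * rexp s := by positivity
      have := tsP _ g0 (sB.of_nonneg_of_le (pt_nonneg (k := k) (D := D) zero_le_one hp.le hg0.le) (ptm _ g0 hp.le hg0.le hs' hgg.le))
      refine (big _ hp hs').trans (le_of_eq ?_)
      rw [← this.tsum_eq]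
      refine tsum_congr fun i => ?_
      rcases i with _ | b
      · simp only [Pw, aw, cst]; rw [mul_inv, ← Real.exp_neg]; simp
      · simp only [Pw, aw, cst]; rw [mul_pow, Int.cast_natCast, mul_comm s, Real.exp_nat_mul]; ring)
  exact ⟨g0, r0, ε, g1, q1, hg0, hr0, hε, hgg, hq1, htree, mom, this.1, this.2⟩
end

section
open Filter Topology

theorem sin_add_sq (x y : ℝ) : rsin (x + y) ^ 2 ≤ 2 * rsin x ^ 2 + 2 * rsin y ^ 2 := by
  rw [Real.sin_add]
  have h1 := Real.sin_sq_add_cos_sq x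
  have h2 := Real.sin_sq_add_cos_sq y
  nlinarith [sq_nonneg (rsin x * rcos y - rcos x * rsin y), mul_nonneg (sq_nonneg (rsin x)) (sq_nonneg (rsin y))]

theorem lb_aux {P : St → ℝ} (P0 : ∀ i, 0 ≤ P i) (x : ℤ × ℤ) (hx : x ∈ AddSubgroup.closure {y | ∃ i, P i ≠ 0 ∧ cst i = y}) :
    ∃ (F : Finset St) (K : ℝ), 0 ≤ K ∧ ∀ β : ℝ × ℝ, rsin ((β.1 * x.1 + β.2 * x.2) / 2) ^ 2 ≤ K * ∑ i ∈ F, P i * (1 - rcos (lc aw vw β i)) := by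
  have nn : ∀ β i, 0 ≤ P i * (1 - rcos (lc aw vw β i)) := fun β i => mul_nonneg (P0 i) (by linarith [Real.cos_le_one (lc aw vw β i)])
  induction hx using AddSubgroup.closure_induction with
  | mem x h =>
    obtain ⟨i, hi, rfl⟩ := h
    refine ⟨{i}, 1 / (2 * P i), by simp_all, fun β => le_of_eq ?_⟩
    have : lc aw vw β i = 2 * ((β.1 * (cst i).1 + β.2 * (cst i).2) / 2) := by simp only [lc, aw, vw]; ring
    rw [sum_singleton, this, Real.cos_two_mul, Real.sin_sq]; field_simp; ring
  | zero => exact ⟨∅, 0, le_rfl, fun β => by simp⟩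
  | add x y _ _ h1 h2 =>
    obtain ⟨F1, K1, k1, h1⟩ := h1
    obtain ⟨F2, K2, k2, h2⟩ := h2
    classical
    refine ⟨F1 ∪ F2, 2 * K1 + 2 * K2, by positivity, fun β => ?_⟩
    have e : (β.1 * ((x + y).1 : ℤ) + β.2 * ((x + y).2 : ℤ)) / 2 = (β.1 * x.1 + β.2 * x.2) / 2 + (β.1 * y.1 + β.2 * y.2) / 2 := by
      simp; ring
    rw [e]
    have s1 := sum_le_sum_of_subset_of_nonneg (f := fun i => P i * (1 - rcos (lc aw vw β i))) (subset_union_left (s₁ := F1) (s₂ := F2)) fun i _ _ => nn β i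
    have s2 := sum_le_sum_of_subset_of_nonneg (f := fun i => P i * (1 - rcos (lc aw vw β i))) (subset_union_right (s₁ := F1) (s₂ := F2)) fun i _ _ => nn β i
    have := mul_le_mul_of_nonneg_left s1 k1
    have := mul_le_mul_of_nonneg_left s2 k2
    linarith [h1 β, h2 β, sin_add_sq ((β.1 * x.1 + β.2 * x.2) / 2) ((β.1 * y.1 + β.2 * y.2) / 2)]
  | neg x _ h =>
    obtain ⟨F, K, k1, h⟩ := h
    refine ⟨F, K, k1, fun β => ?_⟩
    have e : (β.1 * ((-x).1 : ℤ) + β.2 * ((-x).2 : ℤ)) / 2 = -((β.1 * x.1 + β.2 * x.2) / 2) := by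
      simp; ring
    simp_all

theorem sin_half {b : ℝ} (h : |b| ≤ rpi) : (b / rpi) ^ 2 ≤ rsin (b / 2) ^ 2 := by
  rw [← sq_abs (b / rpi), ← sq_abs (rsin _), abs_div, abs_of_pos Real.pi_pos]
  have h1 : 0 ≤ rsin (|b| / 2) := Real.sin_nonneg_of_nonneg_of_le_pi ◆ (by linarith [Real.pi_pos])
  have h2 : |rsin (b / 2)| = rsin (|b| / 2) := by
    rcases abs_cases b with ⟨e, _⟩ | ⟨e, _⟩ <;> rw [e] at h1 ⊢
    · exact abs_of_nonneg h1
    · rw [neg_div, Real.sin_neg] at *; simp_all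
  have h3 := Real.mul_le_sin (x := |b| / 2) ◆ ▲
  rw [h2]; refine pow_le_pow_left₀ ◆ (le_trans (le_of_eq ?_) h3) 2
  field_simp

theorem lb_of {P : St → ℝ} (P0 : ∀ i, 0 ≤ P i) (h1 : (1, 0) ∈ AddSubgroup.closure {y | ∃ i, P i ≠ 0 ∧ cst i = y})
    (h2 : (0, 1) ∈ AddSubgroup.closure {y | ∃ i, P i ≠ 0 ∧ cst i = y}) :
    ∃ (F : Finset St) (c : ℝ), 0 < c ∧ ∀ β : ℝ × ℝ, |β.1| ≤ rpi → |β.2| ≤ rpi →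
      c * (β.1 ^ 2 + β.2 ^ 2) ≤ ∑ i ∈ F, P i * (1 - rcos (lc aw vw β i)) := by
  obtain ⟨F1, K1, k1, h1⟩ := lb_aux P0 _ h1
  obtain ⟨F2, K2, k2, h2⟩ := lb_aux P0 _ h2
  classical
  have hp := Real.pi_pos
  refine ⟨F1 ∪ F2, 1 / (rpi ^ 2 * (K1 + K2 + 1)), by positivity, fun β b1 b2 => ?_⟩
  have nn : ∀ i, 0 ≤ P i * (1 - rcos (lc aw vw β i)) := fun i => mul_nonneg (P0 i) (by linarith [Real.cos_le_one (lc aw vw β i)])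
  have s1 := mul_le_mul_of_nonneg_left (sum_le_sum_of_subset_of_nonneg (f := fun i => P i * (1 - rcos (lc aw vw β i))) (subset_union_left (s₁ := F1) (s₂ := F2)) fun i _ _ => nn i) k1
  have s2 := mul_le_mul_of_nonneg_left (sum_le_sum_of_subset_of_nonneg (f := fun i => P i * (1 - rcos (lc aw vw β i))) (subset_union_right (s₁ := F1) (s₂ := F2)) fun i _ _ => nn i) k2
  have s3 : 0 ≤ ∑ i ∈ F1 ∪ F2, P i * (1 - rcos (lc aw vw β i)) := sum_nonneg fun i _ => nn i
  have e1 := h1 β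
  have e2 := h2 β
  simp only [Int.cast_one, Int.cast_zero, mul_one, mul_zero, add_zero, zero_add] at e1 e2
  have f1 := sin_half b1
  have f2 := sin_half b2
  rw [div_pow] at f1 f2
  rw [one_div_mul_eq_div, div_le_iff₀ ◆]
  have : (β.1 ^ 2 + β.2 ^ 2) / rpi ^ 2 ≤ (K1 + K2 + 1) * ∑ i ∈ F1 ∪ F2, P i * (1 - rcos (lc aw vw β i)) := by
    rw [add_div]; linarith
  rw [div_le_iff₀ ◆] at this
  linarith
end

section
open Filter Topology
variable {D : Set ℕ} {k : ℕ}

theorem gam_ex (h0 : 0 ∉ D) (hne : ∃ a j κ, pp D k a j κ ≠ 0) : ∃ γ : ℕ, 0 < γ ∧ (∀ a j κ, pp D k a j κ ≠ 0 → γ ∣ j) ∧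
    (1 : ℤ) ∈ AddSubgroup.closure {v : ℤ | ∃ a n κ, pp D k a (γ * n) κ ≠ 0 ∧ v = n} := by
  obtain ⟨g, hg⟩ := Int.subgroup_cyclic (AddSubgroup.closure {j : ℤ | ∃ a n κ, pp D k a n κ ≠ 0 ∧ j = n})
  rw [← AddSubgroup.zmultiples_eq_closure] at hg
  have hp : ∀ a j κ, pp D k a j κ ≠ 0 → g.natAbs ∣ j := fun a j κ h => by
    have : (j : ℤ) ∈ AddSubgroup.zmultiples g := hg ▸ AddSubgroup.subset_closure ⟨a, j, κ, h, rfl⟩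
    rw [Int.mem_zmultiples_iff] at this
    exact Int.natAbs_dvd_natAbs.2 this
  have g0 : 0 < g.natAbs := by
    obtain ⟨a, j, κ, h⟩ := hne
    rcases Nat.eq_zero_or_pos g.natAbs with e | e
    · have := hp a j κ h
      rw [e, zero_dvd_iff] at this
      subst this; exact absurd (pp_zero h0 a κ) h
    · exact e
  refine ⟨g.natAbs, g0, hp, ?_⟩
  have hm : (g.natAbs : ℤ) ∈ AddSubgroup.closure {j : ℤ | ∃ a n κ, pp D k a n κ ≠ 0 ∧ j = n} := by
    simp_all
  have he : {j : ℤ | ∃ a n κ, pp D k a n κ ≠ 0 ∧ j = n} = AddMonoidHom.mulLeft (g.natAbs : ℤ) '' {v : ℤ | ∃ a n κ, pp D k a (g.natAbs * n) κ ≠ 0 ∧ v = n} := by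
    ext j; constructor
    · rintro ⟨a, n, κ, h, rfl⟩
      obtain ⟨m, rfl⟩ := hp a n κ h
      exact ⟨m, ⟨a, m, κ, h, rfl⟩, by simp⟩
    · rintro ⟨_, ⟨a, m, κ, h, rfl⟩, rfl⟩
      exact ⟨a, _, κ, h, by simp⟩
  rw [he, ← AddMonoidHom.map_closure] at hm
  obtain ⟨y, hy, e⟩ := hm
  simp_all

def em (γ : ℕ) : St → St := Option.map fun b => (b.1, γ * b.2.1, b.2.2)

theorem em_inj {γ : ℕ} (hγ : 0 < γ) : Function.Injective (em γ) := by
  refine Option.map_injective ?_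
  rintro ⟨a, b, c⟩ ⟨a', b', c'⟩ h
  simp only [Prod.mk.injEq] at h
  obtain ⟨rfl, h2, rfl⟩ := h
  rw [Nat.eq_of_mul_eq_mul_left hγ h2]

theorem Lw_nn (i : St) : 0 ≤ Lw i := by rcases i with _ | b <;> simp only [Lw] <;> positivity
theorem aw_le (i : St) : |aw i| ≤ Lw i := by
  rcases i with _ | b
  · simp [aw, cst, Lw]
  · simp only [aw, cst, Lw, Int.cast_natCast, Nat.abs_cast]
    linarith
theorem vw_le (i : St) : |vw i| ≤ Lw i := by
  rcases i with _ | b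
  · simp [vw, cst, Lw]
  · simp only [vw, cst, Lw, Int.cast_natCast, Nat.abs_cast]
    linarith
theorem hw_le (e1 e2 : ℝ) (i : St) : |hw e1 e2 i| ≤ (|e1| + |e2|) * Lw i := by
  rcases i with _ | b
  · simp [hw, Lw]
  · simp only [hw, Lw, abs_mul, Nat.abs_cast]
    have h1 : ↟0 ≤ b.1 := by positivity
    have h2 : ↟0 ≤ b.2.1 := by positivity
    have h3 : ↟0 ≤ b.2.2 := by positivity
    nlinarith [mul_nonneg (abs_nonneg e1) h1, mul_nonneg (abs_nonneg e1) h2, mul_nonneg (abs_nonneg e2) (add_nonneg (add_nonneg h1 h2) h3)]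

theorem sF {P : St → ℝ} {ε : ℝ} (hε : 0 < ε) (P0 : ∀ i, 0 ≤ P i) (m : Summable fun i => P i * rexp (ε * Lw i)) {f : St → ℝ} {C : ℝ}
    (hf : ∀ i, |f i| ≤ C * Lw i) : (Summable fun i => P i * f i) ∧ ∀ {g : St → ℝ}, (∀ i, |g i| ≤ Lw i) → Summable fun i => P i * (f i * g i) := by
  have q : ∀ i, Lw i ≤ 1 / ε * rexp (ε * Lw i) ∧ Lw i ^ 2 ≤ 2 / ε ^ 2 * rexp (ε * Lw i) := fun i => by
    have hL := Lw_nn i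
    have := Real.quadratic_le_exp_of_nonneg (mul_nonneg hε.le hL)
    constructor
    · rw [one_div_mul_eq_div, le_div_iff₀ hε]; nlinarith
    · rw [div_mul_eq_mul_div, le_div_iff₀ ◆]; nlinarith
  have hC : ∀ i, C * Lw i ≤ |C| * Lw i := fun i => mul_le_mul_of_nonneg_right (le_abs_self C) (Lw_nn i)
  refine ⟨Summable.of_norm_bounded (m.mul_left (|C| * (1 / ε))) fun i => ?_, fun {g} hg => Summable.of_norm_bounded (m.mul_left (|C| * (2 / ε ^ 2))) fun i => ?_⟩
  · rw [norm_mul, Real.norm_of_nonneg (P0 i), Real.norm_eq_abs]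
    calc P i * |f i| ≤ P i * (|C| * (1 / ε * rexp (ε * Lw i))) :=
          mul_le_mul_of_nonneg_left (((hf i).trans (hC i)).trans (mul_le_mul_of_nonneg_left (q i).1 (abs_nonneg C))) (P0 i)
      _ = _ := by ring
  · rw [norm_mul, Real.norm_of_nonneg (P0 i), Real.norm_eq_abs, abs_mul]
    calc P i * (|f i| * |g i|) ≤ P i * (|C| * (2 / ε ^ 2 * rexp (ε * Lw i))) := by
          refine mul_le_mul_of_nonneg_left ?_ (P0 i)
          refine (mul_le_mul ((hf i).trans (hC i)) (hg i) (abs_nonneg _) (mul_nonneg (abs_nonneg C) (Lw_nn i))).trans ?_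
          rw [mul_assoc, ← sq]; exact mul_le_mul_of_nonneg_left (q i).2 (abs_nonneg C)
      _ = _ := by ring

set_option maxHeartbeats 1000000 in
theorem wk_ex (h0 : 0 ∉ D) (i0 : ℕ) (hi : 3 ≤ i0) (hi0 : i0 ∈ D) : ∃ (g0 r0 g1 q1 μ : ℝ) (γ : ℕ), 0 < g0 ∧ 0 < r0 ∧ g0 < g1 ∧ 0 ≤ q1 ∧
    (∀ N, ∑ i ∈ range N, wt D k ↟1 i * g1 ^ i * q1 ^ ⤓i ≤ q1) ∧ 0 < γ ∧ (∀ a j κ, pp D k a j κ ≠ 0 → γ ∣ j) ∧ 0 < μ ∧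
    ∀ e1 e2 : ℝ, ∃ α β ε, Wk (Pw (fun a v κ => pp D k a (γ * v) κ) r0 (g0 ^ γ)) aw vw (hc e1 e2 α β) μ ε ∧
      α * μ = ∑' i, Pw (fun a v κ => pp D k a (γ * v) κ) r0 (g0 ^ γ) i * hw e1 e2 i := by
  obtain ⟨g0, r0, ε, g1, q1, hg0, hr0, hε, hgg, hq1, htree, mom, tot, Ea⟩ := crit3 (k := k) h0 i0 hi hi0
  have P0 : ∀ i, 0 ≤ Pw (pp D k) r0 g0 i := fun i => by rcases i with _ | b <;> simp only [Pw] <;> positivity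
  have hne : ∃ a j κ, pp D k a j κ ≠ 0 := by
    by_contra! h
    have : ∀ i, i ≠ none → Pw (pp D k) r0 g0 i * aw i = 0 := fun i hi => by
      rcases i with _ | b
      · exact absurd rfl hi
      · simp [Pw, h]
    rw [tsum_eq_single none this] at Ea
    simp [Pw, aw, cst, hr0.ne'] at Ea
  obtain ⟨γ, hγ, hp, h1⟩ := gam_ex h0 hne
  set P := Pw (fun a v κ => pp D k a (γ * v) κ) r0 (g0 ^ γ) with hP
  have einj := em_inj hγ
  have eP : ∀ i, P i = Pw (pp D k) r0 g0 (em γ i) := fun i => by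
    rcases i with _ | b
    · simp only [hP, Pw, em, Option.map_none]
    · simp only [hP, Pw, em, Option.map_some, pow_mul]
  have supp : ∀ i, i ∉ Set.range (em γ) → Pw (pp D k) r0 g0 i = 0 := fun i h => by
    rcases i with _ | ⟨a, j, κ⟩
    · exact absurd ⟨none, rfl⟩ h
    · by_contra hc
      have : pp D k a j κ ≠ 0 := fun e => hc (by simp [Pw, e])
      obtain ⟨m, rfl⟩ := hp a j κ this
      exact h ⟨some (a, m, κ), rfl⟩
  have P0' : ∀ i, 0 ≤ P i := fun i => by rw [eP]; exact P0 _
  have tot' : HasSum P 1 := by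
    have := (einj.hasSum_iff supp).2 tot
    exact this.congr_fun fun i => eP i
  have Ea' : ∑' i, P i * aw i = 0 := by
    rw [← Ea, ← einj.tsum_eq (f := fun i => Pw (pp D k) r0 g0 i * aw i)]
    · refine tsum_congr fun i => ?_
      rw [eP]; rcases i with _ | b <;> simp only [em, aw, cst, Option.map_none, Option.map_some]
    · intro i hi; by_contra h
      simp_all
  have mom' : Summable fun i => P i * rexp (ε * Lw i) := by
    refine (mom.comp_injective einj).of_nonneg_of_le (fun i => mul_nonneg (P0' i) (Real.exp_pos _).le) fun i => ?_
    simp only [Function.comp_apply, ← eP]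
    refine mul_le_mul_of_nonneg_left (Real.exp_le_exp.2 (mul_le_mul_of_nonneg_left ?_ hε.le)) (P0' i)
    rcases i with _ | b
    · simp only [em, Option.map_none, le_refl]
    · simp only [em, Option.map_some, Lw]
      have : (b.2.1 : ℝ) ≤ (γ * b.2.1 : ℕ) := by exact_mod_cast Nat.le_mul_of_pos_left _ hγ
      linarith
  have sa := sF hε P0' mom' (f := aw) (C := 1) fun i => by rw [one_mul]; exact aw_le i
  have sv := sF hε P0' mom' (f := vw) (C := 1) fun i => by rw [one_mul]; exact vw_le i
  have Pn : P none = r0⁻¹ := by simp only [hP, Pw]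
  have hμ : 0 < ∑' i, P i * vw i := by
    have : ∃ a n κ, pp D k a (γ * n) κ ≠ 0 ∧ n ≠ 0 := by
      obtain ⟨a, j, κ, h⟩ := hne
      obtain ⟨m, rfl⟩ := hp a j κ h
      exact ⟨a, m, κ, h, fun e => h (by rw [e, mul_zero]; exact pp_zero h0 a κ)⟩
    obtain ⟨a, n, κ, h, hn⟩ := this
    refine sv.1.tsum_pos (fun i => mul_nonneg (P0' i) ?_) (some (a, n, κ)) ?_
    · rcases i with _ | b <;> simp [vw, cst]
    · simp only [hP, Pw, vw, cst, Int.cast_natCast]; positivity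
  have haa : 0 < ∑' i, P i * (aw i * aw i) := by
    refine (sa.2 aw_le).tsum_pos (fun i => mul_nonneg (P0' i) (mul_self_nonneg _)) none ?_
    rw [Pn]; simp [aw, cst, hr0]
  have lb := lb_of P0' (by
      have : ((-1 : ℤ), (0 : ℤ)) ∈ AddSubgroup.closure {y | ∃ i, P i ≠ 0 ∧ cst i = y} := AddSubgroup.subset_closure ⟨none, by rw [Pn]; positivity, rfl⟩
      simpa using AddSubgroup.neg_mem _ this) (by
      have m1 : ((-1 : ℤ), (0 : ℤ)) ∈ AddSubgroup.closure {y | ∃ i, P i ≠ 0 ∧ cst i = y} := AddSubgroup.subset_closure ⟨none, by rw [Pn]; positivity, rfl⟩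
      have : AddSubgroup.closure {v : ℤ | ∃ a n κ, pp D k a (γ * n) κ ≠ 0 ∧ v = n} ≤
          (AddSubgroup.closure {y | ∃ i, P i ≠ 0 ∧ cst i = y}).comap (AddMonoidHom.inr ℤ ℤ) := by
        rw [AddSubgroup.closure_le]
        rintro _ ⟨a, n, κ, h, rfl⟩
        have m2 : ((a : ℤ), (n : ℤ)) ∈ AddSubgroup.closure {y | ∃ i, P i ≠ 0 ∧ cst i = y} :=
          AddSubgroup.subset_closure ⟨some (a, n, κ), by simp only [hP, Pw]; positivity, rfl⟩
        have m3 := AddSubgroup.add_mem _ m2 (AddSubgroup.zsmul_mem _ m1 a)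
        simpa using m3
      exact this h1)
  refine ⟨g0, r0, g1, q1, ∑' i, P i * vw i, γ, hg0, hr0, hgg, hq1, htree, hγ, hp, hμ, fun e1 e2 => ?_⟩
  have sh := sF hε P0' mom' (hw_le e1 e2)
  set μ := ∑' i, P i * vw i with hμd
  obtain ⟨α, hα⟩ : ∃ x, x = (∑' i, P i * hw e1 e2 i) / μ := ⟨_, rfl⟩
  obtain ⟨β, hβ⟩ : ∃ x, x = ((∑' i, P i * (hw e1 e2 i * aw i)) - α * ∑' i, P i * (vw i * aw i)) / ∑' i, P i * (aw i * aw i) := ⟨_, rfl⟩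
  have H1 : HasSum (fun i => P i * hc e1 e2 α β i) ((∑' i, P i * hw e1 e2 i) - α * μ - β * 0) :=
    (((sh.1.hasSum).sub (sv.1.hasSum.mul_left α)).sub ((Ea' ▸ sa.1.hasSum).mul_left β)).congr_fun fun i => by simp only [hc]; ring
  have H2 : HasSum (fun i => P i * (hc e1 e2 α β i * aw i)) ((∑' i, P i * (hw e1 e2 i * aw i)) - α * (∑' i, P i * (vw i * aw i)) - β * ∑' i, P i * (aw i * aw i)) :=
    ((((sh.2 aw_le).hasSum).sub ((sv.2 aw_le).hasSum.mul_left α)).sub ((sa.2 aw_le).hasSum.mul_left β)).congr_fun fun i => by simp only [hc]; ring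
  have hαμ : α * μ = ∑' i, P i * hw e1 e2 i := by grind
  obtain ⟨Kc, hK⟩ : ∃ x, x = 2 + |e1| + |e2| + |α| + |β| := ⟨_, rfl⟩
  have hKc : 0 < Kc := by rw [hK]; positivity
  refine ⟨α, β, ε / Kc, ⟨P0', tot', by positivity, ?_, Ea', ?_, ?_, rfl, hμ, lb⟩, hαμ⟩
  · refine (mom'.mul_left (rexp (ε / Kc))).of_nonneg_of_le (fun i => mul_nonneg (P0' i) (Real.exp_pos _).le) fun i => ?_
    rw [mul_left_comm, ← Real.exp_add]
    refine mul_le_mul_of_nonneg_left (Real.exp_le_exp.2 ?_) (P0' i)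
    have : kk aw vw (hc e1 e2 α β) i ≤ 1 + Kc * Lw i := by
      have h1 := aw_le i
      have h2 := vw_le i
      have h3 := hw_le e1 e2 i
      have h4 : |hc e1 e2 α β i| ≤ |hw e1 e2 i| + |α| * |vw i| + |β| * |aw i| := by
        rw [← abs_mul, ← abs_mul]; simp only [hc]
        exact (abs_sub _ _).trans (add_le_add_left (abs_sub _ _) _)
      have h5 := mul_le_mul_of_nonneg_left h1 (abs_nonneg β)
      have h6 := mul_le_mul_of_nonneg_left h2 (abs_nonneg α)
      simp only [kk, hK]; linarith
    calc ε / Kc * kk aw vw (hc e1 e2 α β) i ≤ ε / Kc * (1 + Kc * Lw i) := by gcongr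
      _ = _ := by field_simp
  · rw [H1.tsum_eq]; linarith only [hαμ]
  · have : β * ∑' i, P i * (aw i * aw i) = _ := hβ ▸ div_mul_cancel₀ _ haa.ne'
    rw [H2.tsum_eq]; linarith only [this]
end

section
open Polynomial
variable {D : Set ℕ} {k : ℕ}

def aN (D : Set ℕ) (k m l j : ℕ) : ℕ[X] := aa (fun i => C (wt D k (1:ℕ) i)) X m l j
def Fc {n : ℕ} (p : Equiv.Perm (Fin ⧉n) × Equiv.Perm (Fin ⧉n)) : ℕ := cycleCount (p.1 * p.2)

theorem card_F (h0 : 0 ∉ D) {n : ℕ} (hn : 0 < n) (f : ℕ) :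
    ((pairFinset D n).filter fun p => Fc p = f).card = (2 * n - 1).factorial * (aN D k (2 * n + 1) 2 ⧉n).coeff f := by
  have h := congrArg (fun q => q.coeff f) (pairs_poly D h0 k 1 hn)
  have e : aa (fun i => C (wt D k ⇈1 i)) (X : ℂ[X]) (2 * n + 1) 2 ⧉n = (aN D k (2 * n + 1) 2 ⧉n).map (Nat.castRingHom ℂ) := by
    rw [← coe_mapRingHom, aN, aa_map]
    congr 1
    · ext i; simp only [coe_mapRingHom, map_C, wt]; split_ifs <;> simp
    · simp
  simp only [e, finsetSum_coeff, one_pow, map_one, one_mul, coeff_X_pow, ← C_eq_natCast, coeff_C_mul, coeff_map] at h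
  rw [sum_boole] at h
  have : ((pairFinset D n).filter fun p => Fc p = f) = (pairFinset D n).filter fun p => f = cycleCount (p.1 * p.2) :=
    filter_congr fun p _ => eq_comm
  rw [this]
  apply Nat.cast_injective (R := ℂ)
  simp_all

theorem aN_zero (m l j : ℕ) : (aN D k m l j).coeff 0 = 0 := by
  induction m generalizing l j with
  | zero => simp only [aN, aa]; split_ifs <;> simp
  | succ m ih =>
    rcases l with _ | l
    · simp only [aN, aa]; split_ifs <;> simp
    · simp only [aN, aa] at ih ⊢
      simp_all

theorem aN_succ1 (m l j : ℕ) : (aN D k ⤒m ⤒l j).coeff 1 = ∑ i ∈ range ⤒j, wt D k (1:ℕ) i * (aN D k m (l + i - 1) (j - i)).coeff 1 := by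
  have z : ∀ l j l' j', (aN D k m l j * aN D k m l' j').coeff 1 = 0 := fun l j l' j' => by
    rw [coeff_mul, Nat.antidiagonal_succ]; simp [aN_zero]
  simp only [aN] at z ⊢
  simp only [aa, coeff_add, finsetSum_coeff, coeff_C_mul, z, sum_const_zero, add_zero]

theorem aN_one (h0 : 0 ∉ D) (h1 : 1 ∉ D) (m l j : ℕ) : (aN D k m ⤒l j).coeff 1 = 0 := by
  induction m generalizing l j with
  | zero => simp [aN, aa]
  | succ m ih =>
    rw [aN_succ1]
    refine sum_eq_zero fun i _ => ?_
    rcases i with _ | _ | i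
    · simp [wt, h0]
    · simp [wt, h1]
    grind

theorem aN_bd (h0 : 0 ∉ D) {g1 q1 : ℝ} (hg : 0 < g1) (hq : 0 ≤ q1) (ht : ∀ N, ∑ i ∈ range N, wt D k ↟1 i * g1 ^ i * q1 ^ ⤓i ≤ q1)
    (m l j : ℕ) : ((aN D k m l j).coeff 1 : ℝ) * g1 ^ j ≤ q1 ^ l := by
  induction m generalizing l j with
  | zero =>
    simp only [aN, aa]; split_ifs with h
    · simp [h.1, h.2]
    · simp; positivity
  | succ m ih =>
    rcases l with _ | l
    · simp only [aN, aa]; split_ifs with h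
      · simp [h]
      · simp
    · rw [aN_succ1, pow_succ]
      push_cast
      refine le_trans ?_ (mul_le_mul_of_nonneg_left (ht ⤒j) (pow_nonneg hq l))
      rw [sum_mul, mul_sum]
      refine sum_le_sum fun i hi => ?_
      have hw : ((wt D k (1:ℕ) i : ℕ) : ℝ) = wt D k ↟1 i := by unfold wt; split_ifs <;> simp
      have hn : 0 ≤ wt D k ↟1 i := by rw [← hw]; positivity
      rw [hw]
      rcases i with _ | i
      · simp [wt, h0]
      have e : g1 ^ j = g1 ^ ⤒i * g1 ^ (j - ⤒i) := by rw [← pow_add]; simp_all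
      have e2 : q1 ^ l * q1 ^ (i + 1 - 1) = q1 ^ (l + ⤒i - 1) := by rw [← pow_add]; rfl
      calc _ = wt D k ↟1 ⤒i * g1 ^ ⤒i * (((aN D k m (l + ⤒i - 1) (j - ⤒i)).coeff 1 : ℝ) * g1 ^ (j - ⤒i)) := by rw [e]; ring
        _ ≤ wt D k ↟1 ⤒i * g1 ^ ⤒i * q1 ^ (l + ⤒i - 1) := mul_le_mul_of_nonneg_left (ih _ _) (mul_nonneg hn ◆)
        _ = _ := by rw [← e2]; ring

theorem aN_s1 {i : ℕ} (hi : i ∈ D)  (m l j f : ℕ) (h : 0 < (aN D k m (l + i - 1) j).coeff f) : 0 < (aN D k ⤒m ⤒l (j + i)).coeff f := by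
  have w : wt D k (1:ℕ) i = 1 := by simp [wt, hi]
  simp only [aN] at h ⊢
  simp only [aa, coeff_add, finsetSum_coeff, coeff_C_mul]
  refine Nat.add_pos_left (sum_pos' (fun _ _ => Nat.zero_le _) ⟨i, by simp, ?_⟩) _
  simp_all

theorem aN_s2 (m l j f : ℕ) (h : 0 < (aN D k m l j).coeff f) : 0 < (aN D k ⤒m (l + 2) j).coeff ⤒f := by
  have w : aa (fun i => C (wt D k (1:ℕ) i)) X m 0 0 = X := by cases m <;> simp [aa]
  simp only [aN] at h ⊢
  simp only [aa, coeff_add, finsetSum_coeff]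
  refine Nat.add_pos_right _ (sum_pos' (fun _ _ => Nat.zero_le _) ⟨0, by simp, sum_pos' (fun _ _ => Nat.zero_le _) ⟨0, by simp, ?_⟩⟩)
  simp_all

theorem aN_s3 (h1 : 1 ∈ D) (c l : ℕ) : 0 < (aN D k (c + l) l l).coeff 1 := by
  induction l with
  | zero => cases c <;> simp [aN, aa]
  | succ l ih => exact aN_s1 h1 _ _ _ _ ih

theorem gam_F (h0 : 0 ∉ D) {γ : ℕ} (hγ : 0 < γ) (hp : ∀ a j κ, pp D k a j κ ≠ 0 → γ ∣ j) {n : ℕ} (hn : 0 < n)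
    (h : ∃ p ∈ pairFinset D n, 2 ≤ Fc p) : γ ∣ 2 * n := by
  by_contra hd
  obtain ⟨L, hL, hb⟩ := bridge D h0 k 1 1 hn (2 * n + 1) ◇
  obtain ⟨H, Kb, -, -, -, hex⟩ := HH_ex h0 1 1 hγ hp 0 (N := 2 * n + 1) ◇
  rw [sum_eq_zero (s := range L), mul_zero] at hb
  · simp only [one_pow, one_mul, mul_one] at hb
    obtain ⟨p, hp, h2⟩ := h
    have h3 : ∑ p ∈ pairFinset D n, Fc p * (Fc p - 1) = 0 := by simp only [Fc]; exact_mod_cast hb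
    have := (sum_eq_zero_iff.1 h3) p hp
    rcases mul_eq_zero.1 this with h | h <;> omega
  · intro m _
    have := congrArg (fun q => q.coeff ⧉n) (hex m)
    simp only [coeff_expand hγ, if_neg hd, HH] at this
    rw [this]; simp

theorem gam_dvd (h0 : 0 ∉ D) {γ : ℕ} (hγ : 0 < γ) (hp : ∀ a j κ, pp D k a j κ ≠ 0 → γ ∣ j) {i0 : ℕ} (hi : 3 ≤ i0) (hi0 : i0 ∈ D)
    {n : ℕ} (hn : 0 < n) (h : (pairFinset D n).Nonempty) : γ ∣ 2 * n := by
  by_cases h2 : ∃ p ∈ pairFinset D n, 2 ≤ Fc p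
  · exact gam_F h0 hγ hp hn h2
  push Not at h2
  obtain ⟨p, hpm⟩ := h
  have key : ∀ f, 0 < (aN D k (2 * n + 1) 2 ⧉n).coeff f ↔ ∃ p ∈ pairFinset D n, Fc p = f := fun f => by
    have := card_F (k := k) h0 hn f
    rw [← Nat.mul_pos_iff_of_pos_left (Nat.factorial_pos (2 * n - 1)), ← this, card_pos]
    simp [Finset.Nonempty]
  have h1 : 1 ∈ D := by
    by_contra h1
    have := (key (Fc p)).2 ⟨p, hpm, rfl⟩
    have hl := h2 p hpm
    interval_cases hF : Fc p
    · rw [aN_zero] at this; omega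
    · rw [aN_one h0 h1] at this; omega
  have big : ∀ n' f, 0 < n' → 2 ≤ f → 0 < (aN D k (2 * n' + 1) 2 ⧉n').coeff f → γ ∣ 2 * n' := fun n' f hn' hf hpos => by
    have := card_F (k := k) h0 hn' f
    have h3 : 0 < ((pairFinset D n').filter fun p => Fc p = f).card := by rw [this]; positivity
    obtain ⟨p, hp'⟩ := card_pos.1 h3
    rw [mem_filter] at hp'
    exact gam_F h0 hγ hp hn' ⟨p, hp'.1, by omega⟩
  obtain ⟨c, rfl⟩ : ∃ c, i0 = c + 3 := ⟨i0 - 3, by omega⟩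
  have two : ∀ c' l f, 0 < (aN D k c' (2 * c + 2 + 2) l).coeff f → 0 < (aN D k (c' + 2) 2 (l + (c + 3) + (c + 3))).coeff f := fun c' l f h => by
    refine aN_s1 hi0 ⤒c' 1 _ _ ?_
    rw [show 1 + (c + 3) - 1 = (c + 2) + 1 by omega]
    refine aN_s1 hi0 c' _ _ _ ?_
    grind
  have d1 := big (2 * c + 4) 2 ◇ le_rfl (by
    have := two _ _ _ (aN_s2 _ _ _ _ (aN_s3 (k := k) h1 (2 * c + 4) (2 * c + 2)))
    grind)
  have d2 := big (2 * c + 3) 3 ◇ ◇ (by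
    have := two _ _ _ (aN_s2 _ _ _ _ (aN_s2 _ _ _ _ (aN_s3 (k := k) h1 (2 * c + 3) ⧉c)))
    grind)
  have : γ ∣ 2 := by
    have := Nat.dvd_sub d1 d2
    rwa [show 2 * (2 * c + 4) - 2 * (2 * c + 3) = 2 by omega] at this
  grind
end

section
open MeasureTheory Filter Topology
variable {D : Set ℕ} {k : ℕ} {r0 G0 e1 e2 α β μ ε : ℝ}

abbrev PT (n : ℕ) := Equiv.Perm (Fin ⧉n) × Equiv.Perm (Fin ⧉n)
def bw {n : ℕ} (p : PT n) : ℝ := Fc p * ((Fc p - 1 : ℕ) : ℝ)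
def Bn (D : Set ℕ) (n : ℕ) : ℝ := ∑ p ∈ pairFinset D n, bw p
def Yv (k : ℕ) (e1 e2 α : ℝ) (V : ℕ) {n : ℕ} (p : PT n) : ℝ := (e1 * degCount p.1 k + e2 * ((Fc p - 2 : ℕ) : ℝ) - α * V) / √n

theorem mlim (h0 : 0 ∉ D) {γ : ℕ} (hγ : 0 < γ) (hp : ∀ a j κ, pp D k a j κ ≠ 0 → γ ∣ j)
    (w : Wk (Pw (fun a v κ => pp D k a (γ * v) κ) r0 G0) aw vw (hc e1 e2 α β) μ ε) (hr : 0 < r0) (hG : 0 < G0)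
    {l : Filter ℕ} (hl : l ≤ atTop) (hcg : l.IsCountablyGenerated) (hnb : l.NeBot) (hdiv : ∀ᶠ n : ℕ in l, γ ∣ 2 * n) :
    (∃ C : ℝ, 0 < C ∧ Tendsto (fun n : ℕ => ↟n * √n * (G0 ^ (2 * n / γ) * (Bn D n / (2 * n).factorial))) l (𝓝 C)) ∧ ∃ s : ℝ, 0 ≤ s ∧
    ∀ z : ℂ, Tendsto (fun n : ℕ => (∑ p ∈ pairFinset D n, (bw p : ℂ) * cexp (z * Yv k e1 e2 α (2 * n / γ) p)) / (Bn D n : ℂ)) l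
      (𝓝 (cexp (s * z ^ 2 / 2))) := by
  obtain ⟨C0, hC0, h⟩ := map_lim h0 hγ hp w hr
  have e : ∀ (z : ℂ) (n : ℕ), ⇈n * (√↟n : ℝ) * (G0 ^ (2 * n / γ) * cexp (-(z / (√↟n : ℝ)) * α * (2 * n / γ : ℕ)) *
        (Sx D k n (cexp (z / (√↟n : ℝ) * e1)) (cexp (z / (√↟n : ℝ) * e2)) / (2 * n).factorial)) =
      (⇈n * (√↟n : ℝ) * (G0 ^ (2 * n / γ) / (2 * n).factorial)) * ∑ p ∈ pairFinset D n, (bw p : ℂ) * cexp (z * Yv k e1 e2 α (2 * n / γ) p) := by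
    intro z n
    have : ∑ p ∈ pairFinset D n, (bw p : ℂ) * cexp (z * Yv k e1 e2 α (2 * n / γ) p) = cexp (-(z / (√↟n : ℝ)) * α * (2 * n / γ : ℕ)) *
        Sx D k n (cexp (z / (√↟n : ℝ) * e1)) (cexp (z / (√↟n : ℝ) * e2)) := by
      rw [Sx, mul_sum]
      refine sum_congr rfl fun p _ => ?_
      have q : z * (Yv k e1 e2 α (2 * n / γ) p : ℂ) = (degCount p.1 k : ℂ) * (z / (√↟n : ℝ) * e1) + ((Fc p - 2 : ℕ) : ℂ) * (z / (√↟n : ℝ) * e2) + (-(z / (√↟n : ℝ)) * α * (2 * n / γ : ℕ)) := by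
        simp only [Yv]; push_cast; ring
      rw [q, Complex.exp_add, Complex.exp_add, Complex.exp_nat_mul, Complex.exp_nat_mul]
      simp only [bw, Fc]; push_cast; ring
    rw [this]; ring
  have z0 := h 0 l hl hcg hnb hdiv
  simp only [e] at z0
  simp only [zero_mul, Complex.exp_zero, mul_one, ne_eq, OfNat.ofNat_ne_zero, not_false_eq_true, zero_pow, mul_zero, zero_div] at z0
  have z1 : Tendsto (fun n : ℕ => ((↟n * √n * (G0 ^ (2 * n / γ) * (Bn D n / (2 * n).factorial)) : ℝ) : ℂ)) l (𝓝 C0) := by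
    refine z0.congr fun n => ?_
    rw [Bn]; push_cast; ring
  have re := (Complex.continuous_re.tendsto _).comp z1
  have im := (Complex.continuous_im.tendsto _).comp z1
  simp only [Function.comp_def, Complex.ofReal_re, Complex.ofReal_im] at re im
  have im0 := tendsto_nhds_unique im tendsto_const_nhds
  have bn : ∀ n, 0 ≤ Bn D n := fun n => sum_nonneg fun p _ => by unfold bw; positivity
  have re0 : 0 ≤ C0.re := ge_of_tendsto' re fun n => by have := bn n; positivity
  refine ⟨⟨C0.re, lt_of_le_of_ne re0 fun hh => hC0 (Complex.ext hh.symm im0), re⟩,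
    2 / (γ * μ) * Vh (Pw (fun a v κ => pp D k a (γ * v) κ) r0 G0) (hc e1 e2 α β), ?_, fun z => ?_⟩
  · have := w.mu0
    exact mul_nonneg ◆ (tsum_nonneg fun i => mul_nonneg (w.P0 i) (sq_nonneg _))
  · have := (h z l hl hcg hnb hdiv).div z0 hC0
    simp only [e] at this
    rw [mul_div_cancel_left₀ _ hC0] at this
    rw [Complex.ofReal_mul]
    refine this.congr' (((eventually_gt_atTop 0).filter_mono hl).mono fun n hn => ?_)
    have hn' : ↟0 < n := by exact_mod_cast hn
    have hs : ((√↟n : ℝ) : ℂ) ≠ 0 := by exact_mod_cast (Real.sqrt_pos.2 hn').ne'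
    have hGc : (G0 : ℂ) ≠ 0 := by exact_mod_cast hG.ne'
    simp only [Pi.div_apply]
    rw [mul_div_mul_left, Bn]
    · push_cast; rfl
    · have : (n : ℂ) ≠ 0 := by exact_mod_cast hn.ne'
      have : ((2 * n).factorial : ℂ) ≠ 0 := by exact_mod_cast Nat.factorial_ne_zero _
      positivity
end

section
open Filter Topology

theorem del_bd {c : ℝ} (hc : 0 < c) : ∃ C : ℝ, ∀ (n F : ℕ), 0 < n → 2 ≤ F → ∀ Z : ℝ, (F : ℝ) = 2 + c * n + √n * Z →
    (↟n ^ 2 / (F * ⤓F) - 1 / c ^ 2) ^ 2 ≤ C * (rexp ⧉Z + rexp (-2 * Z)) / n := by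
  obtain ⟨C, hC⟩ : ∃ C : ℝ, C = 8 * (3 * c + 3) / c ^ 4 + (1 + 1 / c ^ 2) * ((2 / c) ^ 5 * 120) := ⟨_, rfl⟩
  refine ⟨C ^ 2, fun n F hn hF Z hZ => ?_⟩
  have hn1 : ↟1 ≤ n := by exact_mod_cast hn
  obtain ⟨y, hy⟩ : ∃ y, y = √↟n := ⟨_, rfl⟩
  have hy2 : ↟n = y ^ 2 := by simp_all
  have hy1 : 1 ≤ y := by rw [hy]; exact Real.one_le_sqrt.2 hn1
  have hF2 : ↟2 ≤ F := by exact_mod_cast hF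
  rw [← hy, hy2] at hZ
  rw [hy2]
  obtain ⟨x, hx⟩ : ∃ x : ℝ, x = F := ⟨_, rfl⟩
  rw [← hx] at hZ hF2 ⊢
  have hE : 0 < rexp |Z| := Real.exp_pos _
  have key : |(y ^ 2) ^ 2 / (x * ⤓x) - 1 / c ^ 2| ≤ C * rexp |Z| / y := by
    rcases le_or_gt |Z| (c * y / 2) with h | h
    · have h1 : -(c * y / 2) ≤ Z := (abs_le.1 h).1
      have h2 : c * y ^ 2 / 2 ≤ x - 1 := by rw [hZ]; nlinarith
      have h3 : (c * y ^ 2 / 2) * (c * y ^ 2 / 2) ≤ x * ⤓x := by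
        have : 0 < c * y ^ 2 / 2 := by positivity
        nlinarith
      have hp : 0 < x * ⤓x := by nlinarith
      have q := Real.quadratic_le_exp_of_nonneg (abs_nonneg Z)
      have n1 : |c ^ 2 * (y ^ 2) ^ 2 - x * ⤓x| ≤ y ^ 3 * ((3 * c + 3) * (2 * rexp |Z|)) := by
        have e : c ^ 2 * (y ^ 2) ^ 2 - x * ⤓x = -(3 * c * y ^ 2 + 2 * c * y ^ 3 * Z + 2 + 3 * y * Z + y ^ 2 * Z ^ 2) := by rw [hZ]; ring
        rw [e, abs_neg]
        have a1 : |3 * c * y ^ 2 + 2 * c * y ^ 3 * Z + 2 + 3 * y * Z + y ^ 2 * Z ^ 2| ≤ 3 * c * y ^ 2 + 2 * c * y ^ 3 * |Z| + 2 + 3 * y * |Z| + y ^ 2 * |Z| ^ 2 := by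
          refine (abs_add_le _ _).trans (add_le_add ((abs_add_le _ _).trans (add_le_add ((abs_add_le _ _).trans (add_le_add ((abs_add_le _ _).trans (add_le_add ?_ ?_)) ?_)) ?_)) ?_)
          · grind
          · rw [abs_mul, abs_of_nonneg ◆]
          · simp
          · rw [abs_mul, abs_of_nonneg ◆]
          simp
        have y3 : y ^ 2 ≤ y ^ 3 := pow_le_pow_right₀ hy1 ▽
        have y4 : y ≤ y ^ 3 := le_self_pow₀ hy1 ▽
        have y5 : 1 ≤ y ^ 3 := one_le_pow₀ hy1
        have hz := abs_nonneg Z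
        refine a1.trans ?_
        calc _ ≤ 3 * c * y ^ 3 + 2 * c * y ^ 3 * |Z| + 2 * y ^ 3 + 3 * y ^ 3 * |Z| + y ^ 3 * |Z| ^ 2 := by gcongr; linarith
          _ = y ^ 3 * (3 * c + 2 + (2 * c + 3) * |Z| + |Z| ^ 2) := by ring
          _ ≤ _ := by
            refine mul_le_mul_of_nonneg_left ?_ ◆
            nlinarith [mul_nonneg hc.le hz, mul_nonneg hc.le (sq_nonneg |Z|), mul_le_mul_of_nonneg_left q hc.le]
      have e2 : (y ^ 2) ^ 2 / (x * ⤓x) - 1 / c ^ 2 = (c ^ 2 * (y ^ 2) ^ 2 - x * ⤓x) / (c ^ 2 * (x * ⤓x)) := by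
        have := hp.ne'
        rw [div_sub_div _ _ this ◆]; congr 1 <;> ring
      rw [e2, abs_div, abs_of_pos (a := c ^ 2 * (x * ⤓x)) ◆]
      calc _ ≤ y ^ 3 * ((3 * c + 3) * (2 * rexp |Z|)) / (c ^ 2 * ((c * y ^ 2 / 2) * (c * y ^ 2 / 2))) := by gcongr
        _ = 8 * (3 * c + 3) / c ^ 4 * rexp |Z| / y := by field_simp; ring
        _ ≤ _ := by rw [hC]; gcongr; exact le_add_of_nonneg_right ◆
    · have h1 : y ≤ 2 / c * |Z| := by rw [div_mul_eq_mul_div, le_div_iff₀ hc]; linarith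
      have h2 : y ^ 5 ≤ (2 / c) ^ 5 * 120 * rexp |Z| := by
        have := Real.pow_div_factorial_le_exp |Z| (abs_nonneg Z) 5
        rw [div_le_iff₀ ◆] at this
        calc y ^ 5 ≤ (2 / c * |Z|) ^ 5 := by gcongr
          _ = (2 / c) ^ 5 * |Z| ^ 5 := by ring
          _ ≤ (2 / c) ^ 5 * (rexp |Z| * (Nat.factorial 5 : ℕ)) := by gcongr
          _ = _ := by ring
      have hp : 1 ≤ x * ⤓x := by nlinarith
      have a1 : (y ^ 2) ^ 2 / (x * ⤓x) ≤ y ^ 4 := by rw [← pow_mul]; exact div_le_self ◆ hp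
      have y5 : 1 ≤ y ^ 4 := one_le_pow₀ hy1
      have a0 : 0 ≤ (y ^ 2) ^ 2 / (x * ⤓x) := div_nonneg ◆ ▲
      have a2 : 0 < 1 / c ^ 2 := by positivity
      have a3 : |(y ^ 2) ^ 2 / (x * ⤓x) - 1 / c ^ 2| ≤ (1 + 1 / c ^ 2) * y ^ 4 := by
        rw [abs_le]; constructor <;> nlinarith
      rw [le_div_iff₀ ◆]
      calc _ ≤ (1 + 1 / c ^ 2) * y ^ 4 * y := by gcongr
        _ = (1 + 1 / c ^ 2) * y ^ 5 := by ring
        _ ≤ (1 + 1 / c ^ 2) * ((2 / c) ^ 5 * 120 * rexp |Z|) := by gcongr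
        _ = (1 + 1 / c ^ 2) * ((2 / c) ^ 5 * 120) * rexp |Z| := by ring
        _ ≤ _ := by rw [hC]; gcongr; exact le_add_of_nonneg_left ◆
  rw [← sq_abs]
  calc _ ≤ (C * rexp |Z| / y) ^ 2 := by gcongr
    _ = C ^ 2 * rexp (2 * |Z|) / y ^ 2 := by rw [div_pow, mul_pow, ← Real.exp_nat_mul]; norm_num
    _ ≤ _ := by
      gcongr
      rcases abs_cases Z with ⟨h, -⟩ | ⟨h, -⟩ <;> rw [h]
      · linarith [Real.exp_pos (-2 * Z)]
      · rw [mul_neg, ← neg_mul]; linarith [Real.exp_pos ⧉Z]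

variable {ι : ℕ → Type} {A : ∀ n, Finset (ι n)} {b W Y : ∀ n, ι n → ℝ} {B : ℕ → ℝ} {l : Filter ℕ} {κ s : ℝ}

theorem debias (hl : l ≤ atTop) (hb : ∀ n p, 0 ≤ b n p) (hB0 : ∀ᶠ n in l, 0 < B n)
    (hW : ∀ n, ∀ p ∈ A n, b n p ≠ 0 → b n p * W n p = ↟n ^ 2) (hd : Tendsto (fun n => (∑ p ∈ A n, b n p * (W n p - κ) ^ 2) / B n) l (𝓝 0))
    (hT : Tendsto (fun n : ℕ => ↟n ^ 3 * ((A n).filter fun p => b n p = 0).card / B n) l (𝓝 0))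
    {f : ∀ n, ι n → ℂ} {M K : ℝ} {L : ℂ} (hM : ∀ᶠ n in l, ∑ p ∈ A n, b n p * ‖f n p‖ ^ 2 ≤ M * B n)
    (hL : Tendsto (fun n => (∑ p ∈ A n, (b n p : ℂ) * f n p) / (B n : ℂ)) l (𝓝 L)) (hK : ∀ n, 0 < n → ∀ p ∈ A n, ‖f n p‖ ≤ K * n) :
    Tendsto (fun n : ℕ => ⇈n ^ 2 * (∑ p ∈ A n, f n p) / (B n : ℂ)) l (𝓝 (κ * L)) := by
  have key : ∀ n : ℕ, ⇈n ^ 2 * (∑ p ∈ A n, f n p) / (B n : ℂ) = κ * ((∑ p ∈ A n, (b n p : ℂ) * f n p) / (B n : ℂ)) +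
      (∑ p ∈ A n, (b n p : ℂ) * ((W n p - κ : ℝ) : ℂ) * f n p) / (B n : ℂ) + ⇈n ^ 2 * (∑ p ∈ (A n).filter fun p => b n p = 0, f n p) / (B n : ℂ) := fun n => by
    rw [← mul_div_assoc, ← add_div, ← add_div]; congr 1
    rw [sum_filter, mul_sum, mul_sum, mul_sum, ← sum_add_distrib, ← sum_add_distrib]
    refine sum_congr rfl fun p hp => ?_
    split_ifs with h
    · rw [h]; simp
    · have : (b n p : ℂ) * W n p = ⇈n ^ 2 := by exact_mod_cast hW n p hp h
      rw [← this]; push_cast; ring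
  have t2 : Tendsto (fun n => (∑ p ∈ A n, (b n p : ℂ) * ((W n p - κ : ℝ) : ℂ) * f n p) / (B n : ℂ)) l (𝓝 0) := by
    have : Tendsto (fun n => √((∑ p ∈ A n, b n p * (W n p - κ) ^ 2) / B n * M)) l (𝓝 0) := by
      have := (Real.continuous_sqrt.tendsto _).comp (hd.mul_const M)
      simpa [Function.comp_def] using this
    refine squeeze_zero_norm' ?_ this
    filter_upwards [hM, hB0] with n h1 h2
    refine Real.le_sqrt_of_sq_le ?_
    rw [norm_div, Complex.norm_real, Real.norm_of_nonneg h2.le, div_pow, div_mul_eq_mul_div, div_le_div_iff₀ ◆ h2]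
    have c1 : ‖∑ p ∈ A n, (b n p : ℂ) * ((W n p - κ : ℝ) : ℂ) * f n p‖ ≤ ∑ p ∈ A n, (√(b n p) * |W n p - κ|) * (√(b n p) * ‖f n p‖) := by
      refine (norm_sum_le _ _).trans (sum_le_sum fun p _ => le_of_eq ?_)
      rw [norm_mul, norm_mul, Complex.norm_real, Complex.norm_real, Real.norm_of_nonneg (hb n p), Real.norm_eq_abs]
      grind
    have c2 := sum_mul_sq_le_sq_mul_sq (A n) (fun p => √(b n p) * |W n p - κ|) (fun p => √(b n p) * ‖f n p‖)
    have c3 : ∀ p, (√(b n p) * |W n p - κ|) ^ 2 = b n p * (W n p - κ) ^ 2 := fun p => by grind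
    have c4 : ∀ p, (√(b n p) * ‖f n p‖) ^ 2 = b n p * ‖f n p‖ ^ 2 := fun p => by grind
    simp only [c3, c4] at c2
    have c5 : 0 ≤ ∑ p ∈ A n, b n p * (W n p - κ) ^ 2 := sum_nonneg fun p _ => mul_nonneg (hb n p) (sq_nonneg _)
    have c6 := pow_le_pow_left₀ (norm_nonneg _) c1 2
    calc _ ≤ (∑ p ∈ A n, b n p * (W n p - κ) ^ 2) * (M * B n) * B n :=
          mul_le_mul_of_nonneg_right ((c6.trans c2).trans (mul_le_mul_of_nonneg_left h1 c5)) h2.le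
      _ = _ := by ring
  have t3 : Tendsto (fun n : ℕ => ⇈n ^ 2 * (∑ p ∈ (A n).filter fun p => b n p = 0, f n p) / (B n : ℂ)) l (𝓝 0) := by
    have := hT.const_mul K
    rw [mul_zero] at this
    refine squeeze_zero_norm' ?_ this
    filter_upwards [hB0, (eventually_gt_atTop 0).filter_mono hl] with n h2 hn
    rw [norm_div, Complex.norm_real, Real.norm_of_nonneg h2.le, norm_mul, norm_pow, Complex.norm_natCast, ← mul_div_assoc]
    refine div_le_div_of_nonneg_right ?_ h2.le
    have : ‖∑ p ∈ (A n).filter (fun p => b n p = 0), f n p‖ ≤ ((A n).filter fun p => b n p = 0).card • (K * n) :=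
      norm_sum_le_of_le _ (fun p hp => hK n hn p (mem_filter.1 hp).1) |>.trans (by rw [sum_const])
    rw [nsmul_eq_mul] at this
    nlinarith
  have := ((hL.const_mul (κ : ℂ)).add t2).add t3
  simp_all

theorem meanY (hs : 0 ≤ s) (hb : ∀ n p, 0 ≤ b n p) (hB : ∀ n, B n = ∑ p ∈ A n, b n p) (hB0 : ∀ᶠ n in l, 0 < B n)
    (h : ∀ z : ℝ, Tendsto (fun n => (∑ p ∈ A n, b n p * rexp (z * Y n p)) / B n) l (𝓝 (rexp (s * z ^ 2 / 2)))) :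
    Tendsto (fun n => (∑ p ∈ A n, b n p * Y n p) / B n) l (𝓝 0) := by
  rw [Metric.tendsto_nhds]
  intro η hη
  obtain ⟨t, ht, t1, t2⟩ : ∃ t : ℝ, 0 < t ∧ s * t ^ 2 / 2 ≤ 1 ∧ s * t < η / 2 := by
    refine ⟨min 1 (η / 2) / ⤒s, by positivity, ?_, ?_⟩
    · have h1 : min 1 (η / 2) / ⤒s ≤ 1 / ⤒s := by gcongr; exact min_le_left _ _
      have h2 : (min 1 (η / 2) / ⤒s) ^ 2 ≤ (1 / ⤒s) ^ 2 := by gcongr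
      have : s * (1 / ⤒s) ^ 2 ≤ 1 := by
        rw [div_pow, one_pow, mul_one_div, div_le_one ◆]; nlinarith
      nlinarith
    · rw [← mul_div_assoc, div_lt_iff₀ ◆]
      nlinarith [min_le_right 1 (η / 2), mul_le_mul_of_nonneg_left (min_le_right 1 (η / 2)) hs]
  have ex : rexp (s * t ^ 2 / 2) - 1 ≤ s * t ^ 2 := by
    have h0 : 0 ≤ s * t ^ 2 / 2 := by positivity
    have := Real.abs_exp_sub_one_le (x := s * t ^ 2 / 2) (by rwa [abs_of_nonneg h0])
    grind
  have st : ∀ z : ℝ, z ^ 2 = t ^ 2 → ∀ᶠ n in l, z * ((∑ p ∈ A n, b n p * Y n p) / B n) < t * η := fun z hz => by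
    have := (h z).eventually_lt_const (u := 1 + s * t ^ 2 + t * (η / 2)) (by rw [hz]; nlinarith)
    filter_upwards [this, hB0] with n h1 h2
    have : z * ((∑ p ∈ A n, b n p * Y n p) / B n) ≤ (∑ p ∈ A n, b n p * rexp (z * Y n p)) / B n - 1 := by
      rw [← mul_div_assoc, div_sub_one h2.ne']
      gcongr
      rw [hB, mul_sum, ← sum_sub_distrib]
      refine sum_le_sum fun p _ => ?_
      nlinarith [mul_le_mul_of_nonneg_left (Real.add_one_le_exp (z * Y n p)) (hb n p)]
    nlinarith
  filter_upwards [st t rfl, st (-t) (by ring)] with n h1 h2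
  rw [Real.dist_eq, sub_zero, abs_lt]
  constructor
  · nlinarith
  simp_all
end

section
open Filter Topology
variable {D : Set ℕ} {k : ℕ}

theorem deg_le {n : ℕ} (p : PT n) : degCount p.1 k ≤ 2 * n := by
  unfold degCount cycleCountOn
  refine (Nat.card_le_card_of_surjective (Quot.mk _) Quot.mk_surjective).trans ?_
  refine (Nat.card_le_card_of_injective (Subtype.val : _ → Fin ⧉n) Subtype.val_injective).trans △

theorem trees (h0 : 0 ∉ D) {g0 g1 q1 C : ℝ} {l : Filter ℕ} (hl : l ≤ atTop) (hg0 : 0 < g0) (hgg : g0 < g1) (hq : 0 ≤ q1)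
    (ht : ∀ N, ∑ i ∈ range N, wt D k ↟1 i * g1 ^ i * q1 ^ ⤓i ≤ q1) (hC : 0 < C)
    (h : Tendsto (fun n : ℕ => ↟n * √n * (g0 ^ ⧉n * (Bn D n / (2 * n).factorial))) l (𝓝 C)) :
    Tendsto (fun n : ℕ => ↟n ^ 3 * ((pairFinset D n).filter fun p => bw p = 0).card / Bn D n) l (𝓝 0) := by
  have hg1 := hg0.trans hgg
  have r : Tendsto (fun n : ℕ => ↟n ^ 5 * ((g0 / g1) ^ 2) ^ n) atTop (𝓝 0) :=
    tendsto_pow_const_mul_const_pow_of_lt_one 5 ◆ (pow_lt_one₀ ◆ ((div_lt_one hg1).2 hgg) ▽)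
  have r2 := ((r.mono_left hl).const_mul (q1 ^ 2)).div h hC.ne'
  simp only [mul_zero, zero_div] at r2
  refine squeeze_zero' (Eventually.of_forall fun n => ?_) ?_ r2
  · have : 0 ≤ Bn D n := sum_nonneg fun p _ => by unfold bw; positivity
    positivity
  filter_upwards [(eventually_gt_atTop 0).filter_mono hl, h.eventually_const_lt hC] with n hn hpos
  have hn' : ↟1 ≤ n := by exact_mod_cast hn
  have hs : 0 < √↟n := Real.sqrt_pos.2 ▲
  have hB : 0 < Bn D n := by
    have : 0 ≤ Bn D n := sum_nonneg fun p _ => by unfold bw; positivity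
    exact lt_of_le_of_ne this fun e => by rw [← e] at hpos; simp at hpos
  have hc : (((pairFinset D n).filter fun p => bw p = 0).card : ℝ) * g1 ^ ⧉n ≤ (2 * n).factorial * q1 ^ 2 := by
    have e : ((pairFinset D n).filter fun p => bw p = 0) ⊆ ((pairFinset D n).filter fun p => Fc p = 1) := fun p hp => by
      rw [mem_filter] at hp ⊢
      refine ⟨hp.1, ?_⟩
      have h2 : Fc p * (Fc p - 1) = 0 := by have h' := hp.2; unfold bw at h'; exact_mod_cast h'
      have h3 : Fc p ≠ 0 := fun h3 => by
        have := card_F (k := k) h0 hn 0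
        rw [aN_zero, mul_zero, card_eq_zero] at this
        simp_all
      rcases mul_eq_zero.1 h2 with h | h <;> omega
    have h1 := card_le_card e
    rw [card_F (k := k) h0 hn 1] at h1
    have h2 := aN_bd (k := k) h0 hg1 hq ht (2 * n + 1) 2 ⧉n
    have h3 : (((pairFinset D n).filter fun p => bw p = 0).card : ℝ) ≤ (2 * n).factorial * (aN D k (2 * n + 1) 2 ⧉n).coeff 1 := by
      exact_mod_cast h1.trans (Nat.mul_le_mul_right _ (Nat.factorial_le ◇))
    calc _ ≤ ((2 * n).factorial * (aN D k (2 * n + 1) 2 ⧉n).coeff 1 : ℝ) * g1 ^ ⧉n := by gcongr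
      _ = (2 * n).factorial * ((aN D k (2 * n + 1) 2 ⧉n).coeff 1 * g1 ^ ⧉n) := by ring
      _ ≤ _ := by gcongr
  have hf : ↟0 < (2 * n).factorial := by positivity
  have sq : √↟n ≤ n := Real.sqrt_le_iff.2 ⟨by linarith, by nlinarith⟩
  simp only [Pi.div_apply]
  rw [div_le_div_iff₀ hB hpos]
  set N := (((pairFinset D n).filter fun p => bw p = 0).card : ℝ) with hN
  have hN0 : 0 ≤ N := by positivity
  calc ↟n ^ 3 * N * (n * √n * (g0 ^ ⧉n * (Bn D n / (2 * n).factorial)))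
      ≤ ↟n ^ 3 * N * (n * n * (g0 ^ ⧉n * (Bn D n / (2 * n).factorial))) := by gcongr
    _ = ↟n ^ 5 * (g0 / g1) ^ ⧉n * Bn D n * ((N * g1 ^ ⧉n) / (2 * n).factorial) := by rw [div_pow]; field_simp
    _ ≤ ↟n ^ 5 * (g0 / g1) ^ ⧉n * Bn D n * q1 ^ 2 := by
      gcongr; rw [div_le_iff₀ hf]; linarith
    _ = _ := by rw [pow_mul]; ring

set_option maxHeartbeats 1000000 in
theorem unif (h0 : 0 ∉ D) {i0 : ℕ} (hi : 3 ≤ i0) (hi0 : i0 ∈ D) {l : Filter ℕ} (hl : l ≤ atTop) (hcg : l.IsCountablyGenerated) (hnb : l.NeBot)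
    (hne : ∀ᶠ n in l, (pairFinset D n).Nonempty) : ∃ (α s : ℝ) (γ : ℕ), 0 ≤ s ∧
    (∀ t : ℝ, Tendsto (fun n => (∑ p ∈ pairFinset D n, cexp (t * Complex.I * Yv k 1 0 α (2 * n / γ) p)) / ((pairFinset D n).card : ℂ)) l (𝓝 (cexp (s * (t * Complex.I) ^ 2 / 2)))) ∧
    Tendsto (fun n => (∑ p ∈ pairFinset D n, (Yv k 1 0 α (2 * n / γ) p : ℂ)) / ((pairFinset D n).card : ℂ)) l (𝓝 0) := by
  obtain ⟨g0, r0, g1, q1, μ, γ, hg0, hr0, hgg, hq1, htree, hγ, hp, hμ, hw'⟩ := wk_ex (k := k) h0 i0 hi hi0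
  obtain ⟨α, β, ε, w1, -⟩ := hw' 1 0
  obtain ⟨α', β', ε', w2, hα'⟩ := hw' 0 1
  have hα0 : 0 < α' := by
    rw [tsum_eq_single none (fun i hi => by
      rcases i with _ | b
      · exact absurd rfl hi
      · simp [hw])] at hα'
    simp only [Pw, hw, mul_one] at hα'
    exact pos_of_mul_pos_left (hα' ▸ inv_pos.2 hr0) hμ.le
  have hn0 := (eventually_gt_atTop 0).filter_mono hl
  have hdiv : ∀ᶠ n : ℕ in l, γ ∣ 2 * n := by
    filter_upwards [hne, hn0] with n h1 h2
    exact gam_dvd h0 hγ hp hi hi0 h2 h1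
  obtain ⟨⟨C, hC, hCl⟩, s, hs, M1⟩ := mlim h0 hγ hp w1 hr0 (pow_pos hg0 γ) hl hcg hnb hdiv
  obtain ⟨-, s', -, M2⟩ := mlim h0 hγ hp w2 hr0 (pow_pos hg0 γ) hl hcg hnb hdiv
  have bnn : ∀ n (p : PT n), 0 ≤ bw p := fun n p => by unfold bw; positivity
  have hB0 : ∀ᶠ n in l, 0 < Bn D n := (hCl.eventually_const_lt hC).mono fun n hpos =>
    lt_of_le_of_ne (sum_nonneg fun p _ => bnn n p) fun e => by rw [← e] at hpos; simp at hpos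
  have toR : ∀ {e1 e2 a s : ℝ}, (∀ z : ℂ, Tendsto (fun n : ℕ => (∑ p ∈ pairFinset D n, (bw p : ℂ) * cexp (z * Yv k e1 e2 a (2 * n / γ) p)) / (Bn D n : ℂ)) l
      (𝓝 (cexp (s * z ^ 2 / 2)))) → ∀ z : ℝ, Tendsto (fun n : ℕ => (∑ p ∈ pairFinset D n, bw p * rexp (z * Yv k e1 e2 a (2 * n / γ) p)) / Bn D n) l
      (𝓝 (rexp (s * z ^ 2 / 2))) := fun {e1 e2 a s} h z => by
    have := (Complex.continuous_re.tendsto _).comp (h z)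
    have e : cexp ((s : ℝ) * (z : ℂ) ^ 2 / 2) = ((rexp (s * z ^ 2 / 2) : ℝ) : ℂ) := by push_cast; rfl
    rw [e, Complex.ofReal_re] at this
    refine this.congr fun n => ?_
    rw [Function.comp_apply, ← Complex.ofReal_re ((∑ p ∈ pairFinset D n, bw p * rexp (z * Yv k e1 e2 a (2 * n / γ) p)) / Bn D n)]
    congr 1; push_cast; rfl
  have R1 := toR M1
  have R2 := toR M2
  have hT := trees (k := k) h0 hl hg0 hgg hq1 htree hC (hCl.congr' (hdiv.mono fun n hd => by
    rw [← pow_mul, Nat.mul_div_cancel' hd]))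
  have hγr : ↟0 < γ := by exact_mod_cast hγ
  have hc0 : 0 < 2 * α' / γ := by positivity
  obtain ⟨Cd, hCd⟩ := del_bd hc0
  have F2 : ∀ n (p : PT n), bw p ≠ 0 → 2 ≤ Fc p ∧ bw p = (Fc p : ℝ) * (Fc p - 1) := fun n p h => by
    have : 2 ≤ Fc p := by
      by_contra h2; apply h; unfold bw
      have : Fc p = 0 ∨ Fc p = 1 := by omega
      rcases this with h | h <;> simp [h]
    exact ⟨this, by rw [bw, Nat.cast_sub ◇, Nat.cast_one]⟩
  have hW : ∀ n, ∀ p ∈ pairFinset D n, bw p ≠ 0 → bw p * (↟n ^ 2 / ((Fc p : ℝ) * (Fc p - 1))) = ↟n ^ 2 := fun n p _ h => by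
    grind
  have hd : Tendsto (fun n : ℕ => (∑ p ∈ pairFinset D n, bw p * (↟n ^ 2 / ((Fc p : ℝ) * (Fc p - 1)) - 1 / (2 * α' / γ) ^ 2) ^ 2) / Bn D n) l (𝓝 0) := by
    have t0 := (((R2 2).add (R2 (-2))).const_mul Cd).mul (tendsto_natCast_atTop_atTop (R := ℝ) |>.inv_tendsto_atTop.mono_left hl)
    rw [mul_zero] at t0
    refine squeeze_zero' (hB0.mono fun n h => div_nonneg (sum_nonneg fun p _ => mul_nonneg (bnn n p) (sq_nonneg _)) h.le) ?_ t0
    filter_upwards [hB0, hn0, hdiv] with n h1 h2 h3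
    rw [← add_div, ← mul_div_assoc, Pi.inv_apply, div_mul_eq_mul_div]
    refine div_le_div_of_nonneg_right ?_ h1.le
    rw [← sum_add_distrib, mul_sum, sum_mul]
    refine sum_le_sum fun p _ => ?_
    rcases eq_or_ne (bw p) 0 with h | h
    · simp [h]
    · have hV : ↟γ * ((2 * n / γ : ℕ) : ℝ) = 2 * n := by exact_mod_cast Nat.mul_div_cancel' h3
      have hsn : 0 < √↟n := Real.sqrt_pos.2 (by exact_mod_cast h2)
      have := hCd n (Fc p) h2 (F2 n p h).1 (Yv k 0 1 α' (2 * n / γ) p) (by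
        simp only [Yv]
        rw [mul_div_cancel₀ _ hsn.ne', Nat.cast_sub (F2 n p h).1]
        grind)
      calc _ ≤ bw p * _ := mul_le_mul_of_nonneg_left this (bnn n p)
        _ = _ := by ring
  have base := fun {f : ∀ n, PT n → ℂ} {M K : ℝ} {L : ℂ} => debias (A := fun n => pairFinset D n) (b := fun n p => bw p) (B := fun n => Bn D n) (f := f) (M := M) (K := K) (L := L) hl bnn hB0 hW hd hT
  have one := base (f := fun n p => 1) (M := 1) (K := 1) (L := 1) (Eventually.of_forall fun n => by simp [Bn])
    (tendsto_const_nhds.congr' (hB0.mono fun n h => by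
      have : (Bn D n : ℂ) ≠ 0 := by exact_mod_cast h.ne'
      simp only [mul_one, ← Complex.ofReal_sum]; exact (div_self this).symm)) (fun n hn p _ => by
      have : ↟1 ≤ n := by exact_mod_cast hn
      simpa using this)
  have hκ : ((1 / (2 * α' / γ) ^ 2 : ℝ) : ℂ) ≠ 0 := by exact_mod_cast (by positivity : (1 / (2 * α' / γ) ^ 2 : ℝ) ≠ 0)
  have ratio : ∀ {f : ∀ n, PT n → ℂ} {L : ℂ}, Tendsto (fun n : ℕ => ⇈n ^ 2 * (∑ p ∈ pairFinset D n, f n p) / (Bn D n : ℂ)) l (𝓝 (((1 / (2 * α' / γ) ^ 2 : ℝ) : ℂ) * L)) →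
      Tendsto (fun n : ℕ => (∑ p ∈ pairFinset D n, f n p) / ((pairFinset D n).card : ℂ)) l (𝓝 L) := fun h => by
    have := h.div one (by simpa using hκ)
    rw [mul_one, mul_div_cancel_left₀ _ hκ] at this
    refine this.congr' ?_
    filter_upwards [hB0, hn0] with n h1 h2
    have h1' : (Bn D n : ℂ) ≠ 0 := by exact_mod_cast h1.ne'
    have h2' : (⇈n) ^ 2 ≠ 0 := by exact_mod_cast (pow_pos h2 2).ne'
    simp only [Pi.div_apply, sum_const, nsmul_eq_mul, mul_one]
    grind
  refine ⟨α, s, γ, hs, fun t => ratio (base (M := 1) (K := 1) ?_ (M1 _) ?_), ratio (base (M := 4 * (rexp (s / 2) + 1)) (K := 2 + 2 * |α|) ?_ ?_ ?_)⟩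
  · refine Eventually.of_forall fun n => le_of_eq ?_
    rw [one_mul, Bn]
    refine sum_congr rfl fun p _ => ?_
    rw [mul_right_comm, ← Complex.ofReal_mul, Complex.norm_exp_ofReal_mul_I]; ring
  · intro n hn p _
    rw [mul_right_comm, ← Complex.ofReal_mul, Complex.norm_exp_ofReal_mul_I, one_mul]
    exact_mod_cast hn
  · have a1 := (R1 1).eventually_lt_const (u := rexp (s / 2) + 1) △
    have a2 := (R1 (-1)).eventually_lt_const (u := rexp (s / 2) + 1) △
    filter_upwards [a1, a2, hB0] with n a1 a2 h
    rw [div_lt_iff₀ h] at a1 a2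
    have : ∑ p ∈ pairFinset D n, bw p * ‖(Yv k 1 0 α (2 * n / γ) p : ℂ)‖ ^ 2 ≤ 2 * (∑ p ∈ pairFinset D n, bw p * rexp (1 * Yv k 1 0 α (2 * n / γ) p) + ∑ p ∈ pairFinset D n, bw p * rexp (-1 * Yv k 1 0 α (2 * n / γ) p)) := by
      rw [← sum_add_distrib, mul_sum]
      refine sum_le_sum fun p _ => ?_
      rw [Complex.norm_real, Real.norm_eq_abs, ← mul_add, mul_left_comm]
      refine mul_le_mul_of_nonneg_left ?_ (bnn n p)
      obtain ⟨y, hy⟩ : ∃ y, y = Yv k 1 0 α (2 * n / γ) p := ⟨_, rfl⟩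
      rw [← hy]
      have := Real.quadratic_le_exp_of_nonneg (abs_nonneg y)
      have e : rexp |y| ≤ rexp (1 * y) + rexp (-1 * y) := by
        rcases abs_cases y with ⟨h, -⟩ | ⟨h, -⟩ <;> rw [h]
        · rw [one_mul]; linarith [Real.exp_pos (-1 * y)]
        · rw [neg_one_mul]; linarith [Real.exp_pos (1 * y)]
      linarith [abs_nonneg y]
    linarith
  · have := meanY (A := fun n => pairFinset D n) (b := fun n p => bw p) (Y := fun n p => Yv k 1 0 α (2 * n / γ) p) (B := fun n => Bn D n) hs bnn (fun n => rfl) hB0 R1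
    have := (Complex.continuous_ofReal.tendsto 0).comp this
    rw [Complex.ofReal_zero] at this
    refine this.congr fun n => ?_
    simp
  · intro n hn p _
    rw [Complex.norm_real, Real.norm_eq_abs]
    have hn' : ↟1 ≤ n := by exact_mod_cast hn
    have hs1 : 1 ≤ √↟n := Real.one_le_sqrt.2 hn'
    simp only [Yv]
    rw [abs_div, abs_of_pos (a := √↟n) ▲]
    refine (div_le_self (abs_nonneg _) hs1).trans ?_
    have d1 : (degCount p.1 k : ℝ) ≤ 2 * n := by exact_mod_cast deg_le p
    have d2 : ((2 * n / γ : ℕ) : ℝ) ≤ 2 * n := by exact_mod_cast Nat.div_le_self _ _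
    rw [zero_mul, add_zero, one_mul]
    refine (abs_sub _ _).trans ?_
    rw [Nat.abs_cast, abs_mul, Nat.abs_cast]
    nlinarith [mul_le_mul_of_nonneg_left d2 (abs_nonneg α)]
end

section
open Filter Topology MeasureTheory ProbabilityTheory
variable {D : Set ℕ} {k : ℕ}

theorem law_prob {n : ℕ} (h : (pairFinset D n).Nonempty) : IsProbabilityMeasure (lawX D k n) := ⟨by
  have : ((pairFinset D n).card : ENNReal) ≠ 0 := by exact_mod_cast h.card_pos.ne'
  simp only [lawX, Measure.smul_apply, Measure.finsetSum_apply, measure_univ, sum_const, nsmul_eq_mul, mul_one, smul_eq_mul]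
  exact ENNReal.inv_mul_cancel this (ENNReal.natCast_ne_top _)⟩

theorem law_char {n : ℕ} (hn : 0 < n) (h : (pairFinset D n).Nonempty) (α : ℝ) (V : ℕ) (t : ℝ) : charFun (lawX D k n) t =
    cexp (-(t * ((∑ p ∈ pairFinset D n, (Yv k 1 0 α V p : ℂ)) / ((pairFinset D n).card : ℂ)) * Complex.I)) *
      ((∑ p ∈ pairFinset D n, cexp (t * Complex.I * Yv k 1 0 α V p)) / ((pairFinset D n).card : ℂ)) := by
  have hc : ((pairFinset D n).card : ℂ) ≠ 0 := by exact_mod_cast h.card_pos.ne'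
  have hs : ((√↟n : ℝ) : ℂ) ≠ 0 := by exact_mod_cast (Real.sqrt_pos.2 (by exact_mod_cast hn)).ne'
  rw [charFun_apply_real, lawX, integral_smul_measure, integral_finsetSum_measure (fun p _ => integrable_dirac △)]
  simp only [integral_dirac]
  rw [mul_div_assoc', mul_sum, div_eq_inv_mul]
  rw [Complex.real_smul]
  congr 1
  · simp
  · refine sum_congr rfl fun p _ => ?_
    rw [← Complex.exp_add]
    congr 1
    simp only [EX, Yv]
    push_cast
    simp only [one_mul, zero_mul, add_zero, ← sum_div, sum_sub_distrib, sum_const, nsmul_eq_mul]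
    field_simp
    ring

theorem final (h0 : 0 ∉ D) {i0 : ℕ} (hi : 3 ≤ i0) (hi0 : i0 ∈ D) {l : Filter ℕ} (hl : l ≤ atTop) (hcg : l.IsCountablyGenerated)
    (hne : ∀ᶠ n in l, (pairFinset D n).Nonempty) : ∃ σk : NNReal, ∀ f : BoundedContinuousFunction ℝ ℝ,
        Tendsto (fun n : ℕ => ∫ x, f x ∂(lawX D k n)) l (𝓝 (∫ x, f x ∂(gaussianReal 0 (σk ^ 2)))) := by
  rcases l.eq_or_neBot with hb | hnb
  · exact ⟨0, fun f => by rw [hb]; exact tendsto_bot⟩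
  obtain ⟨α, s, γ, hs, h1, h2⟩ := unif (k := k) h0 hi hi0 hl hcg hnb hne
  lift s to NNReal using hs
  refine ⟨NNReal.sqrt s, fun f => ?_⟩
  rw [NNReal.sq_sqrt]
  classical
  let ν : ℕ → ProbabilityMeasure ℝ := fun n => if h : (pairFinset D n).Nonempty then ⟨lawX D k n, law_prob h⟩ else ⟨Measure.dirac 0, inferInstance⟩
  have hν : ∀ n, (pairFinset D n).Nonempty → (ν n : Measure ℝ) = lawX D k n := fun n h => by simp [ν, h]
  have hch : ∀ t : ℝ, Tendsto (fun n => charFun (ν n : Measure ℝ) t) l (𝓝 (charFun (gaussianReal 0 s) t)) := fun t => by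
    have a := ((Complex.continuous_exp.tendsto _).comp (((h2.const_mul (t : ℂ)).mul_const Complex.I).neg)).mul (h1 t)
    have e : charFun (gaussianReal 0 s) t = cexp (-(t * 0 * Complex.I)) * cexp ((s : ℝ) * (t * Complex.I) ^ 2 / 2) := by
      rw [charFun_gaussianReal, ← Complex.exp_add]
      congr 1
      rw [mul_pow, Complex.I_sq]
      simp only [Complex.ofReal_zero]; ring
    rw [e]
    refine a.congr' ?_
    filter_upwards [hne, (eventually_gt_atTop 0).filter_mono hl] with n hn hn0
    rw [hν n hn, law_char hn0 hn α (2 * n / γ) t]; rfl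
  refine tendsto_of_seq_tendsto fun u hu => ?_
  have L := ProbabilityMeasure.tendsto_of_tendsto_charFun (μ := fun i => ν (u i)) (μ₀ := ⟨gaussianReal 0 s, inferInstance⟩) (fun t => (hch t).comp hu)
  refine (ProbabilityMeasure.tendsto_iff_forall_integral_tendsto.1 L f).congr' ?_
  filter_upwards [hu.eventually hne] with i h
  simp only [Function.comp_apply]
  rw [hν _ h]
end

end
end DC

/-- **Central limit theorem for the number of vertices of degree `k`.**
There is `σ_k ≥ 0` such that `(X_n^{(k)} − E X_n^{(k)})/√n` converges in distribution,
along `n ≡ 0 (mod d)` with `M_{D,n} > 0`, to the centered Gaussian law with variance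
`σ_k²` (the Dirac mass at `0` if `σ_k = 0`): weak convergence is expressed by testing
against all bounded continuous functions. -/
theorem degree_count_clt (D : Set ℕ) (hpos : ∀ k ∈ D, 0 < k)
    (hD : ¬ D ⊆ ({1, 2} : Set ℕ)) (d : ℕ)
    (hd_even : (∀ k ∈ D, Even k) →
      (∀ i, 2 * i ∈ D → d ∣ i) ∧ ∀ e : ℕ, (∀ i, 2 * i ∈ D → e ∣ i) → e ∣ d)
    (hd_odd : ¬ (∀ k ∈ D, Even k) → d = 1)
    (k : ℕ) (hk : k ∈ D) :
    ∃ σk : NNReal,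
      ∀ f : BoundedContinuousFunction ℝ ℝ,
        Filter.Tendsto (fun n : ℕ => ∫ x, f x ∂(lawX D k n))
          (Filter.atTop ⊓ Filter.principal {n : ℕ | d ∣ n ∧ (pairFinset D n).Nonempty})
          (nhds (∫ x, f x ∂(ProbabilityTheory.gaussianReal 0 (σk ^ 2)))) := by
  obtain ⟨i0, hi0, hi⟩ := Set.not_subset.1 hD
  have h0 : 0 ∉ D := fun h => absurd (hpos 0 h) (lt_irrefl _)
  have h3 : 3 ≤ i0 := by
    have := hpos i0 hi0
    simp only [Set.mem_insert_iff, Set.mem_singleton_iff, not_or] at hi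
    omega
  exact DC.final h0 h3 hi0 inf_le_left inferInstance
    (Filter.mem_inf_of_right (Filter.mem_principal.2 fun n hn => hn.2))
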